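/- Isolating characters correlating with a multiplicative function: For every κ > 0 and every natural number J ≥ 1 there is a constant C = C(κ,J) > 0 such that for all f in the class C(κ), all real X ≥ C and all natural numbers q with 1 ≤ q ≤ X^{1/4}, setting Q = q·log X, there exists a set 𝒳 of Dirichlet characters mod q with at most J elements satisfying both: (i) for every Dirichlet character χ mod q not in 𝒳, max_{√X ≤ x ≤ X²} |S_f(x,χ)|/x ≤ C · (log X)^{κ−1} · (log Q/log X)^{κ(1−1/√(J+1))} · log(log X/log Q); and (ii) for all real x with √X ≤ x ≤ X² and all a with gcd(a,q) = 1, | ∑_{n ≤ x, n ≡ a (mod q)} f(n) − (1/φ(q))·∑_{χ ∈ 𝒳} χ(a)·S_f(x,χ) | ≤ C · (x/φ(q)) · (log x)^{κ−1} · (log Q/log X)^{κ(1−1/√(J+1))} · log(log X/log Q). -/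

import Mathlib

open Complex MeasureTheory
open scoped Classical

noncomputable section

/-- Membership of `f` in the class `C(κ)`, witnessed by `Λf`. -/
structure IsHalaszClass (κ : ℝ) (f : ℕ → ℂ) (Λf : ℕ → ℂ) : Prop where
  map_one : f 1 = 1
  mult : ∀ m n : ℕ, Nat.Coprime m n → f (m * n) = f m * f n
  supp : ∀ n : ℕ, ¬ IsPrimePow n → Λf n = 0
  bound : ∀ n : ℕ, 1 ≤ n → ‖Λf n‖ ≤ κ * ArithmeticFunction.vonMangoldt n
  conv : ∀ n : ℕ, 1 ≤ n →
    f n * (Real.log n : ℂ) = ∑ d ∈ n.divisors, Λf d * f (n / d)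
  abs_conv : ∀ σ : ℝ, 1 < σ → Summable (fun n : ℕ => ‖f n‖ / (n : ℝ) ^ σ)

/-- The Dirichlet series `F(s) = ∑ f(n) n^{-s}`. -/
def Fser (f : ℕ → ℂ) (s : ℂ) : ℂ := ∑' n : ℕ, f n / (n : ℂ) ^ s

/-- `S_f(x,χ) = ∑_{n ≤ x} f(n) conj(χ(n))`. -/
def Sf {q : ℕ} (f : ℕ → ℂ) (χ : DirichletCharacter ℂ q) (x : ℝ) : ℂ :=
  ∑ n ∈ Finset.Icc 1 ⌊x⌋₊, f n * (starRingEnd ℂ) (χ (n : ZMod q))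

section MertensEstimates
open Finset ArithmeticFunction

/-- Abel summation inequality: domination of partial sums passes to sums with antitone weights. -/
lemma sum_mul_le_sum_mul_of_partial_sums (a b g : ℕ → ℝ) (hg0 : ∀ n, 1 ≤ n → 0 ≤ g n)
    (hg : ∀ n, 1 ≤ n → g (n + 1) ≤ g n)
    (h : ∀ n, ∑ i ∈ Icc 1 n, a i ≤ ∑ i ∈ Icc 1 n, b i) (N : ℕ) :
    ∑ i ∈ Icc 1 N, a i * g i ≤ ∑ i ∈ Icc 1 N, b i * g i := by
  have key : ∀ N : ℕ, g N * (∑ i ∈ Icc 1 N, b i - ∑ i ∈ Icc 1 N, a i) ≤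
      ∑ i ∈ Icc 1 N, b i * g i - ∑ i ∈ Icc 1 N, a i * g i := by
    intro N
    induction N with
    | zero => simp
    | succ k ih =>
      rw [sum_Icc_succ_top (by omega), sum_Icc_succ_top (by omega),
        sum_Icc_succ_top (by omega), sum_Icc_succ_top (by omega)]
      have h1 : g (k + 1) * (∑ i ∈ Icc 1 k, b i - ∑ i ∈ Icc 1 k, a i) ≤
          g k * (∑ i ∈ Icc 1 k, b i - ∑ i ∈ Icc 1 k, a i) := by
        rcases Nat.eq_zero_or_pos k with rfl | hk
        · simp
        · exact mul_le_mul_of_nonneg_right (hg k hk) (sub_nonneg.2 (h k))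
      linarith
  rcases Nat.eq_zero_or_pos N with rfl | hN
  · simp
  · have := mul_nonneg (hg0 N hN) (sub_nonneg.2 (h N))
    linarith [key N]

lemma log_le_sum_inv (N : ℕ) : Real.log N ≤ ∑ i ∈ Icc 1 N, (1 : ℝ) / i := by
  rcases Nat.eq_zero_or_pos N with rfl | hN
  · simp
  have h := log_add_one_le_harmonic N
  rw [harmonic_eq_sum_Icc] at h
  push_cast at h
  have h2 : Real.log N ≤ Real.log (N + 1) :=
    Real.log_le_log (by exact_mod_cast hN) (by linarith)
  simpa using h2.trans h

lemma sum_log_eq_sum_vonMangoldt_mul (N : ℕ) :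
    ∑ n ∈ Icc 1 N, Real.log n = ∑ d ∈ Icc 1 N, vonMangoldt d * ((N / d : ℕ) : ℝ) := by
  have h := sum_Ioc_mul_zeta_eq_sum (R := ℝ) vonMangoldt N
  rw [vonMangoldt_mul_zeta] at h
  have e : Icc 1 N = Ioc 0 N := by ext; simp [Nat.succ_le_iff]
  simpa [ArithmeticFunction.log_apply, e] using h

lemma sum_vonMangoldt_le (N : ℕ) : ∑ n ∈ Icc 1 N, vonMangoldt n ≤ (Real.log 4 + 4) * N := by
  have h := Chebyshev.psi_le_const_mul_self (x := N) (by positivity)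
  have e : Icc 1 N = Ioc 0 N := by ext; simp [Nat.succ_le_iff]
  simpa [Chebyshev.psi, e] using h

lemma sum_vonMangoldt_div_le_log (N : ℕ) :
    ∑ n ∈ Icc 1 N, vonMangoldt n / n ≤ Real.log N + (Real.log 4 + 4) := by
  rcases Nat.eq_zero_or_pos N with rfl | hN
  · simp; positivity
  have hN' : (0 : ℝ) < N := by exact_mod_cast hN
  have h1 : ∑ n ∈ Icc 1 N, Real.log n ≤ N * Real.log N := by
    calc _ ≤ ∑ n ∈ Icc 1 N, Real.log N := by
          apply sum_le_sum
          intro n hn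
          rw [mem_Icc] at hn
          exact Real.log_le_log (by exact_mod_cast hn.1) (by exact_mod_cast hn.2)
      _ = _ := by simp
  rw [sum_log_eq_sum_vonMangoldt_mul] at h1
  have h2 : N * ∑ n ∈ Icc 1 N, vonMangoldt n / n - ∑ n ∈ Icc 1 N, vonMangoldt n ≤
      ∑ d ∈ Icc 1 N, vonMangoldt d * ((N / d : ℕ) : ℝ) := by
    rw [mul_sum, ← sum_sub_distrib]
    apply sum_le_sum
    intro d hd
    rw [mem_Icc] at hd
    have hd' : (0 : ℝ) < d := by exact_mod_cast hd.1
    have h3 : (N : ℝ) / d - 1 ≤ ((N / d : ℕ) : ℝ) := by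
      rw [← Nat.floor_div_eq_div (K := ℝ)]
      linarith [Nat.lt_floor_add_one ((N : ℝ) / d)]
    have := mul_le_mul_of_nonneg_left h3 (vonMangoldt_nonneg (n := d))
    calc _ = vonMangoldt d * ((N : ℝ) / d - 1) := by ring
      _ ≤ _ := this
  have h4 := sum_vonMangoldt_le N
  have h5 : N * ∑ n ∈ Icc 1 N, vonMangoldt n / n ≤ N * (Real.log N + (Real.log 4 + 4)) := by
    linarith
  exact le_of_mul_le_mul_left h5 hN'

lemma rpow_neg_antitone (u : ℝ) (hu : 0 ≤ u) (n : ℕ) (hn : 1 ≤ n) :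
    ((n + 1 : ℕ) : ℝ) ^ (-u) ≤ (n : ℝ) ^ (-u) := by
  apply Real.rpow_le_rpow_of_nonpos (by exact_mod_cast hn) (by push_cast; linarith) (by linarith)

lemma sum_rpow_neg_one_sub_le (u : ℝ) (hu : 0 < u) (N : ℕ) :
    ∑ n ∈ Icc 1 N, (1 : ℝ) / n * (n : ℝ) ^ (-u) ≤ 1 + 1 / u := by
  have key : ∀ N : ℕ, 1 ≤ N → ∑ n ∈ Icc 1 N, (1 : ℝ) / n * (n : ℝ) ^ (-u) ≤
      1 + 1 / u - (N : ℝ) ^ (-u) / u := by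
    intro N hN
    induction N, hN using Nat.le_induction with
    | base => simp
    | succ k hk ih =>
      rw [sum_Icc_succ_top (by omega)]
      have hk0 : (0 : ℝ) < k := by exact_mod_cast hk
      have hk1 : (0 : ℝ) < (k + 1 : ℝ) := by linarith
      have h1 : (1 + u / (k + 1)) * ((k : ℝ) + 1) ^ (-u) ≤ (k : ℝ) ^ (-u) := by
        have e1 : Real.log k ≤ Real.log (k + 1) - 1 / (k + 1) := by
          have := Real.log_le_sub_one_of_pos (show 0 < (k : ℝ) / (k + 1) by positivity)
          rw [Real.log_div hk0.ne' hk1.ne'] at this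
          have e2 : (k : ℝ) / (k + 1) - 1 = - (1 / (k + 1)) := by field_simp; ring
          linarith
        rw [Real.rpow_def_of_pos hk0, Real.rpow_def_of_pos hk1]
        have e3 : 1 + u / (k + 1) ≤ Real.exp (u / (k + 1)) := by
          linarith [Real.add_one_le_exp (u / (k + 1 : ℝ))]
        calc _ ≤ Real.exp (u / (k + 1)) * Real.exp (Real.log (k + 1) * -u) := by gcongr
          _ = Real.exp (u / (k + 1) + Real.log (k + 1) * -u) := by rw [Real.exp_add]
          _ ≤ _ := by
            apply Real.exp_le_exp.2
            have : u * Real.log k ≤ u * (Real.log (k + 1) - 1 / (k + 1)) := by gcongr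
            have e4 : u / (k + 1 : ℝ) = u * (1 / (k + 1)) := by ring
            rw [e4]; linarith
      have h2 : ((k : ℝ) + 1) ^ (-u) / u + 1 / (k + 1) * ((k : ℝ) + 1) ^ (-u) ≤
          (k : ℝ) ^ (-u) / u := by
        calc _ = (1 + u / (k + 1)) * ((k : ℝ) + 1) ^ (-u) / u := by field_simp
          _ ≤ _ := by gcongr
      push_cast
      linarith
  rcases Nat.eq_zero_or_pos N with rfl | hN
  · simp; positivity
  · have := key N hN
    have h2 : 0 ≤ (N : ℝ) ^ (-u) / u := by positivity
    linarith

/-- `∑ Λ(n) n^{-1-u} ≤ 1/u + C`. -/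
lemma sum_vonMangoldt_rpow_le (u : ℝ) (hu : 0 < u) (N : ℕ) :
    ∑ n ∈ Icc 1 N, vonMangoldt n / n * (n : ℝ) ^ (-u) ≤ 1 / u + (Real.log 4 + 5) := by
  have h := sum_mul_le_sum_mul_of_partial_sums (fun n => vonMangoldt n / n)
    (fun n => 1 / (n : ℝ) + if n = 1 then Real.log 4 + 4 else 0) (fun n => (n : ℝ) ^ (-u))
    (fun n _ => by positivity) (fun n hn => rpow_neg_antitone u hu.le n hn) ?_ N
  · refine h.trans ?_
    simp only [add_mul, sum_add_distrib]
    have h1 := sum_rpow_neg_one_sub_le u hu N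
    have h2 : ∑ i ∈ Icc 1 N, (if i = 1 then Real.log 4 + 4 else 0) * (i : ℝ) ^ (-u) ≤
        Real.log 4 + 4 := by
      simp only [ite_mul, zero_mul, sum_ite_eq']
      split_ifs
      · simp
      · positivity
    linarith
  · intro n
    rw [sum_add_distrib, sum_ite_eq']
    rcases Nat.eq_zero_or_pos n with rfl | hn
    · simp
    · rw [if_pos (by simp; omega)]
      linarith [sum_vonMangoldt_div_le_log n, log_le_sum_inv n]

lemma sum_rpow_sub_one_le (δ : ℝ) (hδ : 0 < δ) (hδ1 : δ ≤ 1) (N : ℕ) :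
    ∑ n ∈ Icc 1 N, (n : ℝ) ^ (-(1 - δ)) ≤ (N : ℝ) ^ δ / δ := by
  induction N with
  | zero => simp [hδ.ne']
  | succ k ih =>
    rw [sum_Icc_succ_top (by omega)]
    have hk1 : (0 : ℝ) < (k + 1 : ℝ) := by positivity
    have h1 : (k : ℝ) ^ δ ≤ ((k : ℝ) + 1) ^ δ * (1 - δ / (k + 1)) := by
      have e1 : (k : ℝ) ^ δ = ((k : ℝ) + 1) ^ δ * (1 + -(1 / (k + 1))) ^ δ := by
        rw [← Real.mul_rpow hk1.le]
        · congr 1; field_simp; ring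
        · rw [← sub_eq_add_neg, sub_nonneg, div_le_one hk1]; linarith [Nat.cast_nonneg (α := ℝ) k]
      rw [e1]
      gcongr
      have := rpow_one_add_le_one_add_mul_self (s := -(1 / ((k : ℝ) + 1)))
        (by rw [neg_le_neg_iff, div_le_one hk1]; linarith [Nat.cast_nonneg (α := ℝ) k]) hδ.le hδ1
      calc _ ≤ _ := this
        _ = _ := by ring
    have h2 : ((k : ℝ) + 1) ^ (-(1 - δ)) = ((k : ℝ) + 1) ^ δ / (k + 1) := by
      rw [neg_sub, Real.rpow_sub hk1, Real.rpow_one]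
    push_cast
    rw [h2]
    calc _ ≤ (k : ℝ) ^ δ / δ + ((k : ℝ) + 1) ^ δ / (k + 1) := by gcongr
      _ ≤ ((k : ℝ) + 1) ^ δ * (1 - δ / (k + 1)) / δ + ((k : ℝ) + 1) ^ δ / (k + 1) := by gcongr
      _ = _ := by field_simp; ring

/-- `∑_{n ≤ N} Λ(n) n^{-1+δ} ≤ C N^δ/δ`. -/
lemma sum_vonMangoldt_rpow_sub_one_le (δ : ℝ) (hδ : 0 < δ) (hδ1 : δ ≤ 1) (N : ℕ) :
    ∑ n ∈ Icc 1 N, vonMangoldt n * (n : ℝ) ^ (-(1 - δ)) ≤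
      (Real.log 4 + 4) * ((N : ℝ) ^ δ / δ) := by
  have h := sum_mul_le_sum_mul_of_partial_sums (fun n => vonMangoldt n)
    (fun n => Real.log 4 + 4) (fun n => (n : ℝ) ^ (-(1 - δ)))
    (fun n _ => by positivity) (fun n hn => rpow_neg_antitone _ (by linarith) n hn) ?_ N
  · refine h.trans ?_
    rw [← mul_sum]
    have := sum_rpow_sub_one_le δ hδ hδ1 N
    gcongr
  · intro n
    have := sum_vonMangoldt_le n
    rw [sum_const, Nat.card_Icc, nsmul_eq_mul, mul_comm]
    simpa using this

end MertensEstimates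

section PrimeSums
open Finset ArithmeticFunction

lemma sum_primes_log_rpow_le (u : ℝ) (hu : 0 < u) (S : Finset ℕ) (hS : ∀ p ∈ S, p.Prime) :
    ∑ p ∈ S, Real.log p / p * (p : ℝ) ^ (-u) ≤ 1 / u + (Real.log 4 + 5) := by
  obtain ⟨N, hN⟩ : ∃ N, S ⊆ Icc 1 N := by
    refine ⟨S.sup id, fun p hp => ?_⟩
    rw [mem_Icc]
    exact ⟨(hS p hp).one_le, le_sup (f := id) hp⟩
  refine le_trans ?_ (sum_vonMangoldt_rpow_le u hu N)
  calc _ = ∑ p ∈ S, vonMangoldt p / p * (p : ℝ) ^ (-u) := by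
        apply sum_congr rfl
        intro p hp
        rw [vonMangoldt_apply_prime (hS p hp)]
    _ ≤ _ := by
        apply sum_le_sum_of_subset_of_nonneg hN
        intro i _ _
        have := vonMangoldt_nonneg (n := i)
        positivity

lemma sum_primes_log_div_le (N : ℕ) (S : Finset ℕ) (hS : ∀ p ∈ S, p.Prime ∧ p ≤ N) :
    ∑ p ∈ S, Real.log p / p ≤ Real.log N + (Real.log 4 + 4) := by
  refine le_trans ?_ (sum_vonMangoldt_div_le_log N)
  calc _ = ∑ p ∈ S, vonMangoldt p / p := by
        apply sum_congr rfl
        intro p hp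
        rw [vonMangoldt_apply_prime (hS p hp).1]
    _ ≤ _ := by
        apply sum_le_sum_of_subset_of_nonneg
        · intro p hp
          rw [mem_Icc]
          exact ⟨(hS p hp).1.one_le, (hS p hp).2⟩
        intro i _ _
        have := vonMangoldt_nonneg (n := i)
        positivity

lemma rpow_sub_rpow_eq_integral (p : ℝ) (hp : 0 < p) (a b : ℝ) :
    p ^ (-a) - p ^ (-b) = ∫ u in a..b, Real.log p * p ^ (-u) := by
  rw [intervalIntegral.integral_eq_sub_of_hasDerivAt (f := fun u => - p ^ (-u))]
  · ring
  · intro u _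
    have h := ((hasDerivAt_neg u).const_rpow hp).neg
    refine h.congr_deriv ?_
    ring
  · apply Continuous.intervalIntegrable
    have : Continuous fun u : ℝ => p ^ (-u) :=
      Real.continuous_const_rpow hp.ne' |>.comp continuous_neg
    exact continuous_const.mul this

lemma sum_primes_gt_rpow_inv_log_le (y : ℝ) (hy : 2 ≤ y) (S : Finset ℕ)
    (hS : ∀ p ∈ S, p.Prime ∧ y < p) :
    ∑ p ∈ S, (1 : ℝ) / p * (p : ℝ) ^ (-(1 / Real.log y)) ≤ 12 := by
  have hl : 0 < Real.log y := Real.log_pos (by linarith)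
  have hl2 : Real.log 2 ≤ Real.log y := Real.log_le_log (by norm_num) hy
  have h := sum_primes_log_rpow_le (1 / Real.log y) (by positivity) S (fun p hp => (hS p hp).1)
  have h2 : Real.log y * ∑ p ∈ S, (1 : ℝ) / p * (p : ℝ) ^ (-(1 / Real.log y)) ≤
      ∑ p ∈ S, Real.log p / p * (p : ℝ) ^ (-(1 / Real.log y)) := by
    rw [mul_sum]
    apply sum_le_sum
    intro p hp
    have := Real.log_le_log (by linarith) (hS p hp).2.le
    have hp0 : (0 : ℝ) < p := by exact_mod_cast (hS p hp).1.pos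
    calc _ = Real.log y / p * (p : ℝ) ^ (-(1 / Real.log y)) := by ring
      _ ≤ _ := by gcongr
  have h3 : Real.log 4 = 2 * Real.log 2 := by
    rw [show (4 : ℝ) = 2 ^ 2 by norm_num, Real.log_pow]; norm_num
  have h4 : Real.log y * ∑ p ∈ S, (1 : ℝ) / p * (p : ℝ) ^ (-(1 / Real.log y)) ≤
      Real.log y * 12 := by
    have := Real.log_two_gt_d9
    have e : 1 / (1 / Real.log y) = Real.log y := by field_simp
    rw [e] at h
    linarith
  exact le_of_mul_le_mul_left h4 hl

/-- `∑_{p > y} p^{-1-σ} ≤ log (1/(σ log y)) + C`. -/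
lemma sum_primes_gt_rpow_le (y : ℝ) (hy : 2 ≤ y) (σ : ℝ) (hσ : 0 < σ)
    (hσ1 : σ ≤ 1 / Real.log y) (S : Finset ℕ) (hS : ∀ p ∈ S, p.Prime ∧ y < p) :
    ∑ p ∈ S, (1 : ℝ) / p * (p : ℝ) ^ (-σ) ≤ Real.log (1 / (σ * Real.log y)) + 24 := by
  have hl : 0 < Real.log y := Real.log_pos (by linarith)
  have hl2 : Real.log 2 ≤ Real.log y := Real.log_le_log (by norm_num) hy
  have h := sum_primes_gt_rpow_inv_log_le y hy S hS
  have h3 : Real.log 4 = 2 * Real.log 2 := by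
    rw [show (4 : ℝ) = 2 ^ 2 by norm_num, Real.log_pow]; norm_num
  have hcont : ∀ p ∈ S, IntervalIntegrable (fun u : ℝ => Real.log p / p * (p : ℝ) ^ (-u)) volume
      σ (1 / Real.log y) := by
    intro p hp
    have hp0 : (0 : ℝ) < p := by exact_mod_cast (hS p hp).1.pos
    apply Continuous.intervalIntegrable
    have : Continuous fun u : ℝ => (p : ℝ) ^ (-u) :=
      Real.continuous_const_rpow hp0.ne' |>.comp continuous_neg
    exact continuous_const.mul this
  have h1 : ∑ p ∈ S, (1 : ℝ) / p * (p : ℝ) ^ (-σ) -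
      ∑ p ∈ S, (1 : ℝ) / p * (p : ℝ) ^ (-(1 / Real.log y)) ≤
      ∫ u in σ..(1 / Real.log y), (1 / u + (Real.log 4 + 5)) := by
    rw [← sum_sub_distrib]
    calc _ = ∑ p ∈ S, ∫ u in σ..(1 / Real.log y), Real.log p / p * (p : ℝ) ^ (-u) := by
          apply sum_congr rfl
          intro p hp
          have hp0 : (0 : ℝ) < p := by exact_mod_cast (hS p hp).1.pos
          rw [← mul_sub, rpow_sub_rpow_eq_integral _ hp0, ← intervalIntegral.integral_const_mul]
          congr 1; ext u; ring
      _ = ∫ u in σ..(1 / Real.log y), ∑ p ∈ S, Real.log p / p * (p : ℝ) ^ (-u) := by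
          rw [intervalIntegral.integral_finsetSum hcont]
      _ ≤ _ := by
          apply intervalIntegral.integral_mono_on hσ1
          · have := IntervalIntegrable.sum S hcont
            simpa [Finset.sum_fn] using this
          · apply ContinuousOn.intervalIntegrable
            rw [Set.uIcc_of_le hσ1]
            apply ContinuousOn.add _ continuousOn_const
            apply continuousOn_const.div continuousOn_id
            intro u hu; exact (lt_of_lt_of_le hσ hu.1).ne'
          · intro u hu
            exact sum_primes_log_rpow_le u (lt_of_lt_of_le hσ hu.1) S (fun p hp => (hS p hp).1)
  have h2 : ∫ u in σ..(1 / Real.log y), (1 / u + (Real.log 4 + 5)) =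
      Real.log (1 / (σ * Real.log y)) + (1 / Real.log y - σ) * (Real.log 4 + 5) := by
    rw [intervalIntegral.integral_add, integral_one_div_of_pos hσ (by positivity),
      intervalIntegral.integral_const, smul_eq_mul]
    · congr 2; field_simp
    · apply ContinuousOn.intervalIntegrable
      rw [Set.uIcc_of_le hσ1]
      apply continuousOn_const.div continuousOn_id
      intro u hu; exact (lt_of_lt_of_le hσ hu.1).ne'
    · exact intervalIntegrable_const
  have h4 : (1 / Real.log y - σ) * (Real.log 4 + 5) ≤ 12 := by
    have e1 := Real.log_two_gt_d9
    have e2 := Real.log_two_lt_d9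
    have : 1 / Real.log y ≤ 1.5 := by
      rw [div_le_iff₀ hl]; linarith
    rw [h3]
    nlinarith
  linarith

/-- Mertens upper bound on an interval. -/
lemma sum_primes_Ioc_inv_le (y : ℝ) (hy : 2 ≤ y) (N : ℕ) (hN : y ≤ N) (S : Finset ℕ)
    (hS : ∀ p ∈ S, p.Prime ∧ y < p ∧ p ≤ N) :
    ∑ p ∈ S, (1 : ℝ) / p ≤ Real.log (Real.log N / Real.log y) + 36 := by
  have hl : 0 < Real.log y := Real.log_pos (by linarith)
  have hlN : Real.log y ≤ Real.log N := Real.log_le_log (by linarith) hN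
  have hN0 : 0 < Real.log N := by linarith
  have h1 := sum_primes_gt_rpow_le y hy (1 / Real.log N) (by positivity)
    (by gcongr) S (fun p hp => ⟨(hS p hp).1, (hS p hp).2.1⟩)
  have h2 : ∑ p ∈ S, (1 : ℝ) / p - ∑ p ∈ S, (1 : ℝ) / p * (p : ℝ) ^ (-(1 / Real.log N)) ≤
      (1 / Real.log N) * ∑ p ∈ S, Real.log p / p := by
    rw [mul_sum, ← sum_sub_distrib]
    apply sum_le_sum
    intro p hp
    have hp0 : (0 : ℝ) < p := by exact_mod_cast (hS p hp).1.pos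
    have : 1 - Real.log p * (1 / Real.log N) ≤ (p : ℝ) ^ (-(1 / Real.log N)) := by
      rw [Real.rpow_def_of_pos hp0]
      have := Real.add_one_le_exp (Real.log p * -(1 / Real.log N))
      linarith
    have h5 : (1 : ℝ) / p * (1 - Real.log p * (1 / Real.log N)) ≤
      (1 : ℝ) / p * (p : ℝ) ^ (-(1 / Real.log N)) := by gcongr
    calc _ ≤ (1 : ℝ) / p - 1 / p * (1 - Real.log p * (1 / Real.log N)) := by linarith
      _ = _ := by ring
  have h3 := sum_primes_log_div_le N S (fun p hp => ⟨(hS p hp).1, (hS p hp).2.2⟩)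
  have h4 : (1 / Real.log N) * ∑ p ∈ S, Real.log p / p ≤ 12 := by
    calc _ ≤ (1 / Real.log N) * (Real.log N + (Real.log 4 + 4)) := by gcongr
      _ ≤ 12 := by
        rw [one_div, inv_mul_le_iff₀ hN0]
        have h3 : Real.log 4 = 2 * Real.log 2 := by
          rw [show (4 : ℝ) = 2 ^ 2 by norm_num, Real.log_pow]; norm_num
        have hl2 : Real.log 2 ≤ Real.log y := Real.log_le_log (by norm_num) hy
        have e1 := Real.log_two_gt_d9
        linarith
  have e : 1 / (1 / Real.log N * Real.log y) = Real.log N / Real.log y := by field_simp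
  rw [e] at h1
  linarith

/-- Mertens upper bound. -/
lemma sum_primes_inv_le (N : ℕ) (hN : 2 ≤ N) (S : Finset ℕ)
    (hS : ∀ p ∈ S, p.Prime ∧ p ≤ N) :
    ∑ p ∈ S, (1 : ℝ) / p ≤ Real.log (Real.log N) + 40 := by
  have h1 := sum_primes_Ioc_inv_le 2 le_rfl N (by exact_mod_cast hN) (S.filter (fun p => 2 < p))
    (by
      intro p hp
      rw [mem_filter] at hp
      exact ⟨(hS p hp.1).1, by exact_mod_cast hp.2, (hS p hp.1).2⟩)
  have h2 : ∑ p ∈ S, (1 : ℝ) / p ≤ ∑ p ∈ S.filter (fun p => 2 < p), (1 : ℝ) / p + 1 := by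
    rw [← sum_filter_add_sum_filter_not S (fun p => 2 < p)]
    gcongr
    calc _ ≤ ∑ p ∈ ({2} : Finset ℕ), (1 : ℝ) / p := by
          apply sum_le_sum_of_subset_of_nonneg
          · intro p hp
            rw [mem_filter] at hp
            have := (hS p hp.1).1.two_le
            simp; omega
          · intros; positivity
      _ ≤ 1 := by norm_num
  have hl : 0 < Real.log 2 := Real.log_pos (by norm_num)
  have hlN : 0 < Real.log N := Real.log_pos (by exact_mod_cast hN)
  rw [Real.log_div hlN.ne' hl.ne'] at h1
  have h3 : -1 ≤ Real.log (Real.log 2) := by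
    rw [Real.le_log_iff_exp_le hl]
    have e1 := Real.log_two_gt_d9
    have e2 := Real.exp_neg_one_lt_d9
    linarith
  linarith

end PrimeSums

section EulerBounds
open Finset

/-- A nonnegative multiplicative function bounded by the `K`-th power of the divisor function. -/
structure IsDivisorBounded (K : ℕ) (g : ℕ → ℝ) : Prop where
  nonneg : ∀ n, 0 ≤ g n
  map_one : g 1 = 1
  mult : ∀ m n : ℕ, Nat.Coprime m n → g (m * n) = g m * g n
  le_pow : ∀ p k : ℕ, p.Prime → g (p ^ k) ≤ ((k : ℝ) + 1) ^ K

lemma sum_multiplicative_le_prod (g : ℕ → ℝ) (h0 : ∀ n, 0 ≤ g n) (h1 : g 1 = 1)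
    (hmul : ∀ m n : ℕ, Nat.Coprime m n → g (m * n) = g m * g n)
    (hsum : ∀ p : ℕ, p.Prime → Summable fun k : ℕ => g (p ^ k))
    (P : Finset ℕ) (hP : ∀ p ∈ P, p.Prime) (S : Finset ℕ)
    (hS : ∀ n ∈ S, n ≠ 0 ∧ n.primeFactors ⊆ P) :
    ∑ n ∈ S, g n ≤ ∏ p ∈ P, ∑' k : ℕ, g (p ^ k) := by
  have h := (EulerProduct.summable_and_hasSum_factoredNumbers_prod_filter_prime_tsum (f := g) h1
    (fun {m n} hmn => hmul m n hmn)
    (fun {p} hp => by simpa [Real.norm_eq_abs, abs_of_nonneg (h0 _)] using hsum p hp) P).2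
  rw [filter_true_of_mem hP] at h
  have hS' : ∀ n ∈ S, n ∈ Nat.factoredNumbers P := by
    intro n hn
    rw [Nat.mem_factoredNumbers]
    refine ⟨(hS n hn).1, fun p hp => (hS n hn).2 ?_⟩
    exact List.mem_toFinset.2 hp
  have h2 := sum_le_hasSum (S.subtype (· ∈ Nat.factoredNumbers P)) (fun i _ => h0 i) h
  rwa [sum_subtype_of_mem _ hS'] at h2

lemma summable_succ_pow_mul (K : ℕ) (r : ℝ) (hr0 : 0 ≤ r) (hr : r < 1) :
    Summable fun k : ℕ => ((k : ℝ) + 3) ^ K * r ^ k := by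
  rcases hr0.eq_or_lt with rfl | hr0
  · apply summable_of_ne_finset_zero (s := {0})
    intro b hb
    simp at hb
    simp [hb]
  have h := summable_pow_mul_geometric_of_norm_lt_one K (r := r)
    (by rwa [Real.norm_of_nonneg hr0.le])
  have h2 := (summable_nat_add_iff 3).2 h
  have h3 := h2.mul_left (r⁻¹ ^ 3)
  refine h3.congr fun k => ?_
  push_cast
  field_simp
  ring


/-- The tail constant for local Euler factors. -/
lemma exists_local_tail_bound (K : ℕ) (r : ℝ) (hr0 : 0 ≤ r) (hr : r < 1) : ∃ C : ℝ, 0 < C ∧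
    ∀ a : ℕ → ℝ, (∀ k, 0 ≤ a k) → (∀ k, a k ≤ ((k : ℝ) + 1) ^ K) → ∀ z : ℝ, 0 ≤ z → z ≤ r →
    Summable (fun k => a k * z ^ k) ∧ ∑' k, a k * z ^ k ≤ a 0 + a 1 * z + C * z ^ 2 ∧
    ∑' k, a (k + 2) * z ^ (k + 2) ≤ C * z ^ 2 := by
  have hs := summable_succ_pow_mul K r hr0 hr
  have hpos : 0 ≤ ∑' k : ℕ, ((k : ℝ) + 3) ^ K * r ^ k := tsum_nonneg fun k => by positivity
  refine ⟨∑' k : ℕ, ((k : ℝ) + 3) ^ K * r ^ k + 1, by linarith, ?_⟩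
  intro a ha0 ha z hz0 hz
  have hle : ∀ k, a (k + 2) * z ^ (k + 2) ≤ z ^ 2 * (((k : ℝ) + 3) ^ K * r ^ k) := by
    intro k
    have h1 : a (k + 2) ≤ ((k : ℝ) + 3) ^ K := by
      have := ha (k + 2)
      push_cast at this
      convert this using 2; ring
    calc _ = z ^ 2 * (a (k + 2) * z ^ k) := by ring
      _ ≤ z ^ 2 * (((k : ℝ) + 3) ^ K * r ^ k) := by gcongr
  have hs2 : Summable fun k => a (k + 2) * z ^ (k + 2) :=
    Summable.of_nonneg_of_le (fun k => mul_nonneg (ha0 _) (by positivity)) hle (hs.mul_left _)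
  have hs0 : Summable fun k => a k * z ^ k := (summable_nat_add_iff 2).1 hs2
  have ht : ∑' k, a (k + 2) * z ^ (k + 2) ≤
      (∑' k : ℕ, ((k : ℝ) + 3) ^ K * r ^ k + 1) * z ^ 2 := by
    calc _ ≤ ∑' k : ℕ, z ^ 2 * (((k : ℝ) + 3) ^ K * r ^ k) := hs2.tsum_le_tsum hle (hs.mul_left _)
      _ = (∑' k : ℕ, ((k : ℝ) + 3) ^ K * r ^ k) * z ^ 2 := by rw [tsum_mul_left, mul_comm]
      _ ≤ _ := by gcongr; linarith
  refine ⟨hs0, ?_, ht⟩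
  rw [← hs0.sum_add_tsum_nat_add 2]
  simp only [sum_range_succ, sum_range_zero, pow_zero, pow_one, mul_one, zero_add]
  linarith

lemma sum_primes_rpow_three_half_le (S : Finset ℕ) (hS : ∀ p ∈ S, p.Prime) :
    ∑ p ∈ S, (p : ℝ) ^ (-(3 / 2) : ℝ) ≤ 3 := by
  obtain ⟨N, hN⟩ : ∃ N, S ⊆ Icc 1 N := by
    refine ⟨S.sup id, fun p hp => ?_⟩
    rw [mem_Icc]
    exact ⟨(hS p hp).one_le, le_sup (f := id) hp⟩
  calc _ ≤ ∑ p ∈ Icc 1 N, (p : ℝ) ^ (-(3 / 2) : ℝ) :=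
        sum_le_sum_of_subset_of_nonneg hN (fun i _ _ => by positivity)
    _ = ∑ n ∈ Icc 1 N, (1 : ℝ) / n * (n : ℝ) ^ (-(1 / 2) : ℝ) := by
        apply sum_congr rfl
        intro n hn
        rw [mem_Icc] at hn
        have : (0 : ℝ) < n := by exact_mod_cast hn.1
        rw [show (-(3 / 2) : ℝ) = -1 + -(1 / 2) by norm_num, Real.rpow_add this, Real.rpow_neg_one,
          ← one_div]
    _ ≤ 1 + 1 / (1 / 2) := sum_rpow_neg_one_sub_le _ (by norm_num) N
    _ = 3 := by norm_num

lemma prime_rpow_neg_le (p : ℕ) (hp : p.Prime) (θ : ℝ) (hθ : 3 / 4 ≤ θ) :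
    (p : ℝ) ^ (-θ) ≤ 3 / 5 := by
  have h2 : (2 : ℝ) ≤ p := by exact_mod_cast hp.two_le
  calc (p : ℝ) ^ (-θ) ≤ (2 : ℝ) ^ (-θ) :=
        Real.rpow_le_rpow_of_nonpos (by norm_num) h2 (by linarith)
    _ ≤ (2 : ℝ) ^ (-(3 / 4) : ℝ) := Real.rpow_le_rpow_of_exponent_le (by norm_num) (by linarith)
    _ ≤ 3 / 5 := by
      have h : ((2 : ℝ) ^ (-(3 / 4) : ℝ)) ^ 4 ≤ (3 / 5) ^ 4 := by
        rw [← Real.rpow_natCast, ← Real.rpow_mul (by norm_num)]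
        norm_num
      exact le_of_pow_le_pow_left₀ (by norm_num) (by norm_num) h

/-- Rankin-type Euler product bound. -/
lemma exists_sum_rpow_le_exp (K : ℕ) : ∃ C : ℝ, 0 < C ∧ ∀ g : ℕ → ℝ, IsDivisorBounded K g →
    ∀ θ : ℝ, 3 / 4 ≤ θ → ∀ P : Finset ℕ, (∀ p ∈ P, p.Prime) → ∀ S : Finset ℕ,
    (∀ n ∈ S, n ≠ 0 ∧ n.primeFactors ⊆ P) →
    ∑ n ∈ S, g n * (n : ℝ) ^ (-θ) ≤ C * Real.exp (∑ p ∈ P, g p * (p : ℝ) ^ (-θ)) := by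
  obtain ⟨C, hC, h⟩ := exists_local_tail_bound K (3 / 5) (by norm_num) (by norm_num)
  refine ⟨Real.exp (C * 3), Real.exp_pos _, ?_⟩
  intro g hg θ hθ P hP S hS
  have hz : ∀ p k : ℕ, ((p ^ k : ℕ) : ℝ) ^ (-θ) = ((p : ℝ) ^ (-θ)) ^ k := by
    intro p k
    push_cast
    rw [← Real.rpow_natCast, ← Real.rpow_natCast, ← Real.rpow_mul (by positivity),
      ← Real.rpow_mul (by positivity), mul_comm]
  have hloc : ∀ p : ℕ, p.Prime → Summable (fun k => g (p ^ k) * ((p : ℝ) ^ (-θ)) ^ k) ∧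
      ∑' k, g (p ^ k) * ((p : ℝ) ^ (-θ)) ^ k ≤
      1 + g p * (p : ℝ) ^ (-θ) + C * ((p : ℝ) ^ (-θ)) ^ 2 := by
    intro p hp
    have := h (fun k => g (p ^ k)) (fun k => hg.nonneg _) (fun k => hg.le_pow p k hp)
      ((p : ℝ) ^ (-θ)) (by positivity) (prime_rpow_neg_le p hp θ hθ)
    refine ⟨this.1, this.2.1.trans ?_⟩
    simp [hg.map_one]
  have h1 := sum_multiplicative_le_prod (fun n => g n * (n : ℝ) ^ (-θ))
    (fun n => mul_nonneg (hg.nonneg n) (by positivity)) (by simp [hg.map_one])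
    (fun m n hmn => by
      rw [hg.mult m n hmn]
      push_cast
      rw [Real.mul_rpow (by positivity) (by positivity)]; ring)
    (fun p hp => by simpa only [hz] using (hloc p hp).1) P hP S hS
  refine h1.trans ?_
  simp only [hz]
  calc _ ≤ ∏ p ∈ P, Real.exp (g p * (p : ℝ) ^ (-θ) + C * (p : ℝ) ^ (-(3 / 2) : ℝ)) := by
        apply prod_le_prod
        · intro p _
          exact tsum_nonneg fun k => mul_nonneg (hg.nonneg _) (by positivity)
        · intro p hp
          have hp1 : (1 : ℝ) ≤ p := by exact_mod_cast (hP p hp).one_le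
          refine (hloc p (hP p hp)).2.trans ?_
          have : ((p : ℝ) ^ (-θ)) ^ 2 ≤ (p : ℝ) ^ (-(3 / 2) : ℝ) := by
            rw [← Real.rpow_natCast, ← Real.rpow_mul (by positivity)]
            apply Real.rpow_le_rpow_of_exponent_le hp1
            push_cast; linarith
          have h3 := Real.add_one_le_exp (g p * (p : ℝ) ^ (-θ) + C * (p : ℝ) ^ (-(3 / 2) : ℝ))
          have h4 := mul_le_mul_of_nonneg_left this hC.le
          linarith
    _ = Real.exp (∑ p ∈ P, g p * (p : ℝ) ^ (-θ)) *
          Real.exp (C * ∑ p ∈ P, (p : ℝ) ^ (-(3 / 2) : ℝ)) := by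
        rw [← Real.exp_sum, sum_add_distrib, ← mul_sum, Real.exp_add]
    _ ≤ Real.exp (∑ p ∈ P, g p * (p : ℝ) ^ (-θ)) * Real.exp (C * 3) := by
        gcongr
        exact sum_primes_rpow_three_half_le P hP
    _ = _ := by ring

end EulerBounds

section SelbergSieve
open Finset

lemma sum_moebius_divisors (k : ℕ) :
    ∑ e ∈ k.divisors, (ArithmeticFunction.moebius e : ℝ) = if k = 1 then 1 else 0 := by
  have h := congrArg (fun f : ArithmeticFunction ℝ => f k)
    (ArithmeticFunction.coe_zeta_mul_coe_moebius (R := ℝ))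
  simp only [ArithmeticFunction.coe_zeta_mul_apply, ArithmeticFunction.one_apply,
    ArithmeticFunction.intCoe_apply] at h
  exact h

lemma sum_moebius_between (l m : ℕ) (hm : Squarefree m) (hl : l ∣ m) :
    ∑ d ∈ m.divisors.filter (fun d => l ∣ d), (ArithmeticFunction.moebius d : ℝ) =
      if m = l then (ArithmeticFunction.moebius l : ℝ) else 0 := by
  obtain ⟨k, rfl⟩ := hl
  have hlk := Squarefree.ne_zero hm
  have hl0 : l ≠ 0 := left_ne_zero_of_mul hlk
  have hk0 : k ≠ 0 := right_ne_zero_of_mul hlk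
  have hcop : Nat.Coprime l k := Nat.coprime_of_squarefree_mul hm
  have h1 : (l * k).divisors.filter (fun d => l ∣ d) = k.divisors.image (fun e => l * e) := by
    ext d
    simp only [mem_filter, Nat.mem_divisors, mem_image]
    constructor
    · rintro ⟨⟨h1, _⟩, e, rfl⟩
      exact ⟨e, ⟨(Nat.mul_dvd_mul_iff_left (Nat.pos_of_ne_zero hl0)).1 h1, hk0⟩, rfl⟩
    · rintro ⟨e, ⟨h1, _⟩, rfl⟩
      exact ⟨⟨Nat.mul_dvd_mul_left l h1, hlk⟩, dvd_mul_right _ _⟩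
  rw [h1, sum_image (fun a _ b _ h => Nat.eq_of_mul_eq_mul_left (Nat.pos_of_ne_zero hl0) h)]
  have h2 : ∀ e ∈ k.divisors, (ArithmeticFunction.moebius (l * e) : ℝ) =
      ArithmeticFunction.moebius l * ArithmeticFunction.moebius e := by
    intro e he
    have : Nat.Coprime l e := hcop.coprime_dvd_right (Nat.dvd_of_mem_divisors he)
    rw [ArithmeticFunction.isMultiplicative_moebius.map_mul_of_coprime this]
    push_cast; rfl
  rw [sum_congr rfl h2, ← mul_sum, sum_moebius_divisors k]
  have : (l * k = l) ↔ k = 1 := by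
    constructor
    · intro h; exact Nat.eq_of_mul_eq_mul_left (Nat.pos_of_ne_zero hl0) (by omega)
    · rintro rfl; simp
  simp [this]

/-- The support of the Selberg weights. -/
def sieveSupport (q R : ℕ) : Finset ℕ :=
  (Icc 1 R).filter (fun l => Squarefree l ∧ Nat.Coprime l q)

/-- The Selberg normalisation. -/
def sieveG (q R : ℕ) : ℝ := ∑ l ∈ sieveSupport q R, (1 : ℝ) / (l.totient : ℝ)

/-- The Selberg weights. -/
def sieveWeight (q R d : ℕ) : ℝ :=
  (ArithmeticFunction.moebius d : ℝ) * d / sieveG q R *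
    ∑ l ∈ (sieveSupport q R).filter (fun l => d ∣ l), (1 : ℝ) / (l.totient : ℝ)

lemma mem_sieveSupport {q R l : ℕ} : l ∈ sieveSupport q R ↔
    1 ≤ l ∧ l ≤ R ∧ Squarefree l ∧ Nat.Coprime l q := by
  simp [sieveSupport, and_assoc]

lemma one_mem_sieveSupport (q R : ℕ) (hR : 1 ≤ R) : 1 ∈ sieveSupport q R :=
  mem_sieveSupport.2 ⟨le_rfl, hR, squarefree_one, Nat.coprime_one_left q⟩

lemma mem_sieveSupport_of_dvd {q R l d : ℕ} (hl : l ∈ sieveSupport q R) (hd : d ∣ l) :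
    d ∈ sieveSupport q R := by
  rw [mem_sieveSupport] at hl ⊢
  have hd0 : d ≠ 0 := by rintro rfl; simp at hd; omega
  exact ⟨by omega, (Nat.le_of_dvd (by omega) hd).trans hl.2.1, hl.2.2.1.squarefree_of_dvd hd,
    hl.2.2.2.coprime_dvd_left hd⟩

lemma sieveG_pos (q R : ℕ) (hR : 1 ≤ R) : 0 < sieveG q R := by
  apply sum_pos
  · intro l hl
    have := (mem_sieveSupport.1 hl).1
    have : 0 < l.totient := Nat.totient_pos.2 (by omega)
    positivity
  · exact ⟨1, one_mem_sieveSupport q R hR⟩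

lemma sieveWeight_one (q R : ℕ) (hR : 1 ≤ R) : sieveWeight q R 1 = 1 := by
  have := sieveG_pos q R hR
  simp only [sieveWeight, isUnit_one, IsUnit.dvd, filter_true]
  rw [← sieveG]
  simp [this.ne']

lemma abs_sieveWeight_le (q R d : ℕ) (hR : 1 ≤ R) : |sieveWeight q R d| ≤ d := by
  have hG := sieveG_pos q R hR
  have h1 : ∑ l ∈ (sieveSupport q R).filter (fun l => d ∣ l), (1 : ℝ) / (l.totient : ℝ) ≤
      sieveG q R := by
    apply sum_le_sum_of_subset_of_nonneg (filter_subset _ _)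
    intros; positivity
  have h0 : 0 ≤ ∑ l ∈ (sieveSupport q R).filter (fun l => d ∣ l), (1 : ℝ) / (l.totient : ℝ) :=
    sum_nonneg fun _ _ => by positivity
  rw [sieveWeight, abs_mul, abs_div, abs_mul, abs_of_pos hG, abs_of_nonneg h0, Nat.abs_cast]
  have hμ : |(ArithmeticFunction.moebius d : ℝ)| ≤ 1 := by
    have := ArithmeticFunction.abs_moebius_le_one (n := d)
    exact_mod_cast this
  calc _ ≤ 1 * (d : ℝ) / sieveG q R * sieveG q R := by gcongr
    _ = d := by field_simp

lemma sum_sieveWeight_div (q R l : ℕ) (hl : l ∈ sieveSupport q R) :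
    ∑ d ∈ (sieveSupport q R).filter (fun d => l ∣ d), sieveWeight q R d / d =
      (ArithmeticFunction.moebius l : ℝ) / (sieveG q R * l.totient) := by
  have h1 : ∀ d ∈ (sieveSupport q R).filter (fun d => l ∣ d), sieveWeight q R d / d =
      ∑ m ∈ sieveSupport q R, if d ∣ m then
        (ArithmeticFunction.moebius d : ℝ) / (sieveG q R * m.totient) else 0 := by
    intro d hd
    have hd0 : (d : ℝ) ≠ 0 := by
      have := (mem_sieveSupport.1 (mem_filter.1 hd).1).1
      exact_mod_cast (by omega : d ≠ 0)
    rw [← sum_filter, sieveWeight, mul_sum, sum_div]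
    apply sum_congr rfl
    intro m hm
    field_simp
  rw [sum_congr rfl h1, sum_comm]
  have h2 : ∀ m ∈ sieveSupport q R,
      ∑ d ∈ (sieveSupport q R).filter (fun d => l ∣ d), (if d ∣ m then
        (ArithmeticFunction.moebius d : ℝ) / (sieveG q R * m.totient) else 0) =
      if m = l then (ArithmeticFunction.moebius l : ℝ) / (sieveG q R * l.totient) else 0 := by
    intro m hm
    have hm' := mem_sieveSupport.1 hm
    rw [← sum_filter, ← sum_div]
    have e : ((sieveSupport q R).filter (fun d => l ∣ d)).filter (fun d => d ∣ m) =
        m.divisors.filter (fun d => l ∣ d) := by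
      ext d
      simp only [mem_filter, Nat.mem_divisors]
      constructor
      · rintro ⟨⟨_, h1⟩, h2⟩; exact ⟨⟨h2, by omega⟩, h1⟩
      · rintro ⟨⟨h2, _⟩, h1⟩; exact ⟨⟨mem_sieveSupport_of_dvd hm h2, h1⟩, h2⟩
    rw [e]
    by_cases hlm : l ∣ m
    · rw [sum_moebius_between l m hm'.2.2.1 hlm]
      split_ifs with h
      · rw [h]
      · simp
    · have : m.divisors.filter (fun d => l ∣ d) = ∅ := by
        rw [filter_eq_empty_iff]
        intro d hd hld
        exact hlm (hld.trans (Nat.dvd_of_mem_divisors hd))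
      rw [this, if_neg]
      · simp
      · rintro rfl; exact hlm dvd_rfl
  rw [sum_congr rfl h2, sum_ite_eq', if_pos hl]

lemma sum_sieveWeight_lcm (q R : ℕ) (hR : 1 ≤ R) :
    ∑ d₁ ∈ sieveSupport q R, ∑ d₂ ∈ sieveSupport q R,
      sieveWeight q R d₁ * sieveWeight q R d₂ / (Nat.lcm d₁ d₂ : ℝ) = 1 / sieveG q R := by
  have hG := sieveG_pos q R hR
  have h1 : ∀ d₁ ∈ sieveSupport q R, ∀ d₂ ∈ sieveSupport q R,
      sieveWeight q R d₁ * sieveWeight q R d₂ / (Nat.lcm d₁ d₂ : ℝ) =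
      ∑ l ∈ sieveSupport q R, (l.totient : ℝ) * ((if l ∣ d₁ then sieveWeight q R d₁ / d₁ else 0) *
        (if l ∣ d₂ then sieveWeight q R d₂ / d₂ else 0)) := by
    intro d₁ h₁ d₂ h₂
    have h₁' := (mem_sieveSupport.1 h₁).1
    have h₂' := (mem_sieveSupport.1 h₂).1
    have hd₁ : (d₁ : ℝ) ≠ 0 := by exact_mod_cast (by omega : d₁ ≠ 0)
    have hd₂ : (d₂ : ℝ) ≠ 0 := by exact_mod_cast (by omega : d₂ ≠ 0)
    have hlcm : (Nat.lcm d₁ d₂ : ℝ) ≠ 0 := by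
      exact_mod_cast Nat.lcm_ne_zero (by omega) (by omega)
    have hg : ((Nat.gcd d₁ d₂ : ℕ) : ℝ) * (Nat.lcm d₁ d₂ : ℝ) = d₁ * d₂ := by
      exact_mod_cast Nat.gcd_mul_lcm d₁ d₂
    have e1 : ∑ l ∈ sieveSupport q R, (l.totient : ℝ) *
        ((if l ∣ d₁ then sieveWeight q R d₁ / d₁ else 0) *
        (if l ∣ d₂ then sieveWeight q R d₂ / d₂ else 0)) =
        (∑ l ∈ (Nat.gcd d₁ d₂).divisors, (l.totient : ℝ)) *
          (sieveWeight q R d₁ / d₁ * (sieveWeight q R d₂ / d₂)) := by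
      have : (Nat.gcd d₁ d₂).divisors = (sieveSupport q R).filter (fun l => l ∣ d₁ ∧ l ∣ d₂) := by
        ext l
        simp only [Nat.mem_divisors, mem_filter, Nat.dvd_gcd_iff]
        constructor
        · rintro ⟨h, _⟩; exact ⟨mem_sieveSupport_of_dvd h₁ h.1, h⟩
        · rintro ⟨_, h⟩; exact ⟨h, Nat.gcd_ne_zero_left (by omega)⟩
      rw [this, sum_mul, sum_filter]
      apply sum_congr rfl
      intro l _
      by_cases a1 : l ∣ d₁ <;> by_cases a2 : l ∣ d₂ <;> simp [a1, a2]
    rw [e1]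
    have e2 : ∑ l ∈ (Nat.gcd d₁ d₂).divisors, (l.totient : ℝ) = (Nat.gcd d₁ d₂ : ℕ) := by
      exact_mod_cast Nat.sum_totient (Nat.gcd d₁ d₂)
    rw [e2]
    field_simp
    linear_combination (-1 : ℝ) * sieveWeight q R d₁ * sieveWeight q R d₂ * hg
  rw [sum_congr rfl fun d₁ h₁ => sum_congr rfl fun d₂ h₂ => h1 d₁ h₁ d₂ h₂]
  rw [sum_congr rfl fun d₁ _ => sum_comm, sum_comm]
  have h2 : ∀ l ∈ sieveSupport q R, ∑ d₁ ∈ sieveSupport q R, ∑ d₂ ∈ sieveSupport q R,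
      (l.totient : ℝ) * ((if l ∣ d₁ then sieveWeight q R d₁ / d₁ else 0) *
        (if l ∣ d₂ then sieveWeight q R d₂ / d₂ else 0)) =
      1 / (l.totient : ℝ) / sieveG q R ^ 2 := by
    intro l hl
    have hl' := mem_sieveSupport.1 hl
    have ht : (l.totient : ℝ) ≠ 0 := by
      have : 0 < l.totient := Nat.totient_pos.2 (by omega)
      positivity
    simp_rw [← mul_sum, ← sum_mul]
    rw [← sum_filter, sum_sieveWeight_div q R l hl]
    have hsq : (ArithmeticFunction.moebius l : ℝ) ^ 2 = 1 := by
      have := ArithmeticFunction.moebius_sq_eq_one_of_squarefree hl'.2.2.1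
      exact_mod_cast this
    field_simp
    exact hsq
  rw [sum_congr rfl h2, ← sum_div, ← sieveG]
  field_simp

/-- Selberg's upper bound sieve. -/
lemma selberg_sieve_card_le (q R : ℕ) (hR : 1 ≤ R) (A : Finset ℕ) (M : ℝ) 
    (hA : ∀ d : ℕ, 1 ≤ d → Nat.Coprime d q → |((A.filter (fun n => d ∣ n)).card : ℝ) - M / d| ≤ 1) :
    ((A.filter (fun n => ∀ p : ℕ, p.Prime → p ≤ R → ¬ p ∣ n)).card : ℝ) ≤
      M / sieveG q R + (R : ℝ) ^ 4 := by
  set D := sieveSupport q R with hD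
  set lam := sieveWeight q R with hlam
  have h1 : ((A.filter (fun n => ∀ p : ℕ, p.Prime → p ≤ R → ¬ p ∣ n)).card : ℝ) ≤
      ∑ n ∈ A, (∑ d ∈ D, if d ∣ n then lam d else 0) ^ 2 := by
    rw [card_filter]
    push_cast
    apply sum_le_sum
    intro n _
    split_ifs with h
    · rw [sum_eq_single_of_mem 1 (one_mem_sieveSupport q R hR)]
      · simp [hlam, sieveWeight_one q R hR]
      · intro d hd hd1
        rw [if_neg]
        intro hdn
        have hd' := mem_sieveSupport.1 hd
        obtain ⟨p, hp, hpd⟩ := Nat.exists_prime_and_dvd hd1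
        exact h p hp ((Nat.le_of_dvd (by omega) hpd).trans hd'.2.1) (hpd.trans hdn)
    · positivity
  have h2 : ∑ n ∈ A, (∑ d ∈ D, if d ∣ n then lam d else 0) ^ 2 =
      ∑ d₁ ∈ D, ∑ d₂ ∈ D, lam d₁ * lam d₂ *
        ((A.filter (fun n => Nat.lcm d₁ d₂ ∣ n)).card : ℝ) := by
    simp_rw [sq, sum_mul_sum]
    rw [sum_comm]
    apply sum_congr rfl
    intro d₁ _
    rw [sum_comm]
    apply sum_congr rfl
    intro d₂ _
    rw [card_filter]
    push_cast
    rw [mul_sum]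
    apply sum_congr rfl
    intro n _
    by_cases a1 : d₁ ∣ n <;> by_cases a2 : d₂ ∣ n <;> simp [a1, a2, Nat.lcm_dvd_iff]
  have h3 : ∑ d₁ ∈ D, ∑ d₂ ∈ D, lam d₁ * lam d₂ *
        ((A.filter (fun n => Nat.lcm d₁ d₂ ∣ n)).card : ℝ) ≤
      ∑ d₁ ∈ D, ∑ d₂ ∈ D, (M * (lam d₁ * lam d₂ / (Nat.lcm d₁ d₂ : ℝ)) + (R : ℝ) ^ 2) := by
    apply sum_le_sum
    intro d₁ h₁
    apply sum_le_sum
    intro d₂ h₂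
    have h₁' := mem_sieveSupport.1 h₁
    have h₂' := mem_sieveSupport.1 h₂
    have hl : 0 < Nat.lcm d₁ d₂ := Nat.lcm_pos (by omega) (by omega)
    have hc : Nat.Coprime (Nat.lcm d₁ d₂) q :=
      Nat.Coprime.coprime_dvd_left (Nat.lcm_dvd_mul d₁ d₂) (h₁'.2.2.2.mul_left h₂'.2.2.2)
    have := hA _ hl hc
    have b1 := abs_sieveWeight_le q R d₁ hR
    have b2 := abs_sieveWeight_le q R d₂ hR
    have c1 : (d₁ : ℝ) ≤ R := by exact_mod_cast h₁'.2.1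
    have c2 : (d₂ : ℝ) ≤ R := by exact_mod_cast h₂'.2.1
    have e : lam d₁ * lam d₂ * ((A.filter (fun n => Nat.lcm d₁ d₂ ∣ n)).card : ℝ) =
        M * (lam d₁ * lam d₂ / (Nat.lcm d₁ d₂ : ℝ)) + lam d₁ * lam d₂ *
        (((A.filter (fun n => Nat.lcm d₁ d₂ ∣ n)).card : ℝ) - M / (Nat.lcm d₁ d₂ : ℝ)) := by ring
    rw [e]
    gcongr
    calc _ ≤ |lam d₁ * lam d₂ *
        (((A.filter (fun n => Nat.lcm d₁ d₂ ∣ n)).card : ℝ) - M / (Nat.lcm d₁ d₂ : ℝ))| :=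
          le_abs_self _
      _ = |lam d₁| * |lam d₂| * |((A.filter (fun n => Nat.lcm d₁ d₂ ∣ n)).card : ℝ) -
            M / (Nat.lcm d₁ d₂ : ℝ)| := by rw [abs_mul, abs_mul]
      _ ≤ R * R * 1 := by
          gcongr
          · exact b1.trans c1
          · exact b2.trans c2
      _ = (R : ℝ) ^ 2 := by ring
  have h4 : (D.card : ℝ) ≤ R := by
    have : D.card ≤ (Icc 1 R).card := card_le_card (filter_subset _ _)
    rw [Nat.card_Icc] at this
    exact_mod_cast (by omega : D.card ≤ R)
  calc _ ≤ _ := h1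
    _ ≤ _ := h2.le.trans h3
    _ = M * (∑ d₁ ∈ D, ∑ d₂ ∈ D, lam d₁ * lam d₂ / (Nat.lcm d₁ d₂ : ℝ)) +
        (D.card : ℝ) ^ 2 * (R : ℝ) ^ 2 := by
      simp_rw [sum_add_distrib, ← mul_sum, sum_const, nsmul_eq_mul]
      ring
    _ ≤ _ := by
      rw [hD, hlam, sum_sieveWeight_lcm q R hR, ← hD]
      calc _ ≤ M * (1 / sieveG q R) + (R : ℝ) ^ 2 * (R : ℝ) ^ 2 := by gcongr
        _ = _ := by ring

end SelbergSieve

section SieveInProgressions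
open Finset

lemma prod_primes_tsum_inv (P : Finset ℕ) (hP : ∀ p ∈ P, p.Prime) :
    ∏ p ∈ P, ∑' k : ℕ, ((1 : ℝ) / ((p ^ k : ℕ) : ℝ)) = ∏ p ∈ P, (1 - (p : ℝ)⁻¹)⁻¹ := by
  apply prod_congr rfl
  intro p hp
  have h2 : (2 : ℝ) ≤ p := by exact_mod_cast (hP p hp).two_le
  rw [← tsum_geometric_of_lt_one (by positivity) (inv_lt_one_of_one_lt₀ (by linarith))]
  congr 1; ext k; push_cast; simp

lemma sum_inv_le_prod (P : Finset ℕ) (hP : ∀ p ∈ P, p.Prime) (S : Finset ℕ)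
    (hS : ∀ n ∈ S, n ≠ 0 ∧ n.primeFactors ⊆ P) :
    ∑ n ∈ S, (1 : ℝ) / n ≤ ∏ p ∈ P, (1 - (p : ℝ)⁻¹)⁻¹ := by
  rw [← prod_primes_tsum_inv P hP]
  apply sum_multiplicative_le_prod (fun n => (1 : ℝ) / n) (fun n => by positivity) (by simp)
    (fun m n _ => by push_cast; field_simp) _ P hP S hS
  intro p hp
  have h2 : (2 : ℝ) ≤ p := by exact_mod_cast hp.two_le
  have := summable_geometric_of_lt_one (r := (p : ℝ)⁻¹) (by positivity)
    (inv_lt_one_of_one_lt₀ (by linarith))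
  refine this.congr fun k => ?_
  push_cast; simp

lemma div_totient_eq_prod (n : ℕ) (hn : 1 ≤ n) :
    (n : ℝ) / n.totient = ∏ p ∈ n.primeFactors, (1 - (p : ℝ)⁻¹)⁻¹ := by
  have h := Nat.totient_eq_mul_prod_factors n
  have h' : (n.totient : ℝ) = n * ∏ p ∈ n.primeFactors, (1 - (p : ℝ)⁻¹) := by
    have h2 := congrArg (Rat.cast : ℚ → ℝ) h
    push_cast at h2
    exact h2
  have hn0 : (n : ℝ) ≠ 0 := by exact_mod_cast (by omega : n ≠ 0)
  rw [prod_inv_distrib, h', div_mul_cancel_left₀ hn0]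

/-- Lower bound for the Selberg normalisation. -/
lemma log_le_sieveG (q R : ℕ) (hq : 1 ≤ q) :
    Real.log R ≤ q / q.totient * sieveG q R := by
  refine (log_le_sum_inv R).trans ?_
  set r : ℕ → ℕ := fun n => ∏ p ∈ n.primeFactors \ q.primeFactors, p with hr
  have hrdvd : ∀ n, r n ∣ n := fun n =>
    (prod_dvd_prod_of_subset _ _ _ sdiff_subset).trans (Nat.prod_primeFactors_dvd n)
  have hrsq : ∀ n, Squarefree (r n) := fun n => by
    have h1 : Squarefree (∏ p ∈ n.primeFactors, p) := by
      rw [← Nat.radical_eq_prod_primeFactors]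
      exact UniqueFactorizationMonoid.squarefree_radical
    exact h1.squarefree_of_dvd (prod_dvd_prod_of_subset _ _ _ sdiff_subset)
  have hrpf : ∀ n, (r n).primeFactors = n.primeFactors \ q.primeFactors := fun n =>
    Nat.primeFactors_prod fun p hp => Nat.prime_of_mem_primeFactors (mem_sdiff.1 hp).1
  have hmaps : ∀ n ∈ Icc 1 R, r n ∈ sieveSupport q R := by
    intro n hn
    rw [mem_Icc] at hn
    rw [mem_sieveSupport]
    refine ⟨Nat.pos_of_ne_zero (hrsq n).ne_zero,
      (Nat.le_of_dvd (by omega) (hrdvd n)).trans hn.2, hrsq n, ?_⟩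
    rw [← Nat.disjoint_primeFactors (hrsq n).ne_zero (by omega), hrpf]
    exact sdiff_disjoint
  rw [← sum_fiberwise_of_maps_to hmaps, sieveG, mul_sum]
  apply sum_le_sum
  intro l hl
  have hl' := mem_sieveSupport.1 hl
  have hl0 : (l : ℝ) ≠ 0 := by exact_mod_cast (by omega : l ≠ 0)
  have hdisj : Disjoint q.primeFactors l.primeFactors :=
    (Nat.disjoint_primeFactors (by omega) (by omega)).2 hl'.2.2.2.symm
  set F := (Icc 1 R).filter (fun n => r n = l) with hF
  have hinj : Set.InjOn (fun n => n / l) (F : Set ℕ) := by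
    intro a ha b hb hab
    simp only [hF, coe_filter, Set.mem_ofPred_eq] at ha hb
    have ha' : l ∣ a := ha.2 ▸ hrdvd a
    have hb' : l ∣ b := hb.2 ▸ hrdvd b
    simp only at hab
    rw [← Nat.div_mul_cancel ha', ← Nat.div_mul_cancel hb', hab]
  have h1 : ∑ n ∈ F, (1 : ℝ) / n = 1 / l * ∑ m ∈ F.image (fun n => n / l), (1 : ℝ) / m := by
    rw [sum_image hinj, mul_sum]
    apply sum_congr rfl
    intro n hn
    have hn' := (mem_filter.1 hn)
    have hd : l ∣ n := hn'.2 ▸ hrdvd n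
    have h0 : n ≠ 0 := by have := (mem_Icc.1 hn'.1).1; omega
    rw [Nat.cast_div hd hl0]
    field_simp
  have h2 : ∑ m ∈ F.image (fun n => n / l), (1 : ℝ) / m ≤
      ∏ p ∈ q.primeFactors ∪ l.primeFactors, (1 - (p : ℝ)⁻¹)⁻¹ := by
    apply sum_inv_le_prod
    · intro p hp
      rcases mem_union.1 hp with h | h <;> exact Nat.prime_of_mem_primeFactors h
    · intro m hm
      obtain ⟨n, hn, rfl⟩ := mem_image.1 hm
      have hn' := (mem_filter.1 hn)
      have hd : l ∣ n := hn'.2 ▸ hrdvd n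
      have h0 : n ≠ 0 := by have := (mem_Icc.1 hn'.1).1; omega
      refine ⟨(Nat.div_pos (Nat.le_of_dvd (by omega) hd) (by omega)).ne', ?_⟩
      refine (Nat.primeFactors_mono (Nat.div_dvd_of_dvd hd) h0).trans ?_
      rw [← hn'.2, hrpf]
      intro p hp
      simp only [mem_union, mem_sdiff]
      tauto
  rw [h1]
  calc _ ≤ 1 / (l : ℝ) * ∏ p ∈ q.primeFactors ∪ l.primeFactors, (1 - (p : ℝ)⁻¹)⁻¹ := by gcongr
    _ = _ := by
      rw [prod_union hdisj, ← div_totient_eq_prod q hq, ← div_totient_eq_prod l hl'.1]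
      field_simp

lemma card_Ioc_modEq_sub_le (N H r v : ℕ) (hr : 0 < r) :
    |(((Ioc N (N + H)).filter (fun n => n ≡ v [MOD r])).card : ℝ) - H / r| ≤ 1 := by
  have h := Nat.Ioc_filter_modEq_card N (N + H) hr v
  set c := ((Ioc N (N + H)).filter (fun n => n ≡ v [MOD r])).card
  set x : ℚ := ((N + H : ℕ) - (v : ℚ)) / r with hx
  set y : ℚ := ((N : ℚ) - (v : ℚ)) / r with hy
  have hr' : (0 : ℚ) < r := by exact_mod_cast hr
  have hxy : x - y = H / r := by rw [hx, hy]; push_cast; field_simp; ring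
  have h1 := Int.floor_le x
  have h2 := Int.lt_floor_add_one x
  have h3 := Int.floor_le y
  have h4 := Int.lt_floor_add_one y
  have h5 : (0 : ℚ) ≤ H / r := by positivity
  have h6 : ⌊y⌋ ≤ ⌊x⌋ := Int.floor_le_floor (by linarith)
  rw [max_eq_left (by linarith)] at h
  have h7 : (c : ℚ) = ⌊x⌋ - ⌊y⌋ := by exact_mod_cast h
  have h8 : |(c : ℚ) - H / r| ≤ 1 := by rw [abs_le]; constructor <;> linarith
  have h9 := (Rat.cast_le (K := ℝ)).2 h8
  push_cast at h9
  exact h9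

lemma card_Ioc_modEq_dvd_sub_le (q a N H d : ℕ) (hq : 1 ≤ q) (hd : 1 ≤ d) (hdq : Nat.Coprime d q) :
    |((((Ioc N (N + H)).filter (fun n => n ≡ a [MOD q])).filter (fun n => d ∣ n)).card : ℝ) -
      (H / q : ℝ) / d| ≤ 1 := by
  set v : ℕ := (Nat.chineseRemainder hdq.symm a 0).1
  have hv := (Nat.chineseRemainder hdq.symm a 0).2
  have e : ((Ioc N (N + H)).filter (fun n => n ≡ a [MOD q])).filter (fun n => d ∣ n) =
      (Ioc N (N + H)).filter (fun n => n ≡ v [MOD (q * d)]) := by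
    rw [filter_filter]
    apply filter_congr
    intro n _
    rw [← Nat.modEq_and_modEq_iff_modEq_mul hdq.symm]
    constructor
    · rintro ⟨h1, h2⟩
      exact ⟨h1.trans hv.1.symm, ((Nat.modEq_zero_iff_dvd).2 h2).trans hv.2.symm⟩
    · rintro ⟨h1, h2⟩
      exact ⟨h1.trans hv.1, (Nat.modEq_zero_iff_dvd).1 (h2.trans hv.2)⟩
  rw [e]
  have := card_Ioc_modEq_sub_le N H (q * d) v (by positivity)
  rw [div_div]
  exact_mod_cast this

/-- Sieve bound for rough numbers in an arithmetic progression in a short interval. -/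
lemma card_rough_modEq_le (q a N H w : ℕ) (hq : 1 ≤ q) (hw : 2 ≤ w) :
    (((Ioc N (N + H)).filter (fun n => n ≡ a [MOD q] ∧
      ∀ p : ℕ, p.Prime → p ≤ w → ¬ p ∣ n)).card : ℝ) ≤
      H / (q.totient * Real.log w) + (w : ℝ) ^ 4 := by
  have h := selberg_sieve_card_le q w (by omega)
    ((Ioc N (N + H)).filter (fun n => n ≡ a [MOD q])) (H / q)
    (fun d hd hdq => card_Ioc_modEq_dvd_sub_le q a N H d hq hd hdq)
  rw [filter_filter] at h
  refine h.trans ?_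
  gcongr ?_ + _
  have hG := sieveG_pos q w (by omega)
  have hlog : 0 < Real.log w := Real.log_pos (by exact_mod_cast hw)
  have hφ : (0 : ℝ) < q.totient := by exact_mod_cast Nat.totient_pos.2 (by omega)
  have hq0 : (0 : ℝ) < q := by exact_mod_cast hq
  have h2 := log_le_sieveG q w hq
  have h3 : q.totient * Real.log w ≤ q * sieveG q w := by
    calc _ ≤ q.totient * (q / q.totient * sieveG q w) := by gcongr
      _ = _ := by field_simp
  rw [div_div]
  gcongr

end SieveInProgressions

section BrunTitchmarsh
open Finset ArithmeticFunction

lemma rpow_natCast_aux (m : ℝ) (hm : 0 ≤ m) (a : ℝ) (k : ℕ) : (m ^ a) ^ k = m ^ (a * k) := by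
  rw [← Real.rpow_natCast, ← Real.rpow_mul hm]

lemma sum_vonMangoldt_not_prime_le (S : Finset ℕ) (x : ℝ) (hx : 1 ≤ x)
    (hS : ∀ n ∈ S, ¬ n.Prime ∧ 1 ≤ n ∧ (n : ℝ) ≤ x) :
    ∑ n ∈ S, vonMangoldt n ≤ 2 * √x * Real.log x := by
  refine le_trans ?_ (Chebyshev.psi_sub_theta_le hx)
  rw [Chebyshev.psi_sub_theta_eq_sum_not_prime]
  apply sum_le_sum_of_subset_of_nonneg
  · intro n hn
    rw [mem_filter, mem_Ioc]
    exact ⟨⟨(hS n hn).2.1, Nat.le_floor (hS n hn).2.2⟩, (hS n hn).1⟩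
  · intros; exact vonMangoldt_nonneg

lemma exists_sieve_level (m : ℝ) (hm : 2 ^ 20 ≤ m) : ∃ w : ℕ, 2 ≤ w ∧
    (w : ℝ) ≤ m ^ (1 / 10 : ℝ) ∧ 1 / 20 * Real.log m ≤ Real.log w := by
  have hm0 : 0 < m := by linarith [show (0:ℝ) < 2 ^ 20 by norm_num]
  have h20 : (2 : ℝ) ≤ m ^ (1 / 20 : ℝ) := by
    calc (2 : ℝ) = ((2 : ℝ) ^ (20 : ℕ)) ^ (1 / 20 : ℝ) := by
          rw [← Real.rpow_natCast, ← Real.rpow_mul (by norm_num)]; norm_num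
      _ ≤ _ := by gcongr
  have h10 : m ^ (1 / 10 : ℝ) = m ^ (1 / 20 : ℝ) * m ^ (1 / 20 : ℝ) := by
    rw [← Real.rpow_add hm0]; norm_num
  refine ⟨⌊m ^ (1 / 10 : ℝ)⌋₊, ?_, Nat.floor_le (by positivity), ?_⟩
  · apply Nat.le_floor
    rw [h10]; push_cast; nlinarith
  · rw [← Real.log_rpow hm0]
    apply Real.log_le_log (by positivity)
    have := Nat.lt_floor_add_one (m ^ (1 / 10 : ℝ))
    nlinarith

/-- Brun–Titchmarsh for prime powers in short multiplicative windows. -/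
lemma exists_brun_titchmarsh_window : ∃ C : ℝ, 0 < C ∧ ∀ q : ℕ, 1 ≤ q → ∀ T : ℝ, 1 ≤ T →
    ∀ m : ℕ, 2 ^ 20 ≤ (m : ℝ) → (q * T) ^ 5 ≤ (m : ℝ) → ∀ b : ℕ, ∀ S : Finset ℕ,
    (∀ n ∈ S, n ≡ b [MOD q] ∧ 1 ≤ n ∧ |Real.log n - Real.log m| ≤ 1 / T) →
    ∑ n ∈ S, vonMangoldt n / n ≤ C / (T * q.totient) := by
  refine ⟨720, by norm_num, ?_⟩
  intro q hq T hT m hm hqT b S hS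
  have hm0 : (0 : ℝ) < m := by linarith [show (0:ℝ) < 2 ^ 20 by norm_num]
  have hm1 : (1 : ℝ) < m := by linarith [show (1:ℝ) < 2 ^ 20 by norm_num]
  have hlm : 0 < Real.log m := Real.log_pos hm1
  have hq0 : (1 : ℝ) ≤ q := by exact_mod_cast hq
  have hφ : (0 : ℝ) < q.totient := by exact_mod_cast Nat.totient_pos.2 (by omega)
  have hφq : (q.totient : ℝ) ≤ q := by exact_mod_cast Nat.totient_le q
  have hqT1 : (1 : ℝ) ≤ q * T := one_le_mul_of_one_le_of_one_le hq0 hT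
  have hinvT : 1 / T ≤ 1 := by rw [div_le_one (by linarith)]; exact hT
  have hinvT0 : 0 < 1 / T := by positivity
  obtain ⟨w, hw2, hwm, hlw⟩ := exists_sieve_level m hm
  have he3 : Real.exp (1 / T) ≤ 3 := by
    calc Real.exp (1 / T) ≤ Real.exp 1 := Real.exp_le_exp.2 hinvT
      _ ≤ 3 := by linarith [Real.exp_one_lt_d9]
  have hrange : ∀ n ∈ S, (m : ℝ) * Real.exp (-(1 / T)) ≤ n ∧ (n : ℝ) ≤ m * Real.exp (1 / T) := by
    intro n hn
    obtain ⟨_, h1, h2⟩ := hS n hn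
    have hn0 : (0 : ℝ) < n := by exact_mod_cast h1
    rw [abs_le] at h2
    constructor
    · calc _ = Real.exp (Real.log m + -(1 / T)) := by rw [Real.exp_add, Real.exp_log hm0]
        _ ≤ Real.exp (Real.log n) := Real.exp_le_exp.2 (by linarith)
        _ = n := Real.exp_log hn0
    · calc (n : ℝ) = Real.exp (Real.log n) := (Real.exp_log hn0).symm
        _ ≤ Real.exp (Real.log m + 1 / T) := Real.exp_le_exp.2 (by linarith)
        _ = _ := by rw [Real.exp_add, Real.exp_log hm0]
  have hm3 : ∀ n ∈ S, (m : ℝ) / 3 ≤ n := by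
    intro n hn
    refine le_trans ?_ (hrange n hn).1
    rw [Real.exp_neg, div_eq_mul_inv]
    gcongr
  have h3m : ∀ n ∈ S, (n : ℝ) ≤ 3 * m := by
    intro n hn
    refine (hrange n hn).2.trans ?_
    rw [mul_comm]; gcongr
  have hl3m : Real.log (3 * m) ≤ 2 * Real.log m := by
    rw [Real.log_mul (by norm_num) hm0.ne']
    have : Real.log 3 ≤ Real.log m := Real.log_le_log (by norm_num)
      (by linarith [show (3:ℝ) < 2 ^ 20 by norm_num])
    linarith
  have hpow5 : q * T ≤ (m : ℝ) ^ (1 / 5 : ℝ) := by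
    calc q * T = (((q : ℝ) * T) ^ (5 : ℕ)) ^ (1 / 5 : ℝ) := by
          rw [← Real.rpow_natCast, ← Real.rpow_mul (by positivity)]; norm_num
      _ ≤ _ := by gcongr
  have hm80 : (m : ℝ) ^ (4 / 5 : ℝ) ≤ m / (T * q.totient) := by
    rw [le_div_iff₀ (by positivity)]
    calc _ ≤ (m : ℝ) ^ (4 / 5 : ℝ) * (m : ℝ) ^ (1 / 5 : ℝ) := by
          gcongr
          calc T * q.totient ≤ T * q := by gcongr
            _ = q * T := mul_comm _ _
            _ ≤ _ := hpow5
      _ = m := by rw [← Real.rpow_add hm0]; norm_num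
  have hlog4 : Real.log m ≤ 4 * (m : ℝ) ^ (1 / 4 : ℝ) := by
    have := Real.log_le_rpow_div hm0.le (show (0 : ℝ) < 1 / 4 by norm_num)
    linarith
  -- the interval
  set N : ℕ := ⌈(m : ℝ) * Real.exp (-(1 / T))⌉₊ - 1 with hN
  set H : ℕ := ⌊(m : ℝ) * Real.exp (1 / T)⌋₊ - N with hH
  have hceil : 1 ≤ ⌈(m : ℝ) * Real.exp (-(1 / T))⌉₊ := Nat.ceil_pos.2 (by positivity)
  have hN1 : (m : ℝ) * Real.exp (-(1 / T)) ≤ N + 1 := by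
    have : ((N + 1 : ℕ) : ℝ) = (⌈(m : ℝ) * Real.exp (-(1 / T))⌉₊ : ℝ) := by
      congr 1; omega
    push_cast at this
    rw [this]; exact Nat.le_ceil _
  have hHle : (H : ℝ) ≤ 5 * m / T := by
    have hle : (⌊(m : ℝ) * Real.exp (1 / T)⌋₊ : ℝ) ≤ m * Real.exp (1 / T) :=
      Nat.floor_le (by positivity)
    have e1 := (abs_le.1 (Real.abs_exp_sub_one_le (x := 1 / T) (by rw [abs_of_pos hinvT0]; exact hinvT))).2
    have e2 := (abs_le.1 (Real.abs_exp_sub_one_le (x := -(1 / T)) (by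
      rw [abs_neg, abs_of_pos hinvT0]; exact hinvT))).1
    rw [abs_of_pos hinvT0] at e1
    rw [abs_neg, abs_of_pos hinvT0] at e2
    have hTm : T ≤ m := by
      calc T ≤ q * T := by nlinarith
        _ ≤ (q * T) ^ 5 := le_self_pow₀ hqT1 (by norm_num)
        _ ≤ m := hqT
    have hmT : 1 ≤ m / T := by rw [le_div_iff₀ (by linarith)]; linarith
    have e3 : (m : ℝ) * Real.exp (1 / T) - m * Real.exp (-(1 / T)) ≤ 4 * (m / T) := by
      have : Real.exp (1 / T) - Real.exp (-(1 / T)) ≤ 4 * (1 / T) := by linarith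
      calc _ = m * (Real.exp (1 / T) - Real.exp (-(1 / T))) := by ring
        _ ≤ m * (4 * (1 / T)) := by gcongr
        _ = _ := by ring
    rcases le_total N ⌊(m : ℝ) * Real.exp (1 / T)⌋₊ with h | h
    · rw [hH, Nat.cast_sub h]
      calc _ ≤ 4 * (m / T) + 1 := by linarith
        _ ≤ 5 * m / T := by rw [mul_div_assoc]; linarith
    · rw [hH, Nat.sub_eq_zero_of_le h]
      push_cast; positivity
  have hmem : ∀ n ∈ S, n ∈ Ioc N (N + H) := by
    intro n hn
    rw [mem_Ioc]
    have h1 := Nat.ceil_le.2 (hrange n hn).1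
    have h2 := Nat.le_floor (hrange n hn).2
    omega
  -- primes
  have hprime : ∑ n ∈ S.filter Nat.Prime, vonMangoldt n ≤
      (H / (q.totient * Real.log w) + (w : ℝ) ^ 4) * (2 * Real.log m) := by
    calc _ ≤ ∑ n ∈ S.filter Nat.Prime, 2 * Real.log m := by
          apply sum_le_sum
          intro n hn
          rw [mem_filter] at hn
          rw [vonMangoldt_apply_prime hn.2]
          exact (Real.log_le_log (by exact_mod_cast hn.2.pos) (h3m n hn.1)).trans hl3m
      _ = ((S.filter Nat.Prime).card : ℝ) * (2 * Real.log m) := by rw [sum_const, nsmul_eq_mul]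
      _ ≤ _ := by
        gcongr
        refine le_trans ?_ (card_rough_modEq_le q b N H w hq hw2)
        norm_cast
        apply card_le_card
        intro n hn
        rw [mem_filter] at hn
        rw [mem_filter]
        refine ⟨hmem n hn.1, (hS n hn.1).1, ?_⟩
        intro p hp hpw hpn
        have : p = n := (Nat.prime_dvd_prime_iff_eq hp hn.2).1 hpn
        have h1 := hm3 n hn.1
        have h2 : (n : ℝ) ≤ w := by exact_mod_cast this ▸ hpw
        have h3 : (m : ℝ) ^ (1 / 10 : ℝ) * 4 ≤ m := by
          have e : (m : ℝ) = m ^ (1 / 10 : ℝ) * m ^ (9 / 10 : ℝ) := by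
            rw [← Real.rpow_add hm0]; norm_num
          have : (4 : ℝ) ≤ m ^ (9 / 10 : ℝ) := by
            calc (4 : ℝ) ≤ ((2 : ℝ) ^ (20 : ℕ)) ^ (9 / 10 : ℝ) := by
                  rw [← Real.rpow_natCast, ← Real.rpow_mul (by norm_num)]; norm_num
              _ ≤ _ := by gcongr
          calc _ ≤ (m : ℝ) ^ (1 / 10 : ℝ) * m ^ (9 / 10 : ℝ) := by gcongr
            _ = m := e.symm
        linarith
  have hnp : ∑ n ∈ S.filter (fun n => ¬ n.Prime), vonMangoldt n ≤
      2 * √(3 * m) * (2 * Real.log m) := by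
    refine (sum_vonMangoldt_not_prime_le _ (3 * m) (by linarith) ?_).trans ?_
    · intro n hn
      rw [mem_filter] at hn
      exact ⟨hn.2, (hS n hn.1).2.1, h3m n hn.1⟩
    · gcongr
  have hw4 : (w : ℝ) ^ 4 ≤ (m : ℝ) ^ (2 / 5 : ℝ) := by
    calc (w : ℝ) ^ 4 ≤ ((m : ℝ) ^ (1 / 10 : ℝ)) ^ 4 := by gcongr
      _ = _ := by rw [rpow_natCast_aux _ hm0.le]; norm_num
  have hlogw : 0 < Real.log w := by linarith
  set Y := (m : ℝ) / (T * q.totient) with hY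
  have t1 : H / (q.totient * Real.log w) * (2 * Real.log m) ≤ 200 * Y := by
    calc _ ≤ (5 * m / T) / (q.totient * (1 / 20 * Real.log m)) * (2 * Real.log m) := by gcongr
      _ = 200 * Y := by rw [hY]; field_simp; norm_num
  have t2 : (w : ℝ) ^ 4 * (2 * Real.log m) ≤ 8 * Y := by
    calc _ ≤ (m : ℝ) ^ (2 / 5 : ℝ) * (2 * (4 * (m : ℝ) ^ (1 / 4 : ℝ))) := by gcongr
      _ = 8 * (m : ℝ) ^ (13 / 20 : ℝ) := by
        have : (m : ℝ) ^ (13 / 20 : ℝ) = (m : ℝ) ^ (2 / 5 : ℝ) * (m : ℝ) ^ (1 / 4 : ℝ) := by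
          rw [← Real.rpow_add hm0]; norm_num
        rw [this]; ring
      _ ≤ 8 * (m : ℝ) ^ (4 / 5 : ℝ) := by
        gcongr 8 * ?_
        exact Real.rpow_le_rpow_of_exponent_le hm1.le (by norm_num)
      _ ≤ 8 * Y := by gcongr
  have t3 : 2 * √(3 * m) * (2 * Real.log m) ≤ 32 * Y := by
    have hs : √(3 * m) ≤ 2 * (m : ℝ) ^ (1 / 2 : ℝ) := by
      rw [← Real.sqrt_eq_rpow]
      calc √(3 * m) ≤ √(2 ^ 2 * m) := Real.sqrt_le_sqrt (by linarith)
        _ = 2 * √m := by rw [Real.sqrt_mul (by norm_num), Real.sqrt_sq (by norm_num)]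
    calc _ ≤ 2 * (2 * (m : ℝ) ^ (1 / 2 : ℝ)) * (2 * (4 * (m : ℝ) ^ (1 / 4 : ℝ))) := by gcongr
      _ = 32 * (m : ℝ) ^ (3 / 4 : ℝ) := by
        have : (m : ℝ) ^ (3 / 4 : ℝ) = (m : ℝ) ^ (1 / 2 : ℝ) * (m : ℝ) ^ (1 / 4 : ℝ) := by
          rw [← Real.rpow_add hm0]; norm_num
        rw [this]; ring
      _ ≤ 32 * (m : ℝ) ^ (4 / 5 : ℝ) := by
        gcongr 32 * ?_
        exact Real.rpow_le_rpow_of_exponent_le hm1.le (by norm_num)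
      _ ≤ 32 * Y := by gcongr
  have hsum : ∑ n ∈ S, vonMangoldt n ≤ 240 * Y := by
    rw [← sum_filter_add_sum_filter_not S Nat.Prime]
    linarith
  calc _ ≤ ∑ n ∈ S, 3 / m * vonMangoldt n := by
        apply sum_le_sum
        intro n hn
        have h1 := hm3 n hn
        have hn0 : (0 : ℝ) < n := by exact_mod_cast (hS n hn).2.1
        rw [div_eq_mul_inv, mul_comm]
        refine mul_le_mul_of_nonneg_right ?_ vonMangoldt_nonneg
        rw [inv_eq_one_div, div_le_div_iff₀ hn0 hm0]; linarith
    _ = 3 / m * ∑ n ∈ S, vonMangoldt n := by rw [mul_sum]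
    _ ≤ 3 / m * (240 * Y) := by gcongr
    _ = 720 / (T * q.totient) := by rw [hY]; field_simp; norm_num

end BrunTitchmarsh

section ShiuDecomposition
open Finset

lemma sum_le_sum_of_cover {ι β : Type*} (S : Finset ι) (T : Finset β) (m : β → ι) (g : ι → ℝ)
    (F : β → ℝ) (hF : ∀ b ∈ T, 0 ≤ F b) (h : ∀ n ∈ S, ∃ b ∈ T, m b = n ∧ g n ≤ F b) :
    ∑ n ∈ S, g n ≤ ∑ b ∈ T, F b := by
  rcases S.eq_empty_or_nonempty with rfl | ⟨n₀, hn₀⟩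
  · simpa using sum_nonneg hF
  have : Nonempty β := ⟨(h n₀ hn₀).choose⟩
  choose! s hs using h
  calc ∑ n ∈ S, g n ≤ ∑ n ∈ S, F (s n) := sum_le_sum fun n hn => (hs n hn).2.2
    _ = ∑ b ∈ S.image s, F b := by
        rw [sum_image]
        intro n hn n' hn' e
        rw [← (hs n hn).2.1, ← (hs n' hn').2.1, e]
    _ ≤ _ := by
        apply sum_le_sum_of_subset_of_nonneg
        · intro b hb
          obtain ⟨n, hn, rfl⟩ := mem_image.1 hb
          exact (hs n hn).1
        · intro b hb _
          exact hF b hb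

lemma IsDivisorBounded.prime_le {K : ℕ} {g : ℕ → ℝ} (hg : IsDivisorBounded K g) {p : ℕ}
    (hp : p.Prime) : g p ≤ 2 ^ K := by
  have := hg.le_pow p 1 hp
  rw [pow_one] at this
  refine this.trans (le_of_eq ?_)
  norm_num

lemma IsDivisorBounded.le_exp_of_rough {K : ℕ} {g : ℕ → ℝ} (hg : IsDivisorBounded K g) (w : ℝ)
    (hw : 1 < w) (d : ℕ) (hd : 1 ≤ d) (hdw : ∀ p : ℕ, p.Prime → p ∣ d → w ≤ p) :
    g d ≤ Real.exp (K * Real.log d / Real.log w) := by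
  have hlw : 0 < Real.log w := Real.log_pos hw
  induction d using Nat.recOnPosPrimePosCoprime with
  | prime_pow p n hp hn =>
    have hpw : w ≤ p := hdw p hp (dvd_pow_self p hn.ne')
    have hl : Real.log w ≤ Real.log p := Real.log_le_log (by linarith) hpw
    refine (hg.le_pow p n hp).trans ?_
    have h1 : ((n : ℝ) + 1) ^ K ≤ Real.exp (n * K) := by
      rw [mul_comm, Real.exp_nat_mul]
      gcongr
      exact Real.add_one_le_exp _
    refine h1.trans (Real.exp_le_exp.2 ?_)
    rw [le_div_iff₀ hlw]
    push_cast
    rw [Real.log_pow]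
    calc _ ≤ (n : ℝ) * K * Real.log p := by gcongr
      _ = _ := by ring
  | zero => omega
  | one => rw [hg.map_one]; simp
  | coprime a b ha hb hab iha ihb =>
    have ha0 : (a : ℝ) ≠ 0 := by positivity
    have hb0 : (b : ℝ) ≠ 0 := by positivity
    rw [hg.mult a b hab]
    push_cast
    rw [Real.log_mul ha0 hb0, mul_add, add_div, Real.exp_add]
    have h1 := iha (by omega) fun p hp hpa => hdw p hp (hpa.mul_right b)
    have h2 := ihb (by omega) fun p hp hpb => hdw p hp (hpb.mul_left a)
    exact mul_le_mul h1 h2 (hg.nonneg _) (Real.exp_pos _).le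

lemma IsDivisorBounded.pow {K : ℕ} {g : ℕ → ℝ} (hg : IsDivisorBounded K g) (m : ℕ) :
    IsDivisorBounded (K * m) fun n => g n ^ m where
  nonneg n := pow_nonneg (hg.nonneg n) m
  map_one := by rw [hg.map_one, one_pow]
  mult a b h := by rw [hg.mult a b h, mul_pow]
  le_pow p k hp := by
    rw [pow_mul]
    exact pow_le_pow_left₀ (hg.nonneg _) (hg.le_pow p k hp) m

lemma exists_le_rpow_of_isDivisorBounded (K m : ℕ) (hm : 1 ≤ m) : ∃ C : ℝ, 0 < C ∧
    ∀ g : ℕ → ℝ, IsDivisorBounded K g → ∀ n : ℕ, 1 ≤ n → g n ≤ C * (n : ℝ) ^ (2 / m : ℝ) := by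
  obtain ⟨C, hC, h⟩ := exists_sum_rpow_le_exp (K * m)
  set B := C * Real.exp (2 ^ (K * m) * 3) with hB
  have hB0 : 0 < B := by positivity
  refine ⟨B ^ (1 / m : ℝ), by positivity, fun g hg n hn => ?_⟩
  have hn0 : (0 : ℝ) < n := by exact_mod_cast hn
  have hm0 : (0 : ℝ) < m := by exact_mod_cast hm
  have h1 := h _ (hg.pow m) 2 (by norm_num) n.primeFactors (fun p hp => Nat.prime_of_mem_primeFactors hp)
    {n} (by simp; omega)
  rw [sum_singleton] at h1
  have h2 : ∑ p ∈ n.primeFactors, g p ^ m * (p : ℝ) ^ (-(2 : ℝ)) ≤ 2 ^ (K * m) * 3 := by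
    calc _ ≤ ∑ p ∈ n.primeFactors, 2 ^ (K * m) * (p : ℝ) ^ (-(3 / 2) : ℝ) := by
          apply sum_le_sum
          intro p hp
          have hp' := Nat.prime_of_mem_primeFactors hp
          have h1p : (1 : ℝ) ≤ p := by exact_mod_cast hp'.one_le
          have := (hg.pow m).prime_le hp'
          have h3 : (p : ℝ) ^ (-(2 : ℝ)) ≤ (p : ℝ) ^ (-(3 / 2) : ℝ) :=
            Real.rpow_le_rpow_of_exponent_le h1p (by norm_num)
          exact mul_le_mul this h3 (by positivity) (by positivity)
      _ = 2 ^ (K * m) * ∑ p ∈ n.primeFactors, (p : ℝ) ^ (-(3 / 2) : ℝ) := by rw [mul_sum]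
      _ ≤ _ := by
        gcongr
        exact sum_primes_rpow_three_half_le _ fun p hp => Nat.prime_of_mem_primeFactors hp
  have h3 : g n ^ m ≤ B * (n : ℝ) ^ (2 : ℝ) := by
    have h4 : g n ^ m * (n : ℝ) ^ (-(2 : ℝ)) ≤ B := h1.trans (by rw [hB]; gcongr)
    rw [Real.rpow_neg hn0.le, ← div_eq_mul_inv, div_le_iff₀ (by positivity)] at h4
    exact h4
  have h4 : g n = (g n ^ m) ^ (1 / m : ℝ) := by
    rw [← Real.rpow_natCast, ← Real.rpow_mul (hg.nonneg n), mul_one_div_cancel hm0.ne',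
      Real.rpow_one]
  rw [h4]
  calc _ ≤ (B * (n : ℝ) ^ (2 : ℝ)) ^ (1 / m : ℝ) := by
        gcongr
        exact pow_nonneg (hg.nonneg n) m
    _ = _ := by
      rw [Real.mul_rpow hB0.le (by positivity), ← Real.rpow_mul hn0.le]
      congr 2; ring

/-- Splitting `n` according to the size of its smooth part. -/
lemma exists_shiu_decomposition (n z t : ℕ) (hn : 1 ≤ n) (hz : 1 ≤ z) :
    (∃ b d, n = b * d ∧ b ≤ z ∧ Nat.Coprime b d ∧ (∀ p : ℕ, p.Prime → p ∣ b → p < t) ∧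
      (∀ p : ℕ, p.Prime → p ∣ d → t ≤ p)) ∨
    (∃ b p v d, n = b * (p ^ v * d) ∧ p.Prime ∧ p < t ∧ 1 ≤ v ∧ b ≤ z ∧ z < b * p ^ v ∧
      Nat.Coprime b (p ^ v * d) ∧ (∀ r : ℕ, r.Prime → r ∣ b → r < p) ∧
      (∀ r : ℕ, r.Prime → r ∣ d → p < r)) := by
  induction t with
  | zero =>
    refine Or.inl ⟨1, n, by simp, hz, by simp, ?_, by simp⟩
    intro p hp hp1
    exact absurd (Nat.dvd_one.1 hp1) hp.one_lt.ne'
  | succ t ih =>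
    rcases ih with ⟨b, d, rfl, hbz, hbd, hb, hd⟩ | ⟨b, p, v, d, h1, h2, h3, h4⟩
    · by_cases ht : t.Prime ∧ t ∣ d
      · obtain ⟨htp, htd⟩ := ht
        have hd0 : d ≠ 0 := by rintro rfl; simp at hn
        obtain ⟨v, d', htd', rfl⟩ := Nat.exists_eq_pow_mul_and_not_dvd hd0 t htp.ne_one
        have hv : 1 ≤ v := by
          by_contra hv
          have : v = 0 := by omega
          subst this
          simp at htd
          exact htd' htd
        have hd'r : ∀ r : ℕ, r.Prime → r ∣ d' → t < r := by
          intro r hr hrd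
          have := hd r hr (hrd.mul_left _)
          have hne : t ≠ r := by rintro rfl; exact htd' hrd
          omega
        rcases le_or_gt (b * t ^ v) z with h | h
        · left
          refine ⟨b * t ^ v, d', by ring, h, ?_, ?_, ?_⟩
          · apply Nat.Coprime.mul_left
            · exact hbd.coprime_mul_left_right
            · exact Nat.Coprime.pow_left _ ((Nat.Prime.coprime_iff_not_dvd htp).2 htd')
          · intro p hp hpd
            rcases (Nat.Prime.dvd_mul hp).1 hpd with h | h
            · have := hb p hp h; omega
            · have := (Nat.prime_dvd_prime_iff_eq hp htp).1 (hp.dvd_of_dvd_pow h); omega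
          · intro p hp hpd
            exact hd'r p hp hpd
        · right
          exact ⟨b, t, v, d', rfl, htp, by omega, hv, hbz, h, hbd, hb, hd'r⟩
      · left
        refine ⟨b, d, rfl, hbz, hbd, fun p hp hpb => (hb p hp hpb).trans (by omega), ?_⟩
        intro p hp hpd
        have := hd p hp hpd
        have hne : p ≠ t := by rintro rfl; exact ht ⟨hp, hpd⟩
        omega
    · exact Or.inr ⟨b, p, v, d, h1, h2, by omega, h4⟩

/-- A number exceeding `w` whose prime factors are small has a large prime power factor. -/
lemma exists_prime_pow_dvd_of_smooth (b w P : ℕ) (hb : w < b) (hP : 1 ≤ P) (hw : 1 ≤ w)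
    (hbP : ∀ p : ℕ, p.Prime → p ∣ b → p < P) :
    ∃ p v : ℕ, p.Prime ∧ p ^ v ∣ b ∧ p < P ∧ w < p ^ (v * P) := by
  by_contra hcon
  push Not at hcon
  have hb0 : b ≠ 0 := by omega
  have h1 : b ^ P ≤ w ^ P := by
    calc b ^ P = (∏ p ∈ b.primeFactors, p ^ b.factorization p) ^ P := by
          congr 1
          exact (Nat.prod_factorization_pow_eq_self hb0).symm
      _ = ∏ p ∈ b.primeFactors, p ^ (b.factorization p * P) := by
          rw [← prod_pow]; simp_rw [pow_mul]
      _ ≤ ∏ p ∈ b.primeFactors, w := by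
          apply prod_le_prod' 
          intro p hp
          have hp' := Nat.prime_of_mem_primeFactors hp
          exact hcon p _ hp' (Nat.ordProj_dvd b p) (hbP p hp' (Nat.dvd_of_mem_primeFactors hp))
      _ = w ^ b.primeFactors.card := by rw [prod_const]
      _ ≤ w ^ P := by
          apply Nat.pow_le_pow_right hw
          calc _ ≤ (range P).card := by
                apply card_le_card
                intro p hp
                exact mem_range.2 (hbP p (Nat.prime_of_mem_primeFactors hp)
                  (Nat.dvd_of_mem_primeFactors hp))
            _ = P := card_range P
  have := (Nat.pow_le_pow_iff_left (by omega)).1 h1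
  omega

lemma exists_square_dvd_of_prime_pow (n p v P w : ℕ) (hp : p.Prime) (hpw : p ≤ w) (hv : 2 ≤ v)
    (hn : p ^ v ∣ n) (hw : w < p ^ (v * P)) :
    ∃ s : ℕ, 1 ≤ s ∧ s ≤ w ∧ s ^ 2 ∣ n ∧ w < s ^ (3 * P) := by
  have hex : ∃ j : ℕ, w < p ^ (j * (3 * P)) := by
    refine ⟨v / 2, hw.trans_le (Nat.pow_le_pow_right hp.pos ?_)⟩
    rw [← mul_assoc]
    exact Nat.mul_le_mul_right _ (by omega)
  set j := Nat.find hex with hj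
  have hj1 : w < p ^ (j * (3 * P)) := Nat.find_spec hex
  have hjv : j ≤ v / 2 := by
    apply Nat.find_le (n := v / 2) (h := _)
    refine hw.trans_le (Nat.pow_le_pow_right hp.pos ?_)
    rw [← mul_assoc]
    exact Nat.mul_le_mul_right _ (by omega)
  have hP : 1 ≤ P := by
    by_contra h
    have : P = 0 := by omega
    subst this
    simp at hw
    have := hp.two_le
    omega
  refine ⟨p ^ j, Nat.one_le_pow _ _ hp.pos, ?_, ?_, ?_⟩
  · rcases Nat.lt_or_ge j 2 with h | h
    · calc p ^ j ≤ p ^ 1 := Nat.pow_le_pow_right hp.pos (by omega)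
        _ ≤ w := by simpa using hpw
    · have h2 := Nat.find_min hex (show j - 1 < j by omega)
      push Not at h2
      refine le_trans (Nat.pow_le_pow_right hp.pos ?_) h2
      calc j ≤ (j - 1) * 3 := by omega
        _ ≤ (j - 1) * (3 * P) := Nat.mul_le_mul_left _ (by omega)
  · rw [← pow_mul]
    exact (Nat.pow_dvd_pow p (by omega)).trans hn
  · rw [← pow_mul]; exact hj1

end ShiuDecomposition

section ShiuTheorem
open Finset

lemma card_rough_mul_modEq_le (q a b H w : ℕ) (hq : 1 ≤ q) (hw : 2 ≤ w) (haq : Nat.Coprime a q) :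
    (((Icc 1 H).filter (fun d => b * d ≡ a [MOD q] ∧
      ∀ p : ℕ, p.Prime → p ≤ w → ¬ p ∣ d)).card : ℝ) ≤
      H / (q.totient * Real.log w) + (w : ℝ) ^ 4 := by
  set D := (Icc 1 H).filter (fun d => b * d ≡ a [MOD q] ∧ ∀ p : ℕ, p.Prime → p ≤ w → ¬ p ∣ d)
    with hD
  rcases D.eq_empty_or_nonempty with h | ⟨d₀, hd₀⟩
  · rw [h, card_empty]
    have : 0 ≤ Real.log w := Real.log_natCast_nonneg w
    push_cast
    positivity
  · refine le_trans ?_ (card_rough_modEq_le q d₀ 0 H w hq hw)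
    norm_cast
    apply card_le_card
    intro d hd
    rw [hD, mem_filter, mem_Icc] at hd hd₀
    rw [mem_filter, mem_Ioc]
    refine ⟨by omega, ?_, hd.2.2⟩
    have hbq : Nat.gcd q b = 1 := by
      have h1 : Nat.Coprime (b * d) q := by
        rw [Nat.Coprime, hd.2.1.gcd_eq]; exact haq
      exact (h1.coprime_mul_right).symm
    exact Nat.ModEq.cancel_left_of_coprime hbq (hd.2.1.trans hd₀.2.1.symm)

lemma log_succ_le_two_mul_log (w : ℕ) (hw2 : 2 ≤ w) :
    Real.log ((w : ℝ) + 1) ≤ 2 * Real.log w := by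
  have h2 : (2 : ℝ) ≤ w := by exact_mod_cast hw2
  calc Real.log ((w : ℝ) + 1) ≤ Real.log ((w : ℝ) ^ 2) :=
        Real.log_le_log (by linarith) (by nlinarith)
    _ = _ := by rw [Real.log_pow]; norm_num

lemma sieve_error_le (q N w b p c : ℕ) (hq : 1 ≤ q) (hqN : q ^ 2 ≤ N) (hw1 : 1 ≤ w)
    (hwN : w ^ 16 ≤ N) (hb1 : 1 ≤ b) (hb : b ≤ w ^ 2) (hp1 : 1 ≤ p) (hp : p ≤ w)
    (hc : 2 ≤ c) (hcw : c ≤ w) :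
    ((N / (b * p) : ℕ) : ℝ) / (q.totient * Real.log c) + (c : ℝ) ^ 4 ≤
      2 * N / (b * p * q.totient * Real.log c) := by
  have hlc : 0 < Real.log c := Real.log_pos (by exact_mod_cast hc)
  have hφ : (0 : ℝ) < q.totient := by exact_mod_cast Nat.totient_pos.2 (by omega)
  have hφq : (q.totient : ℝ) ≤ q := by exact_mod_cast Nat.totient_le q
  have hb0 : (0 : ℝ) < b := by exact_mod_cast hb1
  have hp0 : (0 : ℝ) < p := by exact_mod_cast hp1
  have hw0 : (1 : ℝ) ≤ w := by exact_mod_cast hw1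
  have hbw : (b : ℝ) ≤ (w : ℝ) ^ 2 := by exact_mod_cast hb
  have hpw : (p : ℝ) ≤ w := by exact_mod_cast hp
  have hcw' : (c : ℝ) ≤ w := by exact_mod_cast hcw
  have hlcw : Real.log c ≤ w := (Real.log_le_self (by positivity)).trans hcw'
  have h8 : (w : ℝ) ^ 8 * q ≤ N := by
    have h1 : ((w : ℝ) ^ 8) ^ 2 ≤ N := by rw [← pow_mul]; exact_mod_cast hwN
    have h2 : (q : ℝ) ^ 2 ≤ N := by exact_mod_cast hqN
    nlinarith [sq_nonneg ((w : ℝ) ^ 8 - q)]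
  have h1 : ((N / (b * p) : ℕ) : ℝ) ≤ N / (b * p) := by
    have := @Nat.cast_div_le ℝ _ _ _ N (b * p)
    push_cast at this
    exact this
  have h2 : (c : ℝ) ^ 4 ≤ N / (b * p * q.totient * Real.log c) := by
    rw [le_div_iff₀ (by positivity)]
    calc (c : ℝ) ^ 4 * (b * p * q.totient * Real.log c) ≤
          (w : ℝ) ^ 4 * ((w : ℝ) ^ 2 * w * q * w) := by gcongr
      _ = (w : ℝ) ^ 8 * q := by ring
      _ ≤ N := h8
  calc _ ≤ N / (b * p) / (q.totient * Real.log c) + N / (b * p * q.totient * Real.log c) := by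
        gcongr
    _ = _ := by field_simp; ring

lemma sum_primes_restrict_le {K : ℕ} {g : ℕ → ℝ} (hg : IsDivisorBounded K g) (N : ℕ)
    (P : Finset ℕ) (hP : ∀ p ∈ P, p.Prime ∧ p ≤ N) :
    ∑ p ∈ P, g p * (p : ℝ) ^ (-(1 : ℝ)) ≤ ∑ p ∈ (Icc 1 N).filter Nat.Prime, g p / p := by
  calc _ = ∑ p ∈ P, g p / p := by simp_rw [Real.rpow_neg_one, div_eq_mul_inv]
    _ ≤ _ := by
      apply sum_le_sum_of_subset_of_nonneg
      · intro p hp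
        rw [mem_filter, mem_Icc]
        exact ⟨⟨(hP p hp).1.one_le, (hP p hp).2⟩, (hP p hp).1⟩
      · intro p _ _
        exact div_nonneg (hg.nonneg p) (Nat.cast_nonneg p)

lemma exists_shiu_rough_part (K : ℕ) : ∃ C : ℝ, 0 < C ∧ ∀ g : ℕ → ℝ, IsDivisorBounded K g →
    ∀ q N w a : ℕ, 1 ≤ q → q ^ 2 ≤ N → 2 ≤ w → w ^ 16 ≤ N →
    Real.log N ≤ 16 * Real.log (w + 1) → Nat.Coprime a q → ∀ S : Finset ℕ, (∀ n ∈ S, n ∈ Icc 1 N ∧ n ≡ a [MOD q] ∧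
      ∃ b d, n = b * d ∧ b ≤ w ^ 2 ∧ Nat.Coprime b d ∧ (∀ p : ℕ, p.Prime → p ∣ b → p < w + 1) ∧
      (∀ p : ℕ, p.Prime → p ∣ d → w + 1 ≤ p)) →
    ∑ n ∈ S, g n ≤ C * (N / (q.totient * Real.log w)) *
      Real.exp (∑ p ∈ (Icc 1 N).filter Nat.Prime, g p / p) := by
  obtain ⟨C, hC, hE⟩ := exists_sum_rpow_le_exp K
  refine ⟨2 * Real.exp (16 * K) * C, by positivity, ?_⟩
  intro g hg q N w a hq hqN hw2 hwN hNw haq S hS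
  set G := ∑ p ∈ (Icc 1 N).filter Nat.Prime, g p / p with hG
  have hN1 : 1 ≤ N := le_trans (Nat.one_le_pow _ _ (by omega)) hwN
  have hlw : 0 < Real.log w := Real.log_pos (by exact_mod_cast hw2)
  have hφ : (0 : ℝ) < q.totient := by exact_mod_cast Nat.totient_pos.2 (by omega)
  set B := (Icc 1 (w ^ 2)).filter (fun b => ∀ p : ℕ, p.Prime → p ∣ b → p < w + 1) with hB
  set D : ℕ → Finset ℕ := fun b => (Icc 1 (N / (b * 1))).filter (fun d => b * d ≡ a [MOD q] ∧
    ∀ p : ℕ, p.Prime → p ≤ w → ¬ p ∣ d) with hD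
  have hcover : ∑ n ∈ S, g n ≤ ∑ x ∈ B.sigma D, g x.1 * Real.exp (16 * K) := by
    apply sum_le_sum_of_cover S (B.sigma D) (fun x => x.1 * x.2)
    · intro x _
      exact mul_nonneg (hg.nonneg _) (Real.exp_pos _).le
    · intro n hn
      obtain ⟨hnN, hna, b, d, rfl, hbw, hbd, hb, hd⟩ := hS n hn
      rw [mem_Icc] at hnN
      have hb0 : 1 ≤ b := Nat.pos_of_ne_zero (by rintro rfl; simp at hnN)
      have hd0 : 1 ≤ d := Nat.pos_of_ne_zero (by rintro rfl; simp at hnN)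
      refine ⟨⟨b, d⟩, ?_, rfl, ?_⟩
      · rw [mem_sigma, hB, hD]
        simp only [mem_filter, mem_Icc, mul_one]
        refine ⟨⟨⟨hb0, hbw⟩, hb⟩, ⟨hd0, ?_⟩, hna, ?_⟩
        · rw [Nat.le_div_iff_mul_le (by omega), mul_comm]; exact hnN.2
        · intro p hp hpw hpd
          have := hd p hp hpd
          omega
      · rw [hg.mult b d hbd]
        refine mul_le_mul_of_nonneg_left ?_ (hg.nonneg b)
        have hw1 : (1 : ℝ) < ((w : ℝ) + 1) := by
          have : (2 : ℝ) ≤ w := by exact_mod_cast hw2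
          linarith
        refine (hg.le_exp_of_rough (w + 1) hw1 d hd0 fun p hp hpd => by
          exact_mod_cast hd p hp hpd).trans (Real.exp_le_exp.2 ?_)
        rw [div_le_iff₀ (Real.log_pos hw1)]
        have h1 : Real.log d ≤ 16 * Real.log (w + 1) := by
          have h2 : (d : ℝ) ≤ N := by exact_mod_cast (Nat.le_mul_of_pos_left d hb0).trans hnN.2
          exact (Real.log_le_log (by exact_mod_cast hd0) h2).trans hNw
        calc (K : ℝ) * Real.log d ≤ K * (16 * Real.log (w + 1)) := by gcongr
          _ = _ := by ring
  have hcard : ∀ b ∈ B, ((D b).card : ℝ) ≤ 2 * N / (b * (1 : ℕ) * q.totient * Real.log w) := by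
    intro b hb
    rw [hB, mem_filter, mem_Icc] at hb
    exact (card_rough_mul_modEq_le q a b (N / (b * 1)) w hq hw2 haq).trans
      (sieve_error_le q N w b 1 w hq hqN (by omega) hwN hb.1.1 hb.1.2 le_rfl (by omega) hw2 le_rfl)
  have hEB := hE g hg 1 (by norm_num) ((Icc 1 w).filter Nat.Prime)
    (fun p hp => (mem_filter.1 hp).2) B (by
      intro b hb
      rw [hB, mem_filter, mem_Icc] at hb
      refine ⟨by omega, fun p hp => ?_⟩
      have hp' := Nat.prime_of_mem_primeFactors hp
      have := hb.2 p hp' (Nat.dvd_of_mem_primeFactors hp)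
      rw [mem_filter, mem_Icc]
      exact ⟨⟨hp'.one_le, by omega⟩, hp'⟩)
  have hwN' : w ≤ N := (Nat.le_self_pow (by norm_num) w).trans hwN
  have hEB2 := sum_primes_restrict_le hg N ((Icc 1 w).filter Nat.Prime) (by
    intro p hp
    rw [mem_filter, mem_Icc] at hp
    exact ⟨hp.2, by omega⟩)
  calc ∑ n ∈ S, g n ≤ ∑ x ∈ B.sigma D, g x.1 * Real.exp (16 * K) := hcover
    _ = ∑ b ∈ B, (D b).card * (g b * Real.exp (16 * K)) := by
        rw [sum_sigma]
        apply sum_congr rfl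
        intro b _
        dsimp only
        rw [sum_const, nsmul_eq_mul]
    _ ≤ ∑ b ∈ B, 2 * N / (b * (1 : ℕ) * q.totient * Real.log w) * (g b * Real.exp (16 * K)) := by
        apply sum_le_sum
        intro b hb
        exact mul_le_mul_of_nonneg_right (hcard b hb)
          (mul_nonneg (hg.nonneg b) (Real.exp_pos _).le)
    _ = 2 * Real.exp (16 * K) * (N / (q.totient * Real.log w)) *
          ∑ b ∈ B, g b * (b : ℝ) ^ (-(1 : ℝ)) := by
        rw [mul_sum]
        apply sum_congr rfl
        intro b hb
        rw [Real.rpow_neg_one]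
        push_cast
        field_simp
    _ ≤ 2 * Real.exp (16 * K) * (N / (q.totient * Real.log w)) * (C * Real.exp G) := by
        have hx : 0 ≤ 2 * Real.exp (16 * K) * (N / (q.totient * Real.log w)) := by positivity
        have hy := Real.exp_le_exp.2 (hEB2.trans_eq hG.symm)
        have hz := hEB.trans (mul_le_mul_of_nonneg_left hy hC.le)
        exact mul_le_mul_of_nonneg_left hz hx
    _ = _ := by ring

end ShiuTheorem

section ShiuSmooth
open Finset

lemma log_four_le : Real.log 4 ≤ 2 := by
  have : Real.log 4 = 2 * Real.log 2 := by
    rw [show (4 : ℝ) = 2 ^ 2 by norm_num, Real.log_pow]; norm_num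
  linarith [Real.log_two_lt_d9]

lemma one_le_log_of_three_le (x : ℝ) (hx : 3 ≤ x) : 1 ≤ Real.log x := by
  rw [Real.le_log_iff_exp_le (by linarith)]
  linarith [Real.exp_one_lt_d9]

lemma exp_le_one_add_mul (u l : ℝ) (hu : 0 ≤ u) (hul : u ≤ l) :
    Real.exp u ≤ 1 + u * Real.exp l := by
  have h1 : 1 - u ≤ Real.exp (-u) := by linarith [Real.add_one_le_exp (-u)]
  have h2 : Real.exp u * Real.exp (-u) = 1 := by rw [← Real.exp_add]; simp
  have h3 : Real.exp u ≤ Real.exp l := Real.exp_le_exp.2 hul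
  nlinarith [Real.exp_pos u, Real.exp_pos l]

lemma exists_rankin_bound (K : ℕ) (l : ℝ) (hl : 0 ≤ l) : ∃ C : ℝ, 0 < C ∧
    ∀ g : ℕ → ℝ, IsDivisorBounded K g → ∀ p w : ℕ, 3 ≤ p → 4 * l ≤ Real.log p → 1 ≤ w →
    ∀ B : Finset ℕ, (∀ b ∈ B, w ≤ b ∧ ∀ r : ℕ, r.Prime → r ∣ b → r < p) →
    ∑ b ∈ B, g b * (b : ℝ) ^ (-(1 : ℝ)) ≤ C * Real.exp (-(l * Real.log w / Real.log p)) *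
      Real.exp (∑ r ∈ (range p).filter Nat.Prime, g r * (r : ℝ) ^ (-(1 : ℝ))) := by
  obtain ⟨C, hC, hE⟩ := exists_sum_rpow_le_exp K
  refine ⟨C * Real.exp (8 * 2 ^ K * l * Real.exp l), by positivity, ?_⟩
  intro g hg p w hp hlp hw B hB
  have hlogp : 1 ≤ Real.log p := one_le_log_of_three_le p (by exact_mod_cast hp)
  have hw0 : (0 : ℝ) < w := by exact_mod_cast hw
  set e := l / Real.log p with he
  have he0 : 0 ≤ e := by positivity
  have he4 : e ≤ 1 / 4 := by rw [he, div_le_iff₀ (by linarith)]; linarith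
  have hpp : ∀ r ∈ (range p).filter Nat.Prime, r.Prime := fun r hr => (mem_filter.1 hr).2
  have h1 := hE g hg (1 - e) (by linarith) ((range p).filter Nat.Prime) hpp B (by
    intro b hb
    obtain ⟨h1, h2⟩ := hB b hb
    refine ⟨by omega, fun r hr => ?_⟩
    have hr' := Nat.prime_of_mem_primeFactors hr
    rw [mem_filter, mem_range]
    exact ⟨h2 r hr' (Nat.dvd_of_mem_primeFactors hr), hr'⟩)
  have h2 : ∑ r ∈ (range p).filter Nat.Prime, g r * (r : ℝ) ^ (-(1 - e)) ≤
      ∑ r ∈ (range p).filter Nat.Prime, g r * (r : ℝ) ^ (-(1 : ℝ)) +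
        8 * 2 ^ K * l * Real.exp l := by
    have h3 : ∀ r ∈ (range p).filter Nat.Prime, g r * (r : ℝ) ^ (-(1 - e)) ≤
        g r * (r : ℝ) ^ (-(1 : ℝ)) + 2 ^ K * e * Real.exp l * (Real.log r / r) := by
      intro r hr
      rw [mem_filter, mem_range] at hr
      have hr0 : (0 : ℝ) < r := by exact_mod_cast hr.2.pos
      have hr1 : (1 : ℝ) ≤ r := by exact_mod_cast hr.2.one_le
      have hlr : 0 ≤ Real.log r := Real.log_nonneg hr1
      have hrp : Real.log r ≤ Real.log p := Real.log_le_log hr0 (by exact_mod_cast hr.1.le)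
      have h4 : (r : ℝ) ^ (-(1 - e)) = (r : ℝ) ^ (-(1 : ℝ)) * Real.exp (e * Real.log r) := by
        rw [show -(1 - e) = -1 + e by ring, Real.rpow_add hr0, Real.rpow_def_of_pos hr0 e,
          mul_comm (Real.log _)]
      have h5 : Real.exp (e * Real.log r) ≤ 1 + e * Real.log r * Real.exp l := by
        apply exp_le_one_add_mul _ _ (by positivity)
        calc e * Real.log r ≤ e * Real.log p := by gcongr
          _ = l := by rw [he]; field_simp
      rw [h4, Real.rpow_neg_one]
      have h6 := hg.prime_le hr.2
      have h7 := hg.nonneg r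
      calc g r * ((r : ℝ)⁻¹ * Real.exp (e * Real.log r)) ≤
            g r * ((r : ℝ)⁻¹ * (1 + e * Real.log r * Real.exp l)) := by gcongr
        _ = g r * (r : ℝ)⁻¹ + g r * (e * Real.exp l * (Real.log r / r)) := by
          field_simp
        _ ≤ g r * (r : ℝ)⁻¹ + 2 ^ K * (e * Real.exp l * (Real.log r / r)) := by gcongr
        _ = _ := by ring
    refine (sum_le_sum h3).trans ?_
    rw [sum_add_distrib, ← mul_sum]
    have h8 := sum_primes_log_div_le p ((range p).filter Nat.Prime) (by
      intro r hr
      rw [mem_filter, mem_range] at hr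
      exact ⟨hr.2, hr.1.le⟩)
    have h9 : ∑ r ∈ (range p).filter Nat.Prime, Real.log r / r ≤ 8 * Real.log p := by
      linarith [log_four_le]
    have : 2 ^ K * e * Real.exp l * ∑ r ∈ (range p).filter Nat.Prime, Real.log r / r ≤
        2 ^ K * e * Real.exp l * (8 * Real.log p) := by gcongr
    have h10 : 2 ^ K * e * Real.exp l * (8 * Real.log p) = 8 * 2 ^ K * l * Real.exp l := by
      rw [he]; field_simp
    linarith
  calc ∑ b ∈ B, g b * (b : ℝ) ^ (-(1 : ℝ))
      ≤ ∑ b ∈ B, Real.exp (-(l * Real.log w / Real.log p)) * (g b * (b : ℝ) ^ (-(1 - e))) := by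
        apply sum_le_sum
        intro b hb
        obtain ⟨hwb, _⟩ := hB b hb
        have hwb' : (w : ℝ) ≤ b := by exact_mod_cast hwb
        have hb0 : (0 : ℝ) < b := by linarith
        have h4 : (b : ℝ) ^ (-(1 : ℝ)) = (b : ℝ) ^ (-(1 - e)) * (b : ℝ) ^ (-e) := by
          rw [← Real.rpow_add hb0]; congr 1; ring
        have h5 : (b : ℝ) ^ (-e) ≤ Real.exp (-(l * Real.log w / Real.log p)) := by
          rw [Real.rpow_def_of_pos hb0]
          apply Real.exp_le_exp.2
          have : Real.log w ≤ Real.log b := Real.log_le_log hw0 hwb'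
          calc Real.log b * -e = -(e * Real.log b) := by ring
            _ ≤ -(e * Real.log w) := by gcongr
            _ = _ := by rw [he]; ring
        rw [h4]
        have h7 := hg.nonneg b
        calc g b * ((b : ℝ) ^ (-(1 - e)) * (b : ℝ) ^ (-e)) =
              (b : ℝ) ^ (-e) * (g b * (b : ℝ) ^ (-(1 - e))) := by ring
          _ ≤ _ := by gcongr
    _ = Real.exp (-(l * Real.log w / Real.log p)) * ∑ b ∈ B, g b * (b : ℝ) ^ (-(1 - e)) := by
        rw [mul_sum]
    _ ≤ Real.exp (-(l * Real.log w / Real.log p)) * (C * Real.exp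
          (∑ r ∈ (range p).filter Nat.Prime, g r * (r : ℝ) ^ (-(1 : ℝ)) +
            8 * 2 ^ K * l * Real.exp l)) := by
        refine mul_le_mul_of_nonneg_left (h1.trans ?_) (Real.exp_pos _).le
        exact mul_le_mul_of_nonneg_left (Real.exp_le_exp.2 h2) hC.le
    _ = _ := by rw [Real.exp_add]; ring

lemma exists_shiu_smooth_part (K : ℕ) : ∃ P : ℕ, 3 ≤ P ∧ ∃ C : ℝ, 0 < C ∧
    ∀ g : ℕ → ℝ, IsDivisorBounded K g →
    ∀ q N w a : ℕ, 1 ≤ q → q ^ 2 ≤ N → 2 ≤ w → w ^ 16 ≤ N →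
    Real.log N ≤ 16 * Real.log (w + 1) → Nat.Coprime a q →
    ∀ S : Finset ℕ, (∀ n ∈ S, n ∈ Icc 1 N ∧ n ≡ a [MOD q] ∧
      ∃ b p v d, n = b * (p ^ v * d) ∧ p.Prime ∧ p < w + 1 ∧ 1 ≤ v ∧ b ≤ w ^ 2 ∧
      Nat.Coprime b (p ^ v * d) ∧ (∀ r : ℕ, r.Prime → r ∣ b → r < p) ∧
      (∀ r : ℕ, r.Prime → r ∣ d → p < r) ∧ P ≤ p ∧ w < b) →
    ∑ n ∈ S, g n ≤ C * (N / (q.totient * Real.log w)) *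
      Real.exp (∑ p ∈ (Icc 1 N).filter Nat.Prime, g p / p) := by
  set l : ℝ := 32 * K + 1 with hl
  obtain ⟨C, hC, hR⟩ := exists_rankin_bound K l (by positivity)
  refine ⟨max 3 ⌈Real.exp (4 * l)⌉₊, le_max_left _ _, 64 * C, by positivity, ?_⟩
  intro g hg q N w a hq hqN hw2 hwN hNw haq S hS
  set G := ∑ p ∈ (Icc 1 N).filter Nat.Prime, g p / p with hG
  have hlw : 0 < Real.log w := Real.log_pos (by exact_mod_cast hw2)
  have hφ : (0 : ℝ) < q.totient := by exact_mod_cast Nat.totient_pos.2 (by omega)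
  have hN32 : Real.log N ≤ 32 * Real.log w := by linarith [log_succ_le_two_mul_log w hw2]
  have hwN' : w ≤ N := (Nat.le_self_pow (by norm_num) w).trans hwN
  set PP := (Icc 1 w).filter (fun p => p.Prime ∧ max 3 ⌈Real.exp (4 * l)⌉₊ ≤ p) with hPP
  set B : ℕ → Finset ℕ := fun p => (Icc 1 (w ^ 2)).filter
    (fun b => w < b ∧ ∀ r : ℕ, r.Prime → r ∣ b → r < p) with hB
  set D : ℕ → ℕ → Finset ℕ := fun p b => (Icc 1 (N / (b * p))).filter
    (fun d => (b * p) * d ≡ a [MOD q] ∧ ∀ r : ℕ, r.Prime → r ≤ p - 1 → ¬ r ∣ d) with hD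
  set E : ℕ → ℝ := fun p => Real.exp (K * (32 * Real.log w) / Real.log p) with hEdef
  have hPPp : ∀ p ∈ PP, p.Prime ∧ p ≤ w ∧ 3 ≤ p ∧ 4 * l ≤ Real.log p := by
    intro p hp
    rw [hPP, mem_filter, mem_Icc] at hp
    refine ⟨hp.2.1, hp.1.2, (le_max_left _ _).trans hp.2.2, ?_⟩
    rw [Real.le_log_iff_exp_le (by exact_mod_cast hp.1.1)]
    exact (Nat.le_ceil _).trans (by exact_mod_cast (le_max_right _ _).trans hp.2.2)
  have hcover : ∑ n ∈ S, g n ≤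
      ∑ x ∈ PP.sigma (fun p => (B p).sigma (D p)), g x.2.1 * E x.1 := by
    apply sum_le_sum_of_cover S (PP.sigma (fun p => (B p).sigma (D p)))
      (fun x => x.2.1 * x.1 * x.2.2)
    · intro x _
      exact mul_nonneg (hg.nonneg _) (Real.exp_pos _).le
    · intro n hn
      obtain ⟨hnN, hna, b, p, v, d, rfl, hp, hpw, hv, hbw, hbd, hb, hd, hPp, hwb⟩ := hS n hn
      rw [mem_Icc] at hnN
      have hb0 : 1 ≤ b := by omega
      have hd0 : 1 ≤ d := Nat.pos_of_ne_zero (by rintro rfl; simp at hnN)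
      have hpv : p ^ v = p * p ^ (v - 1) := by
        rw [← pow_succ']; congr 1; omega
      have hn' : b * p * (p ^ (v - 1) * d) = b * (p ^ v * d) := by rw [hpv]; ring
      have hpd : 1 ≤ p ^ v * d := Nat.mul_pos (pow_pos hp.pos v) hd0
      refine ⟨⟨p, b, p ^ (v - 1) * d⟩, ?_, hn', ?_⟩
      · rw [mem_sigma, mem_sigma, hB, hD, hPP]
        simp only [mem_filter, mem_Icc]
        refine ⟨⟨⟨hp.one_le, by omega⟩, hp, hPp⟩, ⟨⟨hb0, hbw⟩, hwb, hb⟩,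
          ⟨Nat.mul_pos (pow_pos hp.pos _) hd0, ?_⟩, hn' ▸ hna, ?_⟩
        · rw [Nat.le_div_iff_mul_le (Nat.mul_pos hb0 hp.pos), mul_comm, hn']; exact hnN.2
        · intro r hr hrp hrd
          rcases (Nat.Prime.dvd_mul hr).1 hrd with h | h
          · have := (Nat.prime_dvd_prime_iff_eq hr hp).1 (hr.dvd_of_dvd_pow h)
            have := hp.pos
            omega
          · have := hd r hr h; omega
      · rw [hg.mult b _ hbd]
        refine mul_le_mul_of_nonneg_left ?_ (hg.nonneg b)
        have hp1 : (1 : ℝ) < p := by exact_mod_cast hp.one_lt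
        refine (hg.le_exp_of_rough p hp1 _ hpd fun r hr hrd => ?_).trans
          (Real.exp_le_exp.2 ?_)
        · rcases (Nat.Prime.dvd_mul hr).1 hrd with h | h
          · rw [(Nat.prime_dvd_prime_iff_eq hr hp).1 (hr.dvd_of_dvd_pow h)]
          · exact_mod_cast (hd r hr h).le
        · have h2 : ((p ^ v * d : ℕ) : ℝ) ≤ N := by
            exact_mod_cast (Nat.le_mul_of_pos_left _ hb0).trans hnN.2
          have h3 := Real.log_le_log (by exact_mod_cast hpd) h2
          have h4 := Real.log_pos hp1
          have h5 := h3.trans hN32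
          gcongr
  have hinner : ∀ p ∈ PP, ∑ b ∈ B p, ((D p b).card : ℝ) * (g b * E p) ≤
      8 * C * N / (q.totient * (Real.log w) ^ 2) * Real.exp G * (Real.log p / p) := by
    intro p hp
    obtain ⟨hpp, hpw, hp3, hlp⟩ := hPPp p hp
    have hp0 : (0 : ℝ) < p := by exact_mod_cast hpp.pos
    have hlogp : 1 ≤ Real.log p := one_le_log_of_three_le p (by exact_mod_cast hp3)
    have hlp1 : Real.log p ≤ 2 * Real.log (p - 1 : ℕ) := by
      have := log_succ_le_two_mul_log (p - 1) (by omega)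
      rw [Nat.cast_sub hpp.one_le] at this ⊢
      simpa using this
    have hR' := hR g hg p w hp3 hlp (by omega) (B p) (by
      intro b hb
      rw [hB, mem_filter, mem_Icc] at hb
      exact ⟨hb.2.1.le, hb.2.2⟩)
    have hG' := sum_primes_restrict_le hg N ((range p).filter Nat.Prime) (by
      intro r hr
      rw [mem_filter, mem_range] at hr
      exact ⟨hr.2, by omega⟩)
    set v := Real.log w / Real.log p with hv
    have hv0 : 0 < v := by positivity
    have hEv : E p * Real.exp (-(l * Real.log w / Real.log p)) ≤ 2 / v ^ 2 := by
      rw [hEdef]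
      simp only
      rw [← Real.exp_add]
      have : K * (32 * Real.log w) / Real.log p + -(l * Real.log w / Real.log p) = -v := by
        rw [hl, hv]; ring
      rw [this, Real.exp_neg, le_div_iff₀ (by positivity), inv_mul_le_iff₀ (Real.exp_pos _)]
      have := Real.quadratic_le_exp_of_nonneg hv0.le
      linarith
    have hterm : ∀ b ∈ B p, ((D p b).card : ℝ) * (g b * E p) ≤
        4 * N / (p * q.totient * Real.log p) * E p * (g b * (b : ℝ) ^ (-(1 : ℝ))) := by
      intro b hb
      rw [hB, mem_filter, mem_Icc] at hb
      have hb0 : (0 : ℝ) < b := by exact_mod_cast hb.1.1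
      have hc1 : ((D p b).card : ℝ) ≤ 2 * N / (b * p * q.totient * Real.log (p - 1 : ℕ)) :=
        (card_rough_mul_modEq_le q a (b * p) (N / (b * p)) (p - 1) hq (by omega) haq).trans
        (sieve_error_le q N w b p (p - 1) hq hqN (by omega) hwN hb.1.1 hb.1.2 hpp.one_le hpw
          (by omega) (by omega))
      have hc2 : 2 * N / (b * p * q.totient * Real.log (p - 1 : ℕ)) ≤
          2 * N / (b * p * q.totient * (Real.log p / 2)) := by
        gcongr
        linarith
      have hgE : 0 ≤ g b * E p := mul_nonneg (hg.nonneg b) (Real.exp_pos _).le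
      calc _ ≤ 2 * N / (b * p * q.totient * (Real.log p / 2)) * (g b * E p) :=
            mul_le_mul_of_nonneg_right (hc1.trans hc2) hgE
        _ = _ := by rw [Real.rpow_neg_one]; field_simp; ring
    have hc0 : 0 ≤ 4 * N / (p * q.totient * Real.log p) := by positivity
    have hE0 : 0 < E p := Real.exp_pos _
    calc _ ≤ ∑ b ∈ B p, 4 * N / (p * q.totient * Real.log p) * E p *
            (g b * (b : ℝ) ^ (-(1 : ℝ))) := sum_le_sum hterm
      _ = 4 * N / (p * q.totient * Real.log p) * E p * ∑ b ∈ B p, g b * (b : ℝ) ^ (-(1 : ℝ)) := by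
          rw [mul_sum]
      _ ≤ 4 * N / (p * q.totient * Real.log p) * E p *
            (C * Real.exp (-(l * Real.log w / Real.log p)) * Real.exp G) := by
          refine mul_le_mul_of_nonneg_left (hR'.trans ?_) (mul_nonneg hc0 hE0.le)
          exact mul_le_mul_of_nonneg_left (Real.exp_le_exp.2 hG')
            (mul_nonneg hC.le (Real.exp_pos _).le)
      _ = 4 * N / (p * q.totient * Real.log p) * C * Real.exp G *
            (E p * Real.exp (-(l * Real.log w / Real.log p))) := by ring
      _ ≤ 4 * N / (p * q.totient * Real.log p) * C * Real.exp G * (2 / v ^ 2) := by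
          refine mul_le_mul_of_nonneg_left hEv ?_
          exact mul_nonneg (mul_nonneg hc0 hC.le) (Real.exp_pos _).le
      _ = _ := by rw [hv]; field_simp; ring
  have hPPsum : ∑ p ∈ PP, Real.log p / p ≤ 8 * Real.log w ∨ PP = ∅ := by
    rcases PP.eq_empty_or_nonempty with h | ⟨p, hp⟩
    · exact Or.inr h
    · left
      obtain ⟨_, hpw, hp3, _⟩ := hPPp p hp
      have h1 : 1 ≤ Real.log w := one_le_log_of_three_le w (by exact_mod_cast hp3.trans hpw)
      have := sum_primes_log_div_le w PP (fun p hp => ⟨(hPPp p hp).1, (hPPp p hp).2.1⟩)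
      linarith [log_four_le]
  have hA : 0 ≤ 8 * C * N / (q.totient * (Real.log w) ^ 2) * Real.exp G := by
    have := Real.exp_pos G
    positivity
  calc ∑ n ∈ S, g n ≤ ∑ p ∈ PP, ∑ b ∈ B p, ((D p b).card : ℝ) * (g b * E p) := by
        refine hcover.trans (le_of_eq ?_)
        rw [sum_sigma]
        apply sum_congr rfl
        intro p _
        rw [sum_sigma]
        apply sum_congr rfl
        intro b _
        dsimp only
        rw [sum_const, nsmul_eq_mul]
    _ ≤ ∑ p ∈ PP, 8 * C * N / (q.totient * (Real.log w) ^ 2) * Real.exp G * (Real.log p / p) :=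
        sum_le_sum hinner
    _ = 8 * C * N / (q.totient * (Real.log w) ^ 2) * Real.exp G * ∑ p ∈ PP, Real.log p / p := by
        rw [mul_sum]
    _ ≤ 8 * C * N / (q.totient * (Real.log w) ^ 2) * Real.exp G * (8 * Real.log w) := by
        refine mul_le_mul_of_nonneg_left ?_ hA
        rcases hPPsum with h | h
        · exact h
        · rw [h, sum_empty]; linarith
    _ = _ := by field_simp; ring

end ShiuSmooth

section ShiuAssembly
open Finset

lemma exists_shiu_square_part (K m : ℕ) (hm : 1 ≤ m) : ∃ C : ℝ, 0 < C ∧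
    ∀ g : ℕ → ℝ, IsDivisorBounded K g →
    ∀ q N w a : ℕ, 1 ≤ q → q ^ 2 ≤ N → 2 ≤ w → w ^ 16 ≤ N →
    Real.log N ≤ 16 * Real.log (w + 1) → Nat.Coprime a q →
    ∀ S : Finset ℕ, (∀ n ∈ S, n ∈ Icc 1 N ∧ n ≡ a [MOD q] ∧
      ∃ s : ℕ, 1 ≤ s ∧ s ≤ w ∧ s ^ 2 ∣ n ∧ w < s ^ m) →
    ∑ n ∈ S, g n ≤ C * (N / (q.totient * Real.log w)) := by
  obtain ⟨C, hC, hg'⟩ := exists_le_rpow_of_isDivisorBounded K (256 * m) (by omega)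
  refine ⟨24 * C * m, by positivity, ?_⟩
  intro g hg q N w a hq hqN hw2 hwN hNw haq S hS
  have hlw : 0 < Real.log w := Real.log_pos (by exact_mod_cast hw2)
  have hw0 : (0 : ℝ) < w := by positivity
  have hφ : (0 : ℝ) < q.totient := by exact_mod_cast Nat.totient_pos.2 (by omega)
  have hφq : (q.totient : ℝ) ≤ q := by exact_mod_cast Nat.totient_le q
  have hq0 : (0 : ℝ) < q := by exact_mod_cast hq
  have hm0 : (0 : ℝ) < m := by exact_mod_cast hm
  have hN1 : 1 ≤ N := le_trans (Nat.one_le_pow _ _ (by omega)) hwN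
  have hN0 : (0 : ℝ) < N := by exact_mod_cast hN1
  have hN32 : Real.log N ≤ 32 * Real.log w := by linarith [log_succ_le_two_mul_log w hw2]
  have h8 : w ^ 8 * q ≤ N := by
    have h1 : (w ^ 8) ^ 2 ≤ N := by rw [← pow_mul]; exact hwN
    nlinarith [sq_nonneg ((w ^ 8 : ℤ) - q)]
  clear hNw hwN hqN
  have hgN : ∀ n ∈ Icc 1 N, g n ≤ C * (w : ℝ) ^ (1 / (4 * m) : ℝ) := by
    intro n hn
    rw [mem_Icc] at hn
    refine (hg' g hg n hn.1).trans (mul_le_mul_of_nonneg_left ?_ hC.le)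
    have hn0 : (0 : ℝ) < n := by exact_mod_cast hn.1
    have hlog : Real.log n ≤ 32 * Real.log w :=
      (Real.log_le_log hn0 (by exact_mod_cast hn.2)).trans hN32
    rw [Real.rpow_def_of_pos hn0, Real.rpow_def_of_pos hw0]
    apply Real.exp_le_exp.2
    push_cast
    calc Real.log n * (2 / (256 * m)) ≤ 32 * Real.log w * (2 / (256 * m)) := by gcongr
      _ = _ := by field_simp; norm_num
  set SS := (Icc 1 w).filter (fun s => w < s ^ m) with hSS
  set D : ℕ → Finset ℕ := fun s =>
    ((Ioc 0 (0 + N)).filter (fun n => n ≡ a [MOD q])).filter (fun n => s ^ 2 ∣ n) with hD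
  have hcover : ∑ n ∈ S, g n ≤ ∑ x ∈ SS.sigma D, C * (w : ℝ) ^ (1 / (4 * m) : ℝ) := by
    apply sum_le_sum_of_cover S (SS.sigma D) (fun x => x.2)
    · intro x _
      positivity
    · intro n hn
      obtain ⟨hnN, hna, s, hs1, hsw, hsn, hws⟩ := hS n hn
      refine ⟨⟨s, n⟩, ?_, rfl, hgN n hnN⟩
      rw [mem_Icc] at hnN
      rw [mem_sigma, hSS, hD]
      simp only [mem_filter, mem_Icc, mem_Ioc]
      refine ⟨⟨⟨hs1, hsw⟩, hws⟩, ⟨by omega, hna⟩, hsn⟩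
  have hcard : ∀ s ∈ SS, ((D s).card : ℝ) ≤ 2 * N / q * (w : ℝ) ^ (-(1 / (2 * m)) : ℝ) *
      (1 / s * (s : ℝ) ^ (-(1 / 2) : ℝ)) := by
    intro s hs
    rw [hSS, mem_filter, mem_Icc] at hs
    obtain ⟨⟨hs1, hsw⟩, hws⟩ := hs
    have hs0 : (0 : ℝ) < s := by exact_mod_cast hs1
    have hpow : (s : ℝ) ^ (-(1 / 2) : ℝ) ≤ (w : ℝ) ^ (-(1 / (2 * m)) : ℝ) := by
      have h1 : (w : ℝ) ≤ (s : ℝ) ^ m := by exact_mod_cast hws.le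
      calc (s : ℝ) ^ (-(1 / 2) : ℝ) = ((s : ℝ) ^ m) ^ (-(1 / (2 * m)) : ℝ) := by
            rw [← Real.rpow_natCast, ← Real.rpow_mul hs0.le]
            congr 1; field_simp
        _ ≤ _ := Real.rpow_le_rpow_of_nonpos hw0 h1 (by
            rw [neg_nonpos]; positivity)
    have hs2 : ((s : ℝ) ^ 2)⁻¹ = 1 / s * (s : ℝ) ^ (-(1 / 2) : ℝ) * (s : ℝ) ^ (-(1 / 2) : ℝ) := by
      rw [mul_assoc, ← Real.rpow_add hs0, show (-(1 / 2) : ℝ) + -(1 / 2) = -1 by norm_num,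
        Real.rpow_neg_one]
      field_simp
    have hbound : ((D s).card : ℝ) ≤ 2 * N / q * ((s : ℝ) ^ 2)⁻¹ := by
      rcases (D s).eq_empty_or_nonempty with h | ⟨n, hn⟩
      · rw [h, card_empty]; push_cast; positivity
      · have hsq : Nat.Coprime (s ^ 2) q := by
          rw [hD, mem_filter, mem_filter] at hn
          have h1 : Nat.Coprime n q := by rw [Nat.Coprime, hn.1.2.gcd_eq]; exact haq
          exact Nat.Coprime.coprime_dvd_left hn.2 h1
        have h1 := (abs_le.1 (card_Ioc_modEq_dvd_sub_le q a 0 N (s ^ 2) hq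
          (Nat.one_le_pow _ _ hs1) hsq)).2
        have h2 : (1 : ℝ) ≤ N / q * ((s : ℝ) ^ 2)⁻¹ := by
          rw [← div_eq_mul_inv, le_div_iff₀ (by positivity), le_div_iff₀ hq0, one_mul]
          have : s ^ 2 * q ≤ N := by
            refine le_trans ?_ h8
            gcongr
            · omega
            · norm_num
          exact_mod_cast this
        have h3 : ((N : ℝ) / q) / ((s ^ 2 : ℕ) : ℝ) = N / q * ((s : ℝ) ^ 2)⁻¹ := by
          push_cast; rw [div_eq_mul_inv]
        rw [h3] at h1
        have h4 : 2 * N / q * ((s : ℝ) ^ 2)⁻¹ = 2 * (N / q * ((s : ℝ) ^ 2)⁻¹) := by ring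
        rw [h4]
        linarith
    refine hbound.trans ?_
    rw [hs2]
    calc _ = 2 * N / q * (s : ℝ) ^ (-(1 / 2) : ℝ) * (1 / s * (s : ℝ) ^ (-(1 / 2) : ℝ)) := by ring
      _ ≤ _ := by gcongr
  have hsum : ∑ s ∈ SS, (1 / s * (s : ℝ) ^ (-(1 / 2) : ℝ)) ≤ 3 := by
    calc _ ≤ ∑ s ∈ Icc 1 w, ((1 : ℝ) / s * (s : ℝ) ^ (-(1 / 2) : ℝ)) :=
          sum_le_sum_of_subset_of_nonneg (filter_subset _ _) fun i _ _ => by positivity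
      _ ≤ 1 + 1 / (1 / 2) := sum_rpow_neg_one_sub_le _ (by norm_num) w
      _ = 3 := by norm_num
  have hlogw : (w : ℝ) ^ (-(1 / (4 * m)) : ℝ) ≤ 4 * m / Real.log w := by
    have := Real.log_le_rpow_div hw0.le (show (0 : ℝ) < 1 / (4 * m) by positivity)
    rw [Real.rpow_neg hw0.le, le_div_iff₀ hlw, inv_mul_le_iff₀ (by positivity)]
    calc _ ≤ _ := this
      _ = _ := by field_simp
  have hww : (w : ℝ) ^ (1 / (4 * m) : ℝ) * (w : ℝ) ^ (-(1 / (2 * m)) : ℝ) =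
      (w : ℝ) ^ (-(1 / (4 * m)) : ℝ) := by
    rw [← Real.rpow_add hw0]; congr 1; field_simp; norm_num
  calc ∑ n ∈ S, g n ≤ ∑ s ∈ SS, ((D s).card : ℝ) * (C * (w : ℝ) ^ (1 / (4 * m) : ℝ)) := by
        refine hcover.trans (le_of_eq ?_)
        rw [sum_sigma]
        apply sum_congr rfl
        intro s _
        rw [sum_const, nsmul_eq_mul]
    _ ≤ ∑ s ∈ SS, 2 * N / q * (w : ℝ) ^ (-(1 / (2 * m)) : ℝ) *
          (1 / s * (s : ℝ) ^ (-(1 / 2) : ℝ)) * (C * (w : ℝ) ^ (1 / (4 * m) : ℝ)) := by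
        apply sum_le_sum
        intro s hs
        exact mul_le_mul_of_nonneg_right (hcard s hs) (by positivity)
    _ = 2 * N / q * C * ((w : ℝ) ^ (1 / (4 * m) : ℝ) * (w : ℝ) ^ (-(1 / (2 * m)) : ℝ)) *
          ∑ s ∈ SS, (1 / s * (s : ℝ) ^ (-(1 / 2) : ℝ)) := by
        rw [mul_sum]
        apply sum_congr rfl
        intro s _
        ring
    _ ≤ 2 * N / q.totient * C * (4 * m / Real.log w) * 3 := by
        rw [hww]
        gcongr
    _ = _ := by field_simp; ring

/-- Shiu's Brun–Titchmarsh theorem for multiplicative functions. -/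
theorem exists_shiu_bound (K : ℕ) : ∃ C : ℝ, 0 < C ∧
    ∀ g : ℕ → ℝ, IsDivisorBounded K g → ∀ q N a : ℕ, 1 ≤ q → q ^ 2 ≤ N → 2 ≤ N →
    Nat.Coprime a q →
    ∑ n ∈ (Icc 1 N).filter (fun n => n ≡ a [MOD q]), g n ≤
      C * (N / (q.totient * Real.log N)) *
        Real.exp (∑ p ∈ (Icc 1 N).filter Nat.Prime, g p / p) := by
  obtain ⟨C₁, hC₁, h₁⟩ := exists_shiu_rough_part K
  obtain ⟨P, hP, C₂, hC₂, h₂⟩ := exists_shiu_smooth_part K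
  obtain ⟨C₃, hC₃, h₃⟩ := exists_shiu_square_part K (3 * P) (by omega)
  obtain ⟨C₄, hC₄, h₄⟩ := exists_le_rpow_of_isDivisorBounded K 2 (by norm_num)
  obtain ⟨W, hW⟩ : ∃ W : ℕ, W = P ^ P := ⟨_, rfl⟩
  have hWP : P ≤ W := hW ▸ Nat.le_self_pow (by omega) P
  set V : ℝ := ((W : ℝ) + 1) ^ (16 : ℕ) with hV
  have hV0 : 0 < V := by positivity
  refine ⟨32 * (C₁ + C₂ + C₃) + C₄ * V ^ 3, by positivity, ?_⟩
  intro g hg q N a hq hqN hN2 haq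
  set G := ∑ p ∈ (Icc 1 N).filter Nat.Prime, g p / p with hG
  have hG0 : 0 ≤ G := sum_nonneg fun p _ => div_nonneg (hg.nonneg p) (Nat.cast_nonneg p)
  have hexpG : 1 ≤ Real.exp G := Real.one_le_exp hG0
  have hφ : (0 : ℝ) < q.totient := by exact_mod_cast Nat.totient_pos.2 (by omega)
  have hφq : (q.totient : ℝ) ≤ q := by exact_mod_cast Nat.totient_le q
  have hN0 : (0 : ℝ) < N := by positivity
  have hlN : 0 < Real.log N := Real.log_pos (by exact_mod_cast hN2)
  set w : ℕ := ⌊(N : ℝ) ^ (1 / 16 : ℝ)⌋₊ with hw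
  have hwN : w ^ 16 ≤ N := by
    have h1 : (w : ℝ) ≤ (N : ℝ) ^ (1 / 16 : ℝ) := Nat.floor_le (by positivity)
    have h2 : (w : ℝ) ^ (16 : ℕ) ≤ (N : ℝ) := by
      calc (w : ℝ) ^ (16 : ℕ) ≤ ((N : ℝ) ^ (1 / 16 : ℝ)) ^ (16 : ℕ) := by gcongr
        _ = (N : ℝ) := by rw [rpow_natCast_aux _ hN0.le]; norm_num
    exact_mod_cast h2
  have hNlt : (N : ℝ) ^ (1 / 16 : ℝ) ≤ w + 1 := (Nat.lt_floor_add_one _).le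
  have hNw : Real.log N ≤ 16 * Real.log (w + 1) := by
    have := Real.log_le_log (by positivity) hNlt
    rw [Real.log_rpow hN0] at this
    linarith
  set S := (Icc 1 N).filter (fun n => n ≡ a [MOD q]) with hS
  rcases lt_or_ge w W with hwW | hwW
  · have hNV : (N : ℝ) ≤ V := by
      calc (N : ℝ) = ((N : ℝ) ^ (1 / 16 : ℝ)) ^ (16 : ℕ) := by
            rw [rpow_natCast_aux _ hN0.le]; norm_num
        _ ≤ ((W : ℝ) + 1) ^ (16 : ℕ) := by
            gcongr
            refine hNlt.trans ?_
            have : (w : ℝ) ≤ W := by exact_mod_cast hwW.le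
            linarith
    have h5 : ∑ n ∈ S, g n ≤ C₄ * V ^ 2 := by
      calc ∑ n ∈ S, g n ≤ ∑ n ∈ Icc 1 N, g n :=
            sum_le_sum_of_subset_of_nonneg (filter_subset _ _) fun i _ _ => hg.nonneg i
        _ ≤ ∑ n ∈ Icc 1 N, C₄ * N := by
            apply sum_le_sum
            intro n hn
            rw [mem_Icc] at hn
            refine (h₄ g hg n hn.1).trans ?_
            have : (n : ℝ) ≤ N := by exact_mod_cast hn.2
            norm_num
            gcongr
        _ = C₄ * (N : ℝ) ^ 2 := by
            rw [sum_const, Nat.card_Icc, nsmul_eq_mul]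
            simp
            ring
        _ ≤ _ := by gcongr
    have h6 : 1 ≤ V * (N / (q.totient * Real.log N)) := by
      rw [← mul_div_assoc, le_div_iff₀ (by positivity), one_mul]
      have h7 : q ≤ N := le_trans (Nat.le_self_pow (by norm_num) q) hqN
      have h8 : (q : ℝ) ≤ N := by exact_mod_cast h7
      have h9 : Real.log N ≤ V := (Real.log_le_self hN0.le).trans hNV
      have h10 : (q.totient : ℝ) ≤ N := hφq.trans h8
      calc (q.totient : ℝ) * Real.log N ≤ (N : ℝ) * V := mul_le_mul h10 h9 hlN.le hN0.le
        _ = V * N := mul_comm _ _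
    calc ∑ n ∈ S, g n ≤ C₄ * V ^ 2 * (V * (N / (q.totient * Real.log N))) * Real.exp G := by
          refine h5.trans ?_
          rw [mul_assoc]
          exact le_mul_of_one_le_right (by positivity) (one_le_mul_of_one_le_of_one_le h6 hexpG)
      _ = C₄ * V ^ 3 * (N / (q.totient * Real.log N)) * Real.exp G := by ring
      _ ≤ _ := by
          gcongr
          have : 0 ≤ 32 * (C₁ + C₂ + C₃) := by positivity
          linarith
  · have hw2 : 2 ≤ w := by omega
    have hlw : 0 < Real.log w := Real.log_pos (by exact_mod_cast hw2)
    have hN32 : Real.log N ≤ 32 * Real.log w := by linarith [log_succ_le_two_mul_log w hw2]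
    set Q₁ : ℕ → Prop := fun n => ∃ b d, n = b * d ∧ b ≤ w ^ 2 ∧ Nat.Coprime b d ∧
      (∀ p : ℕ, p.Prime → p ∣ b → p < w + 1) ∧ (∀ p : ℕ, p.Prime → p ∣ d → w + 1 ≤ p) with hQ₁
    set Q₂ : ℕ → Prop := fun n => ∃ b p v d, n = b * (p ^ v * d) ∧ p.Prime ∧ p < w + 1 ∧ 1 ≤ v ∧
      b ≤ w ^ 2 ∧ Nat.Coprime b (p ^ v * d) ∧ (∀ r : ℕ, r.Prime → r ∣ b → r < p) ∧
      (∀ r : ℕ, r.Prime → r ∣ d → p < r) ∧ P ≤ p ∧ w < b with hQ₂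
    set Q₃ : ℕ → Prop := fun n => ∃ s : ℕ, 1 ≤ s ∧ s ≤ w ∧ s ^ 2 ∣ n ∧ w < s ^ (3 * P) with hQ₃
    have hcases : ∀ n ∈ S, Q₁ n ∨ Q₂ n ∨ Q₃ n := by
      intro n hn
      rw [hS, mem_filter, mem_Icc] at hn
      rcases exists_shiu_decomposition n (w ^ 2) (w + 1) hn.1.1 (Nat.one_le_pow _ _ (by omega)) with
        h | ⟨b, p, v, d, hnb, hp, hpw, hv, hbw, hzb, hcop, hb, hd⟩
      · exact Or.inl h
      · right
        rcases le_or_gt b w with hbw' | hbw'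
        · right
          have hpv : w < p ^ v := by
            by_contra hcon
            have : b * p ^ v ≤ w * w := Nat.mul_le_mul hbw' (by omega)
            rw [pow_two] at hzb
            omega
          have hv2 : 2 ≤ v := by
            by_contra hcon
            have : v = 1 := by omega
            subst this
            rw [pow_one] at hpv
            omega
          refine exists_square_dvd_of_prime_pow n p v P w hp (by omega) hv2 ?_ ?_
          · rw [hnb]
            exact (Dvd.intro _ rfl : p ^ v ∣ p ^ v * d).mul_left b
          · exact hpv.trans_le (Nat.pow_le_pow_right hp.pos (Nat.le_mul_of_pos_right v (by omega)))
        · rcases le_or_gt P p with hPp | hPp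
          · exact Or.inl ⟨b, p, v, d, hnb, hp, hpw, hv, hbw, hcop, hb, hd, hPp, hbw'⟩
          · right
            obtain ⟨r, u, hr, hru, hrP, hwr⟩ := exists_prime_pow_dvd_of_smooth b w P hbw'
              (by omega) (by omega) (fun r hr hrb => (hb r hr hrb).trans hPp)
            have hu2 : 2 ≤ u := by
              by_contra hcon
              have h1 : r ^ (u * P) ≤ P ^ P := by
                calc r ^ (u * P) ≤ r ^ P := by
                      apply Nat.pow_le_pow_right hr.pos
                      calc u * P ≤ 1 * P := Nat.mul_le_mul_right _ (by omega)
                        _ = P := one_mul P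
                  _ ≤ P ^ P := Nat.pow_le_pow_left hrP.le P
              omega
            refine exists_square_dvd_of_prime_pow n r u P w hr (by omega) hu2 ?_ hwr
            rw [hnb]
            exact hru.mul_right _
    have e₁ := h₁ g hg q N w a hq hqN hw2 hwN hNw haq (S.filter Q₁) (by
      intro n hn
      rw [mem_filter, hS, mem_filter] at hn
      exact ⟨hn.1.1, hn.1.2, hn.2⟩)
    have e₂ := h₂ g hg q N w a hq hqN hw2 hwN hNw haq (S.filter Q₂) (by
      intro n hn
      rw [mem_filter, hS, mem_filter] at hn
      exact ⟨hn.1.1, hn.1.2, hn.2⟩)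
    have e₃ := h₃ g hg q N w a hq hqN hw2 hwN hNw haq (S.filter Q₃) (by
      intro n hn
      rw [mem_filter, hS, mem_filter] at hn
      exact ⟨hn.1.1, hn.1.2, hn.2⟩)
    clear h₁ h₂ h₃ h₄ hwN hqN hNw
    have hA : 0 ≤ N / (q.totient * Real.log w) := by positivity
    have e₃' : ∑ n ∈ S.filter Q₃, g n ≤ C₃ * (N / (q.totient * Real.log w)) * Real.exp G :=
      e₃.trans (le_mul_of_one_le_right (mul_nonneg hC₃.le hA) hexpG)
    have hsplit : ∑ n ∈ S, g n ≤ ∑ n ∈ S.filter Q₁, g n + ∑ n ∈ S.filter Q₂, g n +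
        ∑ n ∈ S.filter Q₃, g n := by
      clear_value S
      rw [sum_filter (s := S) (p := Q₁), sum_filter (s := S) (p := Q₂),
        sum_filter (s := S) (p := Q₃), ← sum_add_distrib, ← sum_add_distrib]
      apply sum_le_sum
      intro n hn
      have := hg.nonneg n
      rcases hcases n hn with h | h | h
      · rw [if_pos h]; split_ifs <;> linarith
      · rw [if_pos h]; split_ifs <;> linarith
      · rw [if_pos h]; split_ifs <;> linarith
    have hlog : N / (q.totient * Real.log w) ≤ 32 * (N / (q.totient * Real.log N)) := by
      rw [← mul_div_assoc, div_le_div_iff₀ (by positivity) (by positivity)]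
      calc (N : ℝ) * (q.totient * Real.log N) ≤ N * (q.totient * (32 * Real.log w)) := by gcongr
        _ = _ := by ring
    calc ∑ n ∈ S, g n ≤ (C₁ + C₂ + C₃) * (N / (q.totient * Real.log w)) * Real.exp G := by
          refine hsplit.trans ?_
          calc _ ≤ _ := add_le_add (add_le_add e₁ e₂) e₃'
            _ = _ := by ring
      _ ≤ (C₁ + C₂ + C₃) * (32 * (N / (q.totient * Real.log N))) * Real.exp G := by
          gcongr
      _ = 32 * (C₁ + C₂ + C₃) * (N / (q.totient * Real.log N)) * Real.exp G := by ring
      _ ≤ _ := by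
          gcongr
          have : 0 ≤ C₄ * V ^ 3 := by positivity
          linarith

end ShiuAssembly

section HalaszClassBasics
open Finset ArithmeticFunction

lemma sum_succ_pow_le (K k : ℕ) :
    (K + 1 : ℝ) * ∑ j ∈ range k, ((j : ℝ) + 1) ^ K ≤ ((k : ℝ) + 1) ^ (K + 1) := by
  induction k with
  | zero => simp
  | succ k ih =>
    rw [sum_range_succ, mul_add]
    have h : ((k : ℝ) + 1) ^ (K + 1) + (K + 1) * ((k : ℝ) + 1) ^ K ≤ ((k : ℝ) + 1 + 1) ^ (K + 1) := by
      have h1 := one_add_mul_le_pow (a := 1 / ((k : ℝ) + 1))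
        (by have : 0 ≤ 1 / ((k : ℝ) + 1) := by positivity
            linarith) (K + 1)
      have h2 : ((k : ℝ) + 1 + 1) ^ (K + 1) =
          ((k : ℝ) + 1) ^ (K + 1) * (1 + 1 / ((k : ℝ) + 1)) ^ (K + 1) := by
        rw [← mul_pow]; congr 1; field_simp
      rw [h2]
      calc _ = ((k : ℝ) + 1) ^ (K + 1) * (1 + ((K + 1 : ℕ) : ℝ) * (1 / ((k : ℝ) + 1))) := by
            push_cast; field_simp; ring
        _ ≤ _ := by gcongr
    push_cast
    linarith

lemma norm_le_succ_pow_of_recursion (κ : ℝ) (K : ℕ) (hK : 2 * κ ≤ K) (hκ : 0 ≤ κ) (a : ℕ → ℝ)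
    (h0 : a 0 ≤ 1)
    (h : ∀ k : ℕ, 1 ≤ k → k * a k ≤ κ * ∑ j ∈ range k, a (k - 1 - j)) (k : ℕ) :
    a k ≤ ((k : ℝ) + 1) ^ K := by
  induction k using Nat.strong_induction_on with
  | _ k ih =>
    rcases Nat.eq_zero_or_pos k with rfl | hk
    · simpa using h0
    · have h1 := h k hk
      rw [Finset.sum_range_reflect] at h1
      have h2 : ∑ j ∈ range k, a j ≤ ∑ j ∈ range k, ((j : ℝ) + 1) ^ K :=
        sum_le_sum fun j hj => ih j (mem_range.1 hj)
      have h3 := sum_succ_pow_le K k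
      have hk1 : (1 : ℝ) ≤ k := by exact_mod_cast hk
      have h4 : κ * ∑ j ∈ range k, ((j : ℝ) + 1) ^ K ≤ k * ((k : ℝ) + 1) ^ K := by
        have h5 : κ * ((k : ℝ) + 1) ^ (K + 1) ≤ (K + 1) * (k * ((k : ℝ) + 1) ^ K) := by
          rw [pow_succ]
          have : κ * (k + 1) ≤ (K + 1) * k := by nlinarith
          calc _ = (κ * (k + 1)) * ((k : ℝ) + 1) ^ K := by ring
            _ ≤ ((K + 1) * k) * ((k : ℝ) + 1) ^ K := by gcongr
            _ = _ := by ring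
        have h6 : (0 : ℝ) < K + 1 := by positivity
        have h7 : (K + 1) * (κ * ∑ j ∈ range k, ((j : ℝ) + 1) ^ K) ≤
            (K + 1) * (k * ((k : ℝ) + 1) ^ K) := by
          calc _ = κ * ((K + 1) * ∑ j ∈ range k, ((j : ℝ) + 1) ^ K) := by ring
            _ ≤ κ * ((k : ℝ) + 1) ^ (K + 1) := by gcongr
            _ ≤ _ := h5
        exact le_of_mul_le_mul_left h7 h6
      have h8 : (k : ℝ) * a k ≤ k * ((k : ℝ) + 1) ^ K :=
        h1.trans ((mul_le_mul_of_nonneg_left h2 hκ).trans h4)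
      exact le_of_mul_le_mul_left h8 (by linarith)

variable {κ : ℝ} {f Λf : ℕ → ℂ}

lemma IsHalaszClass.apply_one_eq_zero (h : IsHalaszClass κ f Λf) : Λf 1 = 0 :=
  h.supp 1 not_isPrimePow_one

lemma IsHalaszClass.apply_prime_pow_mul (h : IsHalaszClass κ f Λf) {p : ℕ} (hp : p.Prime) (k : ℕ) :
    f (p ^ k) * ((k * Real.log p : ℝ) : ℂ) =
      ∑ j ∈ range k, Λf (p ^ (j + 1)) * f (p ^ (k - 1 - j)) := by
  have h1 := h.conv (p ^ k) (Nat.one_le_pow _ _ hp.pos)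
  rw [Nat.sum_divisors_prime_pow hp, sum_range_succ', pow_zero, h.apply_one_eq_zero, zero_mul,
    add_zero] at h1
  have h2 : Real.log ((p ^ k : ℕ) : ℝ) = k * Real.log p := by
    push_cast; rw [Real.log_pow]
  rw [h2] at h1
  rw [h1]
  apply sum_congr rfl
  intro j hj
  rw [mem_range] at hj
  rw [Nat.pow_div (by omega) hp.pos]
  congr 3
  omega

lemma IsHalaszClass.norm_apply_prime_pow_le (h : IsHalaszClass κ f Λf) {p : ℕ} (hp : p.Prime)
    (j : ℕ) : ‖Λf (p ^ (j + 1))‖ ≤ κ * Real.log p := by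
  have := h.bound (p ^ (j + 1)) (Nat.one_le_pow _ _ hp.pos)
  rwa [vonMangoldt_apply_pow (by omega), vonMangoldt_apply_prime hp] at this

lemma IsHalaszClass.kappa_nonneg (h : IsHalaszClass κ f Λf) : 0 ≤ κ := by
  have h1 := (norm_nonneg _).trans (h.norm_apply_prime_pow_le Nat.prime_two 0)
  exact nonneg_of_mul_nonneg_left h1 (Real.log_pos (by norm_num))

lemma IsHalaszClass.isDivisorBounded (h : IsHalaszClass κ f Λf) (K : ℕ) (hK : 2 * κ ≤ K) :
    IsDivisorBounded K (fun n => ‖f n‖) where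
  nonneg n := norm_nonneg _
  map_one := by simp [h.map_one]
  mult m n hmn := by simp [h.mult m n hmn]
  le_pow p k hp := by
    refine norm_le_succ_pow_of_recursion κ K hK h.kappa_nonneg (fun k => ‖f (p ^ k)‖)
      (by simp [h.map_one]) ?_ k
    intro k hk
    have hlp : 0 < Real.log p := Real.log_pos (by exact_mod_cast hp.one_lt)
    have h1 := congrArg norm (h.apply_prime_pow_mul hp k)
    rw [norm_mul, norm_real, Real.norm_of_nonneg (by positivity)] at h1
    have h2 : ‖∑ j ∈ range k, Λf (p ^ (j + 1)) * f (p ^ (k - 1 - j))‖ ≤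
        ∑ j ∈ range k, κ * Real.log p * ‖f (p ^ (k - 1 - j))‖ := by
      refine norm_sum_le_of_le _ fun j _ => ?_
      rw [norm_mul]
      exact mul_le_mul_of_nonneg_right (h.norm_apply_prime_pow_le hp j) (norm_nonneg _)
    rw [← mul_sum] at h2
    have h3 : Real.log p * (k * ‖f (p ^ k)‖) ≤
        Real.log p * (κ * ∑ j ∈ range k, ‖f (p ^ (k - 1 - j))‖) := by
      calc _ = ‖f (p ^ k)‖ * (k * Real.log p) := by ring
        _ ≤ _ := h1.le.trans h2
        _ = _ := by ring
    exact le_of_mul_le_mul_left h3 hlp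

lemma IsHalaszClass.norm_prime_le (h : IsHalaszClass κ f Λf) {p : ℕ} (hp : p.Prime) :
    ‖f p‖ ≤ κ := by
  have hlp : 0 < Real.log p := Real.log_pos (by exact_mod_cast hp.one_lt)
  have h1 := congrArg norm (h.apply_prime_pow_mul hp 1)
  have h2 := h.norm_apply_prime_pow_le hp 0
  simp only [pow_one, Nat.cast_one, one_mul, range_one, zero_add, sum_singleton, Nat.sub_self,
    pow_zero, h.map_one, mul_one, norm_mul, norm_real, Real.norm_of_nonneg hlp.le] at h1 h2
  rw [← h1] at h2
  exact le_of_mul_le_mul_right h2 hlp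

/-- The logarithm of the largest divisor of `n` composed of primes exceeding `y`. -/
def roughLog (y n : ℕ) : ℝ :=
  ∑ p ∈ n.primeFactors.filter (fun p => y < p), n.factorization p * Real.log p

/-- The restriction of `Λf` to integers with no prime factor up to `y`. -/
def roughLambda (Λf : ℕ → ℂ) (y d : ℕ) : ℂ := if y < d.minFac then Λf d else 0

lemma IsHalaszClass.mul_factorization_mul_log (h : IsHalaszClass κ f Λf) {n p : ℕ} (hn : n ≠ 0)
    (hp : p.Prime) :
    f n * ((n.factorization p * Real.log p : ℝ) : ℂ) =
      ∑ j ∈ range (n.factorization p), Λf (p ^ (j + 1)) * f (n / p ^ (j + 1)) := by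
  set v := n.factorization p with hv
  have hcop : Nat.Coprime p (n / p ^ v) := Nat.coprime_ordCompl hp hn
  have hnm : p ^ v * (n / p ^ v) = n := Nat.ordProj_mul_ordCompl_eq_self n p
  have h1 : f n = f (p ^ v) * f (n / p ^ v) := by
    conv_lhs => rw [← hnm]
    exact h.mult _ _ (hcop.pow_left v)
  rw [h1, mul_right_comm, h.apply_prime_pow_mul hp v, sum_mul]
  apply sum_congr rfl
  intro j hj
  rw [mem_range] at hj
  have h2 : n / p ^ (j + 1) = p ^ (v - 1 - j) * (n / p ^ v) := by
    apply Nat.div_eq_of_eq_mul_right (pow_pos hp.pos _)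
    rw [← mul_assoc, ← pow_add, show j + 1 + (v - 1 - j) = v by omega, hnm]
  rw [h2, h.mult _ _ (hcop.pow_left _), mul_assoc]

lemma sum_prime_powers_eq_sum_divisors {M : Type*} [AddCommMonoid M] (y n : ℕ) (hn : n ≠ 0)
    (G : ℕ → M) (hG : ∀ d, ¬ (IsPrimePow d ∧ y < d.minFac) → G d = 0) :
    ∑ p ∈ n.primeFactors.filter (fun p => y < p), ∑ j ∈ range (n.factorization p), G (p ^ (j + 1)) =
      ∑ d ∈ n.divisors, G d := by
  rw [sum_sigma' (n.primeFactors.filter (fun p => y < p))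
    (fun p => range (n.factorization p)) (fun p j => G (p ^ (j + 1)))]
  apply Finset.sum_of_injOn (fun x : (_ : ℕ) × ℕ => x.1 ^ (x.2 + 1))
  · rintro ⟨p, j⟩ hpj ⟨r, k⟩ hrk hEq
    simp only [coe_sigma, Set.mem_sigma_iff, coe_filter, Set.mem_ofPred_eq, Finset.mem_coe,
      Nat.mem_primeFactors] at hpj hrk hEq
    have hp := hpj.1.1.1
    have hr := hrk.1.1.1
    have h1 : p = r := by
      have h2 : (p ^ (j + 1)).minFac = p := hp.pow_minFac (by omega)
      have h3 : (r ^ (k + 1)).minFac = r := hr.pow_minFac (by omega)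
      rw [← h2, ← h3, hEq]
    subst h1
    have h4 := Nat.pow_right_injective hp.two_le hEq
    have : j = k := by simpa using h4
    subst this
    rfl
  · rintro ⟨p, j⟩ hpj
    simp only [coe_sigma, Set.mem_sigma_iff, coe_filter, Set.mem_ofPred_eq, Finset.mem_coe,
      Nat.mem_primeFactors, mem_range] at hpj
    simp only [Finset.mem_coe, Nat.mem_divisors]
    exact ⟨(hpj.1.1.1.pow_dvd_iff_le_factorization hn).2 hpj.2, hn⟩
  · intro d hd hd'
    apply hG
    rintro ⟨hpp, hy⟩
    apply hd'
    obtain ⟨p, k, hp, hk, rfl⟩ := (isPrimePow_nat_iff d).1 hpp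
    rw [hp.pow_minFac (by omega)] at hy
    rw [Nat.mem_divisors] at hd
    refine ⟨⟨p, k - 1⟩, ?_, ?_⟩
    · simp only [coe_sigma, Set.mem_sigma_iff, coe_filter, Set.mem_ofPred_eq, Finset.mem_coe,
        Nat.mem_primeFactors, mem_range]
      refine ⟨⟨⟨hp, (dvd_pow_self p (by omega)).trans hd.1, hn⟩, hy⟩, ?_⟩
      have := (hp.pow_dvd_iff_le_factorization hn).1 hd.1
      omega
    · simp only
      rw [Nat.sub_add_cancel hk]
  · rintro ⟨p, j⟩ _
    rfl

lemma IsHalaszClass.mul_roughLog (h : IsHalaszClass κ f Λf) (y n : ℕ) (hn : n ≠ 0) :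
    f n * (roughLog y n : ℂ) = ∑ d ∈ n.divisors, roughLambda Λf y d * f (n / d) := by
  rw [roughLog, ofReal_sum, mul_sum,
    ← sum_prime_powers_eq_sum_divisors y n hn (fun d => roughLambda Λf y d * f (n / d))]
  · apply sum_congr rfl
    intro p hp
    rw [mem_filter, Nat.mem_primeFactors] at hp
    rw [h.mul_factorization_mul_log hn hp.1.1]
    apply sum_congr rfl
    intro j _
    rw [roughLambda, if_pos]
    rw [hp.1.1.pow_minFac (by omega)]
    exact hp.2
  · intro d hd
    rw [roughLambda]
    split_ifs with hy
    · rw [h.supp d (fun hpp => hd ⟨hpp, hy⟩), zero_mul]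
    · rw [zero_mul]

lemma roughLog_nonneg (y n : ℕ) : 0 ≤ roughLog y n :=
  sum_nonneg fun p _ => mul_nonneg (Nat.cast_nonneg _) (Real.log_natCast_nonneg p)

lemma roughLog_one (y : ℕ) : roughLog y 1 = 0 := by simp [roughLog]

lemma roughLog_eq_sum (y n : ℕ) (s : Finset ℕ) (hs : n.primeFactors ⊆ s) :
    roughLog y n = ∑ p ∈ s.filter (fun p => y < p), n.factorization p * Real.log p := by
  refine sum_subset (filter_subset_filter _ hs) ?_
  intro p hp hp'
  rw [mem_filter] at hp hp'
  have : p ∉ n.primeFactors := fun hh => hp' ⟨hh, hp.2⟩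
  rw [← Nat.support_factorization, Finsupp.notMem_support_iff] at this
  rw [this]; simp

lemma roughLog_mul (y m n : ℕ) (hm : m ≠ 0) (hn : n ≠ 0) :
    roughLog y (m * n) = roughLog y m + roughLog y n := by
  rw [roughLog_eq_sum y (m * n) (m * n).primeFactors subset_rfl,
    roughLog_eq_sum y m (m * n).primeFactors (Nat.primeFactors_mono (dvd_mul_right m n)
      (mul_ne_zero hm hn)),
    roughLog_eq_sum y n (m * n).primeFactors (Nat.primeFactors_mono (dvd_mul_left n m)
      (mul_ne_zero hm hn)), ← sum_add_distrib]
  apply sum_congr rfl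
  intro p _
  rw [Nat.factorization_mul hm hn]
  simp
  ring

lemma roughLog_prime_pow (y p k : ℕ) (hp : p.Prime) :
    roughLog y (p ^ k) = if y < p then k * Real.log p else 0 := by
  rw [roughLog_eq_sum y (p ^ k) {p} (by
    rcases Nat.eq_zero_or_pos k with rfl | hk
    · simp
    · rw [Nat.primeFactors_prime_pow (by omega) hp]), sum_filter, sum_singleton,
    hp.factorization_pow]
  simp

end HalaszClassBasics

section DampedDecomposition
open Finset ArithmeticFunction

/-- `f(n)` damped by the factor `r ^ (-α)`, `r` being the `y`-rough part of `n`. -/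
def damp (f : ℕ → ℂ) (y : ℕ) (α : ℝ) (n : ℕ) : ℂ :=
  f n * (Real.exp (-(α * roughLog y n)) : ℂ)

/-- The coefficients `Λf(d) d ^ (-α)` restricted to powers of primes exceeding `y`. -/
def dampLambda (Λf : ℕ → ℂ) (y : ℕ) (α : ℝ) (d : ℕ) : ℂ :=
  roughLambda Λf y d * (Real.exp (-(α * Real.log d)) : ℂ)

variable {κ : ℝ} {f Λf : ℕ → ℂ}

lemma IsHalaszClass.roughLambda_ne_zero (h : IsHalaszClass κ f Λf) {y d : ℕ}
    (hd : roughLambda Λf y d ≠ 0) : ∃ p k : ℕ, p.Prime ∧ 1 ≤ k ∧ y < p ∧ d = p ^ k := by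
  rw [roughLambda] at hd
  split_ifs at hd with hy
  · have hpp : IsPrimePow d := by
      by_contra hcon
      exact hd (h.supp d hcon)
    obtain ⟨p, k, hp, hk, rfl⟩ := (isPrimePow_nat_iff d).1 hpp
    rw [hp.pow_minFac (by omega)] at hy
    exact ⟨p, k, hp, hk, hy, rfl⟩
  · exact absurd rfl hd

lemma IsHalaszClass.roughLog_eq_log (h : IsHalaszClass κ f Λf) {y d : ℕ}
    (hd : roughLambda Λf y d ≠ 0) : roughLog y d = Real.log d := by
  obtain ⟨p, k, hp, hk, hy, rfl⟩ := h.roughLambda_ne_zero hd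
  rw [roughLog_prime_pow y p k hp, if_pos hy]
  push_cast
  rw [Real.log_pow]

lemma IsHalaszClass.norm_roughLambda_le (h : IsHalaszClass κ f Λf) (y d : ℕ) :
    ‖roughLambda Λf y d‖ ≤ κ * vonMangoldt d := by
  rw [roughLambda]
  split_ifs with hy
  · rcases Nat.eq_zero_or_pos d with rfl | hd
    · rw [h.supp 0 not_isPrimePow_zero]; simp
    · exact h.bound d hd
  · rw [norm_zero]
    exact mul_nonneg h.kappa_nonneg vonMangoldt_nonneg

lemma damp_zero (f : ℕ → ℂ) (y n : ℕ) : damp f y 0 n = f n := by simp [damp]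

lemma norm_damp (f : ℕ → ℂ) (y n : ℕ) (α : ℝ) :
    ‖damp f y α n‖ = ‖f n‖ * Real.exp (-(α * roughLog y n)) := by
  rw [damp, norm_mul, norm_real, Real.norm_of_nonneg (Real.exp_nonneg _)]

lemma IsHalaszClass.damp_mul_roughLog (h : IsHalaszClass κ f Λf) (y : ℕ) (α : ℝ) {n : ℕ}
    (hn : n ≠ 0) :
    damp f y α n * (roughLog y n : ℂ) =
      ∑ d ∈ n.divisors, dampLambda Λf y α d * damp f y α (n / d) := by
  rw [damp, mul_right_comm, h.mul_roughLog y n hn, sum_mul]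
  apply sum_congr rfl
  intro d hd
  by_cases hz : roughLambda Λf y d = 0
  · simp [dampLambda, hz]
  · have hd' := Nat.mem_divisors.1 hd
    have hd0 : d ≠ 0 := fun h0 => hn (by simpa [h0] using hd'.1)
    have hnd : n / d ≠ 0 := (Nat.div_pos (Nat.le_of_dvd (by omega) hd'.1) (by omega)).ne'
    have h1 : roughLog y n = Real.log d + roughLog y (n / d) := by
      rw [← h.roughLog_eq_log hz, ← roughLog_mul y d (n / d) hd0 hnd, Nat.mul_div_cancel' hd'.1]
    rw [dampLambda, damp, h1, mul_add, neg_add, Real.exp_add]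
    push_cast
    ring

lemma hasDerivAt_damp (f : ℕ → ℂ) (y n : ℕ) (α : ℝ) :
    HasDerivAt (fun a : ℝ => damp f y a n) (-(damp f y α n * (roughLog y n : ℂ))) α := by
  have h1 : HasDerivAt (fun a : ℝ => Real.exp (-(a * roughLog y n)))
      (Real.exp (-(α * roughLog y n)) * (-(1 * roughLog y n))) α :=
    (((hasDerivAt_id α).mul_const _).neg).exp
  have h2 := h1.ofReal_comp.const_mul (f n)
  unfold damp
  refine h2.congr_deriv ?_
  push_cast
  ring

lemma continuous_damp (f : ℕ → ℂ) (y n : ℕ) : Continuous fun a : ℝ => damp f y a n := by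
  unfold damp; fun_prop

lemma continuous_dampLambda (Λf : ℕ → ℂ) (y d : ℕ) :
    Continuous fun a : ℝ => dampLambda Λf y a d := by
  unfold dampLambda; fun_prop

lemma damp_sub_damp (f : ℕ → ℂ) (y n : ℕ) (α η : ℝ) :
    damp f y α n - damp f y η n = ∫ γ in α..η, damp f y γ n * (roughLog y n : ℂ) := by
  have h1 := intervalIntegral.integral_eq_sub_of_hasDerivAt (a := α) (b := η)
    (fun x _ => hasDerivAt_damp f y n x)
    (Continuous.intervalIntegrable (((continuous_damp f y n).mul continuous_const).neg) _ _)
  rw [intervalIntegral.integral_neg] at h1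
  rw [← neg_inj, h1]
  ring

/-- The part of `f` which is a convolution of two von Mangoldt-like factors. -/
def bilinearPart (f Λf : ℕ → ℂ) (y : ℕ) (η α : ℝ) (n : ℕ) : ℂ :=
  ∑ d ∈ n.divisors, dampLambda Λf y α d * (damp f y α (n / d) - damp f y η (n / d))

lemma continuous_bilinearPart (f Λf : ℕ → ℂ) (y n : ℕ) (η : ℝ) :
    Continuous fun α : ℝ => bilinearPart f Λf y η α n := by
  unfold bilinearPart
  refine continuous_finsetSum _ fun d _ => ?_
  exact (continuous_dampLambda _ _ _).mul ((continuous_damp _ _ _).sub continuous_const)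

lemma IsHalaszClass.bilinearPart_eq_integral (h : IsHalaszClass κ f Λf) (y : ℕ) (η α : ℝ) {n : ℕ}
    (hn : n ≠ 0) :
    bilinearPart f Λf y η α n = ∫ γ in α..η, ∑ d ∈ n.divisors, ∑ e ∈ (n / d).divisors,
      dampLambda Λf y α d * dampLambda Λf y γ e * damp f y γ (n / d / e) := by
  rw [bilinearPart, intervalIntegral.integral_finsetSum]
  · apply sum_congr rfl
    intro d hd
    have hd' := Nat.mem_divisors.1 hd
    have hd0 : d ≠ 0 := fun h0 => hn (by simpa [h0] using hd'.1)
    have hnd : n / d ≠ 0 := (Nat.div_pos (Nat.le_of_dvd (by omega) hd'.1) (by omega)).ne'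
    rw [damp_sub_damp, ← intervalIntegral.integral_const_mul]
    apply intervalIntegral.integral_congr
    intro γ _
    simp only
    rw [h.damp_mul_roughLog y γ hnd, mul_sum]
    apply sum_congr rfl
    intro e _
    ring
  · intro d _
    apply Continuous.intervalIntegrable
    refine continuous_finsetSum _ fun e _ => ?_
    exact (continuous_const.mul (continuous_dampLambda _ _ _)).mul (continuous_damp _ _ _)

lemma IsHalaszClass.eq_damp_add (h : IsHalaszClass κ f Λf) (y : ℕ) (η : ℝ) {n : ℕ} (hn : n ≠ 0) :
    f n = damp f y η n +
      (∫ α in (0 : ℝ)..η, ∑ d ∈ n.divisors, dampLambda Λf y α d * damp f y η (n / d)) +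
      ∫ α in (0 : ℝ)..η, bilinearPart f Λf y η α n := by
  rw [add_assoc, ← intervalIntegral.integral_add]
  · rw [← sub_eq_iff_eq_add', ← damp_zero f y n, damp_sub_damp]
    apply intervalIntegral.integral_congr
    intro α _
    simp only
    rw [h.damp_mul_roughLog y α hn, bilinearPart, ← sum_add_distrib]
    apply sum_congr rfl
    intro d _
    ring
  · apply Continuous.intervalIntegrable
    refine continuous_finsetSum _ fun d _ => ?_
    exact (continuous_dampLambda _ _ _).mul continuous_const
  · exact (continuous_bilinearPart f Λf y n η).intervalIntegrable _ _

lemma IsHalaszClass.norm_integral_dampLambda_le (h : IsHalaszClass κ f Λf) (y d : ℕ) {η : ℝ}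
    (hη : 0 ≤ η) :
    ‖∫ α in (0 : ℝ)..η, dampLambda Λf y α d‖ ≤
      if IsPrimePow d ∧ y < d.minFac then κ else 0 := by
  by_cases hz : roughLambda Λf y d = 0
  · simp only [dampLambda, hz, zero_mul, intervalIntegral.integral_zero, norm_zero]
    split_ifs
    · exact h.kappa_nonneg
    · exact le_rfl
  obtain ⟨p, k, hp, hk, hy, rfl⟩ := h.roughLambda_ne_zero hz
  rw [if_pos ⟨(isPrimePow_nat_iff _).2 ⟨p, k, hp, hk, rfl⟩, by rwa [hp.pow_minFac (by omega)]⟩]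
  simp only [dampLambda]
  rw [intervalIntegral.integral_const_mul, norm_mul, intervalIntegral.integral_ofReal, norm_real]
  set l := Real.log ((p ^ k : ℕ) : ℝ) with hl
  have hl0 : 0 < l := Real.log_pos (by exact_mod_cast Nat.one_lt_pow (by omega) hp.one_lt)
  have hpk : Real.log p ≤ l :=
    Real.log_le_log (by exact_mod_cast hp.pos) (by exact_mod_cast Nat.le_self_pow (by omega) p)
  have h1 : ∫ α in (0 : ℝ)..η, Real.exp (-(α * l)) = (1 - Real.exp (-(η * l))) / l := by
    have h2 : ∀ x : ℝ, HasDerivAt (fun a => -Real.exp (-(a * l)) / l) (Real.exp (-(x * l))) x := by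
      intro x
      have h3 : HasDerivAt (fun a : ℝ => Real.exp (-(a * l))) (Real.exp (-(x * l)) * (-(1 * l))) x :=
        (((hasDerivAt_id x).mul_const _).neg).exp
      refine ((h3.neg).div_const l).congr_deriv ?_
      field_simp
    rw [intervalIntegral.integral_eq_sub_of_hasDerivAt (fun x _ => h2 x)
      (Continuous.intervalIntegrable (by fun_prop) _ _)]
    simp
    ring
  have h4 : Real.exp (-(η * l)) ≤ 1 := Real.exp_le_one_iff.2 (neg_nonpos.2 (mul_nonneg hη hl0.le))
  rw [h1, Real.norm_of_nonneg (div_nonneg (by linarith) hl0.le)]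
  have h5 : ‖roughLambda Λf y (p ^ k)‖ ≤ κ * l := by
    refine (h.norm_roughLambda_le y (p ^ k)).trans ?_
    rw [vonMangoldt_apply_pow (by omega), vonMangoldt_apply_prime hp]
    exact mul_le_mul_of_nonneg_left hpk h.kappa_nonneg
  calc _ ≤ (κ * l) * (1 / l) := by
        refine mul_le_mul h5 ?_ (div_nonneg (by linarith) hl0.le)
          (mul_nonneg h.kappa_nonneg hl0.le)
        exact div_le_div_of_nonneg_right (by linarith [Real.exp_nonneg (-(η * l))]) hl0.le
    _ = κ := by field_simp

lemma IsHalaszClass.norm_integral_linear_le (h : IsHalaszClass κ f Λf) (y n : ℕ) {η : ℝ}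
    (hη : 0 ≤ η) :
    ‖∫ α in (0 : ℝ)..η, ∑ d ∈ n.divisors, dampLambda Λf y α d * damp f y η (n / d)‖ ≤
      κ * ∑ d ∈ n.divisors.filter (fun d => IsPrimePow d ∧ y < d.minFac), ‖damp f y η (n / d)‖ := by
  rw [intervalIntegral.integral_finsetSum]
  · rw [sum_filter, mul_sum]
    refine norm_sum_le_of_le _ fun d _ => ?_
    rw [intervalIntegral.integral_mul_const, norm_mul]
    refine (mul_le_mul_of_nonneg_right (h.norm_integral_dampLambda_le y d hη)
      (norm_nonneg _)).trans (le_of_eq ?_)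
    split_ifs <;> simp
  · intro d _
    exact ((continuous_dampLambda _ _ _).mul continuous_const).intervalIntegrable _ _

end DampedDecomposition

section ProgressionErrors
open Finset ArithmeticFunction

/-- Prime powers all of whose prime factors exceed `y`. -/
def IsRoughPrimePow (y d : ℕ) : Prop := IsPrimePow d ∧ y < d.minFac

lemma isRoughPrimePow_prime_pow (y p k : ℕ) (hp : p.Prime) :
    IsRoughPrimePow y (p ^ (k + 1)) ↔ y < p := by
  rw [IsRoughPrimePow, hp.pow_minFac (by omega)]
  exact and_iff_right ((isPrimePow_nat_iff _).2 ⟨p, k + 1, hp, by omega, rfl⟩)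

lemma not_isRoughPrimePow_one (y : ℕ) : ¬ IsRoughPrimePow y 1 := fun h => not_isPrimePow_one h.1

lemma sum_roughPrimePow_mul (y a b : ℕ) (hab : a.Coprime b) (h : ℕ → ℝ)
    (hmul : ∀ m n : ℕ, Nat.Coprime m n → h (m * n) = h m * h n) :
    ∑ d ∈ (a * b).divisors.filter (IsRoughPrimePow y), h (a * b / d) =
      h b * (∑ d ∈ a.divisors.filter (IsRoughPrimePow y), h (a / d)) +
      h a * ∑ d ∈ b.divisors.filter (IsRoughPrimePow y), h (b / d) := by
  have h1 : ∀ n : ℕ, n.divisors.filter (IsRoughPrimePow y) =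
      (n.divisors.filter IsPrimePow).filter (fun d => y < d.minFac) := by
    intro n; ext d; simp only [mem_filter, IsRoughPrimePow]; tauto
  rw [h1, h1, h1, Nat.mul_divisors_filter_prime_pow hab, filter_union, filter_union,
    sum_union ((Nat.disjoint_divisors_filter_isPrimePow hab).mono (filter_subset _ _)
      (filter_subset _ _)), mul_sum, mul_sum]
  congr 1
  · apply sum_congr rfl
    intro d hd
    simp only [mem_filter, Nat.mem_divisors] at hd
    have h2 : a * b / d = (a / d) * b := Nat.div_mul_right_comm hd.1.1.1 b |>.symm ▸ rfl
    rw [h2, hmul _ _ (Nat.Coprime.coprime_dvd_left (Nat.div_dvd_of_dvd hd.1.1.1) hab), mul_comm]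
  · apply sum_congr rfl
    intro d hd
    simp only [mem_filter, Nat.mem_divisors] at hd
    have h2 : a * b / d = a * (b / d) := Nat.mul_div_assoc a hd.1.1.1
    rw [h2, hmul _ _ (Nat.Coprime.coprime_dvd_right (Nat.div_dvd_of_dvd hd.1.1.1) hab)]

lemma sum_roughPrimePow_prime_pow (y p k : ℕ) (hp : p.Prime) (h : ℕ → ℝ) :
    ∑ d ∈ (p ^ k).divisors.filter (IsRoughPrimePow y), h (p ^ k / d) =
      if y < p then ∑ j ∈ range k, h (p ^ j) else 0 := by
  rw [sum_filter, Nat.sum_divisors_prime_pow hp, sum_range_succ', pow_zero,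
    if_neg (not_isRoughPrimePow_one y), add_zero, ← sum_range_reflect]
  simp only [isRoughPrimePow_prime_pow y p _ hp]
  split_ifs
  · apply sum_congr rfl
    intro j hj
    rw [mem_range] at hj
    rw [Nat.pow_div (by omega) hp.pos]
    congr 2
    omega
  · simp

lemma exists_majorant_of_roughPrimePow_sum (K y : ℕ) (h : ℕ → ℝ) (hh : IsDivisorBounded K h)
    (ε : ℝ) (hε : 0 ≤ ε) (hε1 : ε ≤ 1) :
    ∃ g : ℕ → ℝ, IsDivisorBounded (K + 1) g ∧
      (∀ p : ℕ, p.Prime → g p = h p + if y < p then ε else 0) ∧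
      ∀ n : ℕ, n ≠ 0 →
        ε * ∑ d ∈ n.divisors.filter (IsRoughPrimePow y), h (n / d) ≤ g n := by
  set B : ℕ → ℕ → ℝ := fun p k => h (p ^ k) + if y < p then ε * ∑ j ∈ range k, h (p ^ j) else 0
    with hB
  have hB0 : ∀ p k, 0 ≤ B p k := by
    intro p k
    have h1 : 0 ≤ ε * ∑ j ∈ range k, h (p ^ j) :=
      mul_nonneg hε (sum_nonneg fun j _ => hh.nonneg _)
    have h2 := hh.nonneg (p ^ k)
    simp only [hB]
    split_ifs <;> linarith
  set g : ℕ → ℝ := fun n => n.factorization.prod B with hg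
  have hgpow : ∀ p k : ℕ, p.Prime → g (p ^ k) = B p k := by
    intro p k hp
    simp only [hg]
    rw [hp.factorization_pow, Finsupp.prod_single_index]
    simp [hB, hh.map_one]
  have hgmul : ∀ m n : ℕ, Nat.Coprime m n → g (m * n) = g m * g n := by
    intro m n hmn
    simp only [hg]
    rw [Nat.factorization_mul_of_coprime hmn, Finsupp.prod_add_index_of_disjoint]
    exact hmn.disjoint_primeFactors
  have hgdb : IsDivisorBounded (K + 1) g := by
    refine ⟨fun n => ?_, ?_, hgmul, ?_⟩
    · exact prod_nonneg fun p _ => hB0 _ _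
    · simp [hg]
    · intro p k hp
      rw [hgpow p k hp]
      have h1 := hh.le_pow p k hp
      have h2 : ∑ j ∈ range k, h (p ^ j) ≤ k * ((k : ℝ) + 1) ^ K := by
        calc _ ≤ ∑ j ∈ range k, ((k : ℝ) + 1) ^ K := by
              apply sum_le_sum
              intro j hj
              refine (hh.le_pow p j hp).trans ?_
              have : (j : ℝ) ≤ k := by exact_mod_cast (mem_range.1 hj).le
              gcongr
          _ = _ := by simp
      have h3 : 0 ≤ ∑ j ∈ range k, h (p ^ j) := sum_nonneg fun j _ => hh.nonneg _
      have h4 : ε * ∑ j ∈ range k, h (p ^ j) ≤ k * ((k : ℝ) + 1) ^ K :=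
        (mul_le_of_le_one_left h3 hε1).trans h2
      have h5 : 0 ≤ k * ((k : ℝ) + 1) ^ K := by positivity
      have h6 : ((k : ℝ) + 1) ^ (K + 1) = ((k : ℝ) + 1) ^ K + k * ((k : ℝ) + 1) ^ K := by ring
      simp only [hB]
      rw [h6]
      split_ifs <;> linarith
  refine ⟨g, hgdb, ?_, ?_⟩
  · intro p hp
    have := hgpow p 1 hp
    rw [pow_one] at this
    rw [this]
    simp [hB, hh.map_one]
  · suffices H : ∀ n : ℕ, n ≠ 0 →
        h n + ε * ∑ d ∈ n.divisors.filter (IsRoughPrimePow y), h (n / d) ≤ g n by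
      intro n hn
      have := H n hn
      have := hh.nonneg n
      linarith
    intro n
    induction n using Nat.recOnPosPrimePosCoprime with
    | prime_pow p k hp hk =>
      intro _
      rw [sum_roughPrimePow_prime_pow y p k hp, hgpow p k hp]
      simp only [hB]
      split_ifs <;> simp
    | zero => intro h0; exact absurd rfl h0
    | one => intro _; simp [hg, hh.map_one, sum_filter, not_isRoughPrimePow_one]
    | coprime a b ha hb hab iha ihb =>
      intro _
      have iha := iha (by omega)
      have ihb := ihb (by omega)
      rw [sum_roughPrimePow_mul y a b hab h hh.mult, hgmul a b hab,
        hh.mult a b hab]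
      have h1 : 0 ≤ ∑ d ∈ a.divisors.filter (IsRoughPrimePow y), h (a / d) :=
        sum_nonneg fun d _ => hh.nonneg _
      have h2 : 0 ≤ ∑ d ∈ b.divisors.filter (IsRoughPrimePow y), h (b / d) :=
        sum_nonneg fun d _ => hh.nonneg _
      have h3 := hh.nonneg a
      have h4 := hh.nonneg b
      refine le_trans ?_ (mul_le_mul iha ihb (by positivity) (hgdb.nonneg a))
      have h5 : 0 ≤ ε * (∑ d ∈ a.divisors.filter (IsRoughPrimePow y), h (a / d)) *
        (ε * ∑ d ∈ b.divisors.filter (IsRoughPrimePow y), h (b / d)) := by positivity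
      nlinarith

variable {κ : ℝ} {f Λf : ℕ → ℂ}

lemma IsHalaszClass.isDivisorBounded_damp (h : IsHalaszClass κ f Λf) (K : ℕ) (hK : 2 * κ ≤ K)
    (y : ℕ) {η : ℝ} (hη : 0 ≤ η) : IsDivisorBounded K (fun n => ‖damp f y η n‖) where
  nonneg n := norm_nonneg _
  map_one := by simp [norm_damp, h.map_one, roughLog_one]
  mult m n hmn := by
    rcases Nat.eq_zero_or_pos m with rfl | hm
    · have : n = 1 := by simpa using hmn
      simp [this, norm_damp, h.map_one, roughLog_one]
    rcases Nat.eq_zero_or_pos n with rfl | hn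
    · have : m = 1 := by simpa using hmn
      simp [this, norm_damp, h.map_one, roughLog_one]
    simp only [norm_damp]
    rw [roughLog_mul y m n (by omega) (by omega), h.mult m n hmn, mul_add, neg_add, Real.exp_add,
      norm_mul]
    ring
  le_pow p k hp := by
    refine le_trans ?_ ((h.isDivisorBounded K hK).le_pow p k hp)
    rw [norm_damp]
    refine mul_le_of_le_one_right (norm_nonneg _) (Real.exp_le_one_iff.2 ?_)
    exact neg_nonpos.2 (mul_nonneg hη (roughLog_nonneg y _))

lemma norm_damp_prime_le (h : IsHalaszClass κ f Λf) (y p : ℕ) (hp : p.Prime) (η : ℝ) :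
    ‖damp f y η p‖ ≤ if y < p then κ * (p : ℝ) ^ (-η) else κ := by
  have h1 := roughLog_prime_pow y p 1 hp
  rw [pow_one] at h1
  rw [norm_damp, h1]
  have hp0 : (0 : ℝ) < p := by exact_mod_cast hp.pos
  split_ifs
  · rw [Real.rpow_def_of_pos hp0]
    refine mul_le_mul (h.norm_prime_le hp) (le_of_eq ?_) (Real.exp_nonneg _) h.kappa_nonneg
    congr 1
    push_cast; ring
  · simpa using h.norm_prime_le hp

lemma exp_sum_primes_damp_le (h : IsHalaszClass κ f Λf) (y N : ℕ) (hy : 2 ≤ y) :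
    ∑ p ∈ (Icc 1 N).filter Nat.Prime, ‖damp f y (1 / Real.log y) p‖ / p ≤
      κ * (Real.log (Real.log y) + 52) := by
  have hy' : (2 : ℝ) ≤ y := by exact_mod_cast hy
  have h1 := sum_primes_inv_le y hy (((Icc 1 N).filter Nat.Prime).filter (fun p => ¬ y < p))
    (by intro p hp; simp only [mem_filter] at hp; exact ⟨hp.1.2, by omega⟩)
  have h2 := sum_primes_gt_rpow_inv_log_le y hy' (((Icc 1 N).filter Nat.Prime).filter (fun p => y < p))
    (by intro p hp; simp only [mem_filter] at hp; exact ⟨hp.1.2, by exact_mod_cast hp.2⟩)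
  rw [← sum_filter_add_sum_filter_not _ (fun p => y < p)]
  have h3 : ∑ p ∈ ((Icc 1 N).filter Nat.Prime).filter (fun p => y < p),
      ‖damp f y (1 / Real.log y) p‖ / p ≤ κ * 12 := by
    refine le_trans ?_ (mul_le_mul_of_nonneg_left h2 h.kappa_nonneg)
    rw [mul_sum]
    apply sum_le_sum
    intro p hp
    simp only [mem_filter] at hp
    have := norm_damp_prime_le h y p hp.1.2 (1 / Real.log y)
    rw [if_pos hp.2] at this
    calc _ ≤ κ * (p : ℝ) ^ (-(1 / Real.log y)) / p := by gcongr
      _ = _ := by ring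
  have h4 : ∑ p ∈ ((Icc 1 N).filter Nat.Prime).filter (fun p => ¬ y < p),
      ‖damp f y (1 / Real.log y) p‖ / p ≤ κ * (Real.log (Real.log y) + 40) := by
    refine le_trans ?_ (mul_le_mul_of_nonneg_left h1 h.kappa_nonneg)
    rw [mul_sum]
    apply sum_le_sum
    intro p hp
    simp only [mem_filter] at hp
    have := norm_damp_prime_le h y p hp.1.2 (1 / Real.log y)
    rw [if_neg hp.2] at this
    calc _ ≤ κ / p := by gcongr
      _ = _ := by ring
  linarith

end ProgressionErrors

section ProgressionBounds
open Finset ArithmeticFunction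

lemma exp_kappa_mul_log_add (κ c z : ℝ) (hz : 0 < z) :
    Real.exp (κ * (Real.log z + c)) = Real.exp (κ * c) * z ^ κ := by
  rw [Real.rpow_def_of_pos hz, ← Real.exp_add]; ring_nf

lemma exists_sum_norm_modEq_le (κ : ℝ) (K : ℕ) (hK : 2 * κ ≤ K) : ∃ C : ℝ, 0 < C ∧
    ∀ f Λf : ℕ → ℂ, IsHalaszClass κ f Λf → ∀ q N a : ℕ, 1 ≤ q → q ^ 2 ≤ N → 2 ≤ N →
    Nat.Coprime a q →
    ∑ n ∈ (Icc 1 N).filter (fun n => n ≡ a [MOD q]), ‖f n‖ ≤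
      C * (N / (q.totient * Real.log N)) * Real.log N ^ κ := by
  obtain ⟨C, hC, hb⟩ := exists_shiu_bound K
  refine ⟨C * Real.exp (κ * 40), by positivity, ?_⟩
  intro f Λf h q N a hq hqN hN haq
  refine (hb _ (h.isDivisorBounded K hK) q N a hq hqN hN haq).trans ?_
  have hlN : 0 < Real.log N := Real.log_pos (by exact_mod_cast hN)
  have h1 : ∑ p ∈ (Icc 1 N).filter Nat.Prime, ‖f p‖ / p ≤ κ * (Real.log (Real.log N) + 40) := by
    have h2 := sum_primes_inv_le N hN ((Icc 1 N).filter Nat.Prime) (by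
      intro p hp; simp only [mem_filter, mem_Icc] at hp; exact ⟨hp.2, hp.1.2⟩)
    refine le_trans ?_ (mul_le_mul_of_nonneg_left h2 h.kappa_nonneg)
    rw [mul_sum]
    apply sum_le_sum
    intro p hp
    rw [mem_filter] at hp
    have := h.norm_prime_le hp.2
    calc _ ≤ κ / p := by gcongr
      _ = _ := by ring
  have h3 := Real.exp_le_exp.2 h1
  rw [exp_kappa_mul_log_add κ _ _ hlN] at h3
  calc _ ≤ C * (N / (q.totient * Real.log N)) * (Real.exp (κ * 40) * Real.log N ^ κ) :=
        mul_le_mul_of_nonneg_left h3 (by positivity)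
    _ = _ := by ring

lemma exists_sq_sum_norm_le (κ : ℝ) (K : ℕ) (hK : 2 * κ ≤ K) : ∃ C : ℝ, 0 < C ∧
    ∀ f Λf : ℕ → ℂ, IsHalaszClass κ f Λf → ∀ q N a : ℕ, 1 ≤ q → q ^ 2 ≤ N → 2 ≤ N →
    Nat.Coprime a q → ∀ S : Finset ℕ, S ⊆ (Icc 1 N).filter (fun n => n ≡ a [MOD q]) →
    (∑ n ∈ S, ‖f n‖) ^ 2 ≤
      S.card * (C * (N / (q.totient * Real.log N)) * Real.log N ^ (κ ^ 2)) := by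
  obtain ⟨C, hC, hb⟩ := exists_shiu_bound (K * 2)
  refine ⟨C * Real.exp (κ ^ 2 * 40), by positivity, ?_⟩
  intro f Λf h q N a hq hqN hN haq S hS
  have hlN : 0 < Real.log N := Real.log_pos (by exact_mod_cast hN)
  refine sq_sum_le_card_mul_sum_sq.trans ?_
  refine mul_le_mul_of_nonneg_left ?_ (Nat.cast_nonneg _)
  have h1 : ∑ p ∈ (Icc 1 N).filter Nat.Prime, ‖f p‖ ^ 2 / p ≤
      κ ^ 2 * (Real.log (Real.log N) + 40) := by
    have h2 := sum_primes_inv_le N hN ((Icc 1 N).filter Nat.Prime) (by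
      intro p hp; simp only [mem_filter, mem_Icc] at hp; exact ⟨hp.2, hp.1.2⟩)
    refine le_trans ?_ (mul_le_mul_of_nonneg_left h2 (sq_nonneg κ))
    rw [mul_sum]
    apply sum_le_sum
    intro p hp
    rw [mem_filter] at hp
    have := h.norm_prime_le hp.2
    calc _ ≤ κ ^ 2 / p := by gcongr
      _ = _ := by ring
  have h3 := Real.exp_le_exp.2 h1
  rw [exp_kappa_mul_log_add (κ ^ 2) _ _ hlN] at h3
  calc ∑ n ∈ S, ‖f n‖ ^ 2 ≤ ∑ n ∈ (Icc 1 N).filter (fun n => n ≡ a [MOD q]), ‖f n‖ ^ 2 :=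
        sum_le_sum_of_subset_of_nonneg hS fun i _ _ => sq_nonneg _
    _ ≤ _ := hb _ ((h.isDivisorBounded K hK).pow 2) q N a hq hqN hN haq
    _ ≤ C * (N / (q.totient * Real.log N)) * (Real.exp (κ ^ 2 * 40) * Real.log N ^ (κ ^ 2)) :=
        mul_le_mul_of_nonneg_left h3 (by positivity)
    _ = _ := by ring

lemma exists_sum_damp_modEq_le (κ : ℝ) (K : ℕ) (hK : 2 * κ ≤ K) : ∃ C : ℝ, 0 < C ∧
    ∀ f Λf : ℕ → ℂ, IsHalaszClass κ f Λf → ∀ q N a y : ℕ, 1 ≤ q → q ^ 2 ≤ N → 2 ≤ y →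
    y ≤ N → Nat.Coprime a q →
    ∑ n ∈ (Icc 1 N).filter (fun n => n ≡ a [MOD q]), ‖damp f y (1 / Real.log y) n‖ ≤
      C * (N / (q.totient * Real.log N)) * Real.log y ^ κ := by
  obtain ⟨C, hC, hb⟩ := exists_shiu_bound K
  refine ⟨C * Real.exp (κ * 52), by positivity, ?_⟩
  intro f Λf h q N a y hq hqN hy hyN haq
  have hly : 0 < Real.log y := Real.log_pos (by exact_mod_cast hy)
  have hlN : 0 < Real.log N := Real.log_pos (by exact_mod_cast (by omega : 1 < N))
  refine (hb _ (h.isDivisorBounded_damp K hK y (by positivity)) q N a hq hqN (by omega) haq).trans ?_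
  have h3 := Real.exp_le_exp.2 (exp_sum_primes_damp_le h y N hy)
  rw [exp_kappa_mul_log_add κ _ _ hly] at h3
  calc _ ≤ C * (N / (q.totient * Real.log N)) * (Real.exp (κ * 52) * Real.log y ^ κ) :=
        mul_le_mul_of_nonneg_left h3 (by positivity)
    _ = _ := by ring

lemma exists_sum_damp_div_modEq_le (κ : ℝ) (K : ℕ) (hK : 2 * κ ≤ K) : ∃ C : ℝ, 0 < C ∧
    ∀ f Λf : ℕ → ℂ, IsHalaszClass κ f Λf → ∀ q N a y : ℕ, 1 ≤ q → q ^ 2 ≤ N → 2 ≤ y →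
    y ≤ N → Nat.Coprime a q →
    ∑ n ∈ (Icc 1 N).filter (fun n => n ≡ a [MOD q]),
      ∑ d ∈ n.divisors.filter (IsRoughPrimePow y), ‖damp f y (1 / Real.log y) (n / d)‖ ≤
      C * (1 + Real.log (Real.log N / Real.log y)) *
        (N / (q.totient * Real.log N)) * Real.log y ^ κ := by
  obtain ⟨C, hC, hb⟩ := exists_shiu_bound (K + 1)
  refine ⟨C * (Real.exp (κ * 52) * Real.exp 37), by positivity, ?_⟩
  intro f Λf h q N a y hq hqN hy hyN haq
  have hy' : (2 : ℝ) ≤ y := by exact_mod_cast hy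
  have hyN' : (y : ℝ) ≤ N := by exact_mod_cast hyN
  have hly : 0 < Real.log y := Real.log_pos (by linarith)
  have hlN : 0 < Real.log N := Real.log_pos (by linarith)
  set l := Real.log (Real.log N / Real.log y) with hl
  have hl0 : 0 ≤ l := Real.log_nonneg (by
    rw [le_div_iff₀ hly, one_mul]; exact Real.log_le_log (by linarith) hyN')
  set ε : ℝ := 1 / (1 + l) with hε
  have hε0 : 0 < ε := by positivity
  have hε1 : ε ≤ 1 := by rw [hε, div_le_one (by positivity)]; linarith
  obtain ⟨g, hg, hgp, hgn⟩ := exists_majorant_of_roughPrimePow_sum K y _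
    (h.isDivisorBounded_damp K hK y (by positivity : 0 ≤ 1 / Real.log y)) ε hε0.le hε1
  have hprimes : ∑ p ∈ (Icc 1 N).filter Nat.Prime, g p / p ≤
      κ * (Real.log (Real.log y) + 52) + 37 := by
    have h1 := exp_sum_primes_damp_le h y N hy
    have h2 := sum_primes_Ioc_inv_le y hy' N hyN' (((Icc 1 N).filter Nat.Prime).filter (fun p => y < p))
      (by
        intro p hp
        simp only [mem_filter, mem_Icc] at hp
        exact ⟨hp.1.2, by exact_mod_cast hp.2, hp.1.1.2⟩)
    have h3 : ∑ p ∈ (Icc 1 N).filter Nat.Prime, g p / p =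
        ∑ p ∈ (Icc 1 N).filter Nat.Prime, ‖damp f y (1 / Real.log y) p‖ / p +
        ε * ∑ p ∈ ((Icc 1 N).filter Nat.Prime).filter (fun p => y < p), (1 : ℝ) / p := by
      rw [mul_sum, sum_filter (s := (Icc 1 N).filter Nat.Prime) (p := fun p => y < p),
        ← sum_add_distrib]
      apply sum_congr rfl
      intro p hp
      rw [mem_filter] at hp
      rw [hgp p hp.2]
      split_ifs <;> ring
    have h4 : ε * ∑ p ∈ ((Icc 1 N).filter Nat.Prime).filter (fun p => y < p), (1 : ℝ) / p ≤ 37 := by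
      calc _ ≤ ε * (l + 36) := mul_le_mul_of_nonneg_left h2 hε0.le
        _ ≤ 37 := by
          rw [hε, one_div, inv_mul_le_iff₀ (by positivity)]
          linarith
    linarith
  have h3 := Real.exp_le_exp.2 hprimes
  rw [Real.exp_add, exp_kappa_mul_log_add κ _ _ hly] at h3
  have h5 := (hb g hg q N a hq hqN (by omega) haq).trans
    (mul_le_mul_of_nonneg_left h3 (by positivity))
  have h6 : ε * ∑ n ∈ (Icc 1 N).filter (fun n => n ≡ a [MOD q]),
      ∑ d ∈ n.divisors.filter (IsRoughPrimePow y), ‖damp f y (1 / Real.log y) (n / d)‖ ≤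
      ∑ n ∈ (Icc 1 N).filter (fun n => n ≡ a [MOD q]), g n := by
    rw [mul_sum]
    apply sum_le_sum
    intro n hn
    simp only [mem_filter, mem_Icc] at hn
    exact hgn n (by omega)
  have h7 := h6.trans h5
  rw [hε, one_div, inv_mul_le_iff₀ (by positivity)] at h7
  refine h7.trans (le_of_eq ?_)
  ring

end ProgressionBounds

section SmoothPerron

open Finset ArithmeticFunction

open scoped FourierTransform in
/-- Fourier inversion in the `e^{-itv}` normalisation. -/
lemma fourier_inversion_exp {g : ℝ → ℂ} (hc : Continuous g) (hi : Integrable g)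
    (hg : Integrable (fun t : ℝ => ∫ v : ℝ, cexp (-(t * v : ℝ) * I) * g v)) (v : ℝ) :
    g v = (1 / (2 * Real.pi) : ℝ) *
      ∫ t : ℝ, (∫ w : ℝ, cexp (-(t * w : ℝ) * I) * g w) * cexp ((t * v : ℝ) * I) := by
  set G : ℝ → ℂ := fun t : ℝ => ∫ v : ℝ, cexp (-(t * v : ℝ) * I) * g v with hG
  have h2 : (2 * Real.pi) ≠ 0 := by positivity
  have hF : (𝓕 g : ℝ → ℂ) = fun w => G (2 * Real.pi * w) := by
    funext w
    rw [Real.fourier_real_eq_integral_exp_smul]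
    refine integral_congr_ae (Filter.Eventually.of_forall fun u => ?_)
    simp only [smul_eq_mul]
    congr 2
    push_cast; ring
  have hFi : Integrable (𝓕 g : ℝ → ℂ) := by
    rw [hF]; exact hg.comp_mul_left' h2
  have := congrFun (hc.fourierInv_fourier_eq hi hFi) v
  rw [← this, Real.fourierInv_eq', hF]
  have hcv := Measure.integral_comp_mul_left
    (fun t : ℝ => G t * cexp ((t * v : ℝ) * I)) (2 * Real.pi)
  rw [abs_of_pos (by positivity)] at hcv
  have : (1 / (2 * Real.pi) : ℝ) * ∫ t : ℝ, G t * cexp ((t * v : ℝ) * I)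
      = (2 * Real.pi)⁻¹ • ∫ t : ℝ, G t * cexp ((t * v : ℝ) * I) := by
    rw [Complex.real_smul, one_div]
  rw [this, ← hcv]
  refine integral_congr_ae (Filter.Eventually.of_forall fun u => ?_)
  simp only [smul_eq_mul]
  rw [mul_comm]
  congr 3
  simp only [inner, RCLike.re_to_real, star_trivial]
  ring_nf

lemma integrable_inv_sq_add_sq {c : ℝ} (hc : 0 < c) :
    Integrable (fun t : ℝ => (c ^ 2 + t ^ 2)⁻¹) := by
  have h := (integrable_inv_one_add_sq.comp_mul_left' (inv_ne_zero hc.ne')).const_mul ((c ^ 2)⁻¹)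
  refine h.congr (Filter.Eventually.of_forall fun t => ?_)
  simp only
  rw [← mul_inv]
  congr 1
  field_simp

lemma norm_add_mul_I_sq (c t : ℝ) : ‖(c + t * I : ℂ) ^ 2‖ = c ^ 2 + t ^ 2 := by
  rw [norm_pow, ← Complex.normSq_eq_norm_sq, Complex.normSq_add_mul_I]

lemma add_mul_I_ne_zero {c : ℝ} (hc : 0 < c) (t : ℝ) : (c + t * I : ℂ) ≠ 0 := by
  intro h
  have := congrArg Complex.re h
  simp at this
  exact hc.ne' this

lemma continuous_inv_add_mul_I_sq {c : ℝ} (hc : 0 < c) :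
    Continuous (fun t : ℝ => ((c + t * I : ℂ) ^ 2)⁻¹) :=
  Continuous.inv₀ (by fun_prop) fun t => pow_ne_zero _ (add_mul_I_ne_zero hc t)

lemma integrable_inv_add_mul_I_sq {c : ℝ} (hc : 0 < c) :
    Integrable (fun t : ℝ => ((c + t * I : ℂ) ^ 2)⁻¹) := by
  refine (integrable_inv_sq_add_sq hc).mono'
    (continuous_inv_add_mul_I_sq hc).aestronglyMeasurable
    (Filter.Eventually.of_forall fun t => ?_)
  rw [norm_inv, norm_add_mul_I_sq]

/-- Perron's formula with the kernel `s⁻²`. -/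
lemma integral_exp_div_sq {c : ℝ} (hc : 0 < c) (v : ℝ) :
    (max v 0 : ℝ) = (1 / (2 * Real.pi) : ℝ) *
      ∫ t : ℝ, ((c + t * I : ℂ) ^ 2)⁻¹ * cexp ((c + t * I) * v) := by
  set g : ℝ → ℂ := fun v => ((max v 0 * Real.exp (-(c * v)) : ℝ) : ℂ) with hg
  have hgc : Continuous g := by fun_prop
  have hind : g = (Set.Ioi (0 : ℝ)).indicator (fun v => ((v * Real.exp (-(c * v)) : ℝ) : ℂ)) := by
    funext v
    by_cases hv : 0 < v
    · rw [Set.indicator_of_mem (Set.mem_Ioi.2 hv)]; simp only [hg, max_eq_left hv.le]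
    · rw [Set.indicator_of_notMem (by simpa using hv)]
      simp only [hg, max_eq_right (not_lt.1 hv)]; simp
  have hreal : IntegrableOn (fun v => v * Real.exp (-(c * v))) (Set.Ioi 0) := by
    simpa [neg_mul] using integrableOn_rpow_mul_exp_neg_mul_rpow (p := 1) (s := 1) (b := c)
      (by norm_num) zero_lt_one hc
  have hgi : Integrable g := by
    rw [hind, integrable_indicator_iff measurableSet_Ioi]
    exact hreal.ofReal
  have hG : (fun t : ℝ => ∫ v : ℝ, cexp (-(t * v : ℝ) * I) * g v)
      = fun t : ℝ => ((c + t * I : ℂ) ^ 2)⁻¹ := by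
    funext t
    have hs := add_mul_I_ne_zero hc t
    have h1 : ∫ v in Set.Ioi (0 : ℝ), (v : ℂ) * cexp (-((c + t * I) * v))
        = ((c + t * I : ℂ) ^ 2)⁻¹ := by
      have hd : ∀ v ∈ Set.Ici (0 : ℝ), HasDerivAt
          (fun v : ℝ => -((v : ℂ) / (c + t * I) + ((c + t * I : ℂ) ^ 2)⁻¹) *
            cexp (-((c + t * I) * v))) ((v : ℂ) * cexp (-((c + t * I) * v))) v := by
        intro v _
        have h0 : HasDerivAt (fun v : ℝ => (v : ℂ)) 1 v := Complex.ofRealCLM.hasDerivAt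
        refine (((h0.div_const _).add_const _).neg.mul
          ((h0.const_mul (c + t * I : ℂ)).neg.cexp)).congr_deriv ?_
        simp only [Pi.neg_apply]
        field_simp
        ring
      have ht : Filter.Tendsto (fun v : ℝ => -((v : ℂ) / (c + t * I) + ((c + t * I : ℂ) ^ 2)⁻¹) *
            cexp (-((c + t * I) * v))) Filter.atTop (nhds 0) := by
        have t1 := tendsto_rpow_mul_exp_neg_mul_atTop_nhds_zero 1 c hc
        have t0 := tendsto_rpow_mul_exp_neg_mul_atTop_nhds_zero 0 c hc
        simp only [Real.rpow_one, Real.rpow_zero] at t1 t0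
        have t2 := (t1.mul_const ‖(c + t * I : ℂ)‖⁻¹).add
          (t0.mul_const ‖((c + t * I : ℂ) ^ 2)⁻¹‖)
        rw [zero_mul, zero_mul, zero_add] at t2
        refine squeeze_zero_norm' ?_ t2
        filter_upwards [Filter.eventually_ge_atTop 0] with v hv
        rw [norm_mul, norm_neg]
        have e : ‖cexp (-((c + t * I) * v))‖ = Real.exp (-c * v) := by
          rw [Complex.norm_exp]; simp
        rw [e]
        have := norm_add_le ((v : ℂ) / (c + t * I)) (((c + t * I : ℂ) ^ 2)⁻¹)
        rw [norm_div, Complex.norm_real, Real.norm_of_nonneg hv] at this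
        calc _ ≤ (v / ‖(c + t * I : ℂ)‖ + ‖((c + t * I : ℂ) ^ 2)⁻¹‖) * Real.exp (-c * v) := by
              gcongr
          _ = _ := by ring
      have hint : IntegrableOn (fun v : ℝ => (v : ℂ) * cexp (-((c + t * I) * v)))
          (Set.Ioi 0) := by
        refine Integrable.mono' hreal (Continuous.aestronglyMeasurable (by fun_prop)) ?_
        filter_upwards [ae_restrict_mem measurableSet_Ioi] with v hv
        rw [norm_mul, Complex.norm_real, Real.norm_of_nonneg (Set.mem_Ioi.1 hv).le,
          Complex.norm_exp]
        simp
      rw [integral_Ioi_of_hasDerivAt_of_tendsto' hd hint ht]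
      simp
    rw [← h1, ← integral_indicator measurableSet_Ioi]
    refine integral_congr_ae (Filter.Eventually.of_forall fun v => ?_)
    simp only [hind]
    by_cases hv : v ∈ Set.Ioi (0 : ℝ)
    · rw [Set.indicator_of_mem hv, Set.indicator_of_mem hv]
      push_cast
      rw [mul_left_comm, ← Complex.exp_add]
      congr 2
      ring
    · rw [Set.indicator_of_notMem hv, Set.indicator_of_notMem hv, mul_zero]
  have hinv := fourier_inversion_exp hgc hgi (by rw [hG]; exact integrable_inv_add_mul_I_sq hc) v
  have hG' := fun t => congrFun hG t
  have hI : ∫ t : ℝ, (∫ w : ℝ, cexp (-(t * w : ℝ) * I) * g w) * cexp ((t * v : ℝ) * I)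
      = ∫ t : ℝ, ((c + t * I : ℂ) ^ 2)⁻¹ * cexp ((t * v : ℝ) * I) :=
    integral_congr_ae (Filter.Eventually.of_forall fun t => congrArg (· * _) (hG' t))
  rw [hI] at hinv
  have hev : ((max v 0 : ℝ) : ℂ) = g v * cexp (c * v) := by
    simp only [hg]
    push_cast
    rw [mul_assoc, ← Complex.exp_add]
    simp
  rw [hev, hinv, mul_assoc, ← integral_mul_const]
  congr 1
  refine integral_congr_ae (Filter.Eventually.of_forall fun t => ?_)
  simp only
  rw [mul_assoc, ← Complex.exp_add]
  congr 2
  push_cast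
  ring

/-- A cutoff which is `1` for `v ≤ ℓ`, `0` for `v ≥ ℓ + h` and linear in between. -/
def ramp (ℓ h v : ℝ) : ℝ := (max (ℓ + h - v) 0 - max (ℓ - v) 0) / h

/-- The kernel representing `ramp` as a superposition of exponentials. -/
def rampKernel (ℓ h c t : ℝ) : ℂ :=
  (1 / (2 * Real.pi * h) : ℝ) * (((c + t * I : ℂ) ^ 2)⁻¹ *
    (cexp ((c + t * I) * (ℓ + h : ℝ)) - cexp ((c + t * I) * ℓ)))

lemma ramp_of_le {ℓ h v : ℝ} (hh : 0 < h) (hv : v ≤ ℓ) : ramp ℓ h v = 1 := by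
  rw [ramp, max_eq_left (by linarith), max_eq_left (by linarith)]
  field_simp; ring

lemma ramp_of_ge {ℓ h v : ℝ} (hh : 0 < h) (hv : ℓ + h ≤ v) : ramp ℓ h v = 0 := by
  rw [ramp, max_eq_right (by linarith), max_eq_right (by linarith)]; simp

lemma ramp_nonneg {ℓ h : ℝ} (hh : 0 < h) (v : ℝ) : 0 ≤ ramp ℓ h v := by
  refine div_nonneg (sub_nonneg.2 (max_le_max (by linarith) le_rfl)) hh.le

lemma ramp_le_one {ℓ h : ℝ} (hh : 0 < h) (v : ℝ) : ramp ℓ h v ≤ 1 := by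
  rw [ramp, div_le_one hh]
  rcases le_total (ℓ - v) 0 with h1 | h1 <;> rcases le_total (ℓ + h - v) 0 with h2 | h2 <;>
    simp only [max_eq_left, max_eq_right, h1, h2] <;> linarith

lemma continuous_rampKernel (ℓ h : ℝ) {c : ℝ} (hc : 0 < c) : Continuous (rampKernel ℓ h c) := by
  unfold rampKernel
  exact continuous_const.mul ((continuous_inv_add_mul_I_sq hc).mul (by fun_prop))

lemma norm_cexp_add_mul_I_mul (c t v : ℝ) : ‖cexp ((c + t * I) * v)‖ = Real.exp (c * v) := by
  rw [Complex.norm_exp]; simp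

lemma norm_rampKernel_le {ℓ h c : ℝ} (hh : 0 < h) (hc : 0 < c) (t : ℝ) :
    ‖rampKernel ℓ h c t‖ ≤ Real.exp (c * (ℓ + h)) / (h * (c ^ 2 + t ^ 2)) := by
  have hpi := Real.pi_gt_three
  have h0 : 0 < c ^ 2 + t ^ 2 := by positivity
  rw [rampKernel, norm_mul, norm_mul, norm_inv, norm_add_mul_I_sq, Complex.norm_real,
    Real.norm_of_nonneg (by positivity)]
  have h1 : ‖cexp ((c + t * I) * (ℓ + h : ℝ)) - cexp ((c + t * I) * ℓ)‖
      ≤ 2 * Real.exp (c * (ℓ + h)) := by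
    refine (norm_sub_le _ _).trans ?_
    rw [norm_cexp_add_mul_I_mul, norm_cexp_add_mul_I_mul]
    have : Real.exp (c * ℓ) ≤ Real.exp (c * (ℓ + h)) := Real.exp_le_exp.2 (by nlinarith)
    linarith
  calc 1 / (2 * Real.pi * h) * ((c ^ 2 + t ^ 2)⁻¹ * _)
      ≤ 1 / (2 * 1 * h) * ((c ^ 2 + t ^ 2)⁻¹ * (2 * Real.exp (c * (ℓ + h)))) := by
        gcongr; linarith
    _ = _ := by field_simp

lemma norm_exp_sub_one_le_of_re_nonneg {z : ℂ} (hz : 0 ≤ z.re) :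
    ‖cexp z - 1‖ ≤ 2 * Real.exp z.re * ‖z‖ := by
  have h1 : 1 ≤ Real.exp z.re := Real.one_le_exp hz
  rcases le_total ‖z‖ 1 with h | h
  · refine (Complex.norm_exp_sub_one_le h).trans ?_
    nlinarith [norm_nonneg z]
  · refine (norm_sub_le _ _).trans ?_
    rw [Complex.norm_exp, norm_one]
    nlinarith

lemma norm_rampKernel_le' {ℓ h c : ℝ} (hh : 0 < h) (hc : 0 < c) (t : ℝ) :
    ‖rampKernel ℓ h c t‖ ≤ Real.exp (c * (ℓ + h)) / c := by
  have hpi := Real.pi_gt_three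
  have hs := add_mul_I_ne_zero hc t
  have hn : 0 < ‖(c + t * I : ℂ)‖ := norm_pos_iff.2 hs
  have hcn : c ≤ ‖(c + t * I : ℂ)‖ := by
    have := Complex.abs_re_le_norm (c + t * I : ℂ)
    simp at this
    exact (le_abs_self c).trans this
  rw [rampKernel, norm_mul, norm_mul, norm_inv, Complex.norm_real, norm_pow,
    Real.norm_of_nonneg (by positivity)]
  have h1 : ‖cexp ((c + t * I) * (ℓ + h : ℝ)) - cexp ((c + t * I) * ℓ)‖
      ≤ 2 * Real.exp (c * (ℓ + h)) * (‖(c + t * I : ℂ)‖ * h) := by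
    have : cexp ((c + t * I) * (ℓ + h : ℝ)) - cexp ((c + t * I) * ℓ)
        = cexp ((c + t * I) * ℓ) * (cexp ((c + t * I) * h) - 1) := by
      rw [mul_sub, ← Complex.exp_add, mul_one]
      push_cast; ring_nf
    rw [this, norm_mul, norm_cexp_add_mul_I_mul]
    have h2 := norm_exp_sub_one_le_of_re_nonneg (z := (c + t * I) * h) (by simp; positivity)
    have h3 : ((c + t * I : ℂ) * h).re = c * h := by simp
    rw [h3, norm_mul, Complex.norm_real, Real.norm_of_nonneg hh.le] at h2
    calc Real.exp (c * ℓ) * _ ≤ Real.exp (c * ℓ) * (2 * Real.exp (c * h) *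
          (‖(c + t * I : ℂ)‖ * h)) := by gcongr
      _ = _ := by rw [mul_add, Real.exp_add]; ring
  calc 1 / (2 * Real.pi * h) * ((‖(c + t * I : ℂ)‖ ^ 2)⁻¹ * _)
      ≤ 1 / (2 * 1 * h) * ((‖(c + t * I : ℂ)‖ ^ 2)⁻¹ *
        (2 * Real.exp (c * (ℓ + h)) * (‖(c + t * I : ℂ)‖ * h))) := by
        gcongr; linarith
    _ = Real.exp (c * (ℓ + h)) / ‖(c + t * I : ℂ)‖ := by field_simp
    _ ≤ _ := by gcongr

lemma integrable_rampKernel (ℓ : ℝ) {h c : ℝ} (hh : 0 < h) (hc : 0 < c) :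
    Integrable (rampKernel ℓ h c) := by
  refine ((integrable_inv_sq_add_sq hc).const_mul (Real.exp (c * (ℓ + h)) / h)).mono'
    (continuous_rampKernel ℓ h hc).aestronglyMeasurable
    (Filter.Eventually.of_forall fun t => (norm_rampKernel_le hh hc t).trans (le_of_eq ?_))
  rw [div_mul_eq_div_div, div_eq_mul_inv _ (c ^ 2 + t ^ 2)]

lemma ramp_eq_integral (ℓ : ℝ) {h c : ℝ} (hh : 0 < h) (hc : 0 < c) (v : ℝ) :
    (ramp ℓ h v : ℂ) = ∫ t : ℝ, rampKernel ℓ h c t * cexp (-((c + t * I) * v)) := by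
  have hi : ∀ w : ℝ, Integrable
      (fun t : ℝ => ((c + t * I : ℂ) ^ 2)⁻¹ * cexp ((c + t * I) * w)) := by
    intro w
    refine (integrable_inv_add_mul_I_sq hc).mul_bdd (c := Real.exp (c * w)) ?_ ?_
    · exact (Continuous.aestronglyMeasurable (by fun_prop))
    · exact Filter.Eventually.of_forall fun t => (norm_cexp_add_mul_I_mul c t w).le
  have e1 : (ramp ℓ h v : ℂ) = (1 / h : ℝ) *
      (((max (ℓ + h - v) 0 : ℝ) : ℂ) - ((max (ℓ - v) 0 : ℝ) : ℂ)) := by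
    rw [ramp]; push_cast; ring
  rw [e1, integral_exp_div_sq hc, integral_exp_div_sq hc, ← mul_sub,
    ← integral_sub (hi _) (hi _), ← mul_assoc, ← integral_const_mul]
  refine integral_congr_ae (Filter.Eventually.of_forall fun t => ?_)
  simp only [rampKernel]
  have hpi := Real.pi_ne_zero
  have e2 : cexp ((c + t * I) * (ℓ + h - v : ℝ))
      = cexp ((c + t * I) * (ℓ + h : ℝ)) * cexp (-((c + t * I) * v)) := by
    rw [← Complex.exp_add]; congr 1; push_cast; ring
  have e3 : cexp ((c + t * I) * (ℓ - v : ℝ))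
      = cexp ((c + t * I) * ℓ) * cexp (-((c + t * I) * v)) := by
    rw [← Complex.exp_add]; congr 1; push_cast; ring
  have e4 : ((1 / h : ℝ) : ℂ) * (1 / (2 * Real.pi) : ℝ) = (1 / (2 * Real.pi * h) : ℝ) := by
    rw [← Complex.ofReal_mul]; congr 1; field_simp
  rw [e2, e3, ← e4]
  ring

end SmoothPerron

section CuspKernel

open Finset ArithmeticFunction

/-- The Fourier transform of `v ↦ max (1 - |v|) 0 ^ 2`, a positive kernel comparable to
`1 / (1 + ξ ^ 2)`. -/
def cuspKernel (ξ : ℝ) : ℝ := if ξ = 0 then 2 / 3 else 4 * (1 - Real.sinc ξ) / ξ ^ 2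

lemma measurable_cuspKernel : Measurable cuspKernel :=
  Measurable.ite (measurableSet_singleton 0) measurable_const
    (((Real.measurable_sinc.const_sub 1).const_mul 4).div (measurable_id.pow_const 2))

lemma sin_le_sub_cube {x : ℝ} (h0 : 0 ≤ x) (h1 : x ≤ 1) : Real.sin x ≤ x - x ^ 3 / 10 := by
  have h := Real.sin_bound (x := x) (by rw [abs_of_nonneg h0]; exact h1)
  rw [abs_of_nonneg h0] at h
  have h2 := (abs_le.1 h).2
  have h3 : x ^ 4 ≤ x ^ 3 := by
    calc x ^ 4 = x ^ 3 * x := by ring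
      _ ≤ x ^ 3 * 1 := by gcongr
      _ = _ := mul_one _
  nlinarith [pow_nonneg h0 3]

lemma sinc_le_one_sub_sq {x : ℝ} (h1 : |x| ≤ 1) : Real.sinc x ≤ 1 - x ^ 2 / 10 := by
  by_cases h0 : x = 0
  · subst h0; simp
  have hp := abs_pos.2 h0
  have h2 : Real.sinc x = Real.sinc |x| := by
    rcases abs_choice x with h | h <;> rw [h]
    rw [Real.sinc_neg]
  rw [h2, Real.sinc_of_ne_zero hp.ne', div_le_iff₀ hp, ← sq_abs x]
  refine (sin_le_sub_cube hp.le h1).trans (le_of_eq ?_)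
  ring

lemma sinc_le_of_one_le_abs {x : ℝ} (h1 : 1 ≤ |x|) : Real.sinc x ≤ 39 / 40 := by
  have hp : 0 < |x| := by linarith
  have h2 : Real.sinc x = Real.sinc |x| := by
    rcases abs_choice x with h | h <;> rw [h]
    rw [Real.sinc_neg]
  rw [h2, Real.sinc_of_ne_zero hp.ne', div_le_iff₀ hp]
  rcases le_total |x| 2 with h | h
  · have h3 := sin_le_sub_cube (x := |x| / 2) (by positivity) (by linarith)
    have h4 : Real.sin |x| = 2 * Real.sin (|x| / 2) * Real.cos (|x| / 2) := by
      rw [← Real.sin_two_mul]; congr 1; ring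
    have h5 : 0 ≤ Real.sin (|x| / 2) :=
      Real.sin_nonneg_of_nonneg_of_le_pi (by positivity) (by linarith [Real.pi_gt_three])
    have h6 : Real.sin |x| ≤ 2 * Real.sin (|x| / 2) * 1 := by
      rw [h4]; exact mul_le_mul_of_nonneg_left (Real.cos_le_one _) (by positivity)
    nlinarith [mul_nonneg hp.le (mul_nonneg (by linarith : 0 ≤ |x| - 1) (by linarith : 0 ≤ |x| + 1))]
  · linarith [Real.sin_le_one |x|]

lemma inv_one_add_sq_le_cuspKernel (ξ : ℝ) : (1 ^ 2 + ξ ^ 2)⁻¹ ≤ 10 * cuspKernel ξ := by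
  have h0 : (0 : ℝ) < 1 ^ 2 + ξ ^ 2 := by positivity
  rw [inv_le_iff_one_le_mul₀ h0, cuspKernel]
  split_ifs with h
  · subst h; norm_num
  have h2 : 0 < ξ ^ 2 := by positivity
  rw [mul_div_assoc', div_mul_eq_mul_div, one_le_div h2]
  rcases le_total |ξ| 1 with h1 | h1
  · nlinarith [sinc_le_one_sub_sq h1]
  · nlinarith [sinc_le_of_one_le_abs h1]

lemma cuspKernel_nonneg (ξ : ℝ) : 0 ≤ cuspKernel ξ := by
  have := inv_one_add_sq_le_cuspKernel ξ
  have : 0 < (1 ^ 2 + ξ ^ 2)⁻¹ := by positivity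
  linarith

lemma cuspKernel_le (ξ : ℝ) : cuspKernel ξ ≤ 16 * (1 ^ 2 + ξ ^ 2)⁻¹ := by
  have h0 : (0 : ℝ) < 1 ^ 2 + ξ ^ 2 := by positivity
  rw [← div_eq_mul_inv, le_div_iff₀ h0, cuspKernel]
  split_ifs with h
  · subst h; norm_num
  have h2 : 0 < ξ ^ 2 := by positivity
  rw [div_mul_eq_mul_div, div_le_iff₀ h2]
  by_cases h1 : |ξ| ≤ 1
  · have h3 : 1 - ξ ^ 2 / 6 ≤ Real.sinc ξ := by
      have hp := abs_pos.2 h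
      have e : Real.sinc ξ = Real.sinc |ξ| := by
        rcases abs_choice ξ with h | h <;> rw [h]
        rw [Real.sinc_neg]
      rw [e, Real.sinc_of_ne_zero hp.ne', le_div_iff₀ hp, ← sq_abs ξ]
      refine (le_of_eq ?_).trans (Real.sin_gt_sub_cube hp).le
      ring
    have h4 : ξ ^ 2 ≤ 1 := by rw [← sq_abs]; exact pow_le_one₀ (abs_nonneg _) h1
    nlinarith
  · push Not at h1
    have h4 : 1 ≤ ξ ^ 2 := by rw [← sq_abs]; exact one_le_pow₀ h1.le
    nlinarith [Real.neg_one_le_sinc ξ]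

lemma integrable_cuspKernel : Integrable cuspKernel := by
  refine ((integrable_inv_sq_add_sq one_pos).const_mul 16).mono'
    measurable_cuspKernel.aestronglyMeasurable (Filter.Eventually.of_forall fun ξ => ?_)
  rw [Real.norm_of_nonneg (cuspKernel_nonneg ξ)]
  exact cuspKernel_le ξ

/-- The square of the triangle function. -/
def cusp (v : ℝ) : ℝ := max (1 - |v|) 0 ^ 2

lemma continuous_cusp : Continuous cusp := by unfold cusp; fun_prop

lemma cusp_nonneg (v : ℝ) : 0 ≤ cusp v := sq_nonneg _

lemma cusp_le_one (v : ℝ) : cusp v ≤ 1 :=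
  pow_le_one₀ (le_max_right _ _) (max_le (by linarith [abs_nonneg v]) zero_le_one)

lemma cusp_eq_zero {v : ℝ} (hv : 1 ≤ |v|) : cusp v = 0 := by
  rw [cusp, max_eq_right (by linarith), zero_pow two_ne_zero]

lemma integrable_cusp : Integrable cusp := by
  refine continuous_cusp.integrable_of_hasCompactSupport
    (HasCompactSupport.intro (isCompact_Icc (a := -1) (b := 1)) fun v hv => cusp_eq_zero ?_)
  by_contra h
  push Not at h
  exact hv ⟨(abs_le.1 h.le).1, (abs_le.1 h.le).2⟩

lemma integral_cusp_mul_cos {ξ : ℝ} (hξ : ξ ≠ 0) :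
    ∫ v : ℝ, cusp v * Real.cos (ξ * v) = cuspKernel ξ := by
  have h1 : (fun v : ℝ => cusp v * Real.cos (ξ * v))
      = fun v => (fun u : ℝ => max (1 - u) 0 ^ 2 * Real.cos (ξ * u)) |v| := by
    funext v
    simp only [cusp]
    congr 1
    rcases abs_choice v with h | h <;> rw [h]
    rw [mul_neg, Real.cos_neg]
  rw [h1, integral_comp_abs (f := fun u : ℝ => max (1 - u) 0 ^ 2 * Real.cos (ξ * u)), ← Set.Ioc_union_Ioi_eq_Ioi zero_le_one,
    setIntegral_union (t := Set.Ioi 1)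
      (Set.disjoint_left.2 fun x hx hx' => (not_lt.2 hx.2) hx') measurableSet_Ioi]
  · have h2 : ∫ u in Set.Ioi (1 : ℝ), max (1 - u) 0 ^ 2 * Real.cos (ξ * u) = 0 := by
      refine setIntegral_eq_zero_of_forall_eq_zero fun u hu => ?_
      rw [max_eq_right (by linarith [Set.mem_Ioi.1 hu]), zero_pow two_ne_zero, zero_mul]
    have h3 : ∫ u in Set.Ioc (0 : ℝ) 1, max (1 - u) 0 ^ 2 * Real.cos (ξ * u)
        = ∫ u in (0 : ℝ)..1, (1 - u) ^ 2 * Real.cos (ξ * u) := by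
      rw [intervalIntegral.integral_of_le zero_le_one]
      refine setIntegral_congr_fun measurableSet_Ioc fun u hu => ?_
      rw [max_eq_left (by linarith [hu.2])]
    rw [h2, h3, intervalIntegral.integral_eq_sub_of_hasDerivAt
      (f := fun u => (1 - u) ^ 2 * (Real.sin (ξ * u) / ξ) -
        2 * (1 - u) * (Real.cos (ξ * u) / ξ ^ 2) - 2 * (Real.sin (ξ * u) / ξ ^ 3)),
      cuspKernel, if_neg hξ, Real.sinc_of_ne_zero hξ]
    · simp; field_simp; ring
    · intro u _
      have hl : HasDerivAt (fun u : ℝ => ξ * u) ξ u := by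
        simpa using (hasDerivAt_id u).const_mul ξ
      have h1u := (hasDerivAt_id u).const_sub 1
      refine ((((h1u.pow 2).mul (hl.sin.div_const ξ)).sub
        ((h1u.const_mul 2).mul (hl.cos.div_const (ξ ^ 2)))).sub
        ((hl.sin.div_const (ξ ^ 3)).const_mul 2)).congr_deriv ?_
      simp only [id, Pi.pow_apply]
      field_simp
      ring
    · exact Continuous.intervalIntegrable (by fun_prop) _ _
  · exact (Continuous.integrableOn_Icc (by fun_prop)).mono_set Set.Ioc_subset_Icc_self
  · refine (integrableOn_zero).congr_fun (fun u hu => ?_) measurableSet_Ioi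
    simp only
    rw [max_eq_right (by linarith [Set.mem_Ioi.1 hu]), zero_pow two_ne_zero, zero_mul]

lemma integral_cexp_mul_cusp {ξ : ℝ} (hξ : ξ ≠ 0) :
    ∫ v : ℝ, cexp (-(ξ * v : ℝ) * I) * (cusp v : ℂ) = (cuspKernel ξ : ℂ) := by
  have hb : ∀ s : ℝ, Integrable (fun v : ℝ => cexp ((s * v : ℝ) * I) * (cusp v : ℂ)) := by
    intro s
    refine integrable_cusp.ofReal.bdd_mul (c := 1)
      (Continuous.aestronglyMeasurable (by fun_prop)) (Filter.Eventually.of_forall fun v => ?_)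
    rw [Complex.norm_exp_ofReal_mul_I]
  have h1 : ∫ v : ℝ, cexp (-(ξ * v : ℝ) * I) * (cusp v : ℂ)
      = ∫ v : ℝ, cexp ((ξ * v : ℝ) * I) * (cusp v : ℂ) := by
    rw [← integral_neg_eq_self]
    refine integral_congr_ae (Filter.Eventually.of_forall fun v => ?_)
    simp only [cusp, abs_neg]
    congr 3
    push_cast; ring
  have h2 : ∫ v : ℝ, ((cusp v * Real.cos (ξ * v) : ℝ) : ℂ) = (cuspKernel ξ : ℂ) := by
    rw [← integral_cusp_mul_cos hξ]
    exact integral_ofReal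
  have h3 : (2 : ℂ) * ∫ v : ℝ, cexp (-(ξ * v : ℝ) * I) * (cusp v : ℂ)
      = 2 * ∫ v : ℝ, ((cusp v * Real.cos (ξ * v) : ℝ) : ℂ) := by
    rw [two_mul]
    nth_rw 2 [h1]
    have hb' := hb (-ξ)
    have e : (fun v : ℝ => cexp ((-ξ * v : ℝ) * I) * (cusp v : ℂ))
        = fun v : ℝ => cexp (-(ξ * v : ℝ) * I) * (cusp v : ℂ) := by
      funext v; push_cast; ring_nf
    rw [e] at hb'
    rw [← integral_add hb' (hb ξ), ← integral_const_mul]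
    refine integral_congr_ae (Filter.Eventually.of_forall fun v => ?_)
    simp only
    push_cast
    rw [Complex.cos]
    ring_nf
  rw [← h2]
  exact mul_left_cancel₀ two_ne_zero h3

lemma integral_cuspKernel_mul_cexp (v : ℝ) :
    ∫ t : ℝ, (cuspKernel t : ℂ) * cexp ((t * v : ℝ) * I) = ((2 * Real.pi * cusp v : ℝ) : ℂ) := by
  have hae : (fun t : ℝ => ∫ v : ℝ, cexp (-(t * v : ℝ) * I) * (cusp v : ℂ))
      =ᵐ[volume] fun t => (cuspKernel t : ℂ) := by
    have : ∀ᵐ t : ℝ, t ≠ 0 := by simp [ae_iff, measure_singleton]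
    filter_upwards [this] with t ht using integral_cexp_mul_cusp ht
  have hinv := fourier_inversion_exp (g := fun v => (cusp v : ℂ))
    (by have := continuous_cusp; fun_prop) integrable_cusp.ofReal
    (integrable_cuspKernel.ofReal.congr hae.symm) v
  have h2 : ∫ t : ℝ, (∫ w : ℝ, cexp (-(t * w : ℝ) * I) * (cusp w : ℂ)) *
      cexp ((t * v : ℝ) * I) = ∫ t : ℝ, (cuspKernel t : ℂ) * cexp ((t * v : ℝ) * I) := by
    refine integral_congr_ae ?_
    filter_upwards [hae] with t ht
    rw [ht]
  rw [h2] at hinv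
  rw [Complex.ofReal_mul, hinv, ← mul_assoc, ← Complex.ofReal_mul]
  have hpi := Real.pi_ne_zero
  rw [show 2 * Real.pi * (1 / (2 * Real.pi)) = 1 by field_simp]
  simp

lemma integral_cuspKernel_scaled_mul_cexp {T : ℝ} (hT : 0 < T) (v : ℝ) :
    ∫ t : ℝ, (cuspKernel (t / T) : ℂ) * cexp ((t * v : ℝ) * I)
      = ((T * (2 * Real.pi * cusp (T * v)) : ℝ) : ℂ) := by
  have h2 := Measure.integral_comp_div
    (fun s : ℝ => (cuspKernel s : ℂ) * cexp ((s * (T * v) : ℝ) * I)) T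
  rw [integral_cuspKernel_mul_cexp, abs_of_pos hT, Complex.real_smul] at h2
  rw [Complex.ofReal_mul, ← h2]
  refine integral_congr_ae (Filter.Eventually.of_forall fun t => ?_)
  simp only
  rw [← mul_assoc, div_mul_cancel₀ t hT.ne']

lemma norm_integral_cuspKernel_scaled_le {T : ℝ} (hT : 0 < T) (v : ℝ) :
    ‖∫ t : ℝ, (cuspKernel (t / T) : ℂ) * cexp ((t * v : ℝ) * I)‖
      ≤ if |v| ≤ 1 / T then 2 * Real.pi * T else 0 := by
  have hpi := Real.pi_pos
  rw [integral_cuspKernel_scaled_mul_cexp hT, Complex.norm_real, Real.norm_of_nonneg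
      (by have := cusp_nonneg (T * v); positivity)]
  split_ifs with h
  · nlinarith [mul_le_mul_of_nonneg_left (cusp_le_one (T * v))
      (by positivity : 0 ≤ T * (2 * Real.pi))]
  · push Not at h
    rw [cusp_eq_zero]
    · simp
    · rw [abs_mul, abs_of_pos hT]
      rw [div_lt_iff₀ hT] at h
      linarith

lemma integrable_cuspKernel_scaled {T : ℝ} (hT : 0 < T) :
    Integrable (fun t : ℝ => cuspKernel (t / T)) :=
  integrable_cuspKernel.comp_div hT.ne'

lemma sq_div_le_cuspKernel_scaled {T : ℝ} (hT : 0 < T) (t : ℝ) :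
    T ^ 2 / (t ^ 2 + T ^ 2) ≤ 10 * cuspKernel (t / T) := by
  refine (le_of_eq ?_).trans (inv_one_add_sq_le_cuspKernel (t / T))
  field_simp
  ring

end CuspKernel

section CharacterMeanValue

open Finset ArithmeticFunction

lemma conj_char_eq {q : ℕ} (χ : DirichletCharacter ℂ q) {a : ZMod q} (ha : IsUnit a) :
    (starRingEnd ℂ) (χ a) = χ a⁻¹ := by
  have h1 : χ a⁻¹ * χ a = 1 := by
    rw [← map_mul, ZMod.inv_mul_of_unit a ha, map_one]
  have h2 : (starRingEnd ℂ) (χ a) * χ a = 1 := by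
    rw [mul_comm, Complex.mul_conj, Complex.normSq_eq_norm_sq]
    obtain ⟨u, rfl⟩ := ha
    rw [χ.unit_norm_eq_one u]
    simp
  have h3 : χ a ≠ 0 := right_ne_zero_of_mul (h2.trans_ne one_ne_zero)
  exact mul_right_cancel₀ h3 (h2.trans h1.symm)

lemma sum_conj_char_mul_char {q : ℕ} [NeZero q] {a : ZMod q} (ha : IsUnit a) (b : ZMod q) :
    ∑ χ : DirichletCharacter ℂ q, (starRingEnd ℂ) (χ a) * χ b
      = if a = b then (q.totient : ℂ) else 0 := by
  rw [← DirichletCharacter.sum_char_inv_mul_char_eq ℂ ha b]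
  exact sum_congr rfl fun χ _ => by rw [conj_char_eq χ ha]

lemma norm_sum_conj_char_mul_char_le {q : ℕ} [NeZero q] (n m : ℕ) :
    ‖∑ χ : DirichletCharacter ℂ q, (starRingEnd ℂ) (χ (n : ZMod q)) * χ (m : ZMod q)‖
      ≤ if m ≡ n [MOD q] then (q.totient : ℝ) else 0 := by
  by_cases ha : IsUnit (n : ZMod q)
  · rw [sum_conj_char_mul_char ha]
    by_cases h : (n : ZMod q) = m
    · rw [if_pos h, if_pos ((ZMod.natCast_eq_natCast_iff _ _ _).1 h.symm)]
      simp
    · rw [if_neg h, norm_zero]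
      split_ifs <;> positivity
  · rw [sum_eq_zero fun χ _ => by rw [χ.map_nonunit ha, _root_.map_zero, zero_mul], norm_zero]
    split_ifs <;> positivity

/-- The Dirichlet polynomial `∑_{n ∈ S} a(n) conj(χ(n)) n^{-it}`. -/
def dirPoly {q : ℕ} (S : Finset ℕ) (a : ℕ → ℂ) (χ : DirichletCharacter ℂ q) (t : ℝ) : ℂ :=
  ∑ n ∈ S, a n * (starRingEnd ℂ) (χ (n : ZMod q)) * cexp (-((t * Real.log n : ℝ) : ℂ) * I)

lemma continuous_dirPoly {q : ℕ} (S : Finset ℕ) (a : ℕ → ℂ) (χ : DirichletCharacter ℂ q) :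
    Continuous (dirPoly S a χ) := by
  unfold dirPoly; fun_prop

lemma norm_dirPoly_le {q : ℕ} (S : Finset ℕ) (a : ℕ → ℂ) (χ : DirichletCharacter ℂ q) (t : ℝ) :
    ‖dirPoly S a χ t‖ ≤ ∑ n ∈ S, ‖a n‖ := by
  refine (norm_sum_le _ _).trans (sum_le_sum fun n _ => ?_)
  rw [norm_mul, norm_mul, ← Complex.ofReal_neg, Complex.norm_exp_ofReal_mul_I, mul_one,
    RCLike.norm_conj]
  exact mul_le_of_le_one_right (norm_nonneg _) (χ.norm_le_one _)

lemma ofReal_norm_sq_dirPoly {q : ℕ} (S : Finset ℕ) (a : ℕ → ℂ) (χ : DirichletCharacter ℂ q)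
    (t : ℝ) :
    ((‖dirPoly S a χ t‖ ^ 2 : ℝ) : ℂ) = ∑ n ∈ S, ∑ m ∈ S, a n * (starRingEnd ℂ) (a m) *
      ((starRingEnd ℂ) (χ (n : ZMod q)) * χ (m : ZMod q)) *
        cexp ((t * (Real.log m - Real.log n) : ℝ) * I) := by
  rw [← Complex.normSq_eq_norm_sq, ← Complex.mul_conj, dirPoly, map_sum, sum_mul_sum]
  refine sum_congr rfl fun n _ => sum_congr rfl fun m _ => ?_
  simp only [map_mul, Complex.conj_conj, ← Complex.exp_conj, map_neg, Complex.conj_ofReal,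
    Complex.conj_I]
  have : cexp ((t * (Real.log m - Real.log n) : ℝ) * I)
      = cexp (-((t * Real.log n : ℝ) : ℂ) * I) * cexp (-((t * Real.log m : ℝ) : ℂ) * -I) := by
    rw [← Complex.exp_add]; congr 1; push_cast; ring
  rw [this]
  ring

lemma integrable_mul_norm_sq_dirPoly {q : ℕ} {g : ℝ → ℝ} (hg : Integrable g) (S : Finset ℕ)
    (a : ℕ → ℂ) (χ : DirichletCharacter ℂ q) :
    Integrable (fun t => g t * ‖dirPoly S a χ t‖ ^ 2) := by
  refine hg.mul_bdd (c := (∑ n ∈ S, ‖a n‖) ^ 2)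
    ((continuous_dirPoly S a χ).norm.pow 2).aestronglyMeasurable
    (Filter.Eventually.of_forall fun t => ?_)
  rw [norm_pow, norm_norm]
  exact pow_le_pow_left₀ (norm_nonneg _) (norm_dirPoly_le S a χ t) 2

lemma sum_integral_cuspKernel_mul_norm_sq_dirPoly_le {q : ℕ} [NeZero q] {T : ℝ} (hT : 0 < T)
    (S : Finset ℕ) (a : ℕ → ℂ) :
    ∑ χ : DirichletCharacter ℂ q, ∫ t : ℝ, cuspKernel (t / T) * ‖dirPoly S a χ t‖ ^ 2
      ≤ 2 * Real.pi * T * q.totient * ∑ n ∈ S, ‖a n‖ *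
        ∑ m ∈ S.filter (fun m => m ≡ n [MOD q] ∧ |Real.log m - Real.log n| ≤ 1 / T), ‖a m‖ := by
  have hpi := Real.pi_pos
  set K : ℝ → ℂ := fun v => ∫ t : ℝ, (cuspKernel (t / T) : ℂ) * cexp ((t * v : ℝ) * I) with hK
  have hint : ∀ v : ℝ, Integrable
      (fun t : ℝ => (cuspKernel (t / T) : ℂ) * cexp ((t * v : ℝ) * I)) := fun v =>
    (integrable_cuspKernel_scaled hT).ofReal.mul_bdd (c := 1)
      (Continuous.aestronglyMeasurable (by fun_prop))
      (Filter.Eventually.of_forall fun t => by rw [Complex.norm_exp_ofReal_mul_I])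
  have h1 : ∀ χ : DirichletCharacter ℂ q,
      ((∫ t : ℝ, cuspKernel (t / T) * ‖dirPoly S a χ t‖ ^ 2 : ℝ) : ℂ)
        = ∑ n ∈ S, ∑ m ∈ S, a n * (starRingEnd ℂ) (a m) *
          ((starRingEnd ℂ) (χ (n : ZMod q)) * χ (m : ZMod q)) *
            K (Real.log m - Real.log n) := by
    intro χ
    have e : ((∫ t : ℝ, cuspKernel (t / T) * ‖dirPoly S a χ t‖ ^ 2 : ℝ) : ℂ)
        = ∫ t : ℝ, ((cuspKernel (t / T) * ‖dirPoly S a χ t‖ ^ 2 : ℝ) : ℂ) := integral_ofReal.symm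
    rw [e]
    have e2 : (fun t : ℝ => ((cuspKernel (t / T) * ‖dirPoly S a χ t‖ ^ 2 : ℝ) : ℂ))
        = fun t => ∑ n ∈ S, ∑ m ∈ S, (a n * (starRingEnd ℂ) (a m) *
          ((starRingEnd ℂ) (χ (n : ZMod q)) * χ (m : ZMod q))) *
            ((cuspKernel (t / T) : ℂ) * cexp ((t * (Real.log m - Real.log n) : ℝ) * I)) := by
      funext t
      rw [Complex.ofReal_mul, ofReal_norm_sq_dirPoly, mul_sum]
      refine sum_congr rfl fun n _ => ?_
      rw [mul_sum]
      exact sum_congr rfl fun m _ => by ring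
    rw [e2, integral_finsetSum _ fun n _ => integrable_finsetSum _ fun m _ =>
      (hint _).const_mul _]
    refine sum_congr rfl fun n _ => ?_
    rw [integral_finsetSum _ fun m _ => (hint _).const_mul _]
    exact sum_congr rfl fun m _ => integral_const_mul _ _
  have h2 : ((∑ χ : DirichletCharacter ℂ q,
      ∫ t : ℝ, cuspKernel (t / T) * ‖dirPoly S a χ t‖ ^ 2 : ℝ) : ℂ)
      = ∑ n ∈ S, ∑ m ∈ S, a n * (starRingEnd ℂ) (a m) * K (Real.log m - Real.log n) *
        ∑ χ : DirichletCharacter ℂ q, (starRingEnd ℂ) (χ (n : ZMod q)) * χ (m : ZMod q) := by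
    rw [Complex.ofReal_sum, sum_congr rfl fun χ _ => h1 χ, sum_comm]
    refine sum_congr rfl fun n _ => ?_
    rw [sum_comm]
    refine sum_congr rfl fun m _ => ?_
    rw [mul_sum]
    exact sum_congr rfl fun χ _ => by ring
  refine (le_abs_self _).trans ?_
  rw [← Real.norm_eq_abs, ← Complex.norm_real, h2, mul_sum]
  refine (norm_sum_le _ _).trans (sum_le_sum fun n _ => ?_)
  rw [mul_sum, mul_sum, sum_filter]
  refine (norm_sum_le _ _).trans (sum_le_sum fun m _ => ?_)
  rw [norm_mul, norm_mul, norm_mul, RCLike.norm_conj]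
  have k1 := norm_integral_cuspKernel_scaled_le hT (Real.log m - Real.log n)
  have k2 := norm_sum_conj_char_mul_char_le (q := q) n m
  calc ‖a n‖ * ‖a m‖ * ‖K (Real.log m - Real.log n)‖ * _
      ≤ ‖a n‖ * ‖a m‖ * (if |Real.log m - Real.log n| ≤ 1 / T then 2 * Real.pi * T else 0) *
        (if m ≡ n [MOD q] then (q.totient : ℝ) else 0) := by
        gcongr
    _ ≤ _ := by
        by_cases c1 : |Real.log m - Real.log n| ≤ 1 / T <;> by_cases c2 : m ≡ n [MOD q] <;>
          simp only [c1, c2, if_true, if_false, and_self, and_true, and_false, mul_zero, zero_mul,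
            le_refl]
        refine le_of_eq ?_
        ring

theorem exists_mean_value_dirPoly : ∃ C : ℝ, 0 < C ∧ ∀ (q : ℕ) [NeZero q], ∀ T : ℝ, 1 ≤ T →
    ∀ S : Finset ℕ, (∀ n ∈ S, 2 ^ 20 ≤ (n : ℝ) ∧ (q * T) ^ 5 ≤ (n : ℝ)) →
    ∀ (a : ℕ → ℂ) (w : ℕ → ℝ), (∀ n, 0 ≤ w n) → (∀ n ∈ S, ‖a n‖ ≤ w n * (vonMangoldt n / n)) →
    (∀ n ∈ S, ∀ m ∈ S, |Real.log m - Real.log n| ≤ 1 / T → w m ≤ 3 * w n) →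
    ∑ χ : DirichletCharacter ℂ q, ∫ t : ℝ, cuspKernel (t / T) * ‖dirPoly S a χ t‖ ^ 2
      ≤ C * ∑ n ∈ S, vonMangoldt n / n * w n ^ 2 := by
  obtain ⟨C, hC, hBT⟩ := exists_brun_titchmarsh_window
  refine ⟨2 * Real.pi * 3 * C, by have := Real.pi_pos; positivity, ?_⟩
  intro q _ T hT S hS a w hw ha hw3
  have hpi := Real.pi_pos
  have hT0 : 0 < T := by linarith
  have hq : 1 ≤ q := NeZero.one_le
  have hφ : 0 < (q.totient : ℝ) := by exact_mod_cast Nat.totient_pos.2 hq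
  have hΛ : ∀ n : ℕ, 0 ≤ vonMangoldt n / (n : ℝ) := fun n =>
    div_nonneg vonMangoldt_nonneg (Nat.cast_nonneg n)
  refine (sum_integral_cuspKernel_mul_norm_sq_dirPoly_le hT0 S a).trans ?_
  have hin : ∀ n ∈ S, ‖a n‖ *
      ∑ m ∈ S.filter (fun m => m ≡ n [MOD q] ∧ |Real.log m - Real.log n| ≤ 1 / T), ‖a m‖
      ≤ (w n * (vonMangoldt n / n)) * (3 * w n * (C / (T * q.totient))) := by
    intro n hn
    refine mul_le_mul (ha n hn) ?_ (sum_nonneg fun _ _ => norm_nonneg _)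
      (mul_nonneg (hw n) (hΛ n))
    have hb := hBT q hq T hT n (hS n hn).1 (hS n hn).2 n
      (S.filter (fun m => m ≡ n [MOD q] ∧ |Real.log m - Real.log n| ≤ 1 / T)) (by
        intro m hm
        rw [mem_filter] at hm
        refine ⟨hm.2.1, ?_, hm.2.2⟩
        have h1 := (hS m hm.1).1
        have : (1 : ℝ) ≤ m := by linarith [show (1 : ℝ) ≤ 2 ^ 20 by norm_num]
        exact_mod_cast this)
    refine le_trans ?_ (mul_le_mul_of_nonneg_left hb (by linarith [hw n]))
    rw [mul_sum]
    refine sum_le_sum fun m hm => ?_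
    rw [mem_filter] at hm
    exact (ha m hm.1).trans (mul_le_mul_of_nonneg_right (hw3 n hn m hm.1 hm.2.2) (hΛ m))
  calc _ ≤ 2 * Real.pi * T * q.totient * ∑ n ∈ S,
        (w n * (vonMangoldt n / n)) * (3 * w n * (C / (T * q.totient))) := by
        exact mul_le_mul_of_nonneg_left (sum_le_sum hin) (by positivity)
    _ = _ := by
        rw [mul_sum, mul_sum]
        refine sum_congr rfl fun n _ => ?_
        field_simp

end CharacterMeanValue

section OneSidedHarnack

open Metric MeromorphicOn

lemma exists_radius_ne_zero (f : ℂ → ℂ) (hf : AnalyticOnNhd ℂ f (closedBall 0 (1 / 2)))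
    (h0 : f 0 ≠ 0) : ∃ R : ℝ, 1 / 4 < R ∧ R < 1 / 2 ∧ ∀ z : ℂ, ‖z‖ = R → f z ≠ 0 := by
  have hfin : {z ∈ closedBall (0 : ℂ) (1 / 2) | f z = 0}.Finite := by
    by_contra hinf
    obtain ⟨z₀, hz₀, hacc⟩ := Set.Infinite.exists_accPt_of_subset_isCompact hinf
      (isCompact_closedBall (0 : ℂ) (1 / 2)) (Set.sep_subset _ _)
    have hfreq : ∃ᶠ z in nhdsWithin z₀ {z₀}ᶜ, f z = 0 :=
      (accPt_iff_frequently_nhdsNE.mp hacc).mono fun z hz => hz.2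
    have := hf.eqOn_zero_of_preconnected_of_frequently_eq_zero
      (convex_closedBall _ _).isPreconnected hz₀ hfreq (by simp : (0 : ℂ) ∈ closedBall 0 (1 / 2))
    exact h0 (by simpa using this)
  obtain ⟨R, hR, hRn⟩ := ((Set.Ioo_infinite (by norm_num : (1 / 4 : ℝ) < 1 / 2)).sdiff
    (hfin.image norm)).nonempty
  refine ⟨R, hR.1, hR.2, fun z hz hfz => hRn ⟨z, ⟨?_, hfz⟩, hz⟩⟩
  simpa [hz] using hR.2.le

lemma norm_canonicalFactor_le_of_re_nonpos {R x : ℝ} (hx : 0 < x) (hxR : x < R) {w : ℂ}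
    (hw : w ∈ ball (0 : ℂ) R) (hw0 : w ≠ 0) (hre : w.re ≤ 0) :
    ‖canonicalFactor R w x‖ ≤ ‖canonicalFactor R w 0‖ := by
  have hR : 0 < R := hx.trans hxR
  have hwR : ‖w‖ ^ 2 ≤ R ^ 2 := by
    have : ‖w‖ < R := by simpa using hw
    gcongr
  have hxw : (x : ℂ) - w ≠ 0 := by
    intro h
    have := congrArg Complex.re h
    simp at this
    linarith
  simp only [canonicalFactor_apply, norm_div, norm_mul, mul_zero, sub_zero, zero_sub, norm_neg,
    norm_real, norm_pow, Real.norm_of_nonneg hR.le]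
  rw [div_le_div_iff₀ (mul_pos hR (norm_pos_iff.mpr hxw)) (mul_pos hR (norm_pos_iff.mpr hw0))]
  have key : ‖(R : ℂ) ^ 2 - (starRingEnd ℂ) w * x‖ * ‖w‖ ≤ R ^ 2 * ‖(x : ℂ) - w‖ := by
    refine le_of_sq_le_sq ?_ (by positivity)
    rw [mul_pow, mul_pow, Complex.sq_norm, Complex.sq_norm, Complex.sq_norm]
    rw [Complex.sq_norm] at hwR
    have e1 : Complex.normSq ((R : ℂ) ^ 2 - (starRingEnd ℂ) w * x) =
        R ^ 4 - 2 * R ^ 2 * x * w.re + Complex.normSq w * x ^ 2 := by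
      simp only [Complex.normSq_apply, pow_two, sub_re, sub_im, mul_re, mul_im, ofReal_re,
        ofReal_im, conj_re, conj_im]
      ring
    have e2 : Complex.normSq ((x : ℂ) - w) = x ^ 2 - 2 * x * w.re + Complex.normSq w := by
      simp only [Complex.normSq_apply, sub_re, sub_im, ofReal_re, ofReal_im]
      ring
    rw [e1, e2]
    have hN := Complex.normSq_nonneg w
    have h1 : 0 ≤ x ^ 2 * ((R ^ 2 - Complex.normSq w) * (R ^ 2 + Complex.normSq w)) :=
      mul_nonneg (sq_nonneg x) (mul_nonneg (by linarith) (by positivity))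
    have h2 : 0 ≤ (-w.re) * x * (R ^ 2 * (R ^ 2 - Complex.normSq w)) :=
      mul_nonneg (mul_nonneg (by linarith) hx.le) (mul_nonneg (sq_nonneg R) (by linarith))
    nlinarith [h1, h2]
  nlinarith [key, hR]

theorem log_norm_le_of_zeros_re_nonpos (f : ℂ → ℂ) {B : ℝ}
    (hf : AnalyticOnNhd ℂ f (closedBall 0 (1 / 2))) (hB : ∀ z ∈ closedBall (0 : ℂ) (1 / 2), ‖f z‖ ≤ B)
    (h0 : f 0 ≠ 0) (hz : ∀ z ∈ closedBall (0 : ℂ) (1 / 2), f z = 0 → z.re ≤ 0)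
    {x : ℝ} (hx : 0 < x) (hx8 : x ≤ 1 / 8) :
    Real.log ‖f 0‖ ≤ Real.log ‖f x‖ + 16 * x * (Real.log B - Real.log ‖f 0‖) := by
  obtain ⟨R, hR4, hR2, hRz⟩ := exists_radius_ne_zero f hf h0
  have hR : 0 < R := by linarith
  have hsub : closedBall (0 : ℂ) R ⊆ closedBall 0 (1 / 2) := closedBall_subset_closedBall hR2.le
  have hfR : AnalyticOnNhd ℂ f (closedBall 0 R) := hf.mono hsub
  have hmem0 : (0 : ℂ) ∈ closedBall (0 : ℂ) R := by simp [hR.le]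
  have hxb : (x : ℂ) ∈ ball (0 : ℂ) R := by
    simp only [mem_ball, dist_zero_right, norm_real, Real.norm_of_nonneg hx.le]; linarith
  have hmemx : (x : ℂ) ∈ closedBall (0 : ℂ) R := ball_subset_closedBall hxb
  have hord : ∀ w ∈ closedBall (0 : ℂ) R, f w ≠ 0 → meromorphicOrderAt f w = 0 := fun w hw hfw =>
    ((hfR w hw).meromorphicNFAt.meromorphicOrderAt_eq_zero_iff).mpr hfw
  have hfx : f x ≠ 0 := fun h => by
    have := hz x (hsub hmemx) h
    simp at this; linarith
  have htop : ∀ u : closedBall (0 : ℂ) R, meromorphicOrderAt f u ≠ ⊤ := by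
    rw [← hfR.meromorphicOn.exists_meromorphicOrderAt_ne_top_iff_forall
      (Metric.isConnected_closedBall hR.le)]
    exact ⟨⟨0, hmem0⟩, by simp [hord 0 hmem0 h0]⟩
  obtain ⟨h, D⟩ := hfR.meromorphicOn.exists_ecanonicalDecomp htop
  have hsph : ∀ i, divisor f (sphere (0 : ℂ) R) i = 0 := by
    intro i
    by_cases hi : i ∈ sphere (0 : ℂ) R
    · rw [divisor_apply (hfR.meromorphicOn.mono_set sphere_subset_closedBall) hi,
        hord i (sphere_subset_closedBall hi) (hRz i (by simpa using hi))]
      rfl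
    · exact (divisor f (sphere (0 : ℂ) R)).apply_eq_zero_of_notMem hi
  have hlog : ∀ w ∈ closedBall (0 : ℂ) R, f w ≠ 0 → Real.log ‖h w‖ =
      (∑ᶠ i, (divisor f (ball 0 R) i) * Real.log ‖canonicalFactor R i w‖) + Real.log ‖f w‖ := by
    intro w hw hfw
    rw [D.log_norm_eq hw (hord w hw hfw) hR, (hfR w hw).meromorphicTrailingCoeffAt_of_ne_zero hfw]
    simp [hsph]
  have hdiv_nonneg : ∀ i, 0 ≤ (divisor f (ball 0 R) i : ℝ) := fun i =>
    mod_cast (hfR.mono ball_subset_closedBall).divisor_nonneg i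
  have hfinsupp : (divisor f (ball (0 : ℂ) R)).support.Finite :=
    hfR.meromorphicOn.divisor_ball_support_finite
  have hsupp : ∀ i, divisor f (ball (0 : ℂ) R) i ≠ 0 → i ∈ ball (0 : ℂ) R ∧ f i = 0 := by
    intro i hi
    have hi' : i ∈ ball (0 : ℂ) R := (divisor f (ball 0 R)).supportWithinDomain hi
    refine ⟨hi', ?_⟩
    by_contra hfi
    apply hi
    rw [divisor_apply (hfR.meromorphicOn.mono_set ball_subset_closedBall) hi',
      hord i (ball_subset_closedBall hi') hfi]
    rfl
  have hsum : ∀ w : ℂ, (∑ᶠ i, (divisor f (ball 0 R) i : ℝ) * Real.log ‖canonicalFactor R i w‖) =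
      ∑ i ∈ hfinsupp.toFinset, (divisor f (ball 0 R) i : ℝ) * Real.log ‖canonicalFactor R i w‖ := by
    intro w
    refine finsum_eq_sum_of_support_subset _ fun i hi => ?_
    simp only [Set.Finite.coe_toFinset, Function.mem_support] at hi ⊢
    intro h'
    simp [h'] at hi
  have hcmp : (∑ᶠ i, (divisor f (ball 0 R) i : ℝ) * Real.log ‖canonicalFactor R i x‖) ≤
      ∑ᶠ i, (divisor f (ball 0 R) i : ℝ) * Real.log ‖canonicalFactor R i 0‖ := by
    rw [hsum, hsum]
    refine Finset.sum_le_sum fun i hi => mul_le_mul_of_nonneg_left ?_ (hdiv_nonneg i)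
    obtain ⟨hib, hi0⟩ := hsupp i (by simpa using hi)
    have hine : i ≠ 0 := fun h' => h0 (h' ▸ hi0)
    have hre : i.re ≤ 0 := hz i (hsub (ball_subset_closedBall hib)) hi0
    refine Real.log_le_log (norm_pos_iff.mpr (canonicalFactor_ne_zero hib hmemx ?_)) ?_
    · rintro rfl
      exact hfx hi0
    · exact norm_canonicalFactor_le_of_re_nonpos hx (by simpa [abs_of_pos hx] using hxb) hib hine hre
  have hzero_nonneg : 0 ≤ ∑ᶠ i, (divisor f (ball 0 R) i : ℝ) * Real.log ‖canonicalFactor R i 0‖ := by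
    refine finsum_nonneg fun i => ?_
    by_cases hi : divisor f (ball (0 : ℂ) R) i = 0
    · simp [hi]
    obtain ⟨hib, hi0⟩ := hsupp i hi
    have hine : i ≠ 0 := fun h' => h0 (h' ▸ hi0)
    refine mul_nonneg (hdiv_nonneg i) (Real.log_nonneg ?_)
    have : ‖i‖ ≤ R := by simpa using ball_subset_closedBall hib
    simp only [canonicalFactor_apply, norm_div, norm_mul, mul_zero, sub_zero, zero_sub, norm_neg,
      norm_real, norm_pow, Real.norm_of_nonneg hR.le]
    rw [one_le_div (mul_pos hR (norm_pos_iff.mpr hine))]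
    nlinarith
  -- harmonicity of `log ‖h‖`
  have hBpos : 0 < B := (norm_pos_iff.mpr h0).trans_le (hB 0 (hsub hmem0))
  have hBne : (B : ℂ) ≠ 0 := by exact_mod_cast hBpos.ne'
  set V : ℂ → ℝ := fun w => Real.log ‖h w / B‖ with hV
  have hVeq : ∀ w ∈ closedBall (0 : ℂ) R, V w = Real.log ‖h w‖ - Real.log B := by
    intro w hw
    simp only [hV]
    rw [norm_div, norm_real, Real.norm_of_nonneg hBpos.le,
      Real.log_div (norm_ne_zero_iff.mpr (D.ne_zero w hw)) hBpos.ne']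
  have hharm : InnerProductSpace.HarmonicOnNhd V (closedBall 0 R) := fun w hw =>
    ((D.analyticOnNhd w hw).div analyticAt_const hBne).harmonicAt_log_norm
      (div_ne_zero (D.ne_zero w hw) hBne)
  have hVcont : ContinuousOn V (sphere 0 R) := hharm.continuousOn.mono sphere_subset_closedBall
  have hVle : ∀ w ∈ sphere (0 : ℂ) R, V w ≤ 0 := by
    intro w hw
    have hwc := sphere_subset_closedBall hw
    have hfw : f w ≠ 0 := hRz w (by simpa using hw)
    rw [hVeq w hwc, hlog w hwc hfw, hsum]
    have : ∑ i ∈ hfinsupp.toFinset, (divisor f (ball 0 R) i : ℝ) *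
        Real.log ‖canonicalFactor R i w‖ = 0 := by
      refine Finset.sum_eq_zero fun i hi => ?_
      obtain ⟨hib, -⟩ := hsupp i (by simpa using hi)
      rw [norm_canonicalFactor_eval_circle_eq_one hib hw, Real.log_one, mul_zero]
    rw [this, zero_add, sub_nonpos]
    exact Real.log_le_log (norm_pos_iff.mpr hfw) (hB w (hsub hwc))
  have hmean0 : Real.circleAverage V 0 R = V 0 := by
    refine InnerProductSpace.HarmonicOnNhd.circleAverage_eq ?_
    rwa [abs_of_pos hR]
  have hmeanx := InnerProductSpace.HarmonicOnNhd.circleAverage_poissonKernel_smul hharm hxb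
  have hpc : ContinuousOn (poissonKernel 0 (x : ℂ)) (sphere 0 R) := by
    rw [poissonKernel_eq_re_herglotzRieszKernel]
    have := continuousOn_herglotzRieszKernel_sphere hxb
    rw [abs_of_pos hR] at this
    exact Complex.continuous_re.comp_continuousOn this
  have hRx : 1 / 8 ≤ R - x := by linarith
  have hVx : (R + x) / (R - x) * V 0 ≤ V x := by
    rw [← hmeanx, ← hmean0, ← smul_eq_mul, ← Real.circleAverage_smul]
    refine Real.circleAverage_mono ?_ ?_ ?_
    · exact (hVcont.const_smul _).circleIntegrable hR.le
    · exact (hpc.smul hVcont).circleIntegrable hR.le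
    · intro w hw
      rw [abs_of_pos hR] at hw
      have hk := re_herglotzRieszKernel_le hw hxb
      simp only [sub_zero, norm_real, Real.norm_of_nonneg hx.le] at hk
      have hP : poissonKernel 0 (x : ℂ) w ≤ (R + x) / (R - x) := by
        rw [poissonKernel_eq_re_herglotzRieszKernel]
        simpa [herglotzRieszKernel_def] using hk
      simp only [Pi.smul_apply, Pi.smul_apply', smul_eq_mul]
      exact mul_le_mul_of_nonpos_right hP (hVle w hw)
  have hV0 : V 0 ≤ 0 := by
    rw [← hmean0]
    refine Real.circleAverage_mono_on_of_le_circle (hVcont.circleIntegrable hR.le) ?_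
    rwa [abs_of_pos hR]
  have hratio : (R + x) / (R - x) ≤ 1 + 16 * x := by
    rw [div_le_iff₀ (by linarith)]
    nlinarith
  have e0 := hlog 0 hmem0 h0
  have ex := hlog x hmemx hfx
  have v0 := hVeq 0 hmem0
  have vx := hVeq x hmemx
  have h1 : (1 + 16 * x) * V 0 ≤ V x := le_trans (mul_le_mul_of_nonpos_right hratio hV0) hVx
  have h2 : -V 0 ≤ Real.log B - Real.log ‖f 0‖ := by linarith
  have h3 : 16 * x * (-V 0) ≤ 16 * x * (Real.log B - Real.log ‖f 0‖) :=
    mul_le_mul_of_nonneg_left h2 (by positivity)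
  linarith

end OneSidedHarnack

section CharacterLSeries

open Finset

lemma sum_range_char_period {q : ℕ} [NeZero q] (ψ : DirichletCharacter ℂ q) (hψ : ψ ≠ 1) (m : ℕ) :
    ∑ k ∈ range q, ψ ((m + k : ℕ) : ZMod q) = 0 := by
  have h := MulChar.sum_eq_zero_of_ne_one hψ
  rw [← Equiv.sum_comp (Equiv.addLeft (m : ZMod q))] at h
  rw [← h]
  refine Finset.sum_bij' (fun k _ => (k : ZMod q)) (fun a _ => a.val) ?_ ?_ ?_ ?_ ?_
  · simp
  · intro a _
    exact mem_range.mpr (ZMod.val_lt a)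
  · intro k hk
    exact ZMod.val_cast_of_lt (mem_range.mp hk)
  · intro a _
    exact ZMod.natCast_zmod_val a
  · intro k _
    simp

lemma norm_sum_range_char_le {q : ℕ} [NeZero q] (ψ : DirichletCharacter ℂ q) (hψ : ψ ≠ 1)
    (m n : ℕ) : ‖∑ k ∈ range n, ψ ((m + k : ℕ) : ZMod q)‖ ≤ q := by
  induction n using Nat.strong_induction_on with
  | _ n ih =>
    rcases le_or_gt n q with hn | hn
    · calc ‖∑ k ∈ range n, ψ ((m + k : ℕ) : ZMod q)‖
          ≤ ∑ k ∈ range n, ‖ψ ((m + k : ℕ) : ZMod q)‖ := norm_sum_le _ _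
        _ ≤ ∑ k ∈ range n, (1 : ℝ) := sum_le_sum fun k _ => ψ.norm_le_one _
        _ = n := by simp
        _ ≤ q := by exact_mod_cast hn
    · have hq := Nat.pos_of_ne_zero (NeZero.ne q)
      have h := ih (n - q) (by omega)
      have e : ∑ k ∈ range n, ψ ((m + k : ℕ) : ZMod q) =
          ∑ k ∈ range (n - q), ψ ((m + k : ℕ) : ZMod q) := by
        conv_lhs => rw [show n = (n - q) + q by omega]
        rw [sum_range_add]
        simp_rw [← add_assoc m (n - q)]
        rw [sum_range_char_period ψ hψ, add_zero]
      rw [e]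
      exact h

lemma norm_sum_Icc_char_le {q : ℕ} [NeZero q] (ψ : DirichletCharacter ℂ q) (hψ : ψ ≠ 1) (n : ℕ) :
    ‖∑ k ∈ Icc 1 n, ψ (k : ZMod q)‖ ≤ q := by
  have h1 : Icc 1 n = Ico 1 (n + 1) := by ext; simp
  rw [h1, sum_Ico_eq_sum_range]
  exact norm_sum_range_char_le ψ hψ 1 _

lemma exists_analytic_extension_LSeries {q : ℕ} [NeZero q] (ψ : DirichletCharacter ℂ q)
    (hψ : ψ ≠ 1) : ∃ G : ℂ → ℂ, DifferentiableOn ℂ G {s | 0 < s.re} ∧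
      (∀ s, 0 < s.re → ‖G s‖ ≤ q * ‖s‖ / s.re) ∧
      ∀ s, 1 < s.re → G s = LSeries (fun n => ψ n) s := by
  set S : ℝ → ℂ := fun t => ∑ k ∈ Icc 1 ⌊t⌋₊, ψ (k : ZMod q) with hS
  have hSle : ∀ t, ‖S t‖ ≤ q := fun t => norm_sum_Icc_char_le ψ hψ _
  have hSmeas : Measurable S :=
    (measurable_from_nat (f := fun n : ℕ => ∑ k ∈ Icc 1 n, ψ (k : ZMod q))).comp Nat.measurable_floor
  have hS0 : ∀ t, t < 1 → S t = 0 := fun t ht => by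
    simp [hS, Nat.floor_eq_zero.mpr ht]
  have hmel : ∀ s : ℂ, mellin S (-s) = ∫ t in Set.Ioi (1 : ℝ), S t * (t : ℂ) ^ (-(s + 1)) := by
    intro s
    rw [mellin]
    rw [setIntegral_eq_of_subset_of_ae_sdiff_eq_zero (s := Set.Ioi (1 : ℝ)) (t := Set.Ioi (0 : ℝ))
      measurableSet_Ioi.nullMeasurableSet (Set.Ioi_subset_Ioi zero_le_one) ?_]
    · refine setIntegral_congr_fun measurableSet_Ioi fun t _ => ?_
      simp only [smul_eq_mul]
      rw [mul_comm, show -s - 1 = -(s + 1) by ring]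
    · filter_upwards [compl_mem_ae_iff.mpr (measure_singleton (1 : ℝ))] with t ht htm
      have : t < 1 := lt_of_le_of_ne (not_lt.mp htm.2) ht
      simp [hS0 t this]
  have hloc : LocallyIntegrableOn S (Set.Ioi 0) :=
    ((locallyIntegrable_const (q : ℝ)).mono hSmeas.aestronglyMeasurable
      (Filter.Eventually.of_forall fun t => by
        simpa using hSle t)).locallyIntegrableOn _
  refine ⟨fun s => s * mellin S (-s), ?_, ?_, ?_⟩
  · intro s hs
    have hs' : 0 < s.re := hs
    refine (DifferentiableAt.mul differentiableAt_id ?_).differentiableWithinAt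
    have hm : DifferentiableAt ℂ (mellin S) (-s) := by
      refine mellin_differentiableAt_of_isBigO_rpow (a := 0) (b := (-s).re - 1) hloc ?_ (by simpa using hs') ?_ (by simp)
      · refine Asymptotics.IsBigO.of_bound q (Filter.Eventually.of_forall fun t => ?_)
        simpa using hSle t
      · refine Asymptotics.IsBigO.of_bound 1 ?_
        filter_upwards [Ioo_mem_nhdsGT (zero_lt_one' ℝ)] with t ht
        rw [hS0 t ht.2]
        simp
    exact hm.comp s differentiableAt_id.neg
  · intro s hs
    simp only
    rw [hmel, norm_mul, mul_comm (q : ℝ), mul_div_assoc]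
    refine mul_le_mul_of_nonneg_left ?_ (norm_nonneg s)
    calc ‖∫ t in Set.Ioi (1 : ℝ), S t * (t : ℂ) ^ (-(s + 1))‖
        ≤ ∫ t in Set.Ioi (1 : ℝ), (q : ℝ) * t ^ (-s.re - 1) := by
          refine norm_integral_le_of_norm_le ?_ ?_
          · exact (integrableOn_Ioi_rpow_of_lt (by linarith) zero_lt_one).const_mul _
          · refine (ae_restrict_iff' measurableSet_Ioi).mpr (Filter.Eventually.of_forall fun t ht => ?_)
            have ht0 : (0 : ℝ) < t := lt_trans zero_lt_one ht
            rw [norm_mul, Complex.norm_cpow_eq_rpow_re_of_pos ht0]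
            have : (-(s + 1)).re = -s.re - 1 := by simp; ring
            rw [this]
            exact mul_le_mul_of_nonneg_right (hSle t) (Real.rpow_nonneg ht0.le _)
      _ = q / s.re := by
          rw [integral_const_mul, integral_Ioi_rpow_of_lt (by linarith) zero_lt_one]
          have hne := hs.ne'
          rw [Real.one_rpow, show -s.re - 1 + 1 = -s.re by ring, neg_div_neg_eq, mul_one_div]
  · intro s hs
    have hs0 : 0 < s.re := by linarith
    simp only [hmel]
    refine (LSeries_eq_mul_integral (fun n => ψ n) le_rfl hs0
      (DirichletCharacter.LSeriesSummable_of_one_lt_re ψ hs) ?_).symm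
    refine Asymptotics.IsBigO.of_bound q (Filter.Eventually.of_forall fun n => ?_)
    simpa using norm_sum_Icc_char_le ψ hψ n

lemma cpow_neg_eq_rpow_mul_cexp {n : ℕ} (hn : n ≠ 0) (σ τ : ℝ) :
    (n : ℂ) ^ (-((σ : ℂ) + τ * I)) =
      (((n : ℝ) ^ (-σ) : ℝ) : ℂ) * cexp (-((τ * Real.log n : ℝ) : ℂ) * I) := by
  have hn0 : (n : ℂ) ≠ 0 := by exact_mod_cast hn
  rw [neg_add, Complex.cpow_add _ _ hn0, ofReal_cpow (Nat.cast_nonneg n)]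
  congr 1
  · simp
  · rw [Complex.cpow_def_of_ne_zero hn0, ← Complex.natCast_log]
    congr 1
    push_cast
    ring

lemma norm_char_mul_cpow_le {q : ℕ} (ψ : DirichletCharacter ℂ q) {p : ℕ} (hp : p.Prime) (s : ℂ) :
    ‖ψ (p : ZMod q) * (p : ℂ) ^ (-s)‖ ≤ (p : ℝ) ^ (-s.re) := by
  rw [norm_mul, Complex.norm_natCast_cpow_of_pos hp.pos, neg_re]
  exact mul_le_of_le_one_left (by positivity) (ψ.norm_le_one _)

lemma summable_primes_rpow_neg (σ : ℝ) (hσ : 1 < σ) :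
    Summable (fun p : Nat.Primes => ((p : ℕ) : ℝ) ^ (-σ)) :=
  Nat.Primes.summable_rpow.mpr (by linarith)

/-- The logarithm of an `L`-function is its prime sum up to a bounded error. -/
lemma abs_log_norm_LSeries_sub_le {q : ℕ} [NeZero q] (ψ : DirichletCharacter ℂ q) {s : ℂ}
    (hs : 1 < s.re) : LSeries (fun n => ψ n) s ≠ 0 ∧
      |Real.log ‖LSeries (fun n => ψ n) s‖ -
        ∑' p : Nat.Primes, (ψ ((p : ℕ) : ZMod q) * ((p : ℕ) : ℂ) ^ (-s)).re| ≤ 3 := by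
  have hE := DirichletCharacter.LSeries_eulerProduct_exp_log ψ hs
  set z : Nat.Primes → ℂ := fun p => ψ ((p : ℕ) : ZMod q) * ((p : ℕ) : ℂ) ^ (-s) with hz
  have hzle : ∀ p, ‖z p‖ ≤ ((p : ℕ) : ℝ) ^ (-s.re) := fun p => norm_char_mul_cpow_le ψ p.2 s
  have hzsum : Summable z := Summable.of_norm_bounded (summable_primes_rpow_neg _ hs) hzle
  have hzhalf : ∀ p, ‖z p‖ ≤ 1 / 2 := by
    intro p
    refine (hzle p).trans ?_
    have h2 : (2 : ℝ) ≤ ((p : ℕ) : ℝ) := by exact_mod_cast p.2.two_le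
    calc ((p : ℕ) : ℝ) ^ (-s.re) ≤ ((p : ℕ) : ℝ) ^ (-1 : ℝ) :=
          Real.rpow_le_rpow_of_exponent_le (by linarith) (by linarith)
      _ = (((p : ℕ) : ℝ))⁻¹ := Real.rpow_neg_one _
      _ ≤ 2⁻¹ := inv_anti₀ (by norm_num) h2
      _ = 1 / 2 := by norm_num
  have herr : ∀ p, ‖-Complex.log (1 - z p) - z p‖ ≤ ((p : ℕ) : ℝ) ^ (-(3 / 2) : ℝ) := by
    intro p
    have h := Complex.norm_log_one_add_sub_self_le (z := -z p) (by rw [norm_neg]; linarith [hzhalf p])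
    rw [norm_neg] at h
    have e : -Complex.log (1 - z p) - z p = -(Complex.log (1 + -z p) - -z p) := by
      rw [← sub_eq_add_neg]; ring
    rw [e, norm_neg]
    have h1 : (1 - ‖z p‖)⁻¹ ≤ 2 := by
      rw [inv_le_comm₀ (by linarith [hzhalf p]) (by norm_num)]
      linarith [hzhalf p]
    have h2 : ‖z p‖ ^ 2 ≤ ((p : ℕ) : ℝ) ^ (-(3 / 2) : ℝ) := by
      have hp1 : (1 : ℝ) ≤ ((p : ℕ) : ℝ) := by exact_mod_cast p.2.one_le
      calc ‖z p‖ ^ 2 ≤ (((p : ℕ) : ℝ) ^ (-s.re)) ^ 2 := by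
            gcongr
            exact hzle p
        _ = ((p : ℕ) : ℝ) ^ (-s.re * 2) := by
            rw [Real.rpow_mul (by linarith), Real.rpow_two]
        _ ≤ _ := Real.rpow_le_rpow_of_exponent_le hp1 (by linarith)
    calc _ ≤ ‖z p‖ ^ 2 * (1 - ‖z p‖)⁻¹ / 2 := h
      _ ≤ ‖z p‖ ^ 2 * 2 / 2 := by gcongr
      _ = ‖z p‖ ^ 2 := by ring
      _ ≤ _ := h2
  have h32 : Summable (fun p : Nat.Primes => ((p : ℕ) : ℝ) ^ (-(3 / 2) : ℝ)) :=
    summable_primes_rpow_neg (3 / 2) (by norm_num)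
  have herrsum : Summable (fun p => -Complex.log (1 - z p) - z p) :=
    Summable.of_norm_bounded h32 herr
  have hlogsum : Summable (fun p => -Complex.log (1 - z p)) := by
    refine (herrsum.add hzsum).congr fun p => ?_
    ring
  rw [← hE]
  refine ⟨Complex.exp_ne_zero _, ?_⟩
  rw [Complex.norm_exp, Real.log_exp, ← Complex.re_tsum hzsum, ← sub_re]
  change |(∑' p, -Complex.log (1 - z p) - ∑' p, z p).re| ≤ 3
  rw [← hlogsum.tsum_sub hzsum]
  refine (Complex.abs_re_le_norm _).trans ((tsum_of_norm_bounded h32.hasSum herr).trans ?_)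
  refine h32.tsum_le_of_sum_le fun F => ?_
  have := sum_primes_rpow_three_half_le (F.map ⟨fun p : Nat.Primes => (p : ℕ), Subtype.val_injective⟩)
    (by
      intro n hn
      obtain ⟨p, -, rfl⟩ := Finset.mem_map.mp hn
      exact p.2)
  rw [Finset.sum_map] at this
  exact this

end CharacterLSeries

section CharacterPrimeSums

open Finset

lemma abs_tsum_primes_sub_sum_le (a : ℕ → ℝ) (hsum : Summable fun p : Nat.Primes => a p) (N : ℕ)
    (B : ℝ) (hB : ∀ U : Finset ℕ, (∀ p ∈ U, p.Prime ∧ N < p) → ∑ p ∈ U, |a p| ≤ B) :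
    |∑' p : Nat.Primes, a p - ∑ p ∈ (Icc 1 N).filter Nat.Prime, a p| ≤ B := by
  set F : Finset Nat.Primes := (Icc 1 N).subtype Nat.Prime with hF
  have hFsum : ∑ p ∈ (Icc 1 N).filter Nat.Prime, a p = ∑ p ∈ F, a p :=
    (Finset.sum_subtype_eq_sum_filter a).symm
  rw [hFsum]
  have ht : Filter.Tendsto (fun U : Finset Nat.Primes => |∑ p ∈ U, a p - ∑ p ∈ F, a p|)
      Filter.atTop (nhds |∑' p : Nat.Primes, a p - ∑ p ∈ F, a p|) :=
    (hsum.hasSum.sub_const _).abs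
  refine le_of_tendsto ht ?_
  filter_upwards [Filter.eventually_ge_atTop F] with U hU
  rw [← Finset.sum_sdiff hU, add_sub_cancel_right]
  refine (Finset.abs_sum_le_sum_abs _ _).trans ?_
  have h := hB ((U \ F).map ⟨fun p : Nat.Primes => (p : ℕ), Subtype.val_injective⟩) (by
    intro n hn
    obtain ⟨p, hp, rfl⟩ := Finset.mem_map.mp hn
    refine ⟨p.2, ?_⟩
    by_contra hle
    refine (Finset.mem_sdiff.mp hp).2 ?_
    exact Finset.mem_subtype.mpr (mem_Icc.mpr ⟨p.2.one_le, not_lt.mp hle⟩))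
  rw [Finset.sum_map] at h
  exact h

lemma rpow_neg_one_add {n : ℕ} (hn : 0 < n) (σ : ℝ) :
    (n : ℝ) ^ (-(1 + σ)) = 1 / n * (n : ℝ) ^ (-σ) := by
  rw [neg_add, Real.rpow_add (by exact_mod_cast hn), Real.rpow_neg_one, one_div]

lemma sum_primes_gt_rpow_le_of_inv_le (y : ℝ) (hy : 2 ≤ y) {σ : ℝ} (hσ : 1 / Real.log y ≤ σ)
    (S : Finset ℕ) (hS : ∀ p ∈ S, p.Prime ∧ y < p) :
    ∑ p ∈ S, (p : ℝ) ^ (-(1 + σ)) ≤ 12 := by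
  refine le_trans (sum_le_sum fun p hp => ?_) (sum_primes_gt_rpow_inv_log_le y hy S hS)
  rw [rpow_neg_one_add (hS p hp).1.pos]
  refine mul_le_mul_of_nonneg_left ?_ (by positivity)
  exact Real.rpow_le_rpow_of_exponent_le (by exact_mod_cast (hS p hp).1.one_le) (by linarith)

/-- The real part of the prime sum of a non-principal character, twisted by `n ^ (-iτ)` and
restricted to primes beyond `q (|τ| + 3)`, is bounded above. -/
theorem exists_re_sum_char_primes_le : ∃ C : ℝ, 0 < C ∧ ∀ (q : ℕ) [NeZero q]
    (ψ : DirichletCharacter ℂ q) (y N : ℕ) (τ σ : ℝ), ψ ≠ 1 → 2 ^ 20 ≤ (y : ℝ) →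
    q * (|τ| + 3) ≤ (y : ℝ) → 0 < σ → 1 / σ ≤ Real.log N → 1 / σ ≤ y →
    ∑ p ∈ (Icc 1 N).filter (fun p => p.Prime ∧ y < p),
      (ψ (p : ZMod q) * (p : ℂ) ^ (-(((1 + σ : ℝ) : ℂ) + τ * I))).re ≤ C := by
  refine ⟨300, by norm_num, fun q _ ψ y N τ σ hψ hy hqy hσ hσN hσy => ?_⟩
  set r : ℝ → ℕ → ℝ := fun σ p => (ψ (p : ZMod q) * (p : ℂ) ^ (-(((1 + σ : ℝ) : ℂ) + τ * I))).re
    with hr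
  have hy2 : (2 : ℝ) ≤ y := le_trans (by norm_num) hy
  have hly : 13 ≤ Real.log y := by
    have h1 : Real.log (2 ^ 20) ≤ Real.log y := Real.log_le_log (by norm_num) hy
    rw [Real.log_pow] at h1
    have := Real.log_two_gt_d9
    push_cast at h1
    linarith
  have hly0 : 0 < Real.log y := by linarith
  have hrle : ∀ σ (p : ℕ), p.Prime → |r σ p| ≤ (p : ℝ) ^ (-(1 + σ)) := by
    intro σ p hp
    refine (Complex.abs_re_le_norm _).trans ((norm_char_mul_cpow_le ψ hp _).trans (le_of_eq ?_))
    simp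
  have hN1 : 0 < Real.log N := lt_of_lt_of_le (by positivity) hσN
  have hN2 : (2 : ℝ) ≤ N := by
    have : 1 < N := by
      by_contra h
      have h' : N = 0 ∨ N = 1 := by omega
      rcases h' with rfl | rfl <;> simp at hN1
    exact_mod_cast this
  -- bounds for tails
  set σ₁ : ℝ := 1 / Real.log y with hσ₁
  have hσ₁pos : 0 < σ₁ := by positivity
  rcases le_or_gt σ₁ σ with hcase | hcase
  · calc _ ≤ ∑ p ∈ (Icc 1 N).filter (fun p => p.Prime ∧ y < p), (p : ℝ) ^ (-(1 + σ)) :=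
          sum_le_sum fun p hp => (le_abs_self _).trans (hrle σ p (mem_filter.mp hp).2.1)
      _ ≤ 12 := sum_primes_gt_rpow_le_of_inv_le y hy2 hcase _ fun p hp =>
          ⟨(mem_filter.mp hp).2.1, by exact_mod_cast (mem_filter.mp hp).2.2⟩
      _ ≤ 300 := by norm_num
  rcases lt_or_ge N y with hNy | hyN
  · rw [sum_eq_zero]
    · norm_num
    · intro p hp
      obtain ⟨hp1, hp2⟩ := mem_filter.mp hp
      have := (mem_Icc.mp hp1).2
      omega
  have hsummable : ∀ σ, 0 < σ → Summable fun p : Nat.Primes => r σ p := fun σ hσ =>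
    Summable.of_norm_bounded (summable_primes_rpow_neg (1 + σ) (by linarith))
      fun p => by simpa using hrle σ p p.2
  have htailN := abs_tsum_primes_sub_sum_le (r σ) (hsummable σ hσ) N 12 (fun U hU => by
    refine (sum_le_sum fun p hp => hrle σ p (hU p hp).1).trans ?_
    refine sum_primes_gt_rpow_le_of_inv_le N hN2 ?_ U fun p hp =>
      ⟨(hU p hp).1, by exact_mod_cast (hU p hp).2⟩
    rw [div_le_iff₀ hN1]
    rwa [div_le_iff₀' hσ] at hσN)
  have htaily₁ := abs_tsum_primes_sub_sum_le (r σ₁) (hsummable σ₁ hσ₁pos) y 12 (fun U hU => by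
    refine (sum_le_sum fun p hp => hrle σ₁ p (hU p hp).1).trans ?_
    exact sum_primes_gt_rpow_le_of_inv_le y hy2 le_rfl U fun p hp =>
      ⟨(hU p hp).1, by exact_mod_cast (hU p hp).2⟩)
  have htaily := abs_tsum_primes_sub_sum_le (r σ) (hsummable σ hσ) y
    (Real.log (1 / (σ * Real.log y)) + 24) (fun U hU => by
    refine (sum_le_sum fun p hp => hrle σ p (hU p hp).1).trans ?_
    refine le_trans (le_of_eq (sum_congr rfl fun p hp => rpow_neg_one_add (hU p hp).1.pos σ))
      (sum_primes_gt_rpow_le y hy2 σ hσ hcase.le U fun p hp =>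
        ⟨(hU p hp).1, by exact_mod_cast (hU p hp).2⟩))
  have hsplit : ∑ p ∈ (Icc 1 N).filter Nat.Prime, r σ p = ∑ p ∈ (Icc 1 y).filter Nat.Prime, r σ p +
      ∑ p ∈ (Icc 1 N).filter (fun p => p.Prime ∧ y < p), r σ p := by
    rw [← sum_union]
    · congr 1
      ext p
      simp only [mem_union, mem_filter, mem_Icc]
      constructor
      · rintro ⟨⟨h1, h2⟩, h3⟩
        rcases le_or_gt p y with h | h
        · exact Or.inl ⟨⟨h1, h⟩, h3⟩
        · exact Or.inr ⟨⟨h1, h2⟩, h3, h⟩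
      · rintro (⟨⟨h1, h2⟩, h3⟩ | ⟨⟨h1, h2⟩, h3, -⟩)
        · exact ⟨⟨h1, h2.trans hyN⟩, h3⟩
        · exact ⟨⟨h1, h2⟩, h3⟩
    · rw [disjoint_left]
      intro p hp hp'
      simp only [mem_filter, mem_Icc] at hp hp'
      omega
  -- comparison on small primes
  have hsmall : ∑ p ∈ (Icc 1 y).filter Nat.Prime, r σ₁ p -
      ∑ p ∈ (Icc 1 y).filter Nat.Prime, r σ p ≤ 2 := by
    rw [← sum_sub_distrib]
    have hterm : ∀ p ∈ (Icc 1 y).filter Nat.Prime, r σ₁ p - r σ p ≤ σ₁ * (Real.log p / p) := by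
      intro p hp
      have hp' := (mem_filter.mp hp).2
      have hp0 : (0 : ℝ) < p := by exact_mod_cast hp'.pos
      have hp1 : (1 : ℝ) ≤ p := by exact_mod_cast hp'.one_le
      have hlp : 0 ≤ Real.log p := Real.log_nonneg hp1
      have hmono : (p : ℝ) ^ (-(1 + σ₁)) ≤ (p : ℝ) ^ (-(1 + σ)) :=
        Real.rpow_le_rpow_of_exponent_le hp1 (by linarith)
      have e : r σ₁ p - r σ p = (ψ (p : ZMod q) * ((((p : ℝ) ^ (-(1 + σ₁)) -
          (p : ℝ) ^ (-(1 + σ)) : ℝ) : ℂ) * cexp (-((τ * Real.log p : ℝ) : ℂ) * I))).re := by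
        simp only [hr]
        rw [cpow_neg_eq_rpow_mul_cexp hp'.ne_zero, cpow_neg_eq_rpow_mul_cexp hp'.ne_zero, ← sub_re]
        congr 1
        push_cast
        ring
      have hnorm : ‖cexp (-((τ * Real.log p : ℝ) : ℂ) * I)‖ = 1 := by
        rw [← ofReal_neg, Complex.norm_exp_ofReal_mul_I]
      rw [e]
      refine (Complex.re_le_norm _).trans ?_
      rw [norm_mul, norm_mul, hnorm, mul_one, norm_real, Real.norm_eq_abs, abs_of_nonpos (by linarith)]
      refine (mul_le_of_le_one_left (by linarith) (ψ.norm_le_one _)).trans ?_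
      have h1 : (p : ℝ) ^ (-(1 + σ)) ≤ 1 / p := by
        calc (p : ℝ) ^ (-(1 + σ)) ≤ (p : ℝ) ^ (-1 : ℝ) :=
              Real.rpow_le_rpow_of_exponent_le hp1 (by linarith)
          _ = 1 / p := by rw [Real.rpow_neg_one, one_div]
      have h2 : (p : ℝ) ^ (-(1 + σ₁)) = (p : ℝ) ^ (-(1 + σ)) * Real.exp (-((σ₁ - σ) * Real.log p)) := by
        rw [show -(1 + σ₁) = -(1 + σ) + -(σ₁ - σ) by ring, Real.rpow_add hp0]
        congr 1
        rw [Real.rpow_def_of_pos hp0]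
        congr 1
        ring
      have h3 : 1 - (σ₁ - σ) * Real.log p ≤ Real.exp (-((σ₁ - σ) * Real.log p)) := by
        have := Real.add_one_le_exp (-((σ₁ - σ) * Real.log p))
        linarith
      have h4 : 0 ≤ (p : ℝ) ^ (-(1 + σ)) := by positivity
      calc -((p : ℝ) ^ (-(1 + σ₁)) - (p : ℝ) ^ (-(1 + σ)))
          = (p : ℝ) ^ (-(1 + σ)) * (1 - Real.exp (-((σ₁ - σ) * Real.log p))) := by rw [h2]; ring
        _ ≤ (p : ℝ) ^ (-(1 + σ)) * (σ₁ * Real.log p) := by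
            refine mul_le_mul_of_nonneg_left ?_ h4
            nlinarith
        _ ≤ 1 / p * (σ₁ * Real.log p) := by gcongr
        _ = _ := by ring
    refine (sum_le_sum hterm).trans ?_
    rw [← mul_sum]
    have h := sum_primes_log_div_le y ((Icc 1 y).filter Nat.Prime) (fun p hp =>
      ⟨(mem_filter.mp hp).2, (mem_Icc.mp (mem_filter.mp hp).1).2⟩)
    calc σ₁ * ∑ p ∈ (Icc 1 y).filter Nat.Prime, Real.log p / p
        ≤ σ₁ * (Real.log y + (Real.log 4 + 4)) := by gcongr
      _ ≤ σ₁ * (Real.log y + Real.log y) := by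
          gcongr
          linarith [log_four_le]
      _ = 2 := by rw [hσ₁]; field_simp; norm_num
  -- crude lower bound at `σ`
  have hcrude : -(Real.log y + 64) ≤ ∑' p : Nat.Primes, r σ p := by
    have h1 : ∑ p ∈ (Icc 1 y).filter Nat.Prime, -(1 / (p : ℝ)) ≤
        ∑ p ∈ (Icc 1 y).filter Nat.Prime, r σ p := by
      refine sum_le_sum fun p hp => ?_
      have hp' := (mem_filter.mp hp).2
      have := hrle σ p hp'
      have h1 : (p : ℝ) ^ (-(1 + σ)) ≤ 1 / p := by
        calc (p : ℝ) ^ (-(1 + σ)) ≤ (p : ℝ) ^ (-1 : ℝ) :=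
              Real.rpow_le_rpow_of_exponent_le (by exact_mod_cast hp'.one_le) (by linarith)
          _ = 1 / p := by rw [Real.rpow_neg_one, one_div]
      linarith [neg_abs_le (r σ p)]
    rw [sum_neg_distrib] at h1
    have h2 := sum_primes_inv_le y (by exact_mod_cast hy2) ((Icc 1 y).filter Nat.Prime) (fun p hp =>
      ⟨(mem_filter.mp hp).2, (mem_Icc.mp (mem_filter.mp hp).1).2⟩)
    have h3 : Real.log (1 / (σ * Real.log y)) = Real.log (1 / σ) - Real.log (Real.log y) := by
      rw [one_div, one_div, Real.log_inv, Real.log_inv, Real.log_mul hσ.ne' hly0.ne']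
      ring
    have h4 : Real.log (1 / σ) ≤ Real.log y := Real.log_le_log (by positivity) hσy
    have h5 := (abs_le.mp htaily).1
    linarith
  obtain ⟨G, hGd, hGb, hGL⟩ := exists_analytic_extension_LSeries ψ hψ
  set s₀ : ℂ := ((1 + σ : ℝ) : ℂ) + τ * I with hs₀
  have hs₀re : s₀.re = 1 + σ := by simp [hs₀]
  set f : ℂ → ℂ := fun z => G (s₀ + z) with hf
  have hre : ∀ z ∈ Metric.closedBall (0 : ℂ) (1 / 2), 1 / 2 ≤ (s₀ + z).re := by
    intro z hz
    have h1 : ‖z‖ ≤ 1 / 2 := by simpa using hz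
    have h2 := neg_abs_le z.re
    have h3 := Complex.abs_re_le_norm z
    rw [add_re, hs₀re]
    linarith
  have hopen : IsOpen {s : ℂ | 0 < s.re} := isOpen_lt continuous_const Complex.continuous_re
  have hfan : AnalyticOnNhd ℂ f (Metric.closedBall 0 (1 / 2)) := by
    intro z hz
    have h1 : AnalyticAt ℂ G (s₀ + z) := hGd.analyticAt (hopen.mem_nhds
      (show 0 < (s₀ + z).re by linarith [hre z hz]))
    have h2 : AnalyticAt ℂ (fun z => s₀ + z) z := analyticAt_const.add analyticAt_id
    exact AnalyticAt.fun_comp h1 h2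
  have hσ1 : σ ≤ 1 := by
    have : σ₁ ≤ 1 := by rw [hσ₁, div_le_one hly0]; linarith
    linarith
  have hfB : ∀ z ∈ Metric.closedBall (0 : ℂ) (1 / 2), ‖f z‖ ≤ 2 * y := by
    intro z hz
    have h0 := hre z hz
    have h1 : ‖z‖ ≤ 1 / 2 := by simpa using hz
    have h2 : ‖s₀ + z‖ ≤ |τ| + 3 := by
      calc ‖s₀ + z‖ ≤ ‖((1 + σ : ℝ) : ℂ)‖ + ‖(τ : ℂ) * I‖ + ‖z‖ := norm_add₃_le
        _ ≤ (1 + σ) + |τ| + 1 / 2 := by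
            rw [norm_real, norm_mul, norm_I, norm_real, mul_one, Real.norm_eq_abs, Real.norm_eq_abs,
              abs_of_pos (by linarith : 0 < 1 + σ)]
            linarith
        _ ≤ |τ| + 3 := by linarith
    calc ‖f z‖ ≤ q * ‖s₀ + z‖ / (s₀ + z).re := hGb _ (by linarith)
      _ ≤ q * (|τ| + 3) / (1 / 2) := by gcongr
      _ ≤ y / (1 / 2) := by gcongr
      _ = 2 * y := by ring
  have hfre : ∀ z : ℂ, 0 ≤ z.re → f z = LSeries (fun n => ψ n) (s₀ + z) ∧ 1 < (s₀ + z).re := by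
    intro z hz
    have : 1 < (s₀ + z).re := by rw [add_re, hs₀re]; linarith
    exact ⟨hGL _ this, this⟩
  have hfzero : ∀ z ∈ Metric.closedBall (0 : ℂ) (1 / 2), f z = 0 → z.re ≤ 0 := by
    intro z _ hz0
    by_contra hpos
    obtain ⟨h1, h2⟩ := hfre z (not_le.mp hpos).le
    exact (abs_log_norm_LSeries_sub_le ψ h2).1 (h1 ▸ hz0)
  set x : ℝ := σ₁ - σ with hx
  have hxpos : 0 < x := sub_pos.mpr hcase
  have hxle : x ≤ σ₁ := by linarith
  have hσ₁le : σ₁ ≤ 1 / 13 := one_div_le_one_div_of_le (by norm_num) hly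
  obtain ⟨hf0, hf0re⟩ := hfre 0 (by simp)
  obtain ⟨hfx, hfxre⟩ := hfre x (by simpa using hxpos.le)
  obtain ⟨hne0, hlog0⟩ := abs_log_norm_LSeries_sub_le ψ hf0re
  obtain ⟨hnex, hlogx⟩ := abs_log_norm_LSeries_sub_le ψ hfxre
  have hs0 : s₀ + 0 = ((1 + σ : ℝ) : ℂ) + τ * I := by rw [hs₀, add_zero]
  have hsx : s₀ + (x : ℂ) = ((1 + σ₁ : ℝ) : ℂ) + τ * I := by
    rw [hs₀, hx]; push_cast; ring
  have hmain := log_norm_le_of_zeros_re_nonpos f hfan hfB (hf0 ▸ hne0) hfzero hxpos (by linarith)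
  rw [hf0, hfx] at hmain
  rw [hs0] at hmain hlog0
  rw [hsx] at hmain hlogx
  change |_ - ∑' p : Nat.Primes, r σ p| ≤ 3 at hlog0
  change |_ - ∑' p : Nat.Primes, r σ₁ p| ≤ 3 at hlogx
  have hlow0 := (abs_le.mp hlog0).1
  have hlogB : Real.log (2 * y) ≤ Real.log y + 1 := by
    rw [Real.log_mul (by norm_num) (by linarith)]
    linarith [Real.log_two_lt_d9]
  have hcor : 16 * x * (Real.log (2 * y) - Real.log ‖LSeries (fun n => ψ n)
      (((1 + σ : ℝ) : ℂ) + τ * I)‖) ≤ 200 := by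
    calc _ ≤ 16 * x * (2 * Real.log y + 68) := by
          refine mul_le_mul_of_nonneg_left ?_ (by positivity)
          linarith
      _ ≤ 16 * σ₁ * (2 * Real.log y + 68) := by gcongr
      _ = 32 + 1088 * σ₁ := by rw [hσ₁]; field_simp; ring
      _ ≤ 200 := by linarith
  have a1 := (abs_le.mp htailN).1
  have a1' := (abs_le.mp htailN).2
  have a2 := (abs_le.mp htaily₁).2
  have a3 := (abs_le.mp hlogx).2
  linarith

end CharacterPrimeSums

section Repulsion

open Finset

lemma conj_cpow_neg {n : ℕ} (hn : n ≠ 0) (σ τ : ℝ) :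
    (starRingEnd ℂ) ((n : ℂ) ^ (-((σ : ℂ) + τ * I))) = (n : ℂ) ^ (-((σ : ℂ) - τ * I)) := by
  have h := cpow_neg_eq_rpow_mul_cexp hn σ (-τ)
  rw [cpow_neg_eq_rpow_mul_cexp hn σ τ, map_mul, conj_ofReal, ← Complex.exp_conj]
  rw [show (σ : ℂ) - τ * I = (σ : ℂ) + ((-τ : ℝ) : ℂ) * I by push_cast; ring, h]
  rw [map_mul, map_neg, conj_ofReal, conj_I]
  push_cast
  ring_nf

/-- The sum of `f(p) conj(χ(p)) p^(-s)` over primes `y < p ≤ N`. -/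
def primeCorrelation {q : ℕ} (f : ℕ → ℂ) (y N : ℕ) (χ : DirichletCharacter ℂ q) (s : ℂ) : ℂ :=
  ∑ p ∈ (Icc 1 N).filter (fun p => p.Prime ∧ y < p),
    f p * (starRingEnd ℂ) (χ (p : ZMod q)) * (p : ℂ) ^ (-s)

/-- Only few characters can correlate strongly with `f` at large primes. -/
theorem exists_repulsion : ∃ C : ℝ, 0 < C ∧ ∀ (κ : ℝ) (J : ℕ) (f : ℕ → ℂ) (q : ℕ) [NeZero q]
    (y N : ℕ) (T u L : ℝ), 0 ≤ κ → (∀ p : ℕ, p.Prime → ‖f p‖ ≤ κ) → 0 ≤ T →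
    2 ^ 20 ≤ (y : ℝ) → q * (2 * T + 3) ≤ (y : ℝ) → 0 < u → 1 / u ≤ Real.log N → 1 / u ≤ y →
    ∑ p ∈ (Icc 1 N).filter (fun p => p.Prime ∧ y < p), 1 / (p : ℝ) ≤ L →
    ∃ 𝒳 : Finset (DirichletCharacter ℂ q), 𝒳.card ≤ J ∧ ∀ χ ∉ 𝒳, ∀ σ t : ℝ, u ≤ σ → |t| ≤ T →
      (primeCorrelation f y N χ (((1 + σ : ℝ) : ℂ) + t * I)).re
        ≤ κ * (L + J * C) / Real.sqrt ((J : ℝ) + 1) := by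
  obtain ⟨C, hC, hR⟩ := exists_re_sum_char_primes_le
  refine ⟨C, hC, fun κ J f q _ y N T u L hκ hf hT hy hqy hu huN huy hL => ?_⟩
  set P := (Icc 1 N).filter (fun p => p.Prime ∧ y < p) with hP
  have hPp : ∀ p ∈ P, p.Prime := fun p hp => (mem_filter.mp hp).2.1
  have hL0 : 0 ≤ L := le_trans (sum_nonneg fun p _ => by positivity) hL
  set B := κ * (L + J * C) / Real.sqrt ((J : ℝ) + 1) with hB
  set bad : Finset (DirichletCharacter ℂ q) := univ.filter fun χ => ∃ z : ℝ × ℝ, u ≤ z.1 ∧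
    |z.2| ≤ T ∧ B < (primeCorrelation f y N χ (((1 + z.1 : ℝ) : ℂ) + z.2 * I)).re with hbad
  refine ⟨bad, ?_, fun χ hχ σ t hσ ht => ?_⟩
  swap
  · by_contra hlt
    exact hχ (mem_filter.mpr ⟨mem_univ _, (σ, t), hσ, ht, not_le.mp hlt⟩)
  by_contra hcard
  obtain ⟨S, hS, hScard⟩ := Finset.exists_subset_card_eq (Nat.succ_le_of_lt (not_le.mp hcard))
  have hex : ∀ χ : DirichletCharacter ℂ q, ∃ z : ℝ × ℝ, χ ∈ S → u ≤ z.1 ∧ |z.2| ≤ T ∧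
      B < (primeCorrelation f y N χ (((1 + z.1 : ℝ) : ℂ) + z.2 * I)).re := by
    intro χ
    by_cases h : χ ∈ S
    · obtain ⟨z, hz⟩ := (mem_filter.mp (hS h)).2
      exact ⟨z, fun _ => hz⟩
    · exact ⟨(0, 0), fun h' => absurd h' h⟩
  choose z hz using hex
  set a : DirichletCharacter ℂ q → ℕ → ℂ := fun χ p =>
    (starRingEnd ℂ) (χ (p : ZMod q)) * (p : ℂ) ^ (-(((z χ).1 : ℂ) + (z χ).2 * I)) with ha
  have hcorr : ∀ χ, primeCorrelation f y N χ (((1 + (z χ).1 : ℝ) : ℂ) + (z χ).2 * I) =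
      ∑ p ∈ P, f p * (1 / (p : ℝ) : ℝ) * a χ p := by
    intro χ
    refine sum_congr rfl fun p hp => ?_
    have hp0 : p ≠ 0 := (hPp p hp).ne_zero
    rw [ha]
    simp only
    rw [cpow_neg_eq_rpow_mul_cexp hp0, cpow_neg_eq_rpow_mul_cexp hp0,
      rpow_neg_one_add (Nat.pos_of_ne_zero hp0)]
    push_cast
    ring
  have hnorma : ∀ χ ∈ S, ∀ p ∈ P, ‖a χ p‖ ≤ 1 := by
    intro χ hχ p hp
    have hp0 : p ≠ 0 := (hPp p hp).ne_zero
    rw [ha]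
    simp only
    rw [norm_mul, RCLike.norm_conj, cpow_neg_eq_rpow_mul_cexp hp0, norm_mul, norm_real,
      ← ofReal_neg, Complex.norm_exp_ofReal_mul_I, mul_one, Real.norm_of_nonneg (by positivity)]
    exact mul_le_one₀ (χ.norm_le_one _) (by positivity) (Real.rpow_le_one_of_one_le_of_nonpos
      (by exact_mod_cast (hPp p hp).one_le) (by linarith [(hz χ hχ).1]))
  have hcross : ∀ χ ∈ S, ∀ χ' ∈ S, χ ≠ χ' →
      ∑ p ∈ P, 1 / (p : ℝ) * (a χ p * (starRingEnd ℂ) (a χ' p)).re ≤ C := by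
    intro χ hχ χ' hχ' hne
    obtain ⟨h1, h2, -⟩ := hz χ hχ
    obtain ⟨h1', h2', -⟩ := hz χ' hχ'
    have hσ : u ≤ (z χ).1 + (z χ').1 := by linarith
    have hinv : 1 / ((z χ).1 + (z χ').1) ≤ 1 / u := one_div_le_one_div_of_le hu hσ
    have habs : |(z χ).2 - (z χ').2| ≤ 2 * T := (abs_sub _ _).trans (by linarith)
    have hψ : χ' * χ⁻¹ ≠ 1 := fun h => hne (mul_inv_eq_one.mp h).symm
    refine le_trans (le_of_eq ?_) (hR q (χ' * χ⁻¹) y N ((z χ).2 - (z χ').2) _ hψ hy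
      (le_trans (by gcongr) hqy) (by linarith) (hinv.trans huN) (hinv.trans huy))
    refine sum_congr rfl fun p hp => ?_
    have hp0 : p ≠ 0 := (hPp p hp).ne_zero
    have hp0' : 0 < p := Nat.pos_of_ne_zero hp0
    have hpc : (p : ℂ) ≠ 0 := by exact_mod_cast hp0
    rw [← re_ofReal_mul]
    congr 1
    rw [ha]
    simp only
    rw [map_mul, conj_cpow_neg hp0, Complex.conj_conj, starRingEnd_apply,
      MulChar.star_apply', MulChar.mul_apply]
    have e1 : (-(((1 + ((z χ).1 + (z χ').1) : ℝ) : ℂ) + (((z χ).2 - (z χ').2 : ℝ) : ℂ) * I)) =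
        (-1 : ℂ) + (-(((z χ).1 : ℂ) + (z χ).2 * I)) + (-(((z χ').1 : ℂ) - (z χ').2 * I)) := by
      push_cast; ring
    rw [e1, cpow_add _ _ hpc, cpow_add _ _ hpc, cpow_neg_one]
    push_cast
    ring
  have hinner : ∀ χ ∈ S, ∑ χ' ∈ S, ∑ p ∈ P, 1 / (p : ℝ) * (a χ p * (starRingEnd ℂ) (a χ' p)).re
      ≤ L + J * C := by
    intro χ hχ
    rw [← Finset.add_sum_erase _ _ hχ]
    refine add_le_add ?_ ?_
    · refine le_trans (sum_le_sum fun p hp => ?_) hL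
      rw [mul_conj, ofReal_re, normSq_eq_norm_sq]
      exact mul_le_of_le_one_right (by positivity)
        (pow_le_one₀ (norm_nonneg _) (hnorma χ hχ p hp))
    · refine (sum_le_card_nsmul _ _ C fun χ' hχ' => ?_).trans ?_
      · exact hcross χ hχ χ' (mem_of_mem_erase hχ') (ne_of_mem_erase hχ').symm
      · rw [card_erase_of_mem hχ, hScard, nsmul_eq_mul]
        simp
  have hsq : ∑ p ∈ P, 1 / (p : ℝ) * ‖∑ χ ∈ S, a χ p‖ ^ 2 ≤ ((J : ℝ) + 1) * (L + J * C) := by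
    calc ∑ p ∈ P, 1 / (p : ℝ) * ‖∑ χ ∈ S, a χ p‖ ^ 2
        = ∑ χ ∈ S, ∑ χ' ∈ S, ∑ p ∈ P,
            1 / (p : ℝ) * (a χ p * (starRingEnd ℂ) (a χ' p)).re := by
          rw [Finset.sum_congr rfl fun χ _ => Finset.sum_comm, Finset.sum_comm]
          refine sum_congr rfl fun p _ => ?_
          rw [← normSq_eq_norm_sq, ← ofReal_re (normSq _), ← mul_conj, map_sum, sum_mul_sum,
            re_sum, mul_sum]
          refine sum_congr rfl fun χ _ => ?_
          rw [re_sum, mul_sum]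
      _ ≤ ∑ χ ∈ S, (L + J * C) := sum_le_sum hinner
      _ = ((J : ℝ) + 1) * (L + J * C) := by
          rw [sum_const, hScard, nsmul_eq_mul]; push_cast; ring
  set r := Real.sqrt ((J : ℝ) + 1) with hr
  have hr0 : 0 < r := Real.sqrt_pos.mpr (by positivity)
  have hrr : r * r = (J : ℝ) + 1 := Real.mul_self_sqrt (by positivity)
  have hlow : ((J : ℝ) + 1) * B < (∑ χ ∈ S, ∑ p ∈ P, f p * (1 / (p : ℝ) : ℝ) * a χ p).re := by
    rw [re_sum]
    have hne : S.Nonempty := card_pos.mp (by omega)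
    calc ((J : ℝ) + 1) * B = ∑ χ ∈ S, B := by
          rw [sum_const, hScard, nsmul_eq_mul]; push_cast; ring
      _ < _ := sum_lt_sum_of_nonempty hne fun χ hχ => by
          rw [← hcorr χ]; exact (hz χ hχ).2.2
  have hup : (∑ χ ∈ S, ∑ p ∈ P, f p * (1 / (p : ℝ) : ℝ) * a χ p).re ≤ κ * (r * (L + J * C)) := by
    refine (re_le_norm _).trans ?_
    rw [Finset.sum_comm]
    calc ‖∑ p ∈ P, ∑ χ ∈ S, f p * (1 / (p : ℝ) : ℝ) * a χ p‖
        ≤ ∑ p ∈ P, κ * (1 / (p : ℝ) * (r / 2) +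
            1 / (2 * r) * (1 / (p : ℝ) * ‖∑ χ ∈ S, a χ p‖ ^ 2)) := by
          refine norm_sum_le_of_le _ fun p hp => ?_
          rw [← mul_sum, norm_mul, norm_mul, norm_real, Real.norm_of_nonneg (by positivity),
            mul_assoc]
          refine mul_le_mul (hf p (hPp p hp)) ?_ (by positivity) hκ
          have hp0 : (0 : ℝ) ≤ 1 / p := by positivity
          have hag : ‖∑ χ ∈ S, a χ p‖ ≤ r / 2 + 1 / (2 * r) * ‖∑ χ ∈ S, a χ p‖ ^ 2 := by
            have : r / 2 + 1 / (2 * r) * ‖∑ χ ∈ S, a χ p‖ ^ 2 - ‖∑ χ ∈ S, a χ p‖ =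
              (r - ‖∑ χ ∈ S, a χ p‖) ^ 2 / (2 * r) := by field_simp; ring
            have h2 : 0 ≤ (r - ‖∑ χ ∈ S, a χ p‖) ^ 2 / (2 * r) := by positivity
            linarith
          calc _ ≤ 1 / (p : ℝ) * (r / 2 + 1 / (2 * r) * ‖∑ χ ∈ S, a χ p‖ ^ 2) :=
                mul_le_mul_of_nonneg_left hag hp0
            _ = _ := by ring
      _ = κ * ((∑ p ∈ P, 1 / (p : ℝ)) * (r / 2) +
            1 / (2 * r) * ∑ p ∈ P, 1 / (p : ℝ) * ‖∑ χ ∈ S, a χ p‖ ^ 2) := by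
          rw [← mul_sum, sum_add_distrib, ← sum_mul, ← mul_sum]
      _ ≤ κ * (L * (r / 2) + 1 / (2 * r) * (((J : ℝ) + 1) * (L + J * C))) := by gcongr
      _ = κ * (r * (L + J * C / 2)) := by
          rw [← hrr]; field_simp; ring
      _ ≤ κ * (r * (L + J * C)) := by
          have : 0 ≤ J * C := by positivity
          gcongr
          linarith
  have hBr : ((J : ℝ) + 1) * B = κ * (r * (L + J * C)) := by
    rw [hB, ← hrr]; field_simp
  linarith

end Repulsion

section SmoothSeries

open Finset

variable {κ : ℝ} {f Λf : ℕ → ℂ}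

lemma norm_one_add_add_le {w v : ℂ} {κ C z : ℝ} (hκ : 0 ≤ κ) (hC : 0 ≤ C)
    (hz1 : z ≤ 1) (hw : ‖w‖ ≤ κ * z) (hv : ‖v‖ ≤ C * z ^ 2) :
    ‖1 + w + v‖ ≤ Real.exp (w.re + (κ ^ 2 / 2 + C * Real.exp κ) * z ^ 2) := by
  have h1 : ‖1 + w‖ ≤ Real.exp (w.re + κ ^ 2 / 2 * z ^ 2) := by
    refine abs_le_of_sq_le_sq' ?_ (Real.exp_nonneg _) |>.2
    rw [← Real.exp_nat_mul, ← normSq_eq_norm_sq, normSq_add]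
    have hw2 : normSq w ≤ κ ^ 2 * z ^ 2 := by
      rw [normSq_eq_norm_sq, ← mul_pow]
      exact pow_le_pow_left₀ (norm_nonneg _) hw 2
    have := Real.add_one_le_exp (((2 : ℕ) : ℝ) * (w.re + κ ^ 2 / 2 * z ^ 2))
    push_cast at this ⊢
    simp only [map_one, one_mul, conj_re]
    linarith
  have hre : -κ ≤ w.re := by
    have h2 := (abs_le.mp (abs_re_le_norm w)).1
    nlinarith
  have h3 : 1 ≤ Real.exp κ * Real.exp (w.re + κ ^ 2 / 2 * z ^ 2) := by
    rw [← Real.exp_add]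
    exact Real.one_le_exp (by nlinarith [sq_nonneg (κ * z)])
  calc ‖1 + w + v‖ ≤ ‖1 + w‖ + ‖v‖ := norm_add_le _ _
    _ ≤ Real.exp (w.re + κ ^ 2 / 2 * z ^ 2) + C * z ^ 2 *
        (Real.exp κ * Real.exp (w.re + κ ^ 2 / 2 * z ^ 2)) := by
        refine add_le_add h1 (hv.trans ?_)
        exact le_mul_of_one_le_right (by positivity) h3
    _ = Real.exp (w.re + κ ^ 2 / 2 * z ^ 2) * (C * Real.exp κ * z ^ 2 + 1) := by ring
    _ ≤ Real.exp (w.re + κ ^ 2 / 2 * z ^ 2) * Real.exp (C * Real.exp κ * z ^ 2) :=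
        mul_le_mul_of_nonneg_left (Real.add_one_le_exp _) (Real.exp_nonneg _)
    _ = _ := by rw [← Real.exp_add]; ring_nf

/-- The terms of the Dirichlet series of `damp f y γ` twisted by a character. -/
def dampTerm {q : ℕ} (f : ℕ → ℂ) (y : ℕ) (γ : ℝ) (χ : DirichletCharacter ℂ q) (s : ℂ) (m : ℕ) :
    ℂ :=
  damp f y γ m * (starRingEnd ℂ) (χ (m : ZMod q)) * (m : ℂ) ^ (-s)

lemma IsHalaszClass.dampTerm_one (h : IsHalaszClass κ f Λf) {q : ℕ} (y : ℕ) (γ : ℝ)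
    (χ : DirichletCharacter ℂ q) (s : ℂ) : dampTerm f y γ χ s 1 = 1 := by
  simp [dampTerm, damp, h.map_one, roughLog_one]

lemma IsHalaszClass.dampTerm_mul (h : IsHalaszClass κ f Λf) {q : ℕ} (y : ℕ) (γ : ℝ)
    (χ : DirichletCharacter ℂ q) (s : ℂ) {m n : ℕ} (hmn : Nat.Coprime m n) :
    dampTerm f y γ χ s (m * n) = dampTerm f y γ χ s m * dampTerm f y γ χ s n := by
  rcases Nat.eq_zero_or_pos m with rfl | hm
  · have : n = 1 := by simpa using hmn
    subst this
    rw [mul_one, h.dampTerm_one, mul_one]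
  rcases Nat.eq_zero_or_pos n with rfl | hn
  · have : m = 1 := by simpa using hmn
    subst this
    rw [one_mul, h.dampTerm_one, one_mul]
  rw [dampTerm, dampTerm, dampTerm, damp, damp, damp, h.mult m n hmn,
    roughLog_mul y m n hm.ne' hn.ne', Nat.cast_mul, Nat.cast_mul, natCast_mul_natCast_cpow,
    map_mul, map_mul, mul_add, neg_add, Real.exp_add, ofReal_mul]
  ring

lemma norm_dampTerm_prime_pow_le {q : ℕ} (f : ℕ → ℂ) (y : ℕ) (γ : ℝ) (χ : DirichletCharacter ℂ q)
    (s : ℂ) {p : ℕ} (hp : p.Prime) (k : ℕ) :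
    ‖dampTerm f y γ χ s (p ^ k)‖ ≤
      ‖f (p ^ k)‖ * ((p : ℝ) ^ (-(if y < p then s.re + γ else s.re))) ^ k := by
  have hp0 : (0 : ℝ) < p := by exact_mod_cast hp.pos
  have hpk : 0 < p ^ k := pow_pos hp.pos k
  rw [dampTerm, norm_mul, norm_mul, RCLike.norm_conj, norm_natCast_cpow_of_pos hpk, norm_damp,
    roughLog_prime_pow y p k hp, neg_re]
  have hχ : ‖χ ((p ^ k : ℕ) : ZMod q)‖ ≤ 1 := χ.norm_le_one _
  have e1 : ((p ^ k : ℕ) : ℝ) ^ (-s.re) = Real.exp (-(s.re * (k * Real.log p))) := by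
    rw [Real.rpow_def_of_pos (by exact_mod_cast hpk)]
    push_cast
    rw [Real.log_pow]; ring_nf
  have e2 : ∀ θ : ℝ, ((p : ℝ) ^ (-θ)) ^ k = Real.exp (-(θ * (k * Real.log p))) := by
    intro θ
    rw [Real.rpow_def_of_pos hp0, ← Real.exp_nat_mul]; ring_nf
  have hle : ∀ A B : ℝ, ‖f (p ^ k)‖ * Real.exp A * ‖χ ((p ^ k : ℕ) : ZMod q)‖ * Real.exp B ≤
      ‖f (p ^ k)‖ * Real.exp (A + B) := by
    intro A B
    rw [Real.exp_add]
    calc _ ≤ ‖f (p ^ k)‖ * Real.exp A * 1 * Real.exp B := by gcongr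
      _ = _ := by ring
  rw [e1, e2]
  refine (hle _ _).trans (le_of_eq ?_)
  split_ifs
  · ring_nf
  · ring_nf

lemma re_dampTerm_prime_le {q : ℕ} (h : IsHalaszClass κ f Λf) (y : ℕ) (γ : ℝ)
    (χ : DirichletCharacter ℂ q) (c t : ℝ) {p : ℕ} (hp : p.Prime) :
    (dampTerm f y γ χ ((c : ℂ) + t * I) p).re ≤ if y < p then
      (f p * (starRingEnd ℂ) (χ (p : ZMod q)) * (p : ℂ) ^ (-(((c + γ : ℝ) : ℂ) + t * I))).re
      else κ * (p : ℝ) ^ (-c) := by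
  split_ifs with hy
  · refine le_of_eq (congrArg re ?_)
    have hr := roughLog_prime_pow y p 1 hp
    rw [pow_one, if_pos hy, Nat.cast_one, one_mul] at hr
    have hp0 : (0 : ℝ) < p := by exact_mod_cast hp.pos
    have hpc : (p : ℂ) ≠ 0 := by exact_mod_cast hp.ne_zero
    have e1 : (Real.exp (-(γ * Real.log p)) : ℂ) = (p : ℂ) ^ (-(γ : ℂ)) := by
      rw [show -(γ * Real.log p) = Real.log p * (-γ) by ring, ← Real.rpow_def_of_pos hp0,
        ofReal_cpow hp0.le]
      simp
    have e2 : -(((c + γ : ℝ) : ℂ) + t * I) = -(γ : ℂ) + -((c : ℂ) + t * I) := by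
      push_cast; ring
    rw [dampTerm, damp, hr, e1, e2, cpow_add _ _ hpc]
    ring
  · refine (re_le_norm _).trans ?_
    have h1 := norm_dampTerm_prime_pow_le f y γ χ ((c : ℂ) + t * I) hp 1
    rw [pow_one, if_neg hy, pow_one] at h1
    refine h1.trans ?_
    have : ((c : ℂ) + t * I).re = c := by simp
    rw [this]
    exact mul_le_mul_of_nonneg_right (h.norm_prime_le hp) (by positivity)

lemma sum_primes_le_rpow_neg_le (y : ℕ) (hy : 2 ≤ y) (c : ℝ) (hc : 1 - 1 / Real.log y ≤ c)
    (S : Finset ℕ) (hS : ∀ p ∈ S, p.Prime ∧ p ≤ y) :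
    ∑ p ∈ S, (p : ℝ) ^ (-c) ≤ Real.log (Real.log y) + 80 := by
  have hly : 0 < Real.log y := Real.log_pos (by exact_mod_cast hy)
  have hl2 : Real.log 2 ≤ Real.log y := Real.log_le_log (by norm_num) (by exact_mod_cast hy)
  have h2 := Real.log_two_gt_d9
  have h1 := sum_primes_inv_le y hy S hS
  have h3 := sum_primes_log_div_le y S hS
  calc ∑ p ∈ S, (p : ℝ) ^ (-c)
      ≤ ∑ p ∈ S, ((1 : ℝ) / p + 3 / Real.log y * (Real.log p / p)) := by
        refine sum_le_sum fun p hp => ?_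
        obtain ⟨hpp, hpy⟩ := hS p hp
        have hp0 : (0 : ℝ) < p := by exact_mod_cast hpp.pos
        have hlp : Real.log p ≤ Real.log y := Real.log_le_log hp0 (by exact_mod_cast hpy)
        have hlp0 : 0 ≤ Real.log p := Real.log_natCast_nonneg p
        have he := exp_le_one_add_mul (Real.log p / Real.log y) 1 (by positivity)
          ((div_le_one hly).mpr hlp)
        calc (p : ℝ) ^ (-c) ≤ (p : ℝ) ^ (1 / Real.log y + -1) :=
              Real.rpow_le_rpow_of_exponent_le (by exact_mod_cast hpp.one_le) (by linarith)
          _ = Real.exp (Real.log p / Real.log y) * (1 / p) := by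
              rw [Real.rpow_add hp0, Real.rpow_neg_one, Real.rpow_def_of_pos hp0, one_div, one_div,
                div_eq_mul_inv]
          _ ≤ (1 + Real.log p / Real.log y * 3) * (1 / p) := by
              refine mul_le_mul_of_nonneg_right (he.trans ?_) (by positivity)
              have := Real.exp_one_lt_d9
              gcongr
              linarith
          _ = _ := by ring
    _ = ∑ p ∈ S, (1 : ℝ) / p + 3 / Real.log y * ∑ p ∈ S, Real.log p / p := by
        rw [sum_add_distrib, mul_sum]
    _ ≤ (Real.log (Real.log y) + 40) + 3 / Real.log y * (Real.log y + (2 + 4)) := by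
        gcongr
        refine h3.trans ?_
        linarith [log_four_le]
    _ = Real.log (Real.log y) + 43 + 18 / Real.log y := by field_simp; ring
    _ ≤ Real.log (Real.log y) + 80 := by
        have : 18 / Real.log y ≤ 18 / (1 / 2) := by gcongr; linarith
        linarith

/-- Absolute convergence of the twisted series of `damp f y γ` over smooth numbers, and its bound
in terms of the correlation of `f` with the character at large primes. -/
theorem exists_norm_tsum_dampTerm_le (κ : ℝ) (K : ℕ) (hK : 2 * κ ≤ K) : ∃ C : ℝ, 0 < C ∧
    ∀ f Λf : ℕ → ℂ, IsHalaszClass κ f Λf → ∀ (q : ℕ) (χ : DirichletCharacter ℂ q) (y N : ℕ)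
    (γ c t : ℝ), 4 ≤ Real.log y → 0 ≤ γ → 1 - 1 / Real.log y ≤ c →
    Summable (fun m : (N + 1).smoothNumbers => ‖dampTerm f y γ χ ((c : ℂ) + t * I) m‖) ∧
    ‖∑' m : (N + 1).smoothNumbers, dampTerm f y γ χ ((c : ℂ) + t * I) m‖ ≤
      C * Real.log y ^ κ *
        Real.exp (primeCorrelation f y N χ (((c + γ : ℝ) : ℂ) + t * I)).re := by
  obtain ⟨C₁, hC₁, hloc⟩ := exists_local_tail_bound K (3 / 5) (by norm_num) (by norm_num)
  set C₂ := |κ ^ 2 / 2 + C₁ * Real.exp κ| with hC₂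
  refine ⟨Real.exp (κ * 80) * Real.exp (C₂ * 3), by positivity,
    fun f Λf h q χ y N γ c t hly hγ hc => ?_⟩
  have hκ := h.kappa_nonneg
  have hly0 : 0 < Real.log y := by linarith
  have hy2 : 2 ≤ y := by
    by_contra hlt
    interval_cases y <;> norm_num at hly0
  have hc34 : 3 / 4 ≤ c := by
    have : 1 / Real.log y ≤ 1 / 4 := one_div_le_one_div_of_le (by norm_num) hly
    linarith
  set s : ℂ := (c : ℂ) + t * I with hs
  have hsre : s.re = c := by simp [hs]
  set θ : ℕ → ℝ := fun p => if y < p then s.re + γ else s.re with hθ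
  have hθ34 : ∀ p, 3 / 4 ≤ θ p := by
    intro p
    simp only [hθ, hsre]
    split_ifs <;> linarith
  have hnn := (h.isDivisorBounded K hK).nonneg
  have hsumm : ∀ p : ℕ, p.Prime → Summable (fun k : ℕ => ‖dampTerm f y γ χ s (p ^ k)‖) := by
    intro p hp
    obtain ⟨h1, -, -⟩ := hloc (fun k => ‖f (p ^ k)‖) (fun k => norm_nonneg _)
      (fun k => (h.isDivisorBounded K hK).le_pow p k hp) ((p : ℝ) ^ (-θ p)) (by positivity)
      (prime_rpow_neg_le p hp _ (hθ34 p))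
    exact h1.of_nonneg_of_le (fun k => norm_nonneg _)
      (fun k => norm_dampTerm_prime_pow_le f y γ χ s hp k)
  obtain ⟨hS, hprod⟩ := EulerProduct.summable_and_hasSum_smoothNumbers_prod_primesBelow_tsum
    (h.dampTerm_one y γ χ s) (fun {m n} hmn => h.dampTerm_mul y γ χ s hmn)
    (fun {p} hp => hsumm p hp) (N + 1)
  refine ⟨hS, ?_⟩
  rw [hprod.tsum_eq, norm_prod]
  have hfac : ∀ p ∈ (N + 1).primesBelow, ‖∑' k : ℕ, dampTerm f y γ χ s (p ^ k)‖ ≤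
      Real.exp ((dampTerm f y γ χ s p).re + C₂ * (p : ℝ) ^ (-(3 / 2) : ℝ)) := by
    intro p hp
    have hpp : p.Prime := (Nat.mem_primesBelow.mp hp).2
    have hp1 : (1 : ℝ) ≤ p := by exact_mod_cast hpp.one_le
    set z := (p : ℝ) ^ (-θ p) with hz
    have hz35 : z ≤ 3 / 5 := prime_rpow_neg_le p hpp _ (hθ34 p)
    have hz0 : 0 ≤ z := by positivity
    obtain ⟨h1, -, h3⟩ := hloc (fun k => ‖f (p ^ k)‖) (fun k => norm_nonneg _)
      (fun k => (h.isDivisorBounded K hK).le_pow p k hpp) z hz0 hz35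
    have hs1 := (hsumm p hpp).of_norm
    have hs2 := (summable_nat_add_iff 2).mpr (hsumm p hpp)
    rw [← hs1.sum_add_tsum_nat_add 2, sum_range_succ, sum_range_succ, sum_range_zero, zero_add,
      pow_zero, pow_one, h.dampTerm_one]
    have hw : ‖dampTerm f y γ χ s p‖ ≤ κ * z := by
      have := norm_dampTerm_prime_pow_le f y γ χ s hpp 1
      rw [pow_one, pow_one] at this
      exact this.trans (mul_le_mul_of_nonneg_right (h.norm_prime_le hpp) hz0)
    have hv : ‖∑' k, dampTerm f y γ χ s (p ^ (k + 2))‖ ≤ C₁ * z ^ 2 := by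
      refine (norm_tsum_le_tsum_norm hs2).trans (le_trans ?_ h3)
      exact Summable.tsum_le_tsum (fun k => norm_dampTerm_prime_pow_le f y γ χ s hpp (k + 2)) hs2
        ((summable_nat_add_iff 2).mpr h1)
    refine (norm_one_add_add_le hκ hC₁.le (by linarith) hw hv).trans ?_
    refine Real.exp_le_exp.mpr (add_le_add le_rfl ?_)
    have hz2 : z ^ 2 ≤ (p : ℝ) ^ (-(3 / 2) : ℝ) := by
      rw [hz, ← Real.rpow_natCast, ← Real.rpow_mul (by positivity)]
      refine Real.rpow_le_rpow_of_exponent_le hp1 ?_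
      push_cast
      linarith [hθ34 p]
    calc _ ≤ C₂ * z ^ 2 := by gcongr; exact le_abs_self _
      _ ≤ _ := by gcongr
  refine (prod_le_prod (fun p _ => norm_nonneg _) hfac).trans ?_
  rw [← Real.exp_sum, sum_add_distrib, ← mul_sum]
  have hpb : (N + 1).primesBelow = (Icc 1 N).filter Nat.Prime := by
    ext p
    rw [Nat.mem_primesBelow, mem_filter, mem_Icc]
    exact ⟨fun hh => ⟨⟨hh.2.one_le, by omega⟩, hh.2⟩, fun hh => ⟨by omega, hh.2⟩⟩
  have h32 := sum_primes_rpow_three_half_le (N + 1).primesBelow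
    (fun p hp => (Nat.mem_primesBelow.mp hp).2)
  have hmain : ∑ p ∈ (N + 1).primesBelow, (dampTerm f y γ χ s p).re ≤
      (primeCorrelation f y N χ (((c + γ : ℝ) : ℂ) + t * I)).re
        + κ * (Real.log (Real.log y) + 80) := by
    refine (sum_le_sum fun p hp =>
      re_dampTerm_prime_le h y γ χ c t (Nat.mem_primesBelow.mp hp).2).trans ?_
    rw [sum_ite, hpb, filter_filter, filter_filter, primeCorrelation, re_sum, ← mul_sum]
    refine add_le_add le_rfl (mul_le_mul_of_nonneg_left ?_ hκ)
    refine sum_primes_le_rpow_neg_le y hy2 c hc _ fun p hp => ?_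
    have := (mem_filter.mp hp).2
    exact ⟨this.1, not_lt.mp this.2⟩
  have hC₂0 : 0 ≤ C₂ := abs_nonneg _
  calc _ ≤ Real.exp ((primeCorrelation f y N χ (((c + γ : ℝ) : ℂ) + t * I)).re
        + κ * (Real.log (Real.log y) + 80) + C₂ * 3) := by
        refine Real.exp_le_exp.mpr (add_le_add hmain ?_)
        exact mul_le_mul_of_nonneg_left h32 hC₂0
    _ = _ := by
        rw [Real.exp_add, Real.exp_add, exp_kappa_mul_log_add κ _ _ hly0]; ring

end SmoothSeries

section PerronIdentity

open Finset

lemma sum_divisors_eq_sum_sum {M : Type*} [AddCommMonoid M] (D : ℕ) (G : ℕ → ℕ → M)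
    (hG : ∀ d k, D < d * k → G d k = 0) :
    ∑ n ∈ Icc 1 D, ∑ d ∈ n.divisors, G d (n / d) = ∑ d ∈ Icc 1 D, ∑ k ∈ Icc 1 D, G d k := by
  rw [← sum_product', ← sum_filter_add_sum_filter_not (Icc 1 D ×ˢ Icc 1 D)
    (fun p : ℕ × ℕ => p.1 * p.2 ≤ D)]
  rw [sum_eq_zero (s := (Icc 1 D ×ˢ Icc 1 D).filter _) (fun p hp =>
    hG p.1 p.2 (not_le.mp (mem_filter.mp hp).2)), add_zero]
  rw [← sum_fiberwise_of_maps_to (t := Icc 1 D) (g := fun p : ℕ × ℕ => p.1 * p.2)]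
  swap
  · intro p hp
    simp only [mem_filter, mem_product, mem_Icc] at hp ⊢
    exact ⟨Nat.mul_pos (by omega) (by omega), hp.2⟩
  refine sum_congr rfl fun n hn => ?_
  rw [← Nat.sum_divisorsAntidiagonal (fun d k => G d k)]
  refine sum_congr ?_ fun _ _ => rfl
  ext p
  simp only [Nat.mem_divisorsAntidiagonal, mem_filter, mem_product, mem_Icc] at hn ⊢
  constructor
  · rintro ⟨h1, h2⟩
    have hp1 : 0 < p.1 := Nat.pos_of_ne_zero fun h => by simp [h] at h1; omega
    have hp2 : 0 < p.2 := Nat.pos_of_ne_zero fun h => by simp [h] at h1; omega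
    have a1 : p.1 ≤ p.1 * p.2 := Nat.le_mul_of_pos_right _ hp2
    have a2 : p.2 ≤ p.1 * p.2 := Nat.le_mul_of_pos_left _ hp1
    exact ⟨⟨⟨⟨hp1, by omega⟩, hp2, by omega⟩, by omega⟩, h1⟩
  · rintro ⟨-, h1⟩
    exact ⟨h1, by omega⟩

lemma natCast_cpow_neg_eq_cexp {n : ℕ} (hn : n ≠ 0) (s : ℂ) :
    (n : ℂ) ^ (-s) = cexp (-(s * (Real.log n : ℝ))) := by
  rw [cpow_def_of_ne_zero (by exact_mod_cast hn), natCast_log]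
  ring_nf

/-- Mellin-type inversion for triple convolutions weighted by a ramp. -/
theorem sum_ramp_mul_eq_integral {q : ℕ} (χ : DirichletCharacter ℂ q) (α β g : ℕ → ℂ) (D N : ℕ)
    {ℓ h c : ℝ} (hh : 0 < h) (hc : 0 < c) (hD : ℓ + h ≤ Real.log ((D : ℝ) + 1)) (hDN : D ≤ N)
    (hsum : Summable fun m : (N + 1).smoothNumbers => ‖g m‖ * ((m : ℕ) : ℝ) ^ (-c))
    (S : Finset ℕ) (hS : S ⊆ Icc 1 D) (hα : ∀ d ∉ S, α d = 0) (hβ : ∀ e ∉ S, β e = 0) :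
    ∑ n ∈ Icc 1 D, (ramp ℓ h (Real.log n) : ℂ) * (starRingEnd ℂ) (χ (n : ZMod q)) *
      ∑ d ∈ n.divisors, ∑ e ∈ (n / d).divisors, α d * β e * g (n / d / e) =
    ∫ t : ℝ, rampKernel ℓ h c t * (dirPoly S (fun d => α d * ((d : ℝ) ^ (-c) : ℝ)) χ t *
      dirPoly S (fun e => β e * ((e : ℝ) ^ (-c) : ℝ)) χ t) *
      ∑' m : (N + 1).smoothNumbers,
        g m * (starRingEnd ℂ) (χ ((m : ℕ) : ZMod q)) * ((m : ℕ) : ℂ) ^ (-((c : ℂ) + t * I)) := by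
  set A := dirPoly S (fun d => α d * ((d : ℝ) ^ (-c) : ℝ)) χ with hA
  set B := dirPoly S (fun e => β e * ((e : ℝ) ^ (-c) : ℝ)) χ with hB
  set KA := ∑ n ∈ S, ‖α n * ((n : ℝ) ^ (-c) : ℝ)‖ with hKA
  set KB := ∑ n ∈ S, ‖β n * ((n : ℝ) ^ (-c) : ℝ)‖ with hKB
  have hS0 : ∀ d ∈ S, d ≠ 0 := fun d hd => by have := mem_Icc.mp (hS hd); omega
  have hpoly : ∀ (a : ℕ → ℂ) (t : ℝ), dirPoly S (fun d => a d * ((d : ℝ) ^ (-c) : ℝ)) χ t =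
      ∑ d ∈ S, a d * (starRingEnd ℂ) (χ (d : ZMod q)) *
        cexp (-(((c : ℂ) + t * I) * (Real.log d : ℝ))) := by
    intro a t
    refine sum_congr rfl fun d hd => ?_
    rw [← natCast_cpow_neg_eq_cexp (hS0 d hd), cpow_neg_eq_rpow_mul_cexp (hS0 d hd)]
    ring
  set W : ℕ → ℕ → ℕ → ℂ := fun d e m =>
    (ramp ℓ h (Real.log ((d * e * m : ℕ) : ℝ)) : ℂ) *
      (starRingEnd ℂ) (χ ((d * e * m : ℕ) : ZMod q)) * (α d * β e * g m) with hW
  have hramp0 : ∀ n : ℕ, D < n → ramp ℓ h (Real.log n) = 0 := by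
    intro n hn
    refine ramp_of_ge hh (hD.trans (Real.log_le_log (by positivity) ?_))
    exact_mod_cast hn
  have hW0 : ∀ d e m, D < d * e * m → W d e m = 0 := by
    intro d e m hlt
    rw [hW]
    simp only
    rw [hramp0 _ hlt, ofReal_zero, zero_mul, zero_mul]
  have hWS : ∀ d e m, (d ∉ S ∨ e ∉ S) → W d e m = 0 := by
    rintro d e m (hd | he)
    · rw [hW]; simp only; rw [hα d hd, zero_mul, zero_mul, mul_zero]
    · rw [hW]; simp only; rw [hβ e he, mul_zero, zero_mul, mul_zero]
  set Φ : (N + 1).smoothNumbers → ℝ → ℂ := fun m t => rampKernel ℓ h c t * (A t * B t) *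
    (g m * (starRingEnd ℂ) (χ ((m : ℕ) : ZMod q)) * ((m : ℕ) : ℂ) ^ (-((c : ℂ) + t * I))) with hΦ
  have hm0 : ∀ m : (N + 1).smoothNumbers, (m : ℕ) ≠ 0 := fun m =>
    Nat.ne_zero_of_mem_smoothNumbers m.2
  have hΦnorm : ∀ m t, ‖Φ m t‖ ≤
      ‖rampKernel ℓ h c t‖ * (KA * KB * (‖g m‖ * ((m : ℕ) : ℝ) ^ (-c))) := by
    intro m t
    rw [hΦ]
    simp only
    rw [norm_mul, norm_mul, norm_mul, norm_mul, norm_mul, RCLike.norm_conj,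
      norm_natCast_cpow_of_pos (Nat.pos_of_ne_zero (hm0 m))]
    have hre : (-((c : ℂ) + t * I)).re = -c := by simp
    rw [hre]
    have h1 : ‖A t‖ ≤ KA := norm_dirPoly_le _ _ _ _
    have h2 : ‖B t‖ ≤ KB := norm_dirPoly_le _ _ _ _
    have h3 : ‖χ ((m : ℕ) : ZMod q)‖ ≤ 1 := χ.norm_le_one _
    have hKA0 : 0 ≤ KA := (norm_nonneg _).trans h1
    calc _ ≤ ‖rampKernel ℓ h c t‖ * (KA * KB) * (‖g m‖ * 1 * ((m : ℕ) : ℝ) ^ (-c)) := by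
          gcongr
      _ = _ := by ring
  have hΦcont : ∀ m, Continuous (Φ m) := by
    intro m
    have h1 : Continuous (rampKernel ℓ h c) := continuous_rampKernel ℓ h hc
    have h2 : Continuous A := continuous_dirPoly _ _ _
    have h3 : Continuous B := continuous_dirPoly _ _ _
    have h4 : Continuous fun t : ℝ => ((m : ℕ) : ℂ) ^ (-((c : ℂ) + t * I)) := by
      simp_rw [natCast_cpow_neg_eq_cexp (hm0 m)]
      fun_prop
    exact (h1.mul (h2.mul h3)).mul (continuous_const.mul h4)
  have hki := integrable_rampKernel ℓ hh hc
  have hΦint : ∀ m, Integrable (Φ m) := fun m =>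
    (hki.norm.mul_const _).mono' (hΦcont m).aestronglyMeasurable
      (Filter.Eventually.of_forall (hΦnorm m))
  have hΦsum : Summable fun m => ∫ t, ‖Φ m t‖ := by
    refine Summable.of_nonneg_of_le (fun m => integral_nonneg fun t => norm_nonneg _) (fun m => ?_)
      ((hsum.mul_left (KA * KB)).mul_left (∫ t, ‖rampKernel ℓ h c t‖))
    calc ∫ t, ‖Φ m t‖ ≤ ∫ t, ‖rampKernel ℓ h c t‖ *
            (KA * KB * (‖g m‖ * ((m : ℕ) : ℝ) ^ (-c))) :=
          integral_mono (hΦint m).norm (hki.norm.mul_const _) (hΦnorm m)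
      _ = _ := integral_mul_const _ _
  have hswap := (hasSum_integral_of_summable_integral_norm hΦint hΦsum).tsum_eq
  have hΦval : ∀ m, ∫ t, Φ m t = ∑ d ∈ S, ∑ e ∈ S, W d e m := by
    intro m
    have hexp : ∀ t, Φ m t = ∑ d ∈ S, ∑ e ∈ S,
        (starRingEnd ℂ) (χ ((d * e * m : ℕ) : ZMod q)) * (α d * β e * g m) *
        (rampKernel ℓ h c t *
          cexp (-(((c : ℂ) + t * I) * (Real.log ((d * e * m : ℕ) : ℝ) : ℝ)))) := by
      intro t
      rw [hΦ]
      simp only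
      rw [hA, hB, hpoly α t, hpoly β t, sum_mul_sum, mul_sum, sum_mul]
      refine sum_congr rfl fun d hd => ?_
      rw [mul_sum, sum_mul]
      refine sum_congr rfl fun e he => ?_
      have hlog : Real.log ((d * e * m : ℕ) : ℝ) =
          Real.log d + Real.log e + Real.log (m : ℕ) := by
        push_cast
        rw [Real.log_mul (mul_ne_zero (by exact_mod_cast hS0 d hd) (by exact_mod_cast hS0 e he))
          (by exact_mod_cast hm0 m), Real.log_mul (by exact_mod_cast hS0 d hd)
          (by exact_mod_cast hS0 e he)]
      rw [natCast_cpow_neg_eq_cexp (hm0 m), hlog, ofReal_add, ofReal_add, mul_add, mul_add,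
        neg_add, neg_add, Complex.exp_add, Complex.exp_add, Nat.cast_mul, Nat.cast_mul, map_mul,
        map_mul, map_mul, map_mul]
      ring
    have hEi : ∀ v : ℝ, Integrable fun t : ℝ =>
        rampKernel ℓ h c t * cexp (-(((c : ℂ) + t * I) * v)) := by
      intro v
      refine hki.mul_bdd (c := Real.exp (-(c * v))) ?_ ?_
      · exact (by fun_prop : Continuous fun t : ℝ =>
          cexp (-(((c : ℂ) + t * I) * v))).aestronglyMeasurable
      · refine Filter.Eventually.of_forall fun t => ?_
        rw [← mul_neg, ← ofReal_neg, norm_cexp_add_mul_I_mul, mul_neg]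
    simp_rw [hexp]
    rw [integral_finsetSum _ fun d _ => integrable_finsetSum _ fun e _ => (hEi _).const_mul _]
    refine sum_congr rfl fun d _ => ?_
    rw [integral_finsetSum _ fun e _ => (hEi _).const_mul _]
    refine sum_congr rfl fun e _ => ?_
    rw [integral_const_mul, ← ramp_eq_integral ℓ hh hc]
    rw [hW]
    ring
  have hRHS : (∫ t : ℝ, rampKernel ℓ h c t * (A t * B t) * ∑' m : (N + 1).smoothNumbers,
      g m * (starRingEnd ℂ) (χ ((m : ℕ) : ZMod q)) * ((m : ℕ) : ℂ) ^ (-((c : ℂ) + t * I))) =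
      ∑ m ∈ Icc 1 D, ∑ d ∈ S, ∑ e ∈ S, W d e m := by
    have h1 : ∀ t, rampKernel ℓ h c t * (A t * B t) * ∑' m : (N + 1).smoothNumbers,
        g m * (starRingEnd ℂ) (χ ((m : ℕ) : ZMod q)) * ((m : ℕ) : ℂ) ^ (-((c : ℂ) + t * I)) =
        ∑' m, Φ m t := fun t => tsum_mul_left.symm
    simp_rw [h1]
    rw [← hswap]
    simp_rw [hΦval]
    rw [tsum_subtype (N + 1).smoothNumbers (fun m => ∑ d ∈ S, ∑ e ∈ S, W d e m),
      tsum_eq_sum (s := Icc 1 D)]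
    · refine sum_congr rfl fun m hm => Set.indicator_of_mem ?_ _
      have := mem_Icc.mp hm
      exact Nat.mem_smoothNumbers_of_lt this.1 (by omega)
    · intro m hm
      by_cases hms : m ∈ (N + 1).smoothNumbers
      · rw [Set.indicator_of_mem hms]
        have hm1 : m ≠ 0 := Nat.ne_zero_of_mem_smoothNumbers hms
        rw [mem_Icc] at hm
        refine sum_eq_zero fun d hd => sum_eq_zero fun e he => hW0 d e m ?_
        have := Nat.mul_pos (Nat.pos_of_ne_zero (hS0 d hd)) (Nat.pos_of_ne_zero (hS0 e he))
        have := Nat.le_mul_of_pos_left m this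
        omega
      · exact Set.indicator_of_notMem hms _
  rw [hRHS]
  have hL : ∀ n ∈ Icc 1 D, (ramp ℓ h (Real.log n) : ℂ) * (starRingEnd ℂ) (χ (n : ZMod q)) *
      ∑ d ∈ n.divisors, ∑ e ∈ (n / d).divisors, α d * β e * g (n / d / e) =
      ∑ d ∈ n.divisors, ∑ e ∈ (n / d).divisors, W d e (n / d / e) := by
    intro n _
    rw [mul_sum]
    refine sum_congr rfl fun d hd => ?_
    rw [mul_sum]
    refine sum_congr rfl fun e he => ?_
    have : d * e * (n / d / e) = n := by
      rw [mul_assoc, Nat.mul_div_cancel' (Nat.dvd_of_mem_divisors he),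
        Nat.mul_div_cancel' (Nat.dvd_of_mem_divisors hd)]
    rw [hW]
    simp only
    rw [this]
  rw [sum_congr rfl hL, sum_divisors_eq_sum_sum D (fun d k => ∑ e ∈ k.divisors, W d e (k / e))]
  · have h2 : ∀ d ∈ Icc 1 D, ∑ k ∈ Icc 1 D, ∑ e ∈ k.divisors, W d e (k / e) =
        ∑ e ∈ Icc 1 D, ∑ m ∈ Icc 1 D, W d e m := by
      intro d hd
      refine sum_divisors_eq_sum_sum D (fun e m => W d e m) fun e m hlt => hW0 d e m ?_
      have := Nat.le_mul_of_pos_left (e * m) (mem_Icc.mp hd).1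
      rw [mul_assoc]
      omega
    rw [sum_congr rfl h2]
    rw [sum_congr rfl fun d _ => sum_comm, sum_comm]
    refine sum_congr rfl fun m _ => ?_
    refine (sum_subset hS fun d _ hd => sum_eq_zero fun e _ => hWS d e m (Or.inl hd)).symm.trans ?_
    refine sum_congr rfl fun d _ => ?_
    exact (sum_subset hS fun e _ he => hWS d e m (Or.inr he)).symm
  · intro d k hlt
    refine sum_eq_zero fun e he => hW0 d e _ ?_
    rwa [mul_assoc, Nat.mul_div_cancel' (Nat.dvd_of_mem_divisors he)]

end PerronIdentity

section BilinearIntegral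

open Finset ArithmeticFunction

lemma exists_energy_le : ∃ C : ℝ, 0 < C ∧ ∀ (q : ℕ) [NeZero q] (T κ θ : ℝ) (y D : ℕ) (a : ℕ → ℂ),
    1 ≤ T → 0 ≤ κ → |θ| ≤ 1 → 2 ^ 20 ≤ (y : ℝ) → (q * T) ^ 5 ≤ (y : ℝ) →
    (∀ n ∈ Ioc y D, ‖a n‖ ≤ κ * (n : ℝ) ^ θ * (vonMangoldt n / n)) →
    ∑ χ : DirichletCharacter ℂ q, ∫ t : ℝ, cuspKernel (t / T) * ‖dirPoly (Ioc y D) a χ t‖ ^ 2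
      ≤ C * κ ^ 2 * ∑ n ∈ Ioc y D, vonMangoldt n / n * (n : ℝ) ^ (2 * θ) := by
  obtain ⟨C, hC, h⟩ := exists_mean_value_dirPoly
  refine ⟨C, hC, fun q _ T κ θ y D a hT hκ hθ hy hqy ha => ?_⟩
  have hpos : ∀ n ∈ Ioc y D, (0 : ℝ) < n := fun n hn => by
    have := (mem_Ioc.mp hn).1
    exact_mod_cast (by omega : 0 < n)
  refine (h q T hT (Ioc y D) (fun n hn => ?_) a (fun n => κ * (n : ℝ) ^ θ)
    (fun n => by positivity) ha fun n hn m hm hnm => ?_).trans (le_of_eq ?_)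
  · have : (y : ℝ) ≤ n := by exact_mod_cast (mem_Ioc.mp hn).1.le
    exact ⟨hy.trans this, hqy.trans this⟩
  · have h1 : 1 / T ≤ 1 := (div_le_one (by linarith)).mpr hT
    have h2 : θ * (Real.log m - Real.log n) ≤ 1 := by
      refine (le_abs_self _).trans ?_
      rw [abs_mul]
      exact mul_le_one₀ hθ (abs_nonneg _) (hnm.trans h1)
    have h3 : (m : ℝ) ^ θ ≤ 3 * (n : ℝ) ^ θ := by
      rw [Real.rpow_def_of_pos (hpos m hm), Real.rpow_def_of_pos (hpos n hn)]
      calc _ = Real.exp (θ * (Real.log m - Real.log n)) * Real.exp (Real.log n * θ) := by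
            rw [← Real.exp_add]; ring_nf
        _ ≤ Real.exp 1 * Real.exp (Real.log n * θ) := by gcongr
        _ ≤ _ := by
            have := Real.exp_one_lt_d9
            gcongr
            linarith
    calc κ * (m : ℝ) ^ θ ≤ κ * (3 * (n : ℝ) ^ θ) := by gcongr
      _ = _ := by ring
  · rw [mul_assoc C, Finset.mul_sum (Ioc y D) _ (κ ^ 2)]
    congr 1
    refine sum_congr rfl fun n hn => ?_
    rw [mul_pow, ← Real.rpow_natCast ((n : ℝ) ^ θ) 2, ← Real.rpow_mul (hpos n hn).le, mul_comm θ]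
    push_cast
    ring

lemma sum_vonMangoldt_Ioc_rpow_neg_le {u δ : ℝ} (hu : 0 < u) (hδ : 0 ≤ δ) (huδ : u + δ ≤ 1)
    (y D : ℕ) :
    ∑ n ∈ Ioc y D, vonMangoldt n / n * (n : ℝ) ^ (2 * (-u - δ / 2)) ≤ 12 / (u + δ) := by
  have h1 := sum_vonMangoldt_rpow_le (2 * u + δ) (by linarith) D
  have h2 : 1 / (2 * u + δ) ≤ 1 / (u + δ) := one_div_le_one_div_of_le (by linarith) (by linarith)
  have h3 : 1 ≤ 1 / (u + δ) := by rw [le_div_iff₀ (by linarith)]; linarith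
  have h4 := log_four_le
  calc _ ≤ ∑ n ∈ Icc 1 D, vonMangoldt n / n * (n : ℝ) ^ (2 * (-u - δ / 2)) := by
        refine sum_le_sum_of_subset_of_nonneg (fun n hn => ?_) fun n _ _ =>
          mul_nonneg (div_nonneg vonMangoldt_nonneg (by positivity)) (by positivity)
        rw [mem_Ioc] at hn
        exact mem_Icc.mpr ⟨by omega, hn.2⟩
    _ = ∑ n ∈ Icc 1 D, vonMangoldt n / n * (n : ℝ) ^ (-(2 * u + δ)) := by ring_nf
    _ ≤ _ := h1
    _ ≤ 12 * (1 / (u + δ)) := by linarith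
    _ = _ := by ring

lemma sum_vonMangoldt_Ioc_rpow_le {u δ : ℝ} (hu : 0 < u) (hδ : 0 ≤ δ) (huδ : u + δ ≤ 1)
    (y D : ℕ) :
    ∑ n ∈ Ioc y D, vonMangoldt n / n * (n : ℝ) ^ (2 * (-u + δ / 2)) ≤
      12 * (D : ℝ) ^ δ / (u + δ) := by
  have h4 := log_four_le
  have h3 : 1 ≤ 1 / (u + δ) := by rw [le_div_iff₀ (by linarith)]; linarith
  have hsub : ∑ n ∈ Ioc y D, vonMangoldt n / n * (n : ℝ) ^ (2 * (-u + δ / 2)) ≤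
      ∑ n ∈ Icc 1 D, vonMangoldt n / n * (n : ℝ) ^ (2 * (-u + δ / 2)) := by
    refine sum_le_sum_of_subset_of_nonneg (fun n hn => ?_) fun n _ _ =>
      mul_nonneg (div_nonneg vonMangoldt_nonneg (by positivity)) (by positivity)
    rw [mem_Ioc] at hn
    exact mem_Icc.mpr ⟨by omega, hn.2⟩
  refine hsub.trans ?_
  have hD : 0 ≤ (D : ℝ) ^ δ := by positivity
  rcases le_or_gt δ u with hle | hlt
  · have h1 := sum_vonMangoldt_rpow_le (2 * u) (by linarith) D
    have h2 : 1 / (2 * u) ≤ 1 / (u + δ) := one_div_le_one_div_of_le (by linarith) (by linarith)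
    calc _ ≤ ∑ n ∈ Icc 1 D, (D : ℝ) ^ δ * (vonMangoldt n / n * (n : ℝ) ^ (-(2 * u))) := by
          refine sum_le_sum fun n hn => ?_
          rw [mem_Icc] at hn
          have hn0 : (0 : ℝ) < n := by exact_mod_cast hn.1
          have hnD : (n : ℝ) ^ δ ≤ (D : ℝ) ^ δ :=
            Real.rpow_le_rpow hn0.le (by exact_mod_cast hn.2) hδ
          have hΛ : 0 ≤ vonMangoldt n / (n : ℝ) := div_nonneg vonMangoldt_nonneg (by positivity)
          rw [show 2 * (-u + δ / 2) = δ + -(2 * u) by ring, Real.rpow_add hn0]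
          calc _ = (n : ℝ) ^ δ * (vonMangoldt n / n * (n : ℝ) ^ (-(2 * u))) := by ring
            _ ≤ _ := by gcongr
      _ = (D : ℝ) ^ δ * ∑ n ∈ Icc 1 D, vonMangoldt n / n * (n : ℝ) ^ (-(2 * u)) := by
          rw [mul_sum]
      _ ≤ (D : ℝ) ^ δ * (12 * (1 / (u + δ))) := by gcongr; linarith
      _ = _ := by ring
  · have hδ0 : 0 < δ := by linarith
    have h1 := sum_vonMangoldt_rpow_sub_one_le δ hδ0 (by linarith) D
    calc _ ≤ ∑ n ∈ Icc 1 D, vonMangoldt n * (n : ℝ) ^ (-(1 - δ)) := by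
          refine sum_le_sum fun n hn => ?_
          rw [mem_Icc] at hn
          have hn0 : (0 : ℝ) < n := by exact_mod_cast hn.1
          rw [div_mul_eq_mul_div, mul_div_assoc]
          refine mul_le_mul_of_nonneg_left ?_ vonMangoldt_nonneg
          rw [div_eq_mul_inv, ← Real.rpow_neg_one, ← Real.rpow_add hn0]
          exact Real.rpow_le_rpow_of_exponent_le (by exact_mod_cast hn.1) (by linarith)
      _ ≤ (Real.log 4 + 4) * ((D : ℝ) ^ δ / δ) := h1
      _ ≤ 6 * ((D : ℝ) ^ δ / ((u + δ) / 2)) := by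
          gcongr
          · linarith
          · linarith
      _ = _ := by
          have : u + δ ≠ 0 := by linarith
          field_simp
          ring

theorem exists_bilinear_integral_le : ∃ C : ℝ, 0 < C ∧ ∀ (q : ℕ) [NeZero q] (T κ u δ R : ℝ)
    (y D : ℕ) (S : Finset (DirichletCharacter ℂ q)) (a b : ℕ → ℂ) (k : ℝ → ℂ)
    (F : DirichletCharacter ℂ q → ℝ → ℂ),
    1 ≤ T → 0 ≤ κ → 0 < u → 0 ≤ δ → u + δ ≤ 1 → 0 ≤ R → 1 ≤ D → 2 ^ 20 ≤ (y : ℝ) →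
    (q * T) ^ 5 ≤ (y : ℝ) →
    (∀ n ∈ Ioc y D, ‖a n‖ ≤ κ * (n : ℝ) ^ (-u + δ / 2) * (vonMangoldt n / n)) →
    (∀ n ∈ Ioc y D, ‖b n‖ ≤ κ * (n : ℝ) ^ (-u - δ / 2) * (vonMangoldt n / n)) →
    (∀ χ ∈ S, ∀ t, ‖k t‖ * ‖F χ t‖ ≤ R * cuspKernel (t / T)) →
    ∑ χ ∈ S, ‖∫ t : ℝ, k t * (dirPoly (Ioc y D) a χ t * dirPoly (Ioc y D) b χ t) * F χ t‖ ≤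
      C * κ ^ 2 * R * (D : ℝ) ^ (δ / 2) / (u + δ) := by
  obtain ⟨C, hC, h⟩ := exists_energy_le
  refine ⟨12 * C, by positivity, ?_⟩
  intro q _ T κ u δ R y D S a b k F hT hκ hu hδ huδ hR hD hy hqy ha hb hk
  set U := Ioc y D with hU
  have hD0 : (0 : ℝ) < D := by exact_mod_cast hD
  set r := (D : ℝ) ^ (-(δ / 2)) with hr
  have hr0 : 0 < r := by positivity
  have hci := integrable_cuspKernel_scaled (T := T) (by linarith)
  have hEA := (h q T κ (-u + δ / 2) y D a hT hκ (abs_le.mpr ⟨by linarith, by linarith⟩) hy hqy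
    ha).trans (mul_le_mul_of_nonneg_left (sum_vonMangoldt_Ioc_rpow_le hu hδ huδ y D)
      (by positivity))
  have hEB := (h q T κ (-u - δ / 2) y D b hT hκ (abs_le.mpr ⟨by linarith, by linarith⟩) hy hqy
    hb).trans (mul_le_mul_of_nonneg_left (sum_vonMangoldt_Ioc_rpow_neg_le hu hδ huδ y D)
      (by positivity))
  rw [← hU] at hEA hEB
  set EA := fun χ : DirichletCharacter ℂ q => ∫ t : ℝ, cuspKernel (t / T) * ‖dirPoly U a χ t‖ ^ 2
    with hEAdef
  set EB := fun χ : DirichletCharacter ℂ q => ∫ t : ℝ, cuspKernel (t / T) * ‖dirPoly U b χ t‖ ^ 2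
    with hEBdef
  have hEA0 : ∀ χ, 0 ≤ EA χ := fun χ =>
    integral_nonneg fun t => mul_nonneg (cuspKernel_nonneg _) (by positivity)
  have hEB0 : ∀ χ, 0 ≤ EB χ := fun χ =>
    integral_nonneg fun t => mul_nonneg (cuspKernel_nonneg _) (by positivity)
  have hpt : ∀ χ ∈ S, ‖∫ t : ℝ, k t * (dirPoly U a χ t * dirPoly U b χ t) * F χ t‖ ≤
      R * (r / 2) * EA χ + R * (1 / (2 * r)) * EB χ := by
    intro χ hχ
    have hia := (integrable_mul_norm_sq_dirPoly hci U a χ).const_mul (R * (r / 2))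
    have hib := (integrable_mul_norm_sq_dirPoly hci U b χ).const_mul (R * (1 / (2 * r)))
    refine (norm_integral_le_of_norm_le (hia.add hib)
      (Filter.Eventually.of_forall fun t => ?_)).trans (le_of_eq ?_)
    · set A := ‖dirPoly U a χ t‖ with hA
      set B := ‖dirPoly U b χ t‖ with hB
      have hag : A * B ≤ r / 2 * A ^ 2 + 1 / (2 * r) * B ^ 2 := by
        have e : r / 2 * A ^ 2 + 1 / (2 * r) * B ^ 2 - A * B = (r * A - B) ^ 2 / (2 * r) := by
          field_simp; ring
        have : 0 ≤ (r * A - B) ^ 2 / (2 * r) := by positivity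
        linarith
      have hAB : 0 ≤ A * B := by positivity
      have hRc : 0 ≤ R * cuspKernel (t / T) := mul_nonneg hR (cuspKernel_nonneg _)
      rw [norm_mul, norm_mul, norm_mul]
      calc ‖k t‖ * (A * B) * ‖F χ t‖ = ‖k t‖ * ‖F χ t‖ * (A * B) := by ring
        _ ≤ R * cuspKernel (t / T) * (A * B) := mul_le_mul_of_nonneg_right (hk χ hχ t) hAB
        _ ≤ R * cuspKernel (t / T) * (r / 2 * A ^ 2 + 1 / (2 * r) * B ^ 2) :=
            mul_le_mul_of_nonneg_left hag hRc
        _ = _ := by simp only [Pi.add_apply]; ring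
    · rw [integral_add' hia hib, integral_const_mul, integral_const_mul]
  have hA : ∑ χ ∈ S, EA χ ≤ C * κ ^ 2 * (12 * (D : ℝ) ^ δ / (u + δ)) :=
    (sum_le_sum_of_subset_of_nonneg (subset_univ S) fun χ _ _ => hEA0 χ).trans hEA
  have hB : ∑ χ ∈ S, EB χ ≤ C * κ ^ 2 * (12 / (u + δ)) :=
    (sum_le_sum_of_subset_of_nonneg (subset_univ S) fun χ _ _ => hEB0 χ).trans hEB
  have e1 : r * (D : ℝ) ^ δ = (D : ℝ) ^ (δ / 2) := by
    rw [hr, ← Real.rpow_add hD0]; ring_nf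
  have e2 : 1 / r = (D : ℝ) ^ (δ / 2) := by
    rw [hr, Real.rpow_neg hD0.le, one_div, inv_inv]
  calc _ ≤ ∑ χ ∈ S, (R * (r / 2) * EA χ + R * (1 / (2 * r)) * EB χ) := sum_le_sum hpt
    _ = R * (r / 2) * ∑ χ ∈ S, EA χ + R * (1 / (2 * r)) * ∑ χ ∈ S, EB χ := by
        rw [sum_add_distrib, mul_sum, mul_sum]
    _ ≤ R * (r / 2) * (C * κ ^ 2 * (12 * (D : ℝ) ^ δ / (u + δ))) +
        R * (1 / (2 * r)) * (C * κ ^ 2 * (12 / (u + δ))) := by gcongr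
    _ = 6 * C * κ ^ 2 * R * (r * (D : ℝ) ^ δ) / (u + δ) +
        6 * C * κ ^ 2 * R * (1 / r) / (u + δ) := by
        field_simp; ring
    _ = _ := by rw [e1, e2]; ring

end BilinearIntegral

section BilinearSum

open Finset ArithmeticFunction

/-- A series which is small for `|t| ≤ T` and moderate for all `t`, weighted by the ramp kernel,
is dominated by the cusp kernel. -/
lemma norm_rampKernel_mul_le {ℓ h c T A : ℝ} (hh : 0 < h) (hc : 1 / 2 ≤ c) (hT : 0 < T)
    (hA : 0 ≤ A) {F : ℝ → ℂ} (h1 : ∀ t, |t| ≤ T → ‖F t‖ ≤ A) (h2 : ∀ t, ‖F t‖ ≤ h * T ^ 2 * A)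
    (t : ℝ) :
    ‖rampKernel ℓ h c t‖ * ‖F t‖ ≤ 40 * Real.exp (c * (ℓ + h)) * A * cuspKernel (t / T) := by
  have hcusp := sq_div_le_cuspKernel_scaled hT t
  set E := Real.exp (c * (ℓ + h)) with hE
  have hE0 : 0 < E := Real.exp_pos _
  have hpos : 0 < t ^ 2 + T ^ 2 := by positivity
  suffices hs : ‖rampKernel ℓ h c t‖ * ‖F t‖ ≤ 4 * E * A * (T ^ 2 / (t ^ 2 + T ^ 2)) by
    calc _ ≤ _ := hs
      _ ≤ 4 * E * A * (10 * cuspKernel (t / T)) := by gcongr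
      _ = _ := by ring
  rcases le_or_gt |t| T with ht | ht
  · have hk : ‖rampKernel ℓ h c t‖ ≤ 2 * E := by
      refine (norm_rampKernel_le' hh (by linarith) t).trans ?_
      rw [div_le_iff₀ (by linarith)]
      nlinarith
    have hhalf : 1 / 2 ≤ T ^ 2 / (t ^ 2 + T ^ 2) := by
      rw [div_le_div_iff₀ (by norm_num) hpos]
      have : t ^ 2 ≤ T ^ 2 := sq_le_sq' (by linarith [(abs_le.mp ht).1]) (abs_le.mp ht).2
      linarith
    calc _ ≤ 2 * E * A := mul_le_mul hk (h1 t ht) (norm_nonneg _) (by positivity)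
      _ = 4 * E * A * (1 / 2) := by ring
      _ ≤ _ := by gcongr
  · have ht2 : T ^ 2 ≤ t ^ 2 := by
      rw [← sq_abs t]; exact pow_le_pow_left₀ hT.le ht.le 2
    have ht0 : 0 < t ^ 2 := lt_of_lt_of_le (by positivity) ht2
    have hk : ‖rampKernel ℓ h c t‖ ≤ E / (h * t ^ 2) := by
      refine (norm_rampKernel_le hh (by linarith) t).trans ?_
      have : t ^ 2 ≤ c ^ 2 + t ^ 2 := by linarith [sq_nonneg c]
      gcongr
    calc _ ≤ E / (h * t ^ 2) * (h * T ^ 2 * A) :=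
          mul_le_mul hk (h2 t) (norm_nonneg _) (by positivity)
      _ = E * A * T ^ 2 * (1 / t ^ 2) := by field_simp
      _ ≤ E * A * T ^ 2 * (4 / (t ^ 2 + T ^ 2)) := by
          gcongr ?_ * ?_
          rw [div_le_div_iff₀ ht0 hpos]
          linarith
      _ = _ := by ring

lemma IsHalaszClass.summable_norm_damp {κ : ℝ} {f Λf : ℕ → ℂ} (h : IsHalaszClass κ f Λf)
    (y N : ℕ) {γ c : ℝ} (hy : 4 ≤ Real.log y) (hγ : 0 ≤ γ) (hc : 1 - 1 / Real.log y ≤ c) :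
    Summable fun m : (N + 1).smoothNumbers => ‖damp f y γ m‖ * ((m : ℕ) : ℝ) ^ (-c) := by
  obtain ⟨K, hK⟩ := exists_nat_ge (2 * κ)
  obtain ⟨C, _, hC⟩ := exists_norm_tsum_dampTerm_le κ K hK
  refine (hC f Λf h 1 1 y N γ c 0 hy hγ hc).1.congr fun m => ?_
  have hm0 : ((m : ℕ) : ℝ) ≠ 0 := by exact_mod_cast Nat.ne_zero_of_mem_smoothNumbers m.2
  have h1 : (1 : DirichletCharacter ℂ 1) ((m : ℕ) : ZMod 1) = 1 :=
    MulChar.one_apply (isUnit_of_subsingleton _)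
  rw [dampTerm, norm_mul, norm_mul, h1, _root_.map_one, norm_one, mul_one, ← ofReal_natCast,
    norm_cpow_eq_rpow_re_of_pos (lt_of_le_of_ne (by positivity) hm0.symm)]
  simp

lemma IsHalaszClass.norm_dampLambda_mul_rpow_le {κ : ℝ} {f Λf : ℕ → ℂ} (h : IsHalaszClass κ f Λf)
    (y : ℕ) (α c : ℝ) {d : ℕ} (hd : d ≠ 0) :
    ‖dampLambda Λf y α d * ((d : ℝ) ^ (-c) : ℝ)‖ ≤
      κ * (d : ℝ) ^ (1 - c - α) * (vonMangoldt d / d) := by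
  have hd0 : (0 : ℝ) < d := by exact_mod_cast Nat.pos_of_ne_zero hd
  rw [dampLambda, norm_mul, norm_mul, norm_real, norm_real, Real.norm_of_nonneg (Real.exp_nonneg _),
    Real.norm_of_nonneg (by positivity)]
  have h1 : Real.exp (-(α * Real.log d)) = (d : ℝ) ^ (-α) := by
    rw [Real.rpow_def_of_pos hd0]; ring_nf
  have h2 : (d : ℝ) ^ (1 - c - α) = d * ((d : ℝ) ^ (-α) * (d : ℝ) ^ (-c)) := by
    rw [← Real.rpow_add hd0, show 1 - c - α = 1 + (-α + -c) by ring, Real.rpow_add hd0,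
      Real.rpow_one]
  rw [h1, h2, mul_assoc]
  calc _ ≤ κ * vonMangoldt d * ((d : ℝ) ^ (-α) * (d : ℝ) ^ (-c)) := by
        gcongr
        exact h.norm_roughLambda_le y d
    _ = _ := by field_simp

lemma sum_divisors_dampLambda_cutoff {κ : ℝ} {f Λf : ℕ → ℂ} (h : IsHalaszClass κ f Λf)
    (g : ℕ → ℂ) (y D : ℕ) (α γ : ℝ) {n : ℕ} (hn : n ∈ Icc 1 D) :
    ∑ d ∈ n.divisors, ∑ e ∈ (n / d).divisors,
      dampLambda Λf y α d * dampLambda Λf y γ e * g (n / d / e) =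
    ∑ d ∈ n.divisors, ∑ e ∈ (n / d).divisors,
      (if d ∈ Ioc y D then dampLambda Λf y α d else 0) *
        (if e ∈ Ioc y D then dampLambda Λf y γ e else 0) * g (n / d / e) := by
  rw [mem_Icc] at hn
  have key : ∀ (a : ℝ) (d : ℕ), d ≤ D →
      dampLambda Λf y a d = if d ∈ Ioc y D then dampLambda Λf y a d else 0 := by
    intro a d hd
    split_ifs with hm
    · rfl
    · by_contra hne
      have hr : roughLambda Λf y d ≠ 0 := fun h0 => hne (by simp [dampLambda, h0])
      obtain ⟨p, k, hp, hk, hyp, rfl⟩ := h.roughLambda_ne_zero hr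
      exact hm (mem_Ioc.mpr ⟨hyp.trans_le (Nat.le_self_pow (by omega) p), hd⟩)
  refine sum_congr rfl fun d hd => sum_congr rfl fun e he => ?_
  have hd' := Nat.divisor_le hd
  have he' := (Nat.divisor_le he).trans (Nat.div_le_self n d)
  rw [← key α d (hd'.trans hn.2), ← key γ e (he'.trans hn.2)]

theorem exists_norm_bilinear_sum_le (κ : ℝ) : ∃ C : ℝ, 0 < C ∧ ∀ f Λf : ℕ → ℂ,
    IsHalaszClass κ f Λf → ∀ (q : ℕ) [NeZero q] (S : Finset (DirichletCharacter ℂ q))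
    (w : DirichletCharacter ℂ q → ℂ) (y D N : ℕ) (ℓ h u T α γ A : ℝ),
    (∀ χ, ‖w χ‖ ≤ 1) → 1 ≤ T → 0 < u → 0 ≤ α → α ≤ γ → γ ≤ 1 / Real.log y → u + (γ - α) ≤ 1 →
    0 < h → h ≤ 1 → 0 ≤ ℓ → u * ℓ ≤ 2 → ℓ + h ≤ Real.log ((D : ℝ) + 1) →
    (D : ℝ) ≤ Real.exp (ℓ + h) → 1 ≤ D → D ≤ N → 2 ^ 20 ≤ (y : ℝ) → (q * T) ^ 5 ≤ (y : ℝ) →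
    0 ≤ A →
    (∀ χ ∈ S, ∀ t : ℝ, |t| ≤ T → ‖∑' m : (N + 1).smoothNumbers,
      dampTerm f y γ χ (((1 + u - (α + γ) / 2 : ℝ) : ℂ) + t * I) m‖ ≤ A) →
    (∀ χ ∈ S, ∀ t : ℝ, ‖∑' m : (N + 1).smoothNumbers,
      dampTerm f y γ χ (((1 + u - (α + γ) / 2 : ℝ) : ℂ) + t * I) m‖ ≤ h * T ^ 2 * A) →
    ‖∑ n ∈ Icc 1 D, (ramp ℓ h (Real.log n) : ℂ) *
      (∑ χ ∈ S, w χ * (starRingEnd ℂ) (χ (n : ZMod q))) *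
      ∑ d ∈ n.divisors, ∑ e ∈ (n / d).divisors,
        dampLambda Λf y α d * dampLambda Λf y γ e * damp f y γ (n / d / e)‖ ≤
      C * A * Real.exp ℓ * (Real.exp (-(α * ℓ)) / (u + (γ - α))) := by
  obtain ⟨C, hC, hB⟩ := exists_bilinear_integral_le
  refine ⟨C * (κ ^ 2 + 1) * 40 * Real.exp 4, by positivity, ?_⟩
  intro f Λf hf q _ S w y D N ℓ h u T α γ A hw hT hu hα hαγ hγ huδ hh hh1 hℓ huℓ hℓD hDe hD hDN
    hy hqy hA hF1 hF2
  have hκ := hf.kappa_nonneg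
  have hly : 8 ≤ Real.log y := by
    have h1 : Real.log (2 ^ 20) ≤ Real.log y := Real.log_le_log (by norm_num) hy
    have h2 := Real.log_two_gt_d9
    rw [Real.log_pow] at h1
    push_cast at h1
    linarith
  have hη : 1 / Real.log y ≤ 1 / 8 := one_div_le_one_div_of_le (by norm_num) hly
  set c : ℝ := 1 + u - (α + γ) / 2 with hc
  have hc34 : 1 / 2 ≤ c := by linarith
  set α' : ℕ → ℂ := fun d => if d ∈ Ioc y D then dampLambda Λf y α d else 0 with hα'
  set β' : ℕ → ℂ := fun d => if d ∈ Ioc y D then dampLambda Λf y γ d else 0 with hβ'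
  have hsub : Ioc y D ⊆ Icc 1 D := fun n hn => by
    rw [mem_Ioc] at hn; exact mem_Icc.mpr ⟨by omega, hn.2⟩
  have hsum := hf.summable_norm_damp y N (γ := γ) (c := c) (by linarith) (by linarith)
    (by linarith)
  set F : DirichletCharacter ℂ q → ℝ → ℂ := fun χ t => ∑' m : (N + 1).smoothNumbers,
      dampTerm f y γ χ ((c : ℂ) + t * I) m with hFdef
  have hid := fun χ : DirichletCharacter ℂ q => sum_ramp_mul_eq_integral χ α' β' (damp f y γ) D N
    hh (by linarith : 0 < c) hℓD hDN hsum (Ioc y D) hsub (fun d hd => if_neg hd)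
    (fun d hd => if_neg hd)
  have hbound : ∀ (a c' : ℝ), c' = 1 - c - a → ∀ n ∈ Ioc y D,
      ‖(if n ∈ Ioc y D then dampLambda Λf y a n else 0) * ((n : ℝ) ^ (-c) : ℝ)‖ ≤
      κ * (n : ℝ) ^ c' * (vonMangoldt n / n) := by
    intro a c' hc' n hn
    rw [if_pos hn, hc']
    exact hf.norm_dampLambda_mul_rpow_le y a c (by have := (mem_Ioc.mp hn).1; omega)
  have hmain := hB q T κ u (γ - α) (40 * Real.exp (c * (ℓ + h)) * A) y D S
    (fun d => α' d * ((d : ℝ) ^ (-c) : ℝ)) (fun d => β' d * ((d : ℝ) ^ (-c) : ℝ))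
    (rampKernel ℓ h c) F hT hκ hu (by linarith) huδ (by positivity) hD hy hqy
    (hbound α _ (by rw [hc]; ring)) (hbound γ _ (by rw [hc]; ring))
    (fun χ hχ t => norm_rampKernel_mul_le hh hc34 (by linarith) hA (hF1 χ hχ) (hF2 χ hχ) t)
  have hD0 : (0 : ℝ) < D := by exact_mod_cast hD
  have hDpow : (D : ℝ) ^ ((γ - α) / 2) ≤ Real.exp ((γ - α) / 2 * (ℓ + h)) := by
    calc _ ≤ (Real.exp (ℓ + h)) ^ ((γ - α) / 2) :=
          Real.rpow_le_rpow hD0.le hDe (by linarith)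
      _ = _ := by rw [← Real.exp_mul]; ring_nf
  have hexp : Real.exp (c * (ℓ + h)) * (D : ℝ) ^ ((γ - α) / 2) ≤
      Real.exp 4 * (Real.exp ℓ * Real.exp (-(α * ℓ))) := by
    calc _ ≤ Real.exp (c * (ℓ + h)) * Real.exp ((γ - α) / 2 * (ℓ + h)) := by gcongr
      _ = Real.exp ((1 + u - α) * (ℓ + h)) := by rw [← Real.exp_add, hc]; ring_nf
      _ ≤ Real.exp (4 + (ℓ + -(α * ℓ))) := by
          apply Real.exp_le_exp.mpr
          nlinarith
      _ = _ := by rw [Real.exp_add, Real.exp_add]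
  have hu0 : 0 < u + (γ - α) := by linarith
  have heq : ∑ n ∈ Icc 1 D, (ramp ℓ h (Real.log n) : ℂ) *
      (∑ χ ∈ S, w χ * (starRingEnd ℂ) (χ (n : ZMod q))) *
      ∑ d ∈ n.divisors, ∑ e ∈ (n / d).divisors,
        dampLambda Λf y α d * dampLambda Λf y γ e * damp f y γ (n / d / e) =
      ∑ χ ∈ S, w χ * ∫ t : ℝ, rampKernel ℓ h c t *
        (dirPoly (Ioc y D) (fun d => α' d * ((d : ℝ) ^ (-c) : ℝ)) χ t *
        dirPoly (Ioc y D) (fun d => β' d * ((d : ℝ) ^ (-c) : ℝ)) χ t) * F χ t := by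
    calc _ = ∑ n ∈ Icc 1 D, ∑ χ ∈ S, w χ * ((ramp ℓ h (Real.log n) : ℂ) *
          (starRingEnd ℂ) (χ (n : ZMod q)) * ∑ d ∈ n.divisors, ∑ e ∈ (n / d).divisors,
          α' d * β' e * damp f y γ (n / d / e)) := by
          refine sum_congr rfl fun n hn => ?_
          rw [sum_divisors_dampLambda_cutoff hf (damp f y γ) y D α γ hn, Finset.mul_sum S, sum_mul S]
          exact sum_congr rfl fun χ _ => by ring
      _ = ∑ χ ∈ S, w χ * ∑ n ∈ Icc 1 D, ((ramp ℓ h (Real.log n) : ℂ) *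
          (starRingEnd ℂ) (χ (n : ZMod q)) * ∑ d ∈ n.divisors, ∑ e ∈ (n / d).divisors,
          α' d * β' e * damp f y γ (n / d / e)) := by
          rw [sum_comm]
          exact sum_congr rfl fun χ _ => by rw [Finset.mul_sum]
      _ = _ := sum_congr rfl fun χ _ => by rw [hid χ]; rfl
  rw [heq]
  calc _ ≤ _ := (norm_sum_le _ _).trans (sum_le_sum fun χ _ => by
        rw [norm_mul]
        exact mul_le_of_le_one_left (norm_nonneg _) (hw χ))
    _ ≤ C * κ ^ 2 * (40 * Real.exp (c * (ℓ + h)) * A) * (D : ℝ) ^ ((γ - α) / 2) /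
        (u + (γ - α)) := hmain
    _ = C * κ ^ 2 * 40 * A * (Real.exp (c * (ℓ + h)) * (D : ℝ) ^ ((γ - α) / 2)) /
        (u + (γ - α)) := by ring
    _ ≤ C * (κ ^ 2 + 1) * 40 * A * (Real.exp 4 * (Real.exp ℓ * Real.exp (-(α * ℓ)))) /
        (u + (γ - α)) := by
        clear_value F c
        clear hid hmain hbound heq hsum hsub
        gcongr
        linarith
    _ = _ := by ring

end BilinearSum

section BilinearAverage

open Finset ArithmeticFunction

lemma integral_exp_neg_mul_le {ℓ η : ℝ} (hℓ : 0 < ℓ) :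
    ∫ α in (0 : ℝ)..η, Real.exp (-(α * ℓ)) ≤ 1 / ℓ := by
  have hd : ∀ x : ℝ, HasDerivAt (fun a => -(Real.exp (-(a * ℓ)) / ℓ)) (Real.exp (-(x * ℓ))) x := by
    intro x
    have h1 : HasDerivAt (fun a : ℝ => -(a * ℓ)) (-ℓ) x := (hasDerivAt_mul_const ℓ).neg
    exact (h1.exp.div_const ℓ).neg.congr_deriv (by field_simp)
  rw [intervalIntegral.integral_eq_sub_of_hasDerivAt (fun x _ => hd x)
    ((by fun_prop : Continuous fun α : ℝ => Real.exp (-(α * ℓ))).intervalIntegrable _ _)]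
  have : 0 ≤ Real.exp (-(η * ℓ)) / ℓ := by positivity
  simp only [zero_mul, neg_zero, Real.exp_zero]
  linarith

lemma continuousOn_inv_add_sub {u α η : ℝ} (hu : 0 < u) (hα : α ≤ η) :
    ContinuousOn (fun γ : ℝ => 1 / (u + (γ - α))) (Set.uIcc α η) := by
  refine ContinuousOn.div continuousOn_const (by fun_prop) fun γ hγ => ?_
  rw [Set.uIcc_of_le hα] at hγ
  linarith [hγ.1]

lemma integral_inv_add_sub_le {u α η : ℝ} (hu : 0 < u) (h0 : 0 ≤ α) (hα : α ≤ η) :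
    ∫ γ in α..η, 1 / (u + (γ - α)) ≤ Real.log (1 + η / u) := by
  have hd : ∀ x ∈ Set.uIcc α η, HasDerivAt (fun γ => Real.log (u + (γ - α)))
      (1 / (u + (x - α))) x := by
    intro x hx
    rw [Set.uIcc_of_le hα] at hx
    exact (((hasDerivAt_id x).sub_const α).const_add u).log (by simp only [id]; linarith [hx.1])
  rw [intervalIntegral.integral_eq_sub_of_hasDerivAt hd
    (continuousOn_inv_add_sub hu hα).intervalIntegrable, sub_self, add_zero,
    ← Real.log_div (by linarith) hu.ne']
  refine Real.log_le_log (div_pos (by linarith) hu) ?_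
  rw [add_div, div_self hu.ne']
  gcongr
  linarith

theorem exists_norm_bilinearPart_sum_le (κ : ℝ) : ∃ C : ℝ, 0 < C ∧ ∀ f Λf : ℕ → ℂ,
    IsHalaszClass κ f Λf → ∀ (q : ℕ) [NeZero q] (S : Finset (DirichletCharacter ℂ q))
    (w : DirichletCharacter ℂ q → ℂ) (y D N : ℕ) (ℓ h u T η A : ℝ),
    (∀ χ, ‖w χ‖ ≤ 1) → 1 ≤ T → 0 < u → 0 ≤ η → η ≤ 1 / Real.log y → u + η ≤ 1 →
    0 < h → h ≤ 1 → 0 < ℓ → u * ℓ ≤ 2 → ℓ + h ≤ Real.log ((D : ℝ) + 1) →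
    (D : ℝ) ≤ Real.exp (ℓ + h) → 1 ≤ D → D ≤ N → 2 ^ 20 ≤ (y : ℝ) → (q * T) ^ 5 ≤ (y : ℝ) →
    0 ≤ A →
    (∀ α γ : ℝ, 0 ≤ α → α ≤ γ → γ ≤ η → ∀ χ ∈ S, ∀ t : ℝ, |t| ≤ T →
      ‖∑' m : (N + 1).smoothNumbers,
        dampTerm f y γ χ (((1 + u - (α + γ) / 2 : ℝ) : ℂ) + t * I) m‖ ≤ A) →
    (∀ α γ : ℝ, 0 ≤ α → α ≤ γ → γ ≤ η → ∀ χ ∈ S, ∀ t : ℝ, ‖∑' m : (N + 1).smoothNumbers,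
      dampTerm f y γ χ (((1 + u - (α + γ) / 2 : ℝ) : ℂ) + t * I) m‖ ≤ h * T ^ 2 * A) →
    ‖∑ n ∈ Icc 1 D, (ramp ℓ h (Real.log n) : ℂ) *
      (∑ χ ∈ S, w χ * (starRingEnd ℂ) (χ (n : ZMod q))) *
      ∫ α in (0 : ℝ)..η, bilinearPart f Λf y η α n‖ ≤
      C * A * Real.exp ℓ * (Real.log (1 + η / u) / ℓ) := by
  obtain ⟨C, hC, hB⟩ := exists_norm_bilinear_sum_le κ
  refine ⟨C, hC, ?_⟩
  intro f Λf hf q _ S w y D N ℓ h u T η A hw hT hu hη hηy huη hh hh1 hℓ huℓ hℓD hDe hD hDN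
    hy hqy hA hF1 hF2
  set W : ℕ → ℂ := fun n => (ramp ℓ h (Real.log n) : ℂ) *
      (∑ χ ∈ S, w χ * (starRingEnd ℂ) (χ (n : ZMod q))) with hW
  set G := C * A * Real.exp ℓ with hG
  have hG0 : 0 ≤ G := by positivity
  have hlog0 : 0 ≤ Real.log (1 + η / u) := Real.log_nonneg (by linarith [div_nonneg hη hu.le])
  have hinner : ∀ α ∈ Set.Ioc 0 η, ‖∑ n ∈ Icc 1 D, W n * bilinearPart f Λf y η α n‖ ≤
      G * Real.log (1 + η / u) * Real.exp (-(α * ℓ)) := by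
    intro α hα
    have hint : ∑ n ∈ Icc 1 D, W n * bilinearPart f Λf y η α n =
        ∫ γ in α..η, ∑ n ∈ Icc 1 D, W n * ∑ d ∈ n.divisors, ∑ e ∈ (n / d).divisors,
          dampLambda Λf y α d * dampLambda Λf y γ e * damp f y γ (n / d / e) := by
      rw [intervalIntegral.integral_finsetSum]
      · refine sum_congr rfl fun n hn => ?_
        rw [hf.bilinearPart_eq_integral y η α (by have := (mem_Icc.mp hn).1; omega),
          intervalIntegral.integral_const_mul]
      · intro n _
        apply Continuous.intervalIntegrable
        refine continuous_const.mul (continuous_finsetSum _ fun d _ =>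
          continuous_finsetSum _ fun e _ => ?_)
        exact (continuous_const.mul (continuous_dampLambda _ _ _)).mul (continuous_damp _ _ _)
    rw [hint]
    have hci := ((continuousOn_inv_add_sub hu hα.2).const_mul
      (G * Real.exp (-(α * ℓ)))).intervalIntegrable (μ := volume)
    refine (intervalIntegral.norm_integral_le_of_norm_le hα.2 (ae_of_all _ fun γ hγ => ?_)
      hci).trans ?_
    · refine (hB f Λf hf q S w y D N ℓ h u T α γ A hw hT hu hα.1.le hγ.1.le (hγ.2.trans hηy)
        (by linarith [hα.1, hγ.2]) hh hh1 hℓ.le huℓ hℓD hDe hD hDN hy hqy hA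
        (hF1 α γ hα.1.le hγ.1.le hγ.2) (hF2 α γ hα.1.le hγ.1.le hγ.2)).trans (le_of_eq ?_)
      rw [hG]; ring
    · rw [intervalIntegral.integral_const_mul]
      calc _ ≤ G * Real.exp (-(α * ℓ)) * Real.log (1 + η / u) := by
            gcongr
            exact integral_inv_add_sub_le hu hα.1.le hα.2
        _ = _ := by ring
  have hcb : Continuous fun α : ℝ => G * Real.log (1 + η / u) * Real.exp (-(α * ℓ)) := by fun_prop
  calc _ = ‖∫ α in (0 : ℝ)..η, ∑ n ∈ Icc 1 D, W n * bilinearPart f Λf y η α n‖ := by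
        rw [intervalIntegral.integral_finsetSum]
        · congr 1
          exact sum_congr rfl fun n _ => (intervalIntegral.integral_const_mul _ _).symm
        · exact fun n _ => (continuous_const.mul
            (continuous_bilinearPart f Λf y n η)).intervalIntegrable _ _
    _ ≤ ∫ α in (0 : ℝ)..η, G * Real.log (1 + η / u) * Real.exp (-(α * ℓ)) :=
        intervalIntegral.norm_integral_le_of_norm_le hη (ae_of_all _ hinner)
          (hcb.intervalIntegrable _ _)
    _ ≤ G * Real.log (1 + η / u) * (1 / ℓ) := by
        rw [intervalIntegral.integral_const_mul]
        gcongr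
        exact integral_exp_neg_mul_le hℓ
    _ = _ := by ring

end BilinearAverage

section NoncorrelatingSeries

open Finset ArithmeticFunction

lemma re_primeCorrelation_le {q : ℕ} {κ : ℝ} (f : ℕ → ℂ) (hκ : 0 ≤ κ)
    (hf : ∀ p : ℕ, p.Prime → ‖f p‖ ≤ κ) (y N : ℕ) (χ : DirichletCharacter ℂ q) {σ : ℝ}
    (hσ : 0 ≤ σ) (t : ℝ) :
    (primeCorrelation f y N χ (((1 + σ : ℝ) : ℂ) + t * I)).re ≤
      κ * ∑ p ∈ (Icc 1 N).filter (fun p => p.Prime ∧ y < p), 1 / (p : ℝ) := by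
  refine (re_le_norm _).trans ((norm_sum_le _ _).trans ?_)
  rw [Finset.mul_sum]
  refine sum_le_sum fun p hp => ?_
  have hpp := (mem_filter.mp hp).2.1
  have hp0 : (0 : ℝ) < p := by exact_mod_cast hpp.pos
  have h1 : ‖(p : ℂ) ^ (-(((1 + σ : ℝ) : ℂ) + t * I))‖ ≤ 1 / (p : ℝ) := by
    rw [← ofReal_natCast, norm_cpow_eq_rpow_re_of_pos hp0]
    simp only [neg_re, add_re, ofReal_re, mul_re, I_re, mul_zero, ofReal_im, I_im, mul_one,
      sub_self, add_zero]
    rw [one_div, ← Real.rpow_neg_one]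
    exact Real.rpow_le_rpow_of_exponent_le (by exact_mod_cast hpp.one_le) (by linarith)
  rw [norm_mul, norm_mul, RCLike.norm_conj]
  calc _ ≤ κ * 1 * (1 / (p : ℝ)) := by
        gcongr
        · exact hf p hpp
        · exact χ.norm_le_one _
    _ = _ := by ring

theorem exists_noncorrelating_series_bound (κ : ℝ) (J : ℕ) : ∃ C : ℝ, 0 < C ∧ ∀ f Λf : ℕ → ℂ,
    IsHalaszClass κ f Λf → ∀ (q : ℕ) [NeZero q] (y N : ℕ) (T u L h : ℝ), 0 ≤ T → 0 ≤ L →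
    2 ^ 20 ≤ (y : ℝ) → q * (2 * T + 3) ≤ (y : ℝ) → 0 < u → 1 / u ≤ Real.log N → 1 / u ≤ y →
    ∑ p ∈ (Icc 1 N).filter (fun p => p.Prime ∧ y < p), 1 / (p : ℝ) ≤ L →
    Real.exp (κ * L) ≤ h * T ^ 2 →
    ∃ 𝒳 : Finset (DirichletCharacter ℂ q), 𝒳.card ≤ J ∧ ∀ χ ∉ 𝒳, ∀ α γ : ℝ, 0 ≤ α → α ≤ γ →
      γ ≤ 1 / Real.log y →
      (∀ t : ℝ, |t| ≤ T → ‖∑' m : (N + 1).smoothNumbers,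
        dampTerm f y γ χ (((1 + u - (α + γ) / 2 : ℝ) : ℂ) + t * I) m‖ ≤
          C * Real.log y ^ κ * Real.exp (κ * L / Real.sqrt ((J : ℝ) + 1))) ∧
      ∀ t : ℝ, ‖∑' m : (N + 1).smoothNumbers,
        dampTerm f y γ χ (((1 + u - (α + γ) / 2 : ℝ) : ℂ) + t * I) m‖ ≤
          h * T ^ 2 * (C * Real.log y ^ κ * Real.exp (κ * L / Real.sqrt ((J : ℝ) + 1))) := by
  obtain ⟨C₁, hC₁, hR⟩ := exists_repulsion
  obtain ⟨K, hK⟩ := exists_nat_ge (2 * κ)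
  obtain ⟨C₂, hC₂, hS⟩ := exists_norm_tsum_dampTerm_le κ K hK
  set E := Real.exp (|κ| * (J * C₁)) with hE
  have hE1 : 1 ≤ E := Real.one_le_exp (by positivity)
  refine ⟨C₂ * E, by positivity, ?_⟩
  intro f Λf hf q _ y N T u L h hT hL hy hqy hu huN huy hsum hTh
  have hκ := hf.kappa_nonneg
  have hly : 4 ≤ Real.log y := by
    have h1 : Real.log (2 ^ 20) ≤ Real.log y := Real.log_le_log (by norm_num) hy
    have h2 := Real.log_two_gt_d9
    rw [Real.log_pow] at h1
    push_cast at h1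
    linarith
  have hY : 0 ≤ Real.log y ^ κ := by positivity
  set s := Real.sqrt ((J : ℝ) + 1) with hs
  have hs1 : 1 ≤ s := Real.one_le_sqrt.mpr (by linarith [Nat.cast_nonneg (α := ℝ) J])
  obtain ⟨𝒳, hcard, h𝒳⟩ := hR κ J f q y N T u L hκ (fun p hp => hf.norm_prime_le hp) hT hy hqy hu
    huN huy hsum
  refine ⟨𝒳, hcard, fun χ hχ α γ hα hαγ hγ => ?_⟩
  set c := 1 + u - (α + γ) / 2 with hc
  have hcγ : c + γ = 1 + (u + (γ - α) / 2) := by rw [hc]; ring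
  have hseries := fun t => (hS f Λf hf q χ y N γ c t hly (by linarith) (by linarith)).2
  rw [hcγ] at hseries
  constructor
  · intro t ht
    refine (hseries t).trans ?_
    have h1 := h𝒳 χ hχ (u + (γ - α) / 2) t (by linarith) ht
    have h2 : κ * (L + J * C₁) / s ≤ κ * L / s + κ * (J * C₁) := by
      rw [mul_add, add_div]
      gcongr
      exact div_le_self (by positivity) hs1
    calc _ ≤ C₂ * Real.log y ^ κ * Real.exp (κ * L / s + κ * (J * C₁)) := by
          gcongr
          exact h1.trans h2
      _ = _ := by rw [Real.exp_add, hE, abs_of_nonneg hκ]; ring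
  · intro t
    refine (hseries t).trans ?_
    have h1 := (re_primeCorrelation_le f hκ (fun p hp => hf.norm_prime_le hp) y N χ
      (σ := u + (γ - α) / 2) (by linarith) t).trans (mul_le_mul_of_nonneg_left hsum hκ)
    have h2 : 1 ≤ Real.exp (κ * L / s) := Real.one_le_exp (by positivity)
    calc _ ≤ C₂ * Real.log y ^ κ * (h * T ^ 2) := by
          gcongr
          exact (Real.exp_le_exp.mpr h1).trans hTh
      _ = h * T ^ 2 * (C₂ * 1 * Real.log y ^ κ * 1) := by ring
      _ ≤ _ := by
          have : 0 ≤ h * T ^ 2 := (Real.exp_pos _).le.trans hTh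
          gcongr

end NoncorrelatingSeries

section ProgressionErrorTerm

open Finset ArithmeticFunction

/-- A majorant for the part of `f` not captured by the bilinear part, for sums up to `M`. -/
def errorMajorant (κ : ℝ) (f : ℕ → ℂ) (y M n : ℕ) : ℝ :=
  (if M < n then ‖f n‖ else 0) + ‖damp f y (1 / Real.log y) n‖ +
    κ * ∑ d ∈ n.divisors.filter (IsRoughPrimePow y), ‖damp f y (1 / Real.log y) (n / d)‖

lemma IsHalaszClass.errorMajorant_nonneg {κ : ℝ} {f Λf : ℕ → ℂ} (h : IsHalaszClass κ f Λf)
    (y M n : ℕ) : 0 ≤ errorMajorant κ f y M n := by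
  have := h.kappa_nonneg
  unfold errorMajorant
  split_ifs <;> positivity

lemma log_add_le_log_floor {x h : ℝ} (hx : 0 < x) :
    Real.log x + h ≤ Real.log ((⌊x * Real.exp h⌋₊ : ℝ) + 1) := by
  rw [← Real.log_exp h, ← Real.log_mul hx.ne' (Real.exp_ne_zero _), Real.log_exp]
  exact Real.log_le_log (by positivity) (Nat.lt_floor_add_one _).le

lemma floor_le_exp_log_add {x h : ℝ} (hx : 0 < x) :
    (⌊x * Real.exp h⌋₊ : ℝ) ≤ Real.exp (Real.log x + h) := by
  rw [Real.exp_add, Real.exp_log hx]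
  exact Nat.floor_le (by positivity)

lemma floor_mul_exp_le {x h : ℝ} (hx : 0 < x) (hh1 : h ≤ 1) :
    (⌊x * Real.exp h⌋₊ : ℝ) ≤ 3 * x := by
  have h1 : Real.exp h ≤ 3 := (Real.exp_le_exp.mpr hh1).trans (by linarith [Real.exp_one_lt_d9])
  exact (Nat.floor_le (by positivity)).trans (by nlinarith)

lemma floor_mul_exp_sub_le {x h : ℝ} (hx : 0 < x) (hh : 0 < h) (hh1 : h ≤ 1) :
    (⌊x * Real.exp h⌋₊ : ℝ) - ⌊x⌋₊ ≤ 2 * (h * x) + 1 := by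
  have h1 := Nat.floor_le (by positivity : 0 ≤ x * Real.exp h)
  have h2 := Nat.lt_floor_add_one x
  have h3 := Real.abs_exp_sub_one_le (x := h) (by rw [abs_of_pos hh]; exact hh1)
  rw [abs_of_pos hh] at h3
  have h4 := (abs_le.mp h3).2
  nlinarith

lemma half_le_floor_mul_exp {x h : ℝ} (hx : 2 ≤ x) (hh : 0 < h) :
    x / 2 ≤ (⌊x * Real.exp h⌋₊ : ℝ) := by
  have h2 := Nat.lt_floor_add_one (x * Real.exp h)
  have h3 : 1 ≤ Real.exp h := Real.one_le_exp hh.le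
  nlinarith

lemma log_floor_mul_exp_bounds {x h Z : ℝ} (hx : 2 ≤ x) (hh : 0 < h) (hh1 : h ≤ 1) (hZ : 4 ≤ Z)
    (hx1 : Z / 2 ≤ Real.log x) (hx2 : Real.log x ≤ 2 * Z) :
    Z / 4 ≤ Real.log (⌊x * Real.exp h⌋₊ : ℝ) ∧ Real.log (⌊x * Real.exp h⌋₊ : ℝ) ≤ 3 * Z := by
  have h0 := half_le_floor_mul_exp hx hh
  constructor
  · have h1 := Real.log_le_log (by linarith) h0
    rw [Real.log_div (by linarith) (by norm_num)] at h1
    have := Real.log_two_lt_d9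
    linarith
  · have h1 := Real.log_le_log (by linarith) (floor_le_exp_log_add (h := h) (by linarith : 0 < x))
    rw [Real.log_exp] at h1
    linarith

lemma exists_sum_short_interval_le (κ : ℝ) (K : ℕ) (hK : 2 * κ ≤ K) : ∃ C : ℝ, 0 < C ∧
    ∀ f Λf : ℕ → ℂ, IsHalaszClass κ f Λf → ∀ (q a M D : ℕ) (x h Z : ℝ), 1 ≤ q → Nat.Coprime a q →
    4 ≤ Z → 0 < x → h = Z ^ (-(κ ^ 2 + 2)) → (q : ℝ) ≤ h * x → q ^ 2 ≤ D → 2 ≤ D →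
    Real.log D ≤ 3 * Z → (D : ℝ) / (q.totient * Real.log D) ≤ 12 * (x / (q.totient * Z)) →
    (D : ℝ) - M ≤ 2 * (h * x) + 1 → M ≤ D →
    ∑ n ∈ (Icc 1 D).filter (fun n => n ≡ a [MOD q]), (if M < n then ‖f n‖ else 0) ≤
      C * (x / (q.totient * Z)) := by
  obtain ⟨C₁, hC₁, hsq⟩ := exists_sq_sum_norm_le κ K hK
  set C₄ := 1 + 96 * C₁ * 3 ^ (κ ^ 2) with hC₄
  have hC₄1 : 1 ≤ C₄ := by rw [hC₄]; linarith [show 0 ≤ 96 * C₁ * (3 : ℝ) ^ (κ ^ 2) by positivity]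
  refine ⟨C₄, by positivity, ?_⟩
  intro f Λf hf q a M D x h Z hq haq hZ hx0 hh hqx hqD hD2 hlD2 hdens hDM hMD
  have hZ0 : 0 < Z := by linarith
  have hh0 : 0 < h := by rw [hh]; positivity
  have hq0 : (0 : ℝ) < q := by exact_mod_cast hq
  have hφ0 : (0 : ℝ) < q.totient := by exact_mod_cast Nat.totient_pos.mpr hq
  have hφq : (q.totient : ℝ) ≤ q := by exact_mod_cast Nat.totient_le q
  have hlD0 : 0 < Real.log D := Real.log_pos (by exact_mod_cast hD2)
  rw [← sum_filter, filter_filter]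
  set S := (Icc 1 D).filter (fun n => n ≡ a [MOD q] ∧ M < n) with hS
  have hSsub : S ⊆ (Icc 1 D).filter (fun n => n ≡ a [MOD q]) := fun n hn => by
    rw [hS, mem_filter] at hn
    exact mem_filter.mpr ⟨hn.1, hn.2.1⟩
  have hcard : (S.card : ℝ) ≤ 4 * (h * x) / q := by
    have h1 := (abs_le.mp (card_Ioc_modEq_sub_le M (D - M) q a hq)).2
    have h2 : S ⊆ (Ioc M (M + (D - M))).filter (fun n => n ≡ a [MOD q]) := fun n hn => by
      rw [hS, mem_filter, mem_Icc] at hn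
      exact mem_filter.mpr ⟨mem_Ioc.mpr ⟨hn.2.2, by omega⟩, hn.2.1⟩
    have h3 : (S.card : ℝ) ≤ _ := Nat.cast_le.mpr (card_le_card h2)
    have h4 : (((D - M : ℕ) : ℝ)) ≤ 3 * (h * x) := by
      rw [Nat.cast_sub hMD]
      have : (1 : ℝ) ≤ q := by exact_mod_cast hq
      linarith
    have h5 : ((D - M : ℕ) : ℝ) / q ≤ 3 * (h * x) / q := by gcongr
    have h6 : 1 ≤ h * x / q := by rw [le_div_iff₀ hq0]; linarith
    calc (S.card : ℝ) ≤ 3 * (h * x) / q + h * x / q := by linarith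
      _ = _ := by ring
  have h1 := hsq f Λf hf q D a hq hqD hD2 haq S hSsub
  have hpow : Real.log D ^ (κ ^ 2) ≤ 3 ^ (κ ^ 2) * Z ^ (κ ^ 2) := by
    rw [← Real.mul_rpow (by norm_num) hZ0.le]
    exact Real.rpow_le_rpow hlD0.le hlD2 (sq_nonneg κ)
  have hhZ : h * Z ^ (κ ^ 2) = 1 / Z ^ 2 := by
    rw [hh, ← Real.rpow_add hZ0, show -(κ ^ 2 + 2) + κ ^ 2 = -(2 : ℕ) by push_cast; ring,
      Real.rpow_neg hZ0.le, Real.rpow_natCast, one_div]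
  refine abs_le_of_sq_le_sq' ?_ (by positivity) |>.2
  calc (∑ n ∈ S, ‖f n‖) ^ 2 ≤ _ := h1
    _ ≤ 4 * (h * x) / q.totient * (C₁ * (12 * (x / (q.totient * Z))) *
        (3 ^ (κ ^ 2) * Z ^ (κ ^ 2))) := by
        refine mul_le_mul (hcard.trans (by gcongr)) (by gcongr) (by positivity) (by positivity)
    _ = 48 * C₁ * 3 ^ (κ ^ 2) * (x / (q.totient)) ^ 2 * ((h * Z ^ (κ ^ 2)) / Z) := by
        field_simp; ring
    _ = 48 * C₁ * 3 ^ (κ ^ 2) * (x / (q.totient)) ^ 2 * (1 / Z ^ 2) * (1 / Z) := by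
        rw [hhZ]; ring
    _ ≤ C₄ * (x / (q.totient)) ^ 2 * (1 / Z ^ 2) * 1 := by
        gcongr
        · rw [hC₄]; nlinarith [show 0 ≤ C₁ * (3 : ℝ) ^ (κ ^ 2) by positivity]
        · rw [div_le_one hZ0]; linarith
    _ = C₄ * (x / (q.totient * Z)) ^ 2 := by field_simp
    _ ≤ C₄ ^ 2 * (x / (q.totient * Z)) ^ 2 := by
        gcongr
        nlinarith
    _ = _ := by ring

theorem exists_sum_errorMajorant_le (κ : ℝ) : ∃ C : ℝ, 0 < C ∧ ∀ f Λf : ℕ → ℂ,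
    IsHalaszClass κ f Λf → ∀ (q y a : ℕ) (x h Z : ℝ), 1 ≤ q → Nat.Coprime a q → 4 ≤ Z →
    2 ≤ x → Z / 2 ≤ Real.log x → Real.log x ≤ 2 * Z → h = Z ^ (-(κ ^ 2 + 2)) →
    (q : ℝ) ≤ h * x → q ^ 2 ≤ ⌊x * Real.exp h⌋₊ → 2 ≤ y → y ≤ ⌊x * Real.exp h⌋₊ →
    1 ≤ Real.log y → Real.log y ≤ Z →
    ∑ n ∈ (Icc 1 ⌊x * Real.exp h⌋₊).filter (fun n => n ≡ a [MOD q]),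
      errorMajorant κ f y ⌊x⌋₊ n ≤
      C * (x / q.totient) * (Real.log y ^ κ * (1 + Real.log (Z / Real.log y)) / Z) := by
  obtain ⟨K, hK⟩ := exists_nat_ge (2 * κ)
  obtain ⟨C₄, hC₄, hs⟩ := exists_sum_short_interval_le κ K hK
  obtain ⟨C₂, hC₂, hd⟩ := exists_sum_damp_modEq_le κ K hK
  obtain ⟨C₃, hC₃, hdd⟩ := exists_sum_damp_div_modEq_le κ K hK
  refine ⟨C₄ + 12 * C₂ + |κ| * (C₃ * 36), by positivity, ?_⟩
  intro f Λf hf q y a x h Z hq haq hZ hx hx1 hx2 hh hqx hqD hy hyD hly hlyZ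
  have hκ := hf.kappa_nonneg
  rw [abs_of_nonneg hκ]
  have hZ0 : 0 < Z := by linarith
  have hx0 : 0 < x := by linarith
  have hh0 : 0 < h := by rw [hh]; positivity
  have hh1 : h ≤ 1 := by
    rw [hh]; exact Real.rpow_le_one_of_one_le_of_nonpos (by linarith) (by nlinarith [sq_nonneg κ])
  obtain ⟨hlD1, hlD2⟩ := log_floor_mul_exp_bounds hx hh0 hh1 hZ hx1 hx2
  have hD3 := floor_mul_exp_le hx0 hh1
  have hDM := floor_mul_exp_sub_le hx0 hh0 hh1
  have hMD : ⌊x⌋₊ ≤ ⌊x * Real.exp h⌋₊ := Nat.floor_mono (by nlinarith [Real.one_le_exp hh0.le])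
  set D := ⌊x * Real.exp h⌋₊ with hD
  set M := ⌊x⌋₊ with hM
  clear_value D M
  have hq0 : (0 : ℝ) < q := by exact_mod_cast hq
  have hφ0 : (0 : ℝ) < q.totient := by exact_mod_cast Nat.totient_pos.mpr hq
  have hφq : (q.totient : ℝ) ≤ q := by exact_mod_cast Nat.totient_le q
  have hlD0 : 0 < Real.log D := by linarith
  have hD2 : 2 ≤ D := by omega
  have hL0 : 0 ≤ Real.log (Z / Real.log y) := Real.log_nonneg (by rw [le_div_iff₀ (by linarith)]; linarith)
  set L := Real.log (Z / Real.log y) with hL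
  set Y := Real.log y ^ κ with hY
  have hY1 : 1 ≤ Y := Real.one_le_rpow hly hκ
  have hdens : (D : ℝ) / (q.totient * Real.log D) ≤ 12 * (x / (q.totient * Z)) := by
    calc _ ≤ 3 * x / (q.totient * (Z / 4)) := by gcongr
      _ = _ := by field_simp; norm_num
  have hshort := hs f Λf hf q a M D x h Z hq haq hZ hx0 hh hqx hqD hD2 hlD2 hdens hDM hMD
  have hdamp := hd f Λf hf q D a y hq hqD hy hyD haq
  have hdamp2 := hdd f Λf hf q D a y hq hqD hy hyD haq
  have hlog3 : Real.log (Real.log D / Real.log y) ≤ 2 + L := by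
    have h3 : Real.log D / Real.log y ≤ 3 * (Z / Real.log y) := by
      rw [← mul_div_assoc]; gcongr
    have h4 := Real.log_le_log (div_pos hlD0 (by linarith)) h3
    rw [Real.log_mul (by norm_num) (by positivity)] at h4
    have h5 : Real.log 3 ≤ 2 := by
      have := Real.log_le_sub_one_of_pos (show (0 : ℝ) < 3 by norm_num)
      linarith
    linarith
  have hbase : 0 ≤ x / (q.totient * Z) := by positivity
  simp only [errorMajorant, sum_add_distrib, ← Finset.mul_sum]
  calc _ ≤ C₄ * (x / (q.totient * Z)) + C₂ * (12 * (x / (q.totient * Z))) * Y +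
        κ * (C₃ * (3 * (1 + L)) * (12 * (x / (q.totient * Z))) * Y) := by
        refine add_le_add (add_le_add hshort (hdamp.trans ?_))
          (mul_le_mul_of_nonneg_left (hdamp2.trans ?_) hκ)
        · gcongr
        · gcongr
          linarith
    _ ≤ C₄ * (x / (q.totient * Z)) * (Y * (1 + L)) +
        C₂ * (12 * (x / (q.totient * Z))) * (Y * (1 + L)) +
        κ * (C₃ * (3 * (1 + L)) * (12 * (x / (q.totient * Z))) * Y) := by
        have h1 : 1 ≤ Y * (1 + L) := by nlinarith
        have h2 : Y ≤ Y * (1 + L) := by nlinarith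
        have h3 : C₄ * (x / (q.totient * Z)) * 1 ≤ C₄ * (x / (q.totient * Z)) * (Y * (1 + L)) := by
          gcongr
        have h4 : C₂ * (12 * (x / (q.totient * Z))) * Y ≤
          C₂ * (12 * (x / (q.totient * Z))) * (Y * (1 + L)) := by gcongr
        linarith
    _ = _ := by field_simp; ring

theorem IsHalaszClass.norm_sum_mul_le {κ : ℝ} {f Λf : ℕ → ℂ} (hf : IsHalaszClass κ f Λf)
    (y : ℕ) {x h : ℝ} (hx : 0 < x) (hh : 0 < h) (Ψ : ℕ → ℂ) :
    ‖∑ n ∈ Icc 1 ⌊x⌋₊, f n * Ψ n‖ ≤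
      ∑ n ∈ Icc 1 ⌊x * Real.exp h⌋₊, errorMajorant κ f y ⌊x⌋₊ n * ‖Ψ n‖ +
      ‖∑ n ∈ Icc 1 ⌊x * Real.exp h⌋₊, (ramp (Real.log x) h (Real.log n) : ℂ) * Ψ n *
        ∫ α in (0 : ℝ)..(1 / Real.log y), bilinearPart f Λf y (1 / Real.log y) α n‖ := by
  set D := ⌊x * Real.exp h⌋₊ with hD
  set M := ⌊x⌋₊ with hM
  set η := 1 / Real.log y with hη
  have hη0 : 0 ≤ η := by positivity
  have hMD : M ≤ D := Nat.floor_mono (by nlinarith [Real.one_le_exp hh.le])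
  have hext : ∑ n ∈ Icc 1 M, f n * Ψ n = ∑ n ∈ Icc 1 D, if n ≤ M then f n * Ψ n else 0 := by
    rw [← sum_filter]
    refine sum_congr ?_ fun _ _ => rfl
    ext n
    simp only [mem_filter, mem_Icc]
    omega
  have hpt : ∀ n ∈ Icc 1 D, ‖(if n ≤ M then f n * Ψ n else 0) -
      (ramp (Real.log x) h (Real.log n) : ℂ) * Ψ n *
        ∫ α in (0 : ℝ)..η, bilinearPart f Λf y η α n‖ ≤ errorMajorant κ f y M n * ‖Ψ n‖ := by
    intro n hn
    have hn1 := (mem_Icc.mp hn).1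
    have hr0 := ramp_nonneg (ℓ := Real.log x) hh (Real.log n)
    have hr1 := ramp_le_one (ℓ := Real.log x) hh (Real.log n)
    have hdec := hf.eq_damp_add y η (n := n) (by omega)
    have hlin := hf.norm_integral_linear_le y n hη0
    set lin := ∫ α in (0 : ℝ)..η, ∑ d ∈ n.divisors, dampLambda Λf y α d * damp f y η (n / d)
    set bil := ∫ α in (0 : ℝ)..η, bilinearPart f Λf y η α n
    set r := ramp (Real.log x) h (Real.log n) with hr
    have hcut : ‖(if n ≤ M then f n else 0) - (r : ℂ) * f n‖ ≤ if M < n then ‖f n‖ else 0 := by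
      by_cases hnM : n ≤ M
      · have h1 : r = 1 := by
          refine ramp_of_le hh (Real.log_le_log (by exact_mod_cast hn1) ?_)
          exact (Nat.le_floor_iff hx.le).mp hnM
        rw [if_pos hnM, if_neg (by omega), h1]
        simp
      · rw [if_neg hnM, if_pos (by omega), zero_sub, norm_neg, norm_mul, norm_real,
          Real.norm_of_nonneg hr0]
        exact mul_le_of_le_one_left (norm_nonneg _) hr1
    have hsplit : (if n ≤ M then f n * Ψ n else 0) - (r : ℂ) * Ψ n * bil =
        (((if n ≤ M then f n else 0) - (r : ℂ) * f n) + (r : ℂ) * (damp f y η n + lin)) * Ψ n := by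
      rw [show (if n ≤ M then f n * Ψ n else 0) = (if n ≤ M then f n else 0) * Ψ n by
        split_ifs <;> simp]
      linear_combination (r : ℂ) * Ψ n * hdec
    rw [hsplit, norm_mul]
    refine mul_le_mul_of_nonneg_right ?_ (norm_nonneg _)
    calc _ ≤ (if M < n then ‖f n‖ else 0) + 1 * (‖damp f y η n‖ + κ * ∑ d ∈ n.divisors.filter
          (fun d => IsPrimePow d ∧ y < d.minFac), ‖damp f y η (n / d)‖) := by
          refine (norm_add_le _ _).trans (add_le_add hcut ?_)
          rw [norm_mul, norm_real, Real.norm_of_nonneg hr0]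
          exact mul_le_mul hr1 ((norm_add_le _ _).trans (add_le_add le_rfl hlin))
            (norm_nonneg _) zero_le_one
      _ = _ := by
          rw [one_mul, ← add_assoc]
          simp only [errorMajorant, IsRoughPrimePow, hη]
          congr!
  rw [hext]
  have h1 := norm_sum_le_of_le _ hpt
  rw [sum_sub_distrib] at h1
  exact (norm_le_norm_sub_add _ _).trans (add_le_add h1 le_rfl)

end ProgressionErrorTerm

section Parameters

open Finset ArithmeticFunction

lemma exists_parameters (κ : ℝ) (hκ : 0 ≤ κ) : ∃ C : ℝ, 1 ≤ C ∧ ∀ (Z : ℝ) (q : ℕ), 16 ≤ Z →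
    Real.exp (38 * κ) ≤ Z → 1 ≤ q → ∃ (y : ℕ) (T : ℝ), 1 ≤ T ∧ 2 ^ 20 ≤ (y : ℝ) ∧
      (q * T) ^ 5 ≤ (y : ℝ) ∧ q * (2 * T + 3) ≤ (y : ℝ) ∧ Z ≤ y ∧
      Real.log (q * Z) ≤ Real.log y ∧ Real.log y ≤ C * Real.log (q * Z) ∧
      Real.exp (38 * κ) * Z ^ κ ≤ Z ^ (-(κ ^ 2 + 2)) * T ^ 2 := by
  set A := κ ^ 2 + κ + 3 with hA
  have hA1 : 1 ≤ A := by rw [hA]; nlinarith [sq_nonneg κ]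
  refine ⟨6 * A, by linarith, fun Z q hZ hZκ hq => ?_⟩
  have hZ0 : 0 < Z := by linarith
  have hq1 : (1 : ℝ) ≤ q := by exact_mod_cast hq
  set T := Z ^ A with hT
  have hZT : Z ≤ T := by
    calc Z = Z ^ (1 : ℝ) := (Real.rpow_one Z).symm
      _ ≤ _ := Real.rpow_le_rpow_of_exponent_le (by linarith) hA1
  set P := (q : ℝ) * T with hP
  have hTP : T ≤ P := by nlinarith
  have hP16 : 16 ≤ P := by linarith
  have hP5 : P ≤ P ^ 5 := le_self_pow₀ (by linarith) (by norm_num)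
  have hP5' : 16 ^ 5 ≤ P ^ 5 := pow_le_pow_left₀ (by norm_num) hP16 5
  have hP3 : 3 * P ≤ P ^ 5 := by
    calc 3 * P ≤ P * P := by gcongr; linarith
      _ = P ^ 2 := by ring
      _ ≤ P ^ 5 := pow_le_pow_right₀ (by linarith) (by norm_num)
  have hy : P ^ 5 ≤ (⌈P ^ 5⌉₊ : ℝ) := Nat.le_ceil _
  have hy' : (⌈P ^ 5⌉₊ : ℝ) ≤ P ^ 6 := by
    have h1 := (Nat.ceil_lt_add_one (by positivity : 0 ≤ P ^ 5)).le
    calc _ ≤ P ^ 5 + 1 := h1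
      _ ≤ P ^ 5 * P := by nlinarith
      _ = _ := by ring
  have hlq : 0 ≤ Real.log q := Real.log_nonneg hq1
  refine ⟨⌈P ^ 5⌉₊, T, by linarith, le_trans (by norm_num) (hP5'.trans hy), hy, ?_, by linarith, ?_, ?_, ?_⟩
  · calc (q : ℝ) * (2 * T + 3) ≤ q * (3 * T) := by gcongr; linarith
      _ = 3 * P := by ring
      _ ≤ _ := hP3.trans hy
  · refine Real.log_le_log (by positivity) ?_
    calc (q : ℝ) * Z ≤ q * T := by gcongr
      _ ≤ _ := hP5.trans hy
  · have h1 := Real.log_le_log (by linarith) hy'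
    rw [Real.log_pow, hP, Real.log_mul (by linarith) (by linarith), hT, Real.log_rpow hZ0] at h1
    push_cast at h1
    rw [Real.log_mul (by linarith) (by linarith)]
    nlinarith
  · rw [hT, ← Real.rpow_natCast (Z ^ A) 2, ← Real.rpow_mul hZ0.le, ← Real.rpow_add hZ0]
    calc _ ≤ Z * Z ^ κ := by gcongr
      _ = Z ^ (1 + κ) := by rw [Real.rpow_add hZ0, Real.rpow_one]
      _ ≤ _ := by
          refine Real.rpow_le_rpow_of_exponent_le (by linarith) ?_
          rw [hA]; push_cast; nlinarith [sq_nonneg κ]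

lemma log_rpow_mul_exp_le {κ C Z lQ ly s : ℝ} (hκ : 0 ≤ κ) (hC : 1 ≤ C) (hs : 1 ≤ s)
    (hlQ : 0 < lQ) (hQy : lQ ≤ ly) (hyQ : ly ≤ C * lQ) (hQZ : C * lQ ≤ Z / 4) :
    ly ^ κ * Real.exp (κ * Real.log (Z / ly) / s) * (1 + Real.log (Z / ly)) / Z ≤
      2 * C ^ κ * (Z ^ (κ - 1) * (lQ / Z) ^ (κ * (1 - 1 / s)) * Real.log (Z / lQ)) := by
  have hly : 0 < ly := by linarith
  have hZ : 0 < Z := by nlinarith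
  have hs0 : 0 < s := by linarith
  have he0 : 0 ≤ 1 - 1 / s := sub_nonneg.mpr ((div_le_one hs0).mpr hs)
  have he1 : 1 - 1 / s ≤ 1 := by linarith [one_div_pos.mpr hs0]
  have hmain : ly ^ κ * Real.exp (κ * Real.log (Z / ly) / s) =
      Z ^ κ * (ly / Z) ^ (κ * (1 - 1 / s)) := by
    rw [Real.rpow_def_of_pos hly, Real.rpow_def_of_pos hZ, Real.rpow_def_of_pos (by positivity),
      ← Real.exp_add, ← Real.exp_add, Real.log_div hZ.ne' hly.ne', Real.log_div hly.ne' hZ.ne']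
    congr 1
    field_simp
    ring
  have hpow : (ly / Z) ^ (κ * (1 - 1 / s)) ≤ C ^ κ * (lQ / Z) ^ (κ * (1 - 1 / s)) := by
    calc _ ≤ (C * (lQ / Z)) ^ (κ * (1 - 1 / s)) := by
          refine Real.rpow_le_rpow (by positivity) ?_ (by positivity)
          rw [← mul_div_assoc]; gcongr
      _ = C ^ (κ * (1 - 1 / s)) * (lQ / Z) ^ (κ * (1 - 1 / s)) :=
          Real.mul_rpow (by linarith) (by positivity)
      _ ≤ _ := by
          gcongr
          nlinarith
  have hlog : Real.log (Z / ly) ≤ Real.log (Z / lQ) :=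
    Real.log_le_log (by positivity) (by gcongr)
  have hone : 1 ≤ Real.log (Z / lQ) := by
    rw [Real.le_log_iff_exp_le (by positivity), le_div_iff₀ hlQ]
    have := Real.exp_one_lt_d9
    nlinarith
  have hly1 : 0 ≤ 1 + Real.log (Z / ly) := by
    have : 0 ≤ Real.log (Z / ly) := Real.log_nonneg (by rw [le_div_iff₀ hly]; nlinarith)
    linarith
  rw [hmain]
  calc _ ≤ Z ^ κ * (C ^ κ * (lQ / Z) ^ (κ * (1 - 1 / s))) * (2 * Real.log (Z / lQ)) / Z := by
        gcongr
        linarith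
    _ = 2 * C ^ κ * ((Z ^ κ / Z) * (lQ / Z) ^ (κ * (1 - 1 / s)) * Real.log (Z / lQ)) := by ring
    _ = _ := by rw [Real.rpow_sub_one hZ.ne']

end Parameters

section IsolatingSet

open Finset ArithmeticFunction

lemma sum_primes_inv_le_log_div_add {y N : ℕ} {Z : ℝ} (hy : 2 ≤ y) (hyN : y ≤ N)
    (hN : Real.log N ≤ 4 * Z) :
    ∑ p ∈ (Icc 1 N).filter (fun p => p.Prime ∧ y < p), 1 / (p : ℝ) ≤
      Real.log (Z / Real.log y) + 38 := by
  have hy2 : (2 : ℝ) ≤ y := by exact_mod_cast hy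
  have hyN' : (y : ℝ) ≤ N := by exact_mod_cast hyN
  have hl : 0 < Real.log y := Real.log_pos (by linarith)
  have hlN : Real.log y ≤ Real.log N := Real.log_le_log (by linarith) hyN'
  have hZ : 0 < Z := by linarith
  have h1 := sum_primes_Ioc_inv_le y hy2 N hyN' ((Icc 1 N).filter (fun p => p.Prime ∧ y < p))
    (fun p hp => by
      simp only [mem_filter, mem_Icc] at hp
      exact ⟨hp.2.1, by exact_mod_cast hp.2.2, hp.1.2⟩)
  have h2 : Real.log (Real.log N / Real.log y) ≤ Real.log (4 * (Z / Real.log y)) := by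
    refine Real.log_le_log (div_pos (by linarith) hl) ?_
    rw [← mul_div_assoc]
    gcongr
  rw [Real.log_mul (by norm_num) (by positivity)] at h2
  have h3 : Real.log 4 ≤ 2 := by
    rw [show (4 : ℝ) = 2 ^ 2 by norm_num, Real.log_pow]
    push_cast
    linarith [Real.log_two_lt_d9]
  linarith

lemma log_one_add_le_one_add_log {r : ℝ} (hr : 1 ≤ r) : Real.log (1 + r) ≤ 1 + Real.log r := by
  rw [Real.log_le_iff_le_exp (by linarith), Real.exp_add, Real.exp_log (by linarith)]
  nlinarith [Real.add_one_le_exp (1 : ℝ)]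

lemma exists_isolating_set_bilinear (κ : ℝ) (J : ℕ) : ∃ C : ℝ, 0 < C ∧ ∀ f Λf : ℕ → ℂ,
    IsHalaszClass κ f Λf → ∀ (q : ℕ) [NeZero q] (y N : ℕ) (Z T h : ℝ), 16 ≤ Z → 1 ≤ T →
    2 ^ 20 ≤ (y : ℝ) → (q * T) ^ 5 ≤ (y : ℝ) → q * (2 * T + 3) ≤ (y : ℝ) → Z ≤ y →
    Real.log y ≤ Z / 4 → 0 < h → h ≤ 1 → Real.exp (38 * κ) * Z ^ κ ≤ h * T ^ 2 →
    3 * Z ≤ Real.log N → Real.log N ≤ 4 * Z →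
    ∃ 𝒳 : Finset (DirichletCharacter ℂ q), 𝒳.card ≤ J ∧ ∀ x : ℝ, 0 < x →
      Z / 2 ≤ Real.log x → Real.log x ≤ 2 * Z → ∀ (S : Finset (DirichletCharacter ℂ q))
      (w : DirichletCharacter ℂ q → ℂ), (∀ χ ∈ S, χ ∉ 𝒳) → (∀ χ, ‖w χ‖ ≤ 1) →
      ‖∑ n ∈ Icc 1 ⌊x * Real.exp h⌋₊, (ramp (Real.log x) h (Real.log n) : ℂ) *
        (∑ χ ∈ S, w χ * (starRingEnd ℂ) (χ (n : ZMod q))) *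
        ∫ α in (0 : ℝ)..(1 / Real.log y), bilinearPart f Λf y (1 / Real.log y) α n‖ ≤
      C * x * (Real.log y ^ κ * Real.exp (κ * Real.log (Z / Real.log y) / Real.sqrt ((J : ℝ) + 1))
        * (1 + Real.log (Z / Real.log y)) / Z) := by
  obtain ⟨C₁, hC₁, hset⟩ := exists_noncorrelating_series_bound κ J
  obtain ⟨C₂, hC₂, hbil⟩ := exists_norm_bilinearPart_sum_le κ
  refine ⟨C₂ * (C₁ * Real.exp (38 * κ)) * 2, by positivity, ?_⟩
  intro f Λf hf q _ y N Z T h hZ hT hy hqy hqy' hZy hlyZ hh hh1 hTh hN3 hN4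
  have hκ := hf.kappa_nonneg
  have hly : 4 ≤ Real.log y := by
    have h1 : Real.log (2 ^ 20) ≤ Real.log y := Real.log_le_log (by norm_num) hy
    rw [Real.log_pow] at h1
    push_cast at h1
    linarith [Real.log_two_gt_d9]
  have hy0 : (0 : ℝ) < y := by linarith
  have hN0 : (0 : ℝ) < N := by
    rcases Nat.eq_zero_or_pos N with h0 | h0
    · rw [h0] at hN3; norm_num at hN3; linarith
    · exact_mod_cast h0
  have hyN : y ≤ N := by
    have : (y : ℝ) ≤ N := (Real.log_le_log_iff hy0 hN0).mp (by linarith)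
    exact_mod_cast this
  have hy2 : 2 ≤ y := by
    have : (2 : ℝ) ≤ y := by linarith
    exact_mod_cast this
  have hr1 : 1 ≤ Z / Real.log y := by rw [le_div_iff₀ (by linarith)]; linarith
  set L := Real.log (Z / Real.log y) with hL
  have hL0 : 0 ≤ L := Real.log_nonneg hr1
  set s := Real.sqrt ((J : ℝ) + 1) with hs
  have hs1 : 1 ≤ s := by
    rw [hs, Real.one_le_sqrt]
    linarith [(Nat.cast_nonneg J : (0 : ℝ) ≤ J)]
  have hexp : Real.exp (κ * (L + 38)) ≤ h * T ^ 2 := by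
    refine le_trans ?_ hTh
    rw [mul_add, add_comm, Real.exp_add, mul_comm κ 38, mul_comm κ L, hL,
      ← Real.rpow_def_of_pos (by linarith)]
    gcongr
    exact div_le_self (by linarith) (by linarith)
  obtain ⟨𝒳, hcard, h𝒳⟩ := hset f Λf hf q y N T (1 / Z) (L + 38) h (by linarith) (by linarith)
    hy hqy' (by positivity) (by rw [one_div_one_div]; linarith) (by rw [one_div_one_div]; exact hZy)
    (sum_primes_inv_le_log_div_add hy2 hyN hN4) hexp
  refine ⟨𝒳, hcard, fun x hx hx1 hx2 S w hS hw => ?_⟩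
  have hx2' : 2 ≤ x := by
    rw [← Real.log_le_log_iff (by norm_num) hx]
    linarith [Real.log_two_lt_d9]
  have hD1 : 1 ≤ ⌊x * Real.exp h⌋₊ := by
    have h1 : (1 : ℝ) ≤ ⌊x * Real.exp h⌋₊ := by linarith [half_le_floor_mul_exp hx2' hh]
    exact_mod_cast h1
  have hDN : ⌊x * Real.exp h⌋₊ ≤ N := by
    have h1 := floor_le_exp_log_add (h := h) hx
    have h2 : (⌊x * Real.exp h⌋₊ : ℝ) ≤ N := by
      calc _ ≤ Real.exp (Real.log x + h) := h1
        _ ≤ Real.exp (Real.log N) := Real.exp_le_exp.mpr (by linarith)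
        _ = N := Real.exp_log hN0
    exact_mod_cast h2
  have hη1 : 1 / Real.log y ≤ 1 / 4 := one_div_le_one_div_of_le (by norm_num) hly
  have hZ1 : 1 / Z ≤ 1 / 16 := one_div_le_one_div_of_le (by norm_num) hZ
  have hmain := hbil f Λf hf q S w y ⌊x * Real.exp h⌋₊ N (Real.log x) h (1 / Z) T
    (1 / Real.log y) (C₁ * Real.log y ^ κ * Real.exp (κ * (L + 38) / s)) hw hT (by positivity)
    (by positivity) le_rfl (by linarith) hh hh1 (by linarith)
    (by rw [div_mul_eq_mul_div, one_mul, div_le_iff₀ (by linarith)]; exact hx2)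
    (log_add_le_log_floor hx) (floor_le_exp_log_add hx) hD1 hDN hy hqy (by positivity)
    (fun α γ hα hαγ hγ χ hχ t ht => (h𝒳 χ (hS χ hχ) α γ hα hαγ hγ).1 t ht)
    (fun α γ hα hαγ hγ χ hχ t => (h𝒳 χ (hS χ hχ) α γ hα hαγ hγ).2 t)
  refine hmain.trans ?_
  rw [Real.exp_log hx, show 1 / Real.log y / (1 / Z) = Z / Real.log y by
    rw [div_div_eq_mul_div, div_one, one_div_mul_eq_div]]
  have hlog1 : Real.log (1 + Z / Real.log y) / Real.log x ≤ (1 + L) / (Z / 2) := by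
    gcongr
    exact log_one_add_le_one_add_log hr1
  have hexp2 : Real.exp (κ * (L + 38) / s) ≤ Real.exp (38 * κ) * Real.exp (κ * L / s) := by
    rw [← Real.exp_add, Real.exp_le_exp, mul_add, add_div, add_comm]
    have : κ * 38 / s ≤ κ * 38 := div_le_self (by positivity) hs1
    linarith
  have hlog0 : 0 ≤ Real.log (1 + Z / Real.log y) / Real.log x :=
    div_nonneg (Real.log_nonneg (by linarith)) (by linarith)
  calc _ ≤ C₂ * (C₁ * Real.log y ^ κ * (Real.exp (38 * κ) * Real.exp (κ * L / s))) * x *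
        ((1 + L) / (Z / 2)) := by
        gcongr
    _ = _ := by ring

/-- The size of the error terms in terms of `Z = log X`. -/
def correlationBound (κ : ℝ) (J q : ℕ) (Z : ℝ) : ℝ :=
  Z ^ (κ - 1) * (Real.log (q * Z) / Z) ^ (κ * (1 - 1 / Real.sqrt ((J : ℝ) + 1))) *
    Real.log (Z / Real.log (q * Z))

lemma exists_rpow_le_exp (A : ℝ) : ∃ Z₀ : ℝ, ∀ Z : ℝ, Z₀ ≤ Z → Z ^ A ≤ Real.exp (Z / 4) := by
  have h1 := (isLittleO_rpow_exp_pos_mul_atTop A (by norm_num : (0 : ℝ) < 1 / 4)).bound one_pos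
  obtain ⟨Z₀, hZ₀⟩ := Filter.eventually_atTop.mp h1
  refine ⟨Z₀, fun Z hZ => ?_⟩
  have h2 := hZ₀ Z hZ
  rw [one_mul, Real.norm_eq_abs, Real.norm_eq_abs, Real.abs_exp] at h2
  calc _ ≤ |Z ^ A| := le_abs_self _
    _ ≤ _ := h2
    _ = _ := by congr 1; ring

lemma parameter_constraints {κ Z h x : ℝ} {q y : ℕ} (hZ16 : 16 ≤ Z) (hh : h = Z ^ (-(κ ^ 2 + 2)))
    (hZh : Z ^ (κ ^ 2 + 2) ≤ Real.exp (Z / 4)) (hqZ : (q : ℝ) ≤ Real.exp (Z / 4))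
    (hlyZ : Real.log y ≤ Z / 4) (hx : 0 < x) (hx1 : Z / 2 ≤ Real.log x) (hy : (0 : ℝ) < y) :
    (q : ℝ) ≤ h * x ∧ q ^ 2 ≤ ⌊x * Real.exp h⌋₊ ∧ y ≤ ⌊x * Real.exp h⌋₊ ∧ 2 ≤ x := by
  have hZ0 : 0 < Z := by linarith
  have hh0 : 0 < h := by rw [hh]; positivity
  have hxe : Real.exp (Z / 4) * Real.exp (Z / 4) ≤ x := by
    rw [← Real.exp_add, ← Real.le_log_iff_exp_le hx]
    linarith
  have he : 2 ≤ Real.exp (Z / 4) := by linarith [Real.add_one_le_exp (Z / 4)]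
  have hxh : x ≤ x * Real.exp h := le_mul_of_one_le_right hx.le (Real.one_le_exp hh0.le)
  refine ⟨?_, Nat.le_floor ?_, Nat.le_floor ?_, by nlinarith⟩
  · rw [hh, Real.rpow_neg hZ0.le, ← div_eq_inv_mul, le_div_iff₀ (by positivity)]
    calc _ ≤ Real.exp (Z / 4) * Real.exp (Z / 4) := by gcongr
      _ ≤ x := hxe
  · push_cast
    calc (q : ℝ) ^ 2 ≤ Real.exp (Z / 4) ^ 2 := by gcongr
      _ ≤ _ := by rw [sq]; exact hxe.trans hxh
  · have h1 := (Real.log_le_iff_le_exp hy).mp hlyZ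
    nlinarith

theorem exists_isolating_set_majorant (κ : ℝ) (hκ : 0 ≤ κ) (J : ℕ) :
    ∃ C C₀ Z₀ : ℝ, 0 < C ∧ 1 ≤ C₀ ∧ ∀ f Λf : ℕ → ℂ, IsHalaszClass κ f Λf →
    ∀ (q : ℕ) [NeZero q] (Z : ℝ), Z₀ ≤ Z → (q : ℝ) ≤ Real.exp (Z / 4) →
    C₀ * Real.log (q * Z) ≤ Z / 4 →
    ∃ 𝒳 : Finset (DirichletCharacter ℂ q), 𝒳.card ≤ J ∧ ∀ x : ℝ, 0 < x →
      Z / 2 ≤ Real.log x → Real.log x ≤ 2 * Z → ∃ (D : ℕ) (g : ℕ → ℝ), (∀ n, 0 ≤ g n) ∧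
      (∀ a : ℕ, Nat.Coprime a q → ∑ n ∈ (Icc 1 D).filter (fun n => n ≡ a [MOD q]), g n ≤
        C * (x / q.totient) * correlationBound κ J q Z) ∧
      ∀ (S : Finset (DirichletCharacter ℂ q)) (w : DirichletCharacter ℂ q → ℂ),
        (∀ χ ∈ S, χ ∉ 𝒳) → (∀ χ, ‖w χ‖ ≤ 1) →
        ‖∑ n ∈ Icc 1 ⌊x⌋₊, f n * ∑ χ ∈ S, w χ * (starRingEnd ℂ) (χ (n : ZMod q))‖ ≤
          ∑ n ∈ Icc 1 D, g n * ‖∑ χ ∈ S, w χ * (starRingEnd ℂ) (χ (n : ZMod q))‖ +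
          C * x * correlationBound κ J q Z := by
  obtain ⟨C₀, hC₀, hparam⟩ := exists_parameters κ hκ
  obtain ⟨C₁, hC₁, hbil⟩ := exists_isolating_set_bilinear κ J
  obtain ⟨C₂, hC₂, herr⟩ := exists_sum_errorMajorant_le κ
  obtain ⟨Z₁, hZ₁⟩ := exists_rpow_le_exp (κ ^ 2 + 2)
  have hE : 0 < C₀ ^ κ := by positivity
  refine ⟨(C₁ + C₂) * (2 * C₀ ^ κ), C₀, max Z₁ (max 16 (Real.exp (38 * κ))), by positivity, hC₀, ?_⟩
  intro f Λf hf q hq0 Z hZ hqZ hC₀Z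
  have hZ1 : Z₁ ≤ Z := (le_max_left _ _).trans hZ
  have hZ16 : 16 ≤ Z := ((le_max_left _ _).trans (le_max_right _ _)).trans hZ
  have hZκ : Real.exp (38 * κ) ≤ Z := ((le_max_right _ _).trans (le_max_right _ _)).trans hZ
  have hq : 1 ≤ q := Nat.one_le_iff_ne_zero.mpr hq0.ne
  have hq1 : (1 : ℝ) ≤ q := by exact_mod_cast hq
  obtain ⟨y, T, hT, hy, hqy, hqy', hZy, hQy, hyQ, hTh⟩ := hparam Z q hZ16 hZκ hq
  set h := Z ^ (-(κ ^ 2 + 2)) with hh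
  have hZ0 : 0 < Z := by linarith
  have hh0 : 0 < h := by positivity
  have hh1 : h ≤ 1 := Real.rpow_le_one_of_one_le_of_nonpos (by linarith) (by nlinarith)
  have hlyZ : Real.log y ≤ Z / 4 := hyQ.trans hC₀Z
  have hlQ : 0 < Real.log (q * Z) := Real.log_pos (by nlinarith)
  have hs1 : 1 ≤ Real.sqrt ((J : ℝ) + 1) := by
    rw [Real.one_le_sqrt]
    linarith [(Nat.cast_nonneg J : (0 : ℝ) ≤ J)]
  have hbound := log_rpow_mul_exp_le hκ hC₀ hs1 hlQ hQy hyQ hC₀Z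
  have hceil : Real.exp (3 * Z) ≤ (⌈Real.exp (3 * Z)⌉₊ : ℝ) := Nat.le_ceil _
  have hceil' : (⌈Real.exp (3 * Z)⌉₊ : ℝ) ≤ Real.exp (4 * Z) := by
    have h1 := (Nat.ceil_lt_add_one (Real.exp_pos (3 * Z)).le).le
    have h2 : 1 ≤ Real.exp (3 * Z) := Real.one_le_exp (by linarith)
    have h3 : Real.exp (4 * Z) = Real.exp (3 * Z) * Real.exp Z := by
      rw [← Real.exp_add]; ring_nf
    have h4 : 2 ≤ Real.exp Z := by linarith [Real.add_one_le_exp Z]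
    rw [h3]
    nlinarith
  have hceil0 : (0 : ℝ) < (⌈Real.exp (3 * Z)⌉₊ : ℝ) := (Real.exp_pos _).trans_le hceil
  obtain ⟨𝒳, hcard, h𝒳⟩ := hbil f Λf hf q y ⌈Real.exp (3 * Z)⌉₊ Z T h hZ16 hT hy hqy hqy' hZy hlyZ
    hh0 hh1 hTh ((Real.le_log_iff_exp_le hceil0).mpr hceil)
    ((Real.log_le_iff_le_exp hceil0).mpr hceil')
  have hB0 : 0 ≤ correlationBound κ J q Z := by
    refine nonneg_of_mul_nonneg_right (le_trans ?_ hbound) (by positivity)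
    have : 0 ≤ Real.log (Z / Real.log y) :=
      Real.log_nonneg (by rw [le_div_iff₀ (by linarith)]; linarith)
    have : 0 ≤ Real.log y := by linarith
    positivity
  refine ⟨𝒳, hcard, fun x hx hx1 hx2 => ⟨⌊x * Real.exp h⌋₊, errorMajorant κ f y ⌊x⌋₊,
    fun n => hf.errorMajorant_nonneg y _ n, fun a ha => ?_, fun S w hS hw => ?_⟩⟩
  · have hly1 : 1 ≤ Real.log y := by
      have h1 : Real.log (2 ^ 20) ≤ Real.log y := Real.log_le_log (by norm_num) hy
      rw [Real.log_pow] at h1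
      push_cast at h1
      linarith [Real.log_two_gt_d9]
    have hL0 : 0 ≤ Real.log (Z / Real.log y) :=
      Real.log_nonneg (by rw [le_div_iff₀ (by linarith)]; linarith)
    obtain ⟨hxq, hqD, hyD, hx2'⟩ :=
      parameter_constraints (κ := κ) hZ16 hh (hZ₁ Z hZ1) hqZ hlyZ hx hx1 (by linarith : (0 : ℝ) < y)
    have hy2 : 2 ≤ y := by
      have : (2 : ℝ) ≤ y := by linarith
      exact_mod_cast this
    refine (herr f Λf hf q y a x h Z hq ha (by linarith) hx2' hx1 hx2 hh hxq hqD hy2 hyD hly1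
      (by linarith)).trans ?_
    calc _ ≤ C₂ * (x / q.totient) * (2 * C₀ ^ κ * correlationBound κ J q Z) := by
          refine mul_le_mul_of_nonneg_left (le_trans ?_ hbound) (by positivity)
          refine div_le_div_of_nonneg_right ?_ hZ0.le
          refine mul_le_mul_of_nonneg_right ?_ (by linarith)
          exact le_mul_of_one_le_right (by positivity) (Real.one_le_exp (by positivity))
      _ = C₂ * (2 * C₀ ^ κ) * (x / q.totient) * correlationBound κ J q Z := by ring
      _ ≤ _ := by gcongr; linarith
  · refine (hf.norm_sum_mul_le y hx hh0 _).trans ?_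
    gcongr
    refine (h𝒳 x hx hx1 hx2 S w hS hw).trans ?_
    calc _ ≤ C₁ * x * (2 * C₀ ^ κ * correlationBound κ J q Z) :=
          mul_le_mul_of_nonneg_left hbound (by positivity)
      _ = C₁ * (2 * C₀ ^ κ) * x * correlationBound κ J q Z := by ring
      _ ≤ _ := by gcongr; linarith

end IsolatingSet

section IsolatingCharacters

open Finset ArithmeticFunction

lemma sum_coprime_le_totient_mul {q D : ℕ} (hq : 1 ≤ q) (g : ℕ → ℝ) {B : ℝ}
    (hB : ∀ a : ℕ, Nat.Coprime a q → ∑ n ∈ (Icc 1 D).filter (fun n => n ≡ a [MOD q]), g n ≤ B) :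
    ∑ n ∈ (Icc 1 D).filter (fun n => Nat.Coprime n q), g n ≤ q.totient * B := by
  have hmaps : ∀ n ∈ (Icc 1 D).filter (fun n => Nat.Coprime n q),
      n % q ∈ (range q).filter (fun a => q.Coprime a) := by
    intro n hn
    rw [mem_filter] at hn ⊢
    refine ⟨mem_range.mpr (Nat.mod_lt _ hq), ?_⟩
    rw [Nat.Coprime, Nat.gcd_comm, ← Nat.gcd_rec, Nat.gcd_comm]
    exact hn.2
  rw [← sum_fiberwise_of_maps_to hmaps, Nat.totient_eq_card_coprime, ← nsmul_eq_mul]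
  have hcard : (#{a ∈ range q | q.Coprime a}) = #((range q).filter (fun a => q.Coprime a)) := by
    congr!
  rw [hcard]
  refine sum_le_card_nsmul _ _ _ fun a ha => ?_
  rw [mem_filter, mem_range] at ha
  have hset : ((Icc 1 D).filter (fun n => Nat.Coprime n q)).filter (fun n => n % q = a) =
      (Icc 1 D).filter (fun n => n ≡ a [MOD q]) := by
    ext n
    simp only [mem_filter, Nat.ModEq, Nat.mod_eq_of_lt ha.1, and_assoc, and_congr_right_iff,
      and_iff_right_iff_imp]
    intro _ h
    have h1 := ha.2
    rw [← h, Nat.Coprime, Nat.gcd_comm, ← Nat.gcd_rec, Nat.gcd_comm] at h1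
    exact h1
  rw [hset]
  exact hB a ha.2.symm

lemma norm_char_le_ite {q : ℕ} (χ : DirichletCharacter ℂ q) (n : ℕ) :
    ‖χ (n : ZMod q)‖ ≤ if Nat.Coprime n q then 1 else 0 := by
  split_ifs with h
  · exact χ.norm_le_one _
  · rw [MulChar.map_nonunit χ (by rwa [ZMod.isUnit_iff_coprime]), norm_zero]

lemma sum_mul_norm_char_le {q D : ℕ} (hq : 1 ≤ q) {g : ℕ → ℝ} (hg : ∀ n, 0 ≤ g n) {B : ℝ}
    (hB : ∀ a : ℕ, Nat.Coprime a q → ∑ n ∈ (Icc 1 D).filter (fun n => n ≡ a [MOD q]), g n ≤ B)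
    (χ : DirichletCharacter ℂ q) :
    ∑ n ∈ Icc 1 D, g n * ‖χ (n : ZMod q)‖ ≤ q.totient * B := by
  refine le_trans ?_ (sum_coprime_le_totient_mul hq g hB)
  rw [sum_filter]
  refine sum_le_sum fun n _ => ?_
  have h1 := mul_le_mul_of_nonneg_left (norm_char_le_ite χ n) (hg n)
  split_ifs at h1 ⊢ <;> simpa using h1

lemma sum_char_mul_conj_char {q : ℕ} [NeZero q] {a : ℕ} (ha : Nat.Coprime a q) (n : ℕ) :
    ∑ χ : DirichletCharacter ℂ q, χ (a : ZMod q) * (starRingEnd ℂ) (χ (n : ZMod q)) =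
      if n ≡ a [MOD q] then (q.totient : ℂ) else 0 := by
  have h1 := congrArg (starRingEnd ℂ)
    (sum_conj_char_mul_char (q := q) ((ZMod.isUnit_iff_coprime a q).mpr ha) (n : ZMod q))
  rw [map_sum] at h1
  simp only [map_mul, Complex.conj_conj] at h1
  rw [h1]
  have h2 : ((a : ZMod q) = n) ↔ n ≡ a [MOD q] := by
    rw [ZMod.natCast_eq_natCast_iff]
    exact ⟨Nat.ModEq.symm, Nat.ModEq.symm⟩
  simp only [h2]
  split_ifs <;> simp

lemma sum_modEq_sub_eq {q : ℕ} [NeZero q] (f : ℕ → ℂ) {a : ℕ} (ha : Nat.Coprime a q) (x : ℝ)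
    (𝒳 : Finset (DirichletCharacter ℂ q)) :
    (∑ n ∈ (Icc 1 ⌊x⌋₊).filter (fun n : ℕ => (n : ZMod q) = (a : ZMod q)), f n)
      - (1 / (q.totient : ℝ)) * ∑ χ ∈ 𝒳, χ (a : ZMod q) * Sf f χ x =
    (1 / (q.totient : ℝ)) * ∑ n ∈ Icc 1 ⌊x⌋₊, f n *
      ∑ χ ∈ 𝒳ᶜ, χ (a : ZMod q) * (starRingEnd ℂ) (χ (n : ZMod q)) := by
  have hφ : (q.totient : ℂ) ≠ 0 := by
    exact_mod_cast (Nat.totient_pos.mpr (Nat.pos_of_neZero q)).ne'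
  have h1 : ∑ χ ∈ 𝒳, χ (a : ZMod q) * Sf f χ x = ∑ n ∈ Icc 1 ⌊x⌋₊, f n *
      ∑ χ ∈ 𝒳, χ (a : ZMod q) * (starRingEnd ℂ) (χ (n : ZMod q)) := by
    simp only [Sf, mul_sum]
    rw [sum_comm]
    exact sum_congr rfl fun n _ => sum_congr rfl fun χ _ => by ring
  have h2 : ∑ n ∈ (Icc 1 ⌊x⌋₊).filter (fun n : ℕ => (n : ZMod q) = (a : ZMod q)), f n =
      (1 / (q.totient : ℝ)) * ∑ n ∈ Icc 1 ⌊x⌋₊, f n *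
        ∑ χ : DirichletCharacter ℂ q, χ (a : ZMod q) * (starRingEnd ℂ) (χ (n : ZMod q)) := by
    rw [sum_filter, mul_sum]
    refine sum_congr rfl fun n _ => ?_
    rw [sum_char_mul_conj_char ha n]
    simp only [ZMod.natCast_eq_natCast_iff]
    split_ifs
    · push_cast; field_simp
    · simp
  rw [h1, h2, ← mul_sub, ← sum_sub_distrib]
  congr 1
  refine sum_congr rfl fun n _ => ?_
  rw [← mul_sub, ← sum_compl_add_sum 𝒳, add_sub_cancel_right]

lemma norm_sum_compl_le {q J : ℕ} [NeZero q] {a : ℕ} (ha : Nat.Coprime a q) (n : ℕ)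
    {𝒳 : Finset (DirichletCharacter ℂ q)} (hcard : 𝒳.card ≤ J) :
    ‖∑ χ ∈ 𝒳ᶜ, χ (a : ZMod q) * (starRingEnd ℂ) (χ (n : ZMod q))‖ ≤
      (if n ≡ a [MOD q] then (q.totient : ℝ) else 0) + if Nat.Coprime n q then (J : ℝ) else 0 := by
  have h1 := sum_char_mul_conj_char ha n
  rw [← sum_compl_add_sum 𝒳, ← eq_sub_iff_add_eq] at h1
  rw [h1]
  refine (norm_sub_le _ _).trans (add_le_add ?_ ?_)
  · split_ifs <;> simp
  · refine (norm_sum_le _ _).trans ?_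
    calc _ ≤ ∑ χ ∈ 𝒳, (if Nat.Coprime n q then (1 : ℝ) else 0) := by
          refine sum_le_sum fun χ _ => ?_
          rw [norm_mul, RCLike.norm_conj]
          calc _ ≤ 1 * ‖χ (n : ZMod q)‖ := by gcongr; exact χ.norm_le_one _
            _ ≤ _ := by rw [one_mul]; exact norm_char_le_ite χ n
      _ = 𝒳.card * (if Nat.Coprime n q then (1 : ℝ) else 0) := by rw [sum_const, nsmul_eq_mul]
      _ ≤ _ := by
          split_ifs
          · rw [mul_one]; exact_mod_cast hcard
          · simp

lemma sum_mul_norm_sum_compl_le {q J D : ℕ} [NeZero q] {g : ℕ → ℝ} (hg : ∀ n, 0 ≤ g n) {B : ℝ}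
    (hB : ∀ a : ℕ, Nat.Coprime a q → ∑ n ∈ (Icc 1 D).filter (fun n => n ≡ a [MOD q]), g n ≤ B)
    {a : ℕ} (ha : Nat.Coprime a q) {𝒳 : Finset (DirichletCharacter ℂ q)} (hcard : 𝒳.card ≤ J) :
    ∑ n ∈ Icc 1 D, g n * ‖∑ χ ∈ 𝒳ᶜ, χ (a : ZMod q) * (starRingEnd ℂ) (χ (n : ZMod q))‖ ≤
      (J + 1) * (q.totient * B) := by
  calc _ ≤ ∑ n ∈ Icc 1 D, g n * ((if n ≡ a [MOD q] then (q.totient : ℝ) else 0) +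
        if Nat.Coprime n q then (J : ℝ) else 0) :=
        sum_le_sum fun n _ => mul_le_mul_of_nonneg_left (norm_sum_compl_le ha n hcard) (hg n)
    _ = q.totient * ∑ n ∈ (Icc 1 D).filter (fun n => n ≡ a [MOD q]), g n +
        J * ∑ n ∈ (Icc 1 D).filter (fun n => Nat.Coprime n q), g n := by
        rw [sum_filter, sum_filter, mul_sum, mul_sum, ← sum_add_distrib]
        refine sum_congr rfl fun n _ => ?_
        split_ifs <;> ring
    _ ≤ q.totient * B + J * (q.totient * B) := by
        gcongr
        · exact hB a ha
        · exact sum_coprime_le_totient_mul (Nat.pos_of_neZero q) g hB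
    _ = _ := by ring

/-- The characters in `𝒳` account for the distribution of `f` up to an error of relative size `E`. -/
def IsIsolatingSet {q : ℕ} (f : ℕ → ℂ) (Z E : ℝ) (𝒳 : Finset (DirichletCharacter ℂ q)) : Prop :=
  ∀ x : ℝ, 0 < x → Z / 2 ≤ Real.log x → Real.log x ≤ 2 * Z →
    (∀ χ ∉ 𝒳, ‖Sf f χ x‖ ≤ x * E) ∧
    ∀ a : ℕ, Nat.Coprime a q →
      ‖(∑ n ∈ (Icc 1 ⌊x⌋₊).filter (fun n : ℕ => (n : ZMod q) = (a : ZMod q)), f n)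
        - (1 / (q.totient : ℝ)) * ∑ χ ∈ 𝒳, χ (a : ZMod q) * Sf f χ x‖ ≤ x / q.totient * E

lemma isIsolatingSet_of_majorant {q J : ℕ} [NeZero q] {f : ℕ → ℂ} {Z E : ℝ}
    {𝒳 : Finset (DirichletCharacter ℂ q)} (hcard : 𝒳.card ≤ J) (hE : 0 ≤ E)
    (h : ∀ x : ℝ, 0 < x → Z / 2 ≤ Real.log x → Real.log x ≤ 2 * Z →
      ∃ (D : ℕ) (g : ℕ → ℝ), (∀ n, 0 ≤ g n) ∧
      (∀ a : ℕ, Nat.Coprime a q → ∑ n ∈ (Icc 1 D).filter (fun n => n ≡ a [MOD q]), g n ≤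
        x / q.totient * E) ∧
      ∀ (S : Finset (DirichletCharacter ℂ q)) (w : DirichletCharacter ℂ q → ℂ),
        (∀ χ ∈ S, χ ∉ 𝒳) → (∀ χ, ‖w χ‖ ≤ 1) →
        ‖∑ n ∈ Icc 1 ⌊x⌋₊, f n * ∑ χ ∈ S, w χ * (starRingEnd ℂ) (χ (n : ZMod q))‖ ≤
          ∑ n ∈ Icc 1 D, g n * ‖∑ χ ∈ S, w χ * (starRingEnd ℂ) (χ (n : ZMod q))‖ + x * E) :
    IsIsolatingSet f Z ((J + 2) * E) 𝒳 := by
  intro x hx hx1 hx2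
  obtain ⟨D, g, hg, hB, hS⟩ := h x hx hx1 hx2
  have hφ : (0 : ℝ) < q.totient := by
    exact_mod_cast Nat.totient_pos.mpr (Nat.pos_of_neZero q)
  have hφB : (q.totient : ℝ) * (x / q.totient * E) = x * E := by field_simp
  have hJ : (0 : ℝ) ≤ J := Nat.cast_nonneg J
  refine ⟨fun χ hχ => ?_, fun a ha => ?_⟩
  · have h1 := hS {χ} (fun _ => 1) (by simpa using hχ) (by simp)
    simp only [sum_singleton, one_mul, RCLike.norm_conj] at h1
    have h2 := sum_mul_norm_char_le (Nat.pos_of_neZero q) hg hB χ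
    rw [hφB] at h2
    have h3 : 0 ≤ x * E := by positivity
    calc ‖Sf f χ x‖ ≤ _ := h1
      _ ≤ x * E + x * E := by linarith
      _ ≤ _ := by nlinarith
  · have h1 := hS 𝒳ᶜ (fun χ => χ (a : ZMod q)) (fun χ hχ => mem_compl.mp hχ)
      (fun χ => χ.norm_le_one _)
    have h2 := sum_mul_norm_sum_compl_le hg hB ha hcard
    rw [hφB] at h2
    rw [sum_modEq_sub_eq f ha x 𝒳, norm_mul]
    have h3 : ‖((1 / (q.totient : ℝ) : ℝ) : ℂ)‖ = 1 / (q.totient : ℝ) := by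
      rw [Complex.norm_real, Real.norm_of_nonneg (by positivity)]
    push_cast at h3 ⊢
    rw [h3]
    calc _ ≤ 1 / (q.totient : ℝ) * ((J + 1) * (x * E) + x * E) := by
          gcongr
          linarith
      _ = _ := by ring

lemma correlationBound_ge {κ Z c : ℝ} {J q : ℕ} (hκ : 0 ≤ κ) (hZ : 1 ≤ Z) (hc : 0 < c) (hc1 : c ≤ 1)
    (hQ : c * Z ≤ Real.log (q * Z)) (hQ2 : Real.log (q * Z) ≤ Z / 2) :
    Z ^ (κ - 1) ≤ 2 * c⁻¹ ^ κ * correlationBound κ J q Z := by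
  have hZ0 : 0 < Z := by linarith
  have hs1 : 1 ≤ Real.sqrt ((J : ℝ) + 1) := by
    rw [Real.one_le_sqrt]
    linarith [(Nat.cast_nonneg J : (0 : ℝ) ≤ J)]
  have he0 : 0 ≤ 1 - 1 / Real.sqrt ((J : ℝ) + 1) :=
    sub_nonneg.mpr ((div_le_one (by linarith)).mpr hs1)
  have he1 : 1 - 1 / Real.sqrt ((J : ℝ) + 1) ≤ 1 := by
    have : 0 < 1 / Real.sqrt ((J : ℝ) + 1) := by positivity
    linarith
  have hlQ : 0 < Real.log (q * Z) := lt_of_lt_of_le (by positivity) hQ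
  have h1 : c ^ κ ≤ (Real.log (q * Z) / Z) ^ (κ * (1 - 1 / Real.sqrt ((J : ℝ) + 1))) := by
    calc c ^ κ ≤ c ^ (κ * (1 - 1 / Real.sqrt ((J : ℝ) + 1))) :=
          Real.rpow_le_rpow_of_exponent_ge hc hc1 (mul_le_of_le_one_right hκ he1)
      _ ≤ _ := by
          refine Real.rpow_le_rpow hc.le ?_ (by positivity)
          rwa [le_div_iff₀ hZ0]
  have h2 : 1 / 2 ≤ Real.log (Z / Real.log (q * Z)) := by
    calc (1 : ℝ) / 2 ≤ Real.log 2 := by linarith [Real.log_two_gt_d9]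
      _ ≤ _ := Real.log_le_log (by norm_num) (by rw [le_div_iff₀ hlQ]; linarith)
  unfold correlationBound
  have hck : c⁻¹ ^ κ * c ^ κ = 1 := by
    rw [← Real.mul_rpow (by positivity) hc.le, inv_mul_cancel₀ hc.ne', Real.one_rpow]
  calc Z ^ (κ - 1) = 2 * c⁻¹ ^ κ * (Z ^ (κ - 1) * c ^ κ * (1 / 2)) := by
        linear_combination (-Z ^ (κ - 1)) * hck
    _ ≤ _ := by gcongr

lemma IsHalaszClass.isIsolatingSet_empty {κ : ℝ} {f Λf : ℕ → ℂ} (hf : IsHalaszClass κ f Λf)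
    {C Z : ℝ} (hC : 0 < C) (hZ : 16 ≤ Z) {q : ℕ} [NeZero q] (hqZ : (q : ℝ) ≤ Real.exp (Z / 4))
    (hshiu : ∀ N a : ℕ, q ^ 2 ≤ N → 2 ≤ N → Nat.Coprime a q →
      ∑ n ∈ (Icc 1 N).filter (fun n => n ≡ a [MOD q]), ‖f n‖ ≤
        C * (N / (q.totient * Real.log N)) * Real.log N ^ κ) :
    IsIsolatingSet f Z (C * (4 * 2 ^ κ) * Z ^ (κ - 1)) (∅ : Finset (DirichletCharacter ℂ q)) := by
  intro x hx hx1 hx2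
  have hκ := hf.kappa_nonneg
  have hZ0 : 0 < Z := by linarith
  have hφ : (0 : ℝ) < q.totient := by
    exact_mod_cast Nat.totient_pos.mpr (Nat.pos_of_neZero q)
  have hxe : Real.exp (Z / 4) * Real.exp (Z / 4) ≤ x := by
    rw [← Real.exp_add, ← Real.le_log_iff_exp_le hx]
    linarith
  have he : 2 ≤ Real.exp (Z / 4) := by linarith [Real.add_one_le_exp (Z / 4)]
  have hx4 : 4 ≤ x := by nlinarith
  have hqN : q ^ 2 ≤ ⌊x⌋₊ := Nat.le_floor (by
    push_cast
    calc (q : ℝ) ^ 2 ≤ Real.exp (Z / 4) ^ 2 := by gcongr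
      _ ≤ _ := by rw [sq]; exact hxe)
  have h2N : 2 ≤ ⌊x⌋₊ := Nat.le_floor (by push_cast; linarith)
  have hNx : (⌊x⌋₊ : ℝ) ≤ x := Nat.floor_le hx.le
  have hN2 : x / 2 ≤ (⌊x⌋₊ : ℝ) := by linarith [Nat.lt_floor_add_one x]
  have hN0 : (0 : ℝ) < ⌊x⌋₊ := by linarith
  have hlN : Z / 4 ≤ Real.log ⌊x⌋₊ := by
    have h1 := Real.log_le_log (by positivity) hN2
    rw [Real.log_div hx.ne' (by norm_num)] at h1
    linarith [Real.log_two_lt_d9]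
  have hlN2 : Real.log ⌊x⌋₊ ≤ 2 * Z := (Real.log_le_log hN0 hNx).trans hx2
  have hB : ∀ a : ℕ, Nat.Coprime a q →
      ∑ n ∈ (Icc 1 ⌊x⌋₊).filter (fun n => n ≡ a [MOD q]), ‖f n‖ ≤
        x / q.totient * (C * (4 * 2 ^ κ) * Z ^ (κ - 1)) := by
    intro a ha
    refine (hshiu _ a hqN h2N ha).trans ?_
    have hl0 : 0 < Real.log ⌊x⌋₊ := by linarith
    calc _ ≤ C * (x / (q.totient * (Z / 4))) * (2 * Z) ^ κ := by gcongr
      _ = x / q.totient * (C * (4 * 2 ^ κ) * (Z ^ κ / Z)) := by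
          rw [Real.mul_rpow (by norm_num) hZ0.le]
          field_simp
      _ = _ := by rw [Real.rpow_sub_one hZ0.ne']
  refine ⟨fun χ _ => ?_, fun a ha => ?_⟩
  · calc ‖Sf f χ x‖ ≤ ∑ n ∈ Icc 1 ⌊x⌋₊, ‖f n‖ * ‖χ (n : ZMod q)‖ := by
          refine (norm_sum_le _ _).trans (sum_le_sum fun n _ => ?_)
          rw [norm_mul, RCLike.norm_conj]
      _ ≤ _ := sum_mul_norm_char_le (Nat.pos_of_neZero q) (fun n => norm_nonneg _) hB χ
      _ = _ := by field_simp
  · rw [sum_empty, mul_zero, sub_zero]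
    refine (norm_sum_le _ _).trans ?_
    simp only [ZMod.natCast_eq_natCast_iff]
    exact hB a ha

lemma IsIsolatingSet.mono {q : ℕ} {f : ℕ → ℂ} {Z E E' : ℝ} {𝒳 : Finset (DirichletCharacter ℂ q)}
    (h : IsIsolatingSet f Z E 𝒳) (hE : E ≤ E') : IsIsolatingSet f Z E' 𝒳 :=
  fun x hx hx1 hx2 =>
    ⟨fun χ hχ => ((h x hx hx1 hx2).1 χ hχ).trans (by gcongr),
      fun a ha => ((h x hx hx1 hx2).2 a ha).trans (by gcongr)⟩

theorem exists_isIsolatingSet (κ : ℝ) (hκ : 0 ≤ κ) (J : ℕ) :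
    ∃ C Z₀ : ℝ, 0 < C ∧ 1 ≤ Z₀ ∧ ∀ f Λf : ℕ → ℂ, IsHalaszClass κ f Λf → ∀ (q : ℕ) [NeZero q] (Z : ℝ),
    Z₀ ≤ Z → (q : ℝ) ≤ Real.exp (Z / 4) → 0 ≤ correlationBound κ J q Z ∧
    ∃ 𝒳 : Finset (DirichletCharacter ℂ q), 𝒳.card ≤ J ∧
      IsIsolatingSet f Z (C * correlationBound κ J q Z) 𝒳 := by
  obtain ⟨C₁, C₀, Z₁, hC₁, hC₀, hmain⟩ := exists_isolating_set_majorant κ hκ J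
  obtain ⟨K, hK⟩ := exists_nat_ge (2 * κ)
  obtain ⟨C₂, hC₂, hshiu⟩ := exists_sum_norm_modEq_le κ K hK
  obtain ⟨Z₂, hZ₂⟩ := exists_rpow_le_exp 1
  set c := (4 * C₀)⁻¹ with hc
  have hc0 : 0 < c := by positivity
  have hc1 : c ≤ 1 := inv_le_one_of_one_le₀ (by linarith)
  refine ⟨(J + 2) * C₁ + C₂ * (4 * 2 ^ κ) * (2 * c⁻¹ ^ κ), max Z₁ (max Z₂ 16), by positivity,
    le_trans (by norm_num) ((le_max_right _ _).trans (le_max_right _ _)), ?_⟩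
  intro f Λf hf q hq0 Z hZ hqZ
  have hZ1 : Z₁ ≤ Z := (le_max_left _ _).trans hZ
  have hZ2 : Z₂ ≤ Z := ((le_max_left _ _).trans (le_max_right _ _)).trans hZ
  have hZ16 : 16 ≤ Z := ((le_max_right _ _).trans (le_max_right _ _)).trans hZ
  have hZ0 : 0 < Z := by linarith
  have hq1 : (1 : ℝ) ≤ q := by exact_mod_cast Nat.pos_of_neZero q
  have hlogZ : Real.log Z ≤ Z / 4 := by
    rw [Real.log_le_iff_le_exp hZ0]
    simpa using hZ₂ Z hZ2
  have hQ0 : 0 < Real.log (q * Z) := Real.log_pos (by nlinarith)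
  have hQ2 : Real.log (q * Z) ≤ Z / 2 := by
    rw [Real.log_mul (by linarith) hZ0.ne']
    have := (Real.log_le_iff_le_exp (by linarith)).mpr hqZ
    linarith
  have hB : 0 ≤ correlationBound κ J q Z := by
    have h1 : 0 ≤ Real.log (Z / Real.log (q * Z)) :=
      Real.log_nonneg (by rw [le_div_iff₀ hQ0]; linarith)
    unfold correlationBound
    positivity
  refine ⟨hB, ?_⟩
  rcases le_or_gt (C₀ * Real.log (q * Z)) (Z / 4) with hreg | hreg
  · obtain ⟨𝒳, hcard, h𝒳⟩ := hmain f Λf hf q Z hZ1 hqZ hreg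
    refine ⟨𝒳, hcard, ?_⟩
    have h1 := isIsolatingSet_of_majorant (f := f) (Z := Z) (E := C₁ * correlationBound κ J q Z) hcard
      (by positivity) (by
        intro x hx hx1 hx2
        obtain ⟨D, g, hg, hga, hgS⟩ := h𝒳 x hx hx1 hx2
        refine ⟨D, g, hg, fun a ha => (hga a ha).trans_eq (by ring), fun S w hS hw => ?_⟩
        exact (hgS S w hS hw).trans_eq (by ring))
    refine h1.mono ?_
    have h2 : 0 ≤ C₂ * (4 * 2 ^ κ) * (2 * c⁻¹ ^ κ) * correlationBound κ J q Z := by positivity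
    linarith
  · refine ⟨∅, by simp, ?_⟩
    refine (hf.isIsolatingSet_empty hC₂ hZ16 hqZ
      (fun N a hN h2N ha => hshiu f Λf hf q N a (Nat.pos_of_neZero q) hN h2N ha)).mono ?_
    have hcQ : c * Z ≤ Real.log (q * Z) := by
      rw [hc, inv_mul_le_iff₀ (by positivity)]
      linarith
    have h2 : 0 ≤ (J + 2) * C₁ * correlationBound κ J q Z := by positivity
    calc _ ≤ C₂ * (4 * 2 ^ κ) * (2 * c⁻¹ ^ κ * correlationBound κ J q Z) := by
          gcongr
          exact correlationBound_ge hκ (by linarith) hc0 hc1 hcQ hQ2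
      _ ≤ _ := by linarith

lemma rpow_sub_one_le_mul {κ Z l : ℝ} (hκ : 0 ≤ κ) (hZ : 0 < Z) (h1 : Z / 2 ≤ l) (h2 : l ≤ 2 * Z) :
    Z ^ (κ - 1) ≤ 2 ^ (κ + 1) * l ^ (κ - 1) := by
  have hl : 0 < l := by linarith
  rw [Real.rpow_sub_one hZ.ne', Real.rpow_sub_one hl.ne', Real.rpow_add_one (by norm_num),
    div_le_iff₀ hZ]
  calc Z ^ κ ≤ (2 * l) ^ κ := by gcongr; linarith
    _ = 2 ^ κ * l ^ κ := Real.mul_rpow (by norm_num) hl.le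
    _ ≤ 2 ^ κ * l ^ κ * (2 * Z / l) := by
        refine le_mul_of_one_le_right (by positivity) ?_
        rwa [one_le_div hl]
    _ = _ := by ring

end IsolatingCharacters

theorem isolating_correlating_characters (κ : ℝ) (hκ : 0 < κ) (J : ℕ) (hJ : 1 ≤ J) :
    ∃ C : ℝ, 0 < C ∧ ∀ f Λf : ℕ → ℂ, IsHalaszClass κ f Λf →
    ∀ X : ℝ, C ≤ X → ∀ q : ℕ, 1 ≤ q → (q : ℝ) ≤ X ^ ((1 : ℝ) / 4) →
    ∃ 𝒳 : Finset (DirichletCharacter ℂ q), 𝒳.card ≤ J ∧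
      (∀ χ : DirichletCharacter ℂ q, χ ∉ 𝒳 →
        ∀ x : ℝ, Real.sqrt X ≤ x → x ≤ X ^ 2 →
          ‖Sf f χ x‖ / x ≤
            C * Real.log X ^ (κ - 1)
              * (Real.log ((q : ℝ) * Real.log X) / Real.log X)
                  ^ (κ * (1 - 1 / Real.sqrt ((J : ℝ) + 1)))
              * Real.log (Real.log X / Real.log ((q : ℝ) * Real.log X))) ∧
      (∀ x : ℝ, Real.sqrt X ≤ x → x ≤ X ^ 2 → ∀ a : ℕ, Nat.Coprime a q →
        ‖(∑ n ∈ (Finset.Icc 1 ⌊x⌋₊).filter (fun n : ℕ => (n : ZMod q) = (a : ZMod q)), f n)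
            - (1 / (q.totient : ℝ)) * ∑ χ ∈ 𝒳, χ (a : ZMod q) * Sf f χ x‖ ≤
          C * (x / (q.totient : ℝ)) * Real.log x ^ (κ - 1)
            * (Real.log ((q : ℝ) * Real.log X) / Real.log X)
                ^ (κ * (1 - 1 / Real.sqrt ((J : ℝ) + 1)))
            * Real.log (Real.log X / Real.log ((q : ℝ) * Real.log X))) := by
  obtain ⟨C, Z₀, hC, hZ₀, hmain⟩ := exists_isIsolatingSet κ hκ.le J
  have h2κ : (1 : ℝ) ≤ 2 ^ (κ + 1) := Real.one_le_rpow (by norm_num) (by linarith)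
  refine ⟨max (Real.exp Z₀) (C * 2 ^ (κ + 1)), by positivity, ?_⟩
  set C' := max (Real.exp Z₀) (C * 2 ^ (κ + 1)) with hC'
  have hCC' : C * 2 ^ (κ + 1) ≤ C' := le_max_right _ _
  have hCC'' : C ≤ C' := le_trans (by nlinarith) hCC'
  intro f Λf hf X hX q hq hqX
  have hXe : Real.exp Z₀ ≤ X := (le_max_left _ _).trans hX
  have hX0 : 0 < X := (Real.exp_pos _).trans_le hXe
  set Z := Real.log X with hZ
  have hZZ : Z₀ ≤ Z := (Real.le_log_iff_exp_le hX0).mpr hXe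
  have hZ0 : 0 < Z := by linarith
  have hqZ : (q : ℝ) ≤ Real.exp (Z / 4) := by
    refine hqX.trans_eq ?_
    rw [Real.rpow_def_of_pos hX0, hZ]
    congr 1
    ring
  have : NeZero q := ⟨by lia⟩
  obtain ⟨hB, 𝒳, hcard, h𝒳⟩ := hmain f Λf hf q Z hZZ hqZ
  have hrange : ∀ x : ℝ, Real.sqrt X ≤ x → x ≤ X ^ 2 →
      0 < x ∧ Z / 2 ≤ Real.log x ∧ Real.log x ≤ 2 * Z := by
    intro x h1 h2
    have hx : 0 < x := (Real.sqrt_pos.mpr hX0).trans_le h1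
    refine ⟨hx, ?_, ?_⟩
    · rw [hZ, ← Real.log_sqrt hX0.le]
      exact Real.log_le_log (Real.sqrt_pos.mpr hX0) h1
    · have h3 := Real.log_le_log hx h2
      rw [Real.log_pow] at h3
      exact_mod_cast h3
  refine ⟨𝒳, hcard, fun χ hχ x h1 h2 => ?_, fun x h1 h2 a ha => ?_⟩
  · obtain ⟨hx, hx1, hx2⟩ := hrange x h1 h2
    rw [div_le_iff₀ hx]
    calc _ ≤ x * (C * correlationBound κ J q Z) := (h𝒳 x hx hx1 hx2).1 χ hχ
      _ ≤ x * (C' * correlationBound κ J q Z) := by gcongr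
      _ = _ := by unfold correlationBound; ring
  · obtain ⟨hx, hx1, hx2⟩ := hrange x h1 h2
    have hl0 : 0 < Real.log x := by linarith
    set R := (Real.log (q * Z) / Z) ^ (κ * (1 - 1 / Real.sqrt ((J : ℝ) + 1))) *
      Real.log (Z / Real.log (q * Z)) with hR
    have hBR : correlationBound κ J q Z = Z ^ (κ - 1) * R := by
      rw [hR, correlationBound, mul_assoc]
    have hR0 : 0 ≤ R := by
      rw [hBR] at hB
      exact nonneg_of_mul_nonneg_right hB (by positivity)
    refine ((h𝒳 x hx hx1 hx2).2 a ha).trans ?_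
    calc _ = x / q.totient * (C * (Z ^ (κ - 1) * R)) := by rw [hBR]
      _ ≤ x / q.totient * (C * (2 ^ (κ + 1) * Real.log x ^ (κ - 1) * R)) := by
          gcongr
          exact rpow_sub_one_le_mul hκ.le hZ0 hx1 hx2
      _ = C * 2 ^ (κ + 1) * (x / q.totient * Real.log x ^ (κ - 1) * R) := by ring
      _ ≤ C' * (x / q.totient * Real.log x ^ (κ - 1) * R) := by gcongr
      _ = _ := by rw [hR]; ring
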